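/- Let K be a number field or a function field of characteristic 0, let n ≥ 2, let f ∈ K[X] be a polynomial of degree at least 2, and let φ = (f,…,f) : (P^1_K)^n → (P^1_K)^n be the diagonally split self-map. Let V be an absolutely irreducible φ-preperiodic closed subvariety of (P^1_K)^n that is either a curve or a hypersurface, and let P ∈ (P^1)^n(K) be a point whose forward orbit O_φ(P) does not intersect V(K). Then there are infinitely many non-archimedean places 𝔭 of K such that the 𝔭-adic closure of O_φ(P) in (P^1)^n(K_𝔭) is disjoint from V(K_𝔭). -/

import Mathlib

open Polynomial OnePoint

/-- Action of a polynomial on the projective line `P^1(L) = L ∪ {∞}`: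
`∞ ↦ ∞` and `a ↦ f(a)`. -/
def polyEvalP1 {L : Type} [CommRing L] (f : Polynomial L) : OnePoint L → OnePoint L :=
  OnePoint.map fun a => f.eval a

/-- The diagonally split self-map `(f,…,f)` of `(P^1)^n` (coordinatewise action). -/
def splitMap {L : Type} [CommRing L] {ι : Type} (f : Polynomial L)
    (x : ι → OnePoint L) : ι → OnePoint L :=
  fun i => polyEvalP1 f (x i)

/-- The forward orbit of a point under a self-map. -/
def fwdOrbit {X : Type*} (φ : X → X) (P : X) : Set X :=
  Set.range fun k : ℕ => φ^[k] P

/-- Homogeneous coordinates of a point of `P^1(L)`: `a ↦ (a, 1)`, `∞ ↦ (1, 0)`. -/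
def homCoords {L : Type} [CommRing L] (x : OnePoint L) : Fin 2 → L :=
  Option.elim x ![1, 0] (fun a => ![a, 1])

/-- A polynomial in variables `(i, 0), (i, 1)` (`i : ι`) is multihomogeneous if it is
homogeneous in the pair of variables indexed by each `i` separately. -/
def MultiHomog {K : Type} [CommSemiring K] {ι : Type} [DecidableEq ι]
    (p : MvPolynomial (ι × Fin 2) K) : Prop :=
  ∀ i : ι, ∃ d : ℕ,
    p.IsWeightedHomogeneous (fun jk => if jk.1 = i then (1 : ℕ) else 0) d

/-- A closed subvariety of `(P^1_K)^ι`, given by a set of multihomogeneous equations over `K`. -/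
structure ClosedSubvar (K : Type) [CommRing K] (ι : Type) [DecidableEq ι] where
  polys : Set (MvPolynomial (ι × Fin 2) K)
  homog : ∀ p ∈ polys, MultiHomog p

/-- Whether a multihomogeneous polynomial vanishes at a point of `(P^1(L))^ι`. -/
def vanishesAt {K : Type} [CommRing K] {ι : Type} [DecidableEq ι] {L : Type} [CommRing L]
    (φ : K →+* L) (p : MvPolynomial (ι × Fin 2) K) (x : ι → OnePoint L) : Prop :=
  MvPolynomial.eval (fun jk => homCoords (x jk.1) jk.2) (MvPolynomial.map φ p) = 0

/-- The `L`-points of a closed subvariety, for a `K`-algebra `L` via `φ : K →+* L`. -/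
def ClosedSubvar.pts {K : Type} [CommRing K] {ι : Type} [DecidableEq ι]
    (V : ClosedSubvar K ι) {L : Type} [CommRing L] (φ : K →+* L) :
    Set (ι → OnePoint L) :=
  {x | ∀ p ∈ V.polys, vanishesAt φ p x}

/-- A subset of `(P^1(L))^ι` is Zariski closed if it is the common zero set of a family of
multihomogeneous polynomials over `L`. -/
def IsZarClosed {L : Type} [CommRing L] {ι : Type} [DecidableEq ι]
    (S : Set (ι → OnePoint L)) : Prop :=
  ∃ V : ClosedSubvar L ι, S = V.pts (RingHom.id L)

/-- The Zariski closure of a set of points. -/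
def zarClosure {L : Type} [CommRing L] {ι : Type} [DecidableEq ι]
    (S : Set (ι → OnePoint L)) : Set (ι → OnePoint L) :=
  ⋂₀ {Z | IsZarClosed Z ∧ S ⊆ Z}

/-- An irreducible (closed) subvariety of `(P^1(L))^ι`, as a set of points. -/
def IrrSubvar {L : Type} [CommRing L] {ι : Type} [DecidableEq ι]
    (S : Set (ι → OnePoint L)) : Prop :=
  S.Nonempty ∧ IsZarClosed S ∧
    ∀ Z₁ Z₂ : Set (ι → OnePoint L), IsZarClosed Z₁ → IsZarClosed Z₂ →
      S ⊆ Z₁ ∪ Z₂ → S ⊆ Z₁ ∨ S ⊆ Z₂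

/-- The dimension of a (closed) subvariety, as the Krull dimension of the poset of
irreducible closed subsets contained in it. -/
noncomputable def varDim {L : Type} [CommRing L] {ι : Type} [DecidableEq ι]
    (S : Set (ι → OnePoint L)) : WithBot ℕ∞ :=
  Order.krullDim {T : Set (ι → OnePoint L) // IrrSubvar T ∧ T ⊆ S}

/-- `T` is an irreducible component of `S`: a maximal irreducible closed subset of `S`. -/
def IsComponentOf {L : Type} [CommRing L] {ι : Type} [DecidableEq ι]
    (T S : Set (ι → OnePoint L)) : Prop :=
  IrrSubvar T ∧ T ⊆ S ∧ ∀ T', IrrSubvar T' → T ⊆ T' → T' ⊆ S → T' = T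

/-- A hypersurface in `(P^1(L))^n`: a nonempty Zariski closed set all of whose irreducible
components have dimension `n - 1`. -/
def IsHypersurfaceSet {L : Type} [CommRing L] {n : ℕ}
    (S : Set (Fin n → OnePoint L)) : Prop :=
  S.Nonempty ∧ IsZarClosed S ∧
    ∀ T, IsComponentOf T S → varDim T = ((n - 1 : ℕ) : ℕ∞)

/-- A set of points (e.g. a subvariety) is periodic under the split map `(f,…,f)`. -/
def SubvarPeriodic {L : Type} [CommRing L] {ι : Type} (f : Polynomial L)
    (S : Set (ι → OnePoint L)) : Prop :=
  ∃ m : ℕ, 1 ≤ m ∧ (splitMap f)^[m] '' S = S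

/-- A set of points (e.g. a subvariety) is preparation under `(f,…,f)`. -/
def SubvarPreperiodic {L : Type} [CommRing L] {ι : Type} (f : Polynomial L)
    (S : Set (ι → OnePoint L)) : Prop :=
  ∃ k : ℕ, SubvarPeriodic f ((splitMap f)^[k] '' S)

/-- A place of a field `K`, represented by a nontrivial absolute value. -/
structure PlaceK (K : Type) [Field K] where
  v : AbsoluteValue K ℝ
  nontrivial : ∃ x : K, x ≠ 0 ∧ v x ≠ 1

/-- A place is non-archimedean if its absolute value satisfies the ultrametric inequality. -/
def PlaceK.IsNonarch {K : Type} [Field K] (w : PlaceK K) : Prop :=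
  ∀ x y : K, w.v (x + y) ≤ max (w.v x) (w.v y)

/-- Equivalence of places (equality of the associated topologies / unit balls). -/
def PlaceK.Equiv {K : Type} [Field K] (w w' : PlaceK K) : Prop :=
  ∀ x : K, w.v x < 1 ↔ w'.v x < 1

/-- A choice of completion of `K` at a place `w`: a field `carrier` with an absolute value
extending that of `w` through `emb`, which is complete and in which `K` is dense. -/
structure CompletionOf {K : Type} [Field K] (w : PlaceK K) where
  carrier : Type
  [field : Field carrier]
  emb : K →+* carrier
  absv : AbsoluteValue carrier ℝ
  compat : ∀ x : K, absv (emb x) = w.v x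
  complete : ∀ s : ℕ → carrier,
    (∀ ε : ℝ, 0 < ε → ∃ N : ℕ, ∀ m ≥ N, ∀ k ≥ N, absv (s m - s k) < ε) →
    ∃ a : carrier, ∀ ε : ℝ, 0 < ε → ∃ N : ℕ, ∀ m ≥ N, absv (s m - a) < ε
  dense : ∀ a : carrier, ∀ ε : ℝ, 0 < ε → ∃ x : K, absv (a - emb x) < ε

attribute [instance] CompletionOf.field

/-- The chordal metric on `P^1(L)` attached to an absolute value on `L`. -/
noncomputable def p1Dist {L : Type} [Field L] (w : AbsoluteValue L ℝ) :
    OnePoint L → OnePoint L → ℝ :=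
  fun x y =>
    Option.elim x
      (Option.elim y 0 fun b => 1 / max 1 (w b))
      (fun a => Option.elim y (1 / max 1 (w a))
        (fun b => w (a - b) / (max 1 (w a) * max 1 (w b))))

/-- The topology on `P^1(L)` generated by the balls of the chordal metric. -/
noncomputable def p1Top {L : Type} [Field L] (w : AbsoluteValue L ℝ) :
    TopologicalSpace (OnePoint L) :=
  TopologicalSpace.generateFrom
    {U | ∃ (x : OnePoint L) (ε : ℝ), 0 < ε ∧ U = {y | p1Dist w x y < ε}}

/-- The topology on `(P^1(L))^ι` induced by the chordal metric topology on each factor. -/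
noncomputable def pnTop {L : Type} [Field L] (ι : Type) (w : AbsoluteValue L ℝ) :
    TopologicalSpace (ι → OnePoint L) :=
  @Pi.topologicalSpace ι (fun _ => OnePoint L) (fun _ => p1Top w)

/-- The closure of a set of points of `(P^1(L))^ι` in the topology induced by an
absolute value on `L`. -/
noncomputable def adicClosure {L : Type} [Field L] {ι : Type} (w : AbsoluteValue L ℝ)
    (S : Set (ι → OnePoint L)) : Set (ι → OnePoint L) :=
  @closure _ (pnTop ι w) S

/-- Base change of a point of `P^1(K)` along a field embedding. -/
def mapPoint {K L : Type} [Field K] [Field L] (φ : K →+* L) :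
    OnePoint K → OnePoint L :=
  OnePoint.map φ

/-- `K` is a number field, or a function field of characteristic zero over the ground
field `κ` (finitely generated of transcendence degree 1 over `κ`, with `κ` relatively
algebraically closed in `K`). -/
def NumberFieldOrFunctionFieldOver (K : Type) [Field K] (κ : Subfield K) : Prop :=
  NumberField K ∨
    (CharZero K ∧
      (∃ t : K, Transcendental κ t ∧
        FiniteDimensional (IntermediateField.adjoin κ {t}) K) ∧
      (∀ x : K, IsAlgebraic κ x → x ∈ κ))

/-- The places of `K` relevant for the theorems: in the number field case all places are
allowed; in the function field case only places trivial on the ground field `κ`. -/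
def PlaceK.IsPlaceOver {K : Type} [Field K] (κ : Subfield K) (w : PlaceK K) : Prop :=
  NumberField K ∨ (∀ c : K, c ∈ κ → c ≠ 0 → w.v c = 1)

/-- At the place `w`, the `w`-adic closure of the `(f,…,f)`-orbit of `P` does not meet
`V(K_w)`: for every completion of `K` at `w`, the `w`-adic closure of the orbit in
`(P^1)^n` of the completion is disjoint from the set of points of `V` over the
completion. -/
def OrbitClosureAvoids {K : Type} [Field K] {n : ℕ} (w : PlaceK K)
    (f : Polynomial K) (P : Fin n → OnePoint K) (V : ClosedSubvar K (Fin n)) : Prop :=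
  ∀ C : CompletionOf w,
    adicClosure C.absv
        (fwdOrbit (splitMap (f.map C.emb)) fun i => mapPoint C.emb (P i)) ∩
      V.pts C.emb = ∅

/-- There are infinitely many (pairwise inequivalent) non-archimedean places of `K`
(trivial on the ground field `κ` in the function field case) satisfying `Q`. -/
def InfinitelyManyPlaces (K : Type) [Field K] (κ : Subfield K)
    (Q : PlaceK K → Prop) : Prop :=
  ∃ T : Set (PlaceK K), T.Infinite ∧
    (T.Pairwise fun w w' => ¬ PlaceK.Equiv w w') ∧
    ∀ w ∈ T, w.IsNonarch ∧ w.IsPlaceOver κ ∧ Q w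

/-- All but finitely many non-archimedean places of `K` (trivial on the ground field `κ`
in the function field case) satisfy `Q`. -/
def AllButFinitelyManyPlaces (K : Type) [Field K] (κ : Subfield K)
    (Q : PlaceK K → Prop) : Prop :=
  ∃ T : Set (PlaceK K), T.Finite ∧
    ∀ w : PlaceK K, w.IsNonarch → w.IsPlaceOver κ →
      (∃ w' ∈ T, PlaceK.Equiv w w') ∨ Q w

section

section AbsoluteValueExtension

/-- The trivial absolute value is nonarchimedean. -/
theorem isNonarchimedean_of_forall_eq_one {K : Type*} [Field K] (w : AbsoluteValue K ℝ)
    (h : ∀ x ≠ 0, w x = 1) : IsNonarchimedean w := by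
  intro x y
  by_cases hx : x = 0
  · simp [hx]
  by_cases hxy : x + y = 0
  · simp [hxy]
  · rw [h _ hxy, h _ hx]
    exact le_max_left _ _

theorem exists_nonarchimedean_extension_of_nontrivial {K : Type} [Field K]
    (w : AbsoluteValue K ℝ) (hw : IsNonarchimedean w) (hnt : ∃ x, 1 < w x)
    (Ω : Type) [Field Ω] [Algebra K Ω] [Algebra.IsAlgebraic K Ω] :
    ∃ W : AbsoluteValue Ω ℝ, IsNonarchimedean W ∧ ∀ x, W (algebraMap K Ω x) = w x := by
  let F := w.Completion
  have hdense : ∀ x : WithAbs w, ‖(x : F)‖ = w x.ofAbs := fun x => by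
    rw [UniformSpace.Completion.norm_coe, WithAbs.norm_eq_apply_ofAbs]
  have hu : IsUltrametricDist F := by
    refine IsUltrametricDist.isUltrametricDist_of_forall_norm_add_le_max_norm ?_
    intro x y
    induction x, y using UniformSpace.Completion.induction_on₂ with
    | hp => exact isClosed_le (by fun_prop) (by fun_prop)
    | ih a b =>
      rw [← UniformSpace.Completion.coe_add, hdense, hdense, hdense, WithAbs.ofAbs_add]
      exact hw _ _
  let : NontriviallyNormedField F :=
    { (inferInstance : NormedField F) with
      non_trivial := by
        obtain ⟨x, hx⟩ := hnt
        exact ⟨((WithAbs.toAbs w x : WithAbs w) : F), by rw [hdense]; simpa using hx⟩ }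
  let ι : K →+* F := (UniformSpace.Completion.coeRingHom).comp (WithAbs.equiv w).symm.toRingHom
  have hι : ∀ x, ‖ι x‖ = w x := fun x => by
    change ‖((WithAbs.toAbs w x : WithAbs w) : F)‖ = _
    rw [hdense]
  let : Algebra K F := ι.toAlgebra
  let E := AlgebraicClosure F
  let : Algebra K E := ((algebraMap F E).comp ι).toAlgebra
  let j : Ω →ₐ[K] E := IsAlgClosed.lift
  let : NormedField E := spectralNorm.normedField F E
  have hE : ∀ x : E, ‖x‖ = spectralNorm F E x := fun x => rfl
  refine ⟨⟨⟨fun x => ‖j x‖, fun x y => by simp⟩, fun x => norm_nonneg _, fun x => by simp,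
    fun x y => by
      change ‖j (x + y)‖ ≤ ‖j x‖ + ‖j y‖
      rw [map_add]
      exact norm_add_le _ _⟩, ?_, ?_⟩
  · intro x y
    change ‖j (x + y)‖ ≤ max ‖j x‖ ‖j y‖
    rw [map_add]
    exact isNonarchimedean_spectralNorm _ _
  · intro x
    change ‖j (algebraMap K Ω x)‖ = _
    rw [AlgHom.commutes, ← hι]
    exact spectralNorm_extends (K := F) (L := E) (ι x)

theorem exists_nonarchimedean_extension {K : Type} [Field K]
    (w : AbsoluteValue K ℝ) (hw : IsNonarchimedean w)
    (Ω : Type) [Field Ω] [Algebra K Ω] [Algebra.IsAlgebraic K Ω] :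
    ∃ W : AbsoluteValue Ω ℝ, IsNonarchimedean W ∧ ∀ x, W (algebraMap K Ω x) = w x := by
  by_cases hnt : ∃ x, 1 < w x
  · exact exists_nonarchimedean_extension_of_nontrivial w hw hnt Ω
  · push Not at hnt
    have h1 : ∀ x ≠ 0, w x = 1 := fun x hx => by
      refine le_antisymm (hnt x) ?_
      have := hnt x⁻¹
      rw [map_inv₀] at this
      exact (inv_le_one₀ (w.pos hx)).1 this
    classical
    refine ⟨AbsoluteValue.trivial, isNonarchimedean_of_forall_eq_one _ fun x hx => by
      simp [AbsoluteValue.trivial, hx], fun x => ?_⟩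
    by_cases hx : x = 0
    · simp [hx]
    · rw [h1 x hx]
      simp [AbsoluteValue.trivial, hx]

end AbsoluteValueExtension

end

section

section NonarchimedeanBasics

variable {F : Type*} [Field F]

theorem AbsoluteValue.sum_le_of_nonarchimedean {ι : Type*} {W : AbsoluteValue F ℝ}
    (hW : IsNonarchimedean W) (s : Finset ι) (g : ι → F) (B : ℝ) (hB : 0 ≤ B)
    (h : ∀ i ∈ s, W (g i) ≤ B) : W (∑ i ∈ s, g i) ≤ B := by
  classical
  induction s using Finset.induction_on with
  | empty => simpa
  | insert a s ha ih =>
    rw [Finset.sum_insert ha]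
    exact (hW _ _).trans (max_le (h a (by simp)) (ih fun i hi => h i (by simp [hi])))

theorem AbsoluteValue.add_eq_right_of_lt {W : AbsoluteValue F ℝ}
    (hW : IsNonarchimedean W) {x y : F} (h : W x < W y) : W (x + y) = W y := by
  refine le_antisymm ((hW x y).trans (max_le h.le le_rfl)) ?_
  by_contra hlt
  push Not at hlt
  have := hW (x + y) (-x)
  rw [add_neg_cancel_comm, W.map_neg] at this
  exact absurd this (not_le.2 (max_lt hlt h))

theorem AbsoluteValue.eval_le_one {K : Type*} [CommRing K] {W : AbsoluteValue F ℝ}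
    (hW : IsNonarchimedean W)
    (φ : K →+* F) (p : K[X]) (hp : ∀ n, W (φ (p.coeff n)) ≤ 1) {z : F} (hz : W z ≤ 1) :
    W (p.eval₂ φ z) ≤ 1 := by
  rw [eval₂_eq_sum_range]
  refine AbsoluteValue.sum_le_of_nonarchimedean hW _ _ 1 zero_le_one fun i _ => ?_
  rw [map_mul, map_pow]
  exact mul_le_one₀ (hp i) (by positivity) (pow_le_one₀ (W.nonneg _) hz)

theorem AbsoluteValue.le_one_of_monic_root {K : Type*} [CommRing K] {W : AbsoluteValue F ℝ}
    (hW : IsNonarchimedean W) (φ : K →+* F) (p : K[X]) (hm : p.Monic)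
    (hp : ∀ n, W (φ (p.coeff n)) ≤ 1) {z : F} (hz : p.eval₂ φ z = 0) : W z ≤ 1 := by
  by_contra hlt
  push Not at hlt
  rw [eval₂_eq_sum_range, Finset.sum_range_succ, hm.coeff_natDegree, map_one, one_mul] at hz
  have h1 : W (z ^ p.natDegree) = W (∑ i ∈ Finset.range p.natDegree, φ (p.coeff i) * z ^ i) := by
    rw [eq_neg_of_add_eq_zero_right hz, W.map_neg]
  obtain h0 | ⟨N, hN⟩ : p.natDegree = 0 ∨ ∃ N, p.natDegree = N + 1 :=
    (Nat.eq_zero_or_eq_succ_pred _).imp id fun h => ⟨_, h⟩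
  · rw [h0] at h1
    simp at h1
  · have h2 : W (∑ i ∈ Finset.range p.natDegree, φ (p.coeff i) * z ^ i) ≤ W z ^ N := by
      refine AbsoluteValue.sum_le_of_nonarchimedean hW _ _ _ (by positivity) fun i hi => ?_
      rw [map_mul, map_pow]
      calc _ ≤ 1 * W z ^ i := by gcongr; exact hp i
        _ ≤ W z ^ N := by
          rw [one_mul]
          exact pow_le_pow_right₀ hlt.le (by rw [Finset.mem_range] at hi; omega)
    rw [← h1, map_pow, hN, pow_succ] at h2
    have : 0 < W z ^ N := by positivity
    nlinarith

theorem AbsoluteValue.eq_one_of_monic_root {K : Type*} [CommRing K] {W : AbsoluteValue F ℝ}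
    (hW : IsNonarchimedean W) (φ : K →+* F) (p : K[X]) (hm : p.Monic)
    (hp : ∀ n, W (φ (p.coeff n)) ≤ 1) (h0 : W (φ (p.coeff 0)) = 1) {z : F}
    (hz : p.eval₂ φ z = 0) : W z = 1 := by
  have hle := AbsoluteValue.le_one_of_monic_root hW φ p hm hp hz
  refine le_antisymm hle ?_
  have h1 : W (p.divX.eval₂ φ z) ≤ 1 :=
    AbsoluteValue.eval_le_one hW φ _ (fun n => by rw [coeff_divX]; exact hp _) hle
  have h2 : φ (p.coeff 0) = -(p.divX.eval₂ φ z * z) := by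
    have := congrArg (eval₂ φ z) p.divX_mul_X_add
    rw [eval₂_add, eval₂_mul, eval₂_X, eval₂_C, hz] at this
    exact eq_neg_of_add_eq_zero_right this
  have h3 := congrArg W h2
  rw [h0, W.map_neg, map_mul] at h3
  nlinarith [W.nonneg z]

/-- Nonzero algebraic elements are units at almost all members of a family of extensions of
absolute values, if the same holds for the elements of the base field. -/
theorem finite_setOf_extension_ne_one {K : Type*} [Field K] [Algebra K F]
    {I : Type*} (w : I → AbsoluteValue K ℝ) (s : Set I)
    (hfin : ∀ x ≠ 0, {i | w i x ≠ 1}.Finite) (W : I → AbsoluteValue F ℝ)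
    (hW : ∀ i ∈ s, IsNonarchimedean (W i)) (hext : ∀ i ∈ s, ∀ x, W i (algebraMap K F x) = w i x)
    (z : F) (hz : z ≠ 0) (hinteg : IsIntegral K z) : {i ∈ s | W i z ≠ 1}.Finite := by
  classical
  set p := minpoly K z
  have h1 : (⋃ n ∈ p.support, {i | w i (p.coeff n) ≠ 1}).Finite := by
    refine Set.Finite.biUnion p.support.finite_toSet fun n hn => hfin _ ?_
    simpa using hn
  refine h1.subset fun i hi => ?_
  by_contra hcon
  simp only [Set.mem_iUnion, Set.mem_ofPred_eq, not_exists, not_not] at hcon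
  refine hi.2 (AbsoluteValue.eq_one_of_monic_root (hW i hi.1) (algebraMap K F) p
    (minpoly.monic hinteg) (fun n => ?_) ?_ (minpoly.aeval K z))
  · rw [hext i hi.1]
    by_cases hn : n ∈ p.support
    · exact (hcon n hn).le
    · simp [notMem_support_iff.1 hn]
  · rw [hext i hi.1]
    exact hcon 0 (by simpa using minpoly.coeff_zero_ne_zero hinteg hz)

end NonarchimedeanBasics

/-- A family of absolute values (with repetitions) satisfying the product formula. -/
structure ProductFormulaFamily (K : Type) [Field K] where
  Idx : Type
  w : Idx → AbsoluteValue K ℝ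
  finite_ne_one : ∀ x ≠ 0, {i | w i x ≠ 1}.Finite
  finprod_eq_one : ∀ x ≠ 0, ∏ᶠ i, w i x = 1
  finite_arch : {i | ¬ IsNonarchimedean (w i)}.Finite
  nontrivial : ∃ i x, 1 < w i x

theorem exists_family_of_finite_extension {F K : Type} [Field F] [CharZero F] [Field K]
    [Algebra F K] [FiniteDimensional F K] (M : ProductFormulaFamily F)
    (hM : ∀ i, IsNonarchimedean (M.w i)) :
    ∃ N : ProductFormulaFamily K, ∀ j : N.Idx, ∃ i : M.Idx, ∀ x, N.w j (algebraMap F K x) = M.w i x := by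
  let Ω := AlgebraicClosure F
  choose W hW hext using fun i => exists_nonarchimedean_extension (M.w i) (hM i) Ω
  let w : M.Idx × (K →ₐ[F] Ω) → AbsoluteValue K ℝ := fun j => (W j.1).comp (f := j.2.toRingHom)
    j.2.toRingHom.injective
  have hw : ∀ j x, w j x = W j.1 (j.2 x) := fun _ _ => rfl
  have hnon : ∀ j, IsNonarchimedean (w j) := fun j x y => by
    rw [hw, hw, hw, map_add]
    exact hW _ _ _
  have hwext : ∀ j x, w j (algebraMap F K x) = M.w j.1 x := fun j x => by
    rw [hw, AlgHom.commutes, hext]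
  have hfin : ∀ x ≠ 0, {j | w j x ≠ 1}.Finite := by
    intro x hx
    have h : ∀ τ : K →ₐ[F] Ω, {i | W i (τ x) ≠ 1}.Finite := fun τ => by
      have := finite_setOf_extension_ne_one M.w Set.univ M.finite_ne_one W (fun i _ => hW i)
        (fun i _ => hext i) (τ x) (by simpa using hx) (Algebra.IsIntegral.isIntegral _)
      simpa using this
    refine ((Set.finite_iUnion h).prod (Set.finite_univ (α := K →ₐ[F] Ω))).subset ?_
    rintro ⟨i, τ⟩ hj
    exact ⟨Set.mem_iUnion.2 ⟨τ, hj⟩, trivial⟩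
  refine ⟨⟨M.Idx × (K →ₐ[F] Ω), w, hfin, ?_, ?_, ?_⟩, fun j => ⟨j.1, hwext j⟩⟩
  · intro x hx
    rw [finprod_curry _ (hfin x hx), ← M.finprod_eq_one (Algebra.norm F x) (Algebra.norm_ne_zero_iff.2 hx)]
    refine finprod_congr fun i => ?_
    rw [finprod_eq_prod_of_fintype, ← hext, Algebra.norm_eq_prod_embeddings F Ω, map_prod]
    rfl
  · convert Set.finite_empty
    ext j
    simpa using hnon j
  · obtain ⟨i, x, hx⟩ := M.nontrivial
    exact ⟨(i, IsAlgClosed.lift), algebraMap F K x, by rwa [hwext]⟩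

end

section

section RationalFunctionField

open IsDedekindDomain

variable (k : Type) [Field k]

open scoped Classical in
/-- The absolute value on `k(t)` given by the degree. -/
noncomputable def RatFunc.degreeAbv : AbsoluteValue (RatFunc k) ℝ where
  toFun x := if x = 0 then 0 else 2 ^ (RatFunc.intDegree x)
  map_mul' x y := by
    by_cases hx : x = 0
    · simp [hx]
    by_cases hy : y = 0
    · simp [hy]
    simp [hx, hy, RatFunc.intDegree_mul hx hy, zpow_add₀]
  nonneg' x := by positivity
  eq_zero' x := by
    by_cases hx : x = 0
    · simp [hx]
    · simp only [hx, if_false, iff_false]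
      positivity
  add_le' x y := by
    by_cases hx : x = 0
    · simp [hx]
    by_cases hy : y = 0
    · simp [hy]
    by_cases hxy : x + y = 0
    · simp only [hxy, if_true]
      positivity
    simp only [hx, hy, hxy, if_false]
    have h := RatFunc.intDegree_add_le hy hxy
    have h1 : (2 : ℝ) ^ (x + y).intDegree ≤ 2 ^ (max x.intDegree y.intDegree) :=
      zpow_le_zpow_right₀ one_le_two h
    have h2 : (0 : ℝ) < 2 ^ x.intDegree := by positivity
    have h3 : (0 : ℝ) < 2 ^ y.intDegree := by positivity
    rcases max_cases x.intDegree y.intDegree with h4 | h4 <;> rw [h4.1] at h1 <;> linarith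

open scoped Classical in
theorem RatFunc.degreeAbv_apply {x : RatFunc k} (hx : x ≠ 0) :
    RatFunc.degreeAbv k x = 2 ^ (RatFunc.intDegree x) := by
  change (if x = 0 then (0 : ℝ) else 2 ^ (RatFunc.intDegree x)) = _
  simp [hx]

theorem RatFunc.isNonarchimedean_degreeAbv : IsNonarchimedean (RatFunc.degreeAbv k) := by
  intro x y
  by_cases hx : x = 0
  · simp [hx]
  by_cases hy : y = 0
  · simp [hy]
  by_cases hxy : x + y = 0
  · simp [hxy]
  rw [RatFunc.degreeAbv_apply k hx, RatFunc.degreeAbv_apply k hy, RatFunc.degreeAbv_apply k hxy]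
  have h := RatFunc.intDegree_add_le hy hxy
  rcases le_max_iff.1 h with h | h
  · exact (zpow_le_zpow_right₀ one_le_two h).trans (le_max_left _ _)
  · exact (zpow_le_zpow_right₀ one_le_two h).trans (le_max_right _ _)

open Submodule.IsPrincipal in
/-- The normalized base of the adic absolute value on `k(t)` attached to a prime of `k[t]`. -/
noncomputable def RatFunc.adicBase (v : HeightOneSpectrum k[X]) : NNReal :=
  2 ^ (generator v.asIdeal).natDegree

theorem RatFunc.natDegree_pos_of_span_eq (v : HeightOneSpectrum k[X]) (p : k[X])
    (h : v.asIdeal = Ideal.span {p}) : 0 < p.natDegree := by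
  by_contra h0
  have h1 : p.natDegree = 0 := by omega
  rw [natDegree_eq_zero] at h1
  obtain ⟨c, rfl⟩ := h1
  by_cases hc : c = 0
  · exact v.ne_bot (by simp [h, hc])
  · refine v.isPrime.ne_top ?_
    rw [h, Ideal.span_singleton_eq_top]
    exact isUnit_C.2 (isUnit_iff_ne_zero.2 hc)

theorem RatFunc.one_lt_adicBase (v : HeightOneSpectrum k[X]) : 1 < RatFunc.adicBase k v :=
  one_lt_pow₀ one_lt_two (RatFunc.natDegree_pos_of_span_eq k v _
    (Ideal.span_singleton_generator _).symm).ne'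

/-- The normalized adic absolute value on `k(t)` attached to a prime of `k[t]`. -/
noncomputable def RatFunc.primeAbv (v : HeightOneSpectrum k[X]) : AbsoluteValue (RatFunc k) ℝ :=
  v.adicAbv (RatFunc.one_lt_adicBase k v)

theorem RatFunc.primeAbv_of_span_eq (v : HeightOneSpectrum k[X]) {p : k[X]} (hp : p ≠ 0)
    (h : v.asIdeal = Ideal.span {p}) :
    RatFunc.primeAbv k v (algebraMap _ _ p) = (2 ^ p.natDegree)⁻¹ := by
  have h1 : (Submodule.IsPrincipal.generator v.asIdeal).natDegree = p.natDegree := by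
    refine natDegree_eq_of_degree_eq (degree_eq_degree_of_associated ?_)
    rw [← Ideal.span_singleton_eq_span_singleton, ← h]
    exact Ideal.span_singleton_generator _
  rw [RatFunc.primeAbv, HeightOneSpectrum.adicAbv_of_algebraMap]
  have hb : RatFunc.adicBase k v ≠ 0 := (zero_lt_one.trans (RatFunc.one_lt_adicBase k v)).ne'
  change ((WithZeroMulInt.toNNReal hb (v.intValuation p) : NNReal) : ℝ) = _
  rw [HeightOneSpectrum.intValuation_singleton v hp h,
    WithZeroMulInt.toNNReal_neg_apply hb WithZero.exp_ne_zero]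
  have h2 : (WithZero.unzero (WithZero.exp_ne_zero (a := (-1 : ℤ)))).toAdd = -1 := rfl
  rw [h2]
  simp [RatFunc.adicBase, h1]

theorem RatFunc.primeAbv_polynomial (p : k[X]) (hp : p ≠ 0) :
    {v | RatFunc.primeAbv k v (algebraMap _ _ p) ≠ 1}.Finite ∧
      ∏ᶠ v, RatFunc.primeAbv k v (algebraMap _ _ p) = (2 ^ p.natDegree)⁻¹ := by
  induction p using UniqueFactorizationMonoid.induction_on_prime with
  | h₁ => exact absurd rfl hp
  | h₂ p hu =>
    have h1 : ∀ v, RatFunc.primeAbv k v (algebraMap _ _ p) = 1 := fun v => by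
      rw [RatFunc.primeAbv, HeightOneSpectrum.adicAbv_coe_eq_one_iff]
      exact fun h => v.isPrime.ne_top (Ideal.eq_top_of_isUnit_mem _ h hu)
    have h2 : p.natDegree = 0 := natDegree_eq_zero_of_isUnit hu
    simp [h1, h2]
  | h₃ a p ha hpr ih =>
    obtain ⟨ih1, ih2⟩ := ih ha
    let v0 : HeightOneSpectrum k[X] := ⟨Ideal.span {p},
      (Ideal.span_singleton_prime hpr.ne_zero).2 hpr, by simpa using hpr.ne_zero⟩
    have hne : ∀ v, v ≠ v0 → RatFunc.primeAbv k v (algebraMap _ _ p) = 1 := fun v hv => by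
      rw [RatFunc.primeAbv, HeightOneSpectrum.adicAbv_coe_eq_one_iff]
      intro hpv
      refine hv (HeightOneSpectrum.ext ?_)
      have hmax : v0.asIdeal.IsMaximal := v0.isMaximal
      exact (hmax.eq_of_le v.isPrime.ne_top (by simpa [v0, Ideal.span_le] using hpv)).symm
    have hsub : {v | RatFunc.primeAbv k v (algebraMap _ _ p) ≠ 1} ⊆ {v0} := fun v hv => by
      by_contra h
      exact hv (hne v h)
    have hfin := (Set.finite_singleton v0).subset hsub
    have hp1 : ∏ᶠ v, RatFunc.primeAbv k v (algebraMap _ _ p) = (2 ^ p.natDegree)⁻¹ := by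
      rw [finprod_eq_single _ v0 hne]
      exact RatFunc.primeAbv_of_span_eq k v0 hpr.ne_zero rfl
    constructor
    · refine (hfin.union ih1).subset fun v hv => ?_
      by_contra hcon
      simp only [Set.mem_union, Set.mem_ofPred_eq, not_or, not_not] at hcon
      exact hv (by rw [map_mul, map_mul, hcon.1, hcon.2, one_mul])
    · simp only [map_mul]
      rw [finprod_mul_distrib hfin ih1, hp1, ih2, natDegree_mul hpr.ne_zero ha, pow_add, mul_inv]

theorem exists_family_ratFunc : ∃ M : ProductFormulaFamily (RatFunc k),
    (∀ i, IsNonarchimedean (M.w i)) ∧ ∀ i, ∀ c ≠ 0, M.w i (RatFunc.C c) = 1 := by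
  let w : Option (HeightOneSpectrum k[X]) → AbsoluteValue (RatFunc k) ℝ := fun o =>
    o.elim (RatFunc.degreeAbv k) (RatFunc.primeAbv k)
  have hnon : ∀ i, IsNonarchimedean (w i) := by
    rintro (_ | v)
    · exact RatFunc.isNonarchimedean_degreeAbv k
    · exact HeightOneSpectrum.isNonarchimedean_adicAbv _ _
  have hpoly : ∀ p : k[X], p ≠ 0 → {i | w i (algebraMap _ _ p) ≠ 1}.Finite ∧
      ∏ᶠ i, w i (algebraMap _ _ p) = 1 := by
    intro p hp
    obtain ⟨h1, h2⟩ := RatFunc.primeAbv_polynomial k p hp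
    have hp0 : algebraMap k[X] (RatFunc k) p ≠ 0 := by simpa using hp
    have hfin : {i | w i (algebraMap _ _ p) ≠ 1}.Finite := by
      refine ((Set.finite_singleton none).union (h1.image Option.some)).subset ?_
      rintro (_ | v) hv
      · left; rfl
      · right; exact ⟨v, hv, rfl⟩
    refine ⟨hfin, ?_⟩
    rw [finprod_option (f := fun i => w i (algebraMap _ _ p)) h1]
    change RatFunc.degreeAbv k _ * ∏ᶠ v, RatFunc.primeAbv k v (algebraMap _ _ p) = 1
    rw [h2, RatFunc.degreeAbv_apply k hp0, RatFunc.intDegree_polynomial, zpow_natCast]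
    exact mul_inv_cancel₀ (by positivity)
  have hfrac : ∀ x : RatFunc k, x ≠ 0 → {i | w i x ≠ 1}.Finite ∧ ∏ᶠ i, w i x = 1 := by
    intro x hx
    have hn := hpoly x.num (RatFunc.num_ne_zero hx)
    have hd := hpoly x.denom (RatFunc.denom_ne_zero x)
    have hx' : ∀ i, w i x = w i (algebraMap _ _ x.num) / w i (algebraMap _ _ x.denom) := fun i => by
      rw [← map_div₀, RatFunc.num_div_denom]
    refine ⟨(hn.1.union hd.1).subset fun i hi => ?_, ?_⟩
    · by_contra hcon
      simp only [Set.mem_union, Set.mem_ofPred_eq, not_or, not_not] at hcon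
      exact hi (by rw [hx', hcon.1, hcon.2, div_one])
    · simp only [hx']
      rw [finprod_div_distrib hn.1 hd.1, hn.2, hd.2, div_one]
  refine ⟨⟨_, w, fun x hx => (hfrac x hx).1, fun x hx => (hfrac x hx).2, ?_, ?_⟩, hnon, ?_⟩
  · convert Set.finite_empty
    ext j
    simpa using hnon j
  · refine ⟨none, RatFunc.X, ?_⟩
    change 1 < RatFunc.degreeAbv k RatFunc.X
    rw [RatFunc.degreeAbv_apply k RatFunc.X_ne_zero]
    simp
  · rintro (_ | v) c hc
    · change RatFunc.degreeAbv k _ = 1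
      rw [RatFunc.degreeAbv_apply k (by simpa using hc)]
      simp
    · change RatFunc.primeAbv k v _ = 1
      rw [← RatFunc.algebraMap_C, RatFunc.primeAbv, HeightOneSpectrum.adicAbv_coe_eq_one_iff]
      exact fun h => v.isPrime.ne_top (Ideal.eq_top_of_isUnit_mem _ h
        (isUnit_C.2 (isUnit_iff_ne_zero.2 hc)))

end RationalFunctionField

end

section

section ProductFormula

theorem exists_family_numberField (K : Type) [Field K] [NumberField K] :
    Nonempty (ProductFormulaFamily K) := by
  classical
  let l := (Height.AdmissibleAbsValues.archAbsVal (K := K)).toList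
  let A := Fin l.length
  let B := (Height.AdmissibleAbsValues.nonarchAbsVal (K := K))
  let w : A ⊕ B → AbsoluteValue K ℝ := Sum.elim (fun a => l.get a) (fun b => b.1)
  have hB : ∀ x : K, x ≠ 0 → {b : B | b.1 x ≠ 1}.Finite := fun x hx =>
    Height.AdmissibleAbsValues.hasFiniteMulSupport hx
  have hfin : ∀ x : K, x ≠ 0 → {i | w i x ≠ 1}.Finite := by
    intro x hx
    refine ((Set.finite_range (Sum.inl : A → A ⊕ B)).union ((hB x hx).image Sum.inr)).subset ?_
    rintro (a | b) h
    · left; exact ⟨a, rfl⟩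
    · right; exact ⟨b, h, rfl⟩
  refine ⟨⟨A ⊕ B, w, hfin, ?_, ?_, ?_⟩⟩
  · intro x hx
    have h := Height.AdmissibleAbsValues.product_formula hx
    have h1 : (Multiset.map (fun v : AbsoluteValue K ℝ => v x)
        (Height.AdmissibleAbsValues.archAbsVal (K := K))).prod = ∏ a : A, w (Sum.inl a) x := by
      conv_lhs => rw [← Multiset.coe_toList (Height.AdmissibleAbsValues.archAbsVal (K := K))]
      rw [Multiset.map_coe, Multiset.prod_coe, ← Fin.prod_univ_fun_getElem]
      rfl
    rw [h1, ← finprod_eq_prod_of_fintype, ← finprod_mem_range (f := fun i => w i x) Sum.inl_injective] at h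
    have h2 : ∏ᶠ b : B, b.1 x = ∏ᶠ i ∈ Set.range (Sum.inr : B → A ⊕ B), w i x := by
      rw [finprod_mem_range Sum.inr_injective]
      rfl
    change (∏ᶠ i ∈ Set.range (Sum.inl : A → A ⊕ B), w i x) * ∏ᶠ b : B, b.1 x = 1 at h
    rw [h2, ← finprod_mem_union' Set.isCompl_range_inl_range_inr.disjoint
      ((hfin x hx).subset Set.inter_subset_right) ((hfin x hx).subset Set.inter_subset_right),
      Set.range_inl_union_range_inr, finprod_mem_univ] at h
    exact h
  · refine (Set.finite_range (Sum.inl : A → A ⊕ B)).subset ?_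
    rintro (a | b) h
    · exact ⟨a, rfl⟩
    · exact absurd (Height.AdmissibleAbsValues.isNonarchimedean b.1 b.2) h
  · obtain ⟨v⟩ : Nonempty (NumberField.InfinitePlace K) := inferInstance
    have hv : v.1 ∈ l := by
      rw [Multiset.mem_toList]
      exact NumberField.mem_multisetInfinitePlace.2 v.2
    obtain ⟨a, ha⟩ := List.get_of_mem hv
    refine ⟨Sum.inl a, 2, ?_⟩
    change 1 < (l.get a) 2
    rw [ha]
    have := NumberField.InfinitePlace.norm_embedding_eq v 2
    rw [map_ofNat] at this
    change 1 < v 2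
    rw [← this]
    norm_num

/-- The members of the family are places in the sense of `PlaceK.IsPlaceOver`. -/
def ProductFormulaFamily.IsOver {K : Type} [Field K] (M : ProductFormulaFamily K)
    (κ : Subfield K) : Prop :=
  NumberField K ∨ ∀ i, ∀ c ∈ κ, c ≠ 0 → M.w i c = 1

theorem exists_productFormulaFamily (K : Type) [Field K] (κ : Subfield K)
    (hK : NumberFieldOrFunctionFieldOver K κ) :
    ∃ M : ProductFormulaFamily K, M.IsOver κ := by
  rcases hK with h | ⟨h0, ⟨t, ht, hfd⟩, -⟩
  · obtain ⟨M⟩ := exists_family_numberField K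
    exact ⟨M, Or.inl h⟩
  · obtain ⟨M, hM, hC⟩ := exists_family_ratFunc κ
    let e := RatFunc.algEquivOfTranscendental t ht
    let : Algebra (RatFunc κ) K :=
      ((algebraMap (IntermediateField.adjoin κ {t}) K).comp e.toRingEquiv.toRingHom).toAlgebra
    have hfd' : FiniteDimensional (RatFunc κ) K := by
      refine Module.Finite.of_equiv_equiv e.symm.toRingEquiv (RingEquiv.refl K) ?_
      ext x
      change algebraMap (IntermediateField.adjoin κ {t}) K (e (e.symm x)) = _
      rw [e.apply_symm_apply]
      rfl
    have : CharZero (RatFunc κ) := by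
      have : CharZero κ := inferInstance
      exact charZero_of_injective_algebraMap (algebraMap κ (RatFunc κ)).injective
    obtain ⟨N, hN⟩ := exists_family_of_finite_extension (K := K) M hM
    refine ⟨N, Or.inr fun j c hc hc0 => ?_⟩
    obtain ⟨i, hi⟩ := hN j
    have h1 : algebraMap (RatFunc κ) K (RatFunc.C ⟨c, hc⟩) = c := by
      change algebraMap (IntermediateField.adjoin κ {t}) K (e (RatFunc.C ⟨c, hc⟩)) = c
      rw [← RatFunc.algebraMap_eq_C, e.commutes]
      rfl
    rw [← h1, hi, hC]
    intro h
    exact hc0 (congrArg Subtype.val h)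

end ProductFormula

end

section

namespace ProductFormulaFamily

open Filter

variable {K : Type} [Field K] (M : ProductFormulaFamily K)

theorem exists_ext (i : M.Idx) : ∃ W : AbsoluteValue (AlgebraicClosure K) ℝ, IsNonarchimedean W ∧
    (IsNonarchimedean (M.w i) → ∀ x, W (algebraMap K _ x) = M.w i x) := by
  classical
  by_cases h : IsNonarchimedean (M.w i)
  · obtain ⟨W, h1, h2⟩ := exists_nonarchimedean_extension (M.w i) h (AlgebraicClosure K)
    exact ⟨W, h1, fun _ => h2⟩
  · exact ⟨AbsoluteValue.trivial, isNonarchimedean_of_forall_eq_one _ fun x hx => by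
      simp [AbsoluteValue.trivial, hx], fun h' => absurd h' h⟩

/-- An extension to the algebraic closure of a nonarchimedean member of the family. -/
noncomputable def ext (i : M.Idx) : AbsoluteValue (AlgebraicClosure K) ℝ :=
  (M.exists_ext i).choose

theorem ext_nonarch (i : M.Idx) : IsNonarchimedean (M.ext i) := (M.exists_ext i).choose_spec.1

theorem ext_algebraMap {i : M.Idx} (hi : IsNonarchimedean (M.w i)) (x : K) :
    M.ext i (algebraMap K _ x) = M.w i x := (M.exists_ext i).choose_spec.2 hi x

theorem eventually_nonarch : ∀ᶠ i in cofinite, IsNonarchimedean (M.w i) := M.finite_arch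

theorem eventually_w_eq_one {x : K} (hx : x ≠ 0) : ∀ᶠ i in cofinite, M.w i x = 1 :=
  M.finite_ne_one x hx

theorem eventually_w_le_one (x : K) : ∀ᶠ i in cofinite, M.w i x ≤ 1 := by
  by_cases hx : x = 0
  · simp [hx]
  · exact (M.eventually_w_eq_one hx).mono fun i hi => hi.le

theorem eventually_ext_eq_one {z : AlgebraicClosure K} (hz : z ≠ 0) :
    ∀ᶠ i in cofinite, M.ext i z = 1 := by
  have h := finite_setOf_extension_ne_one M.w {i | IsNonarchimedean (M.w i)} M.finite_ne_one M.ext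
    (fun i _ => M.ext_nonarch i) (fun i hi => M.ext_algebraMap hi) z hz
    (Algebra.IsIntegral.isIntegral z)
  have h' : ∀ᶠ i in cofinite, ¬ (i ∈ {i | IsNonarchimedean (M.w i)} ∧ M.ext i z ≠ 1) := by
    rw [Filter.eventually_cofinite]
    simpa only [not_not] using h
  filter_upwards [h', M.eventually_nonarch] with i h1 h2
  by_contra h3
  exact h1 ⟨h2, h3⟩

theorem eventually_ext_le_one (z : AlgebraicClosure K) : ∀ᶠ i in cofinite, M.ext i z ≤ 1 := by
  by_cases hz : z = 0
  · simp [hz]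
  · exact (M.eventually_ext_eq_one hz).mono fun i hi => hi.le

theorem eventually_ext_coeff_le_one (p : (AlgebraicClosure K)[X]) :
    ∀ᶠ i in cofinite, ∀ n, M.ext i (p.coeff n) ≤ 1 := by
  have h : ∀ᶠ i in cofinite, ∀ n ∈ p.support, M.ext i (p.coeff n) ≤ 1 :=
    (Filter.eventually_all_finset p.support).2 fun n _ => M.eventually_ext_le_one _
  filter_upwards [h] with i hi n
  by_cases hn : n ∈ p.support
  · exact hi n hn
  · simp [notMem_support_iff.1 hn]

theorem eventually_ext_mvCoeff_le_one {σ : Type*} (p : MvPolynomial σ (AlgebraicClosure K)) :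
    ∀ᶠ i in cofinite, ∀ s, M.ext i (p.coeff s) ≤ 1 := by
  have h : ∀ᶠ i in cofinite, ∀ s ∈ p.support, M.ext i (p.coeff s) ≤ 1 :=
    (Filter.eventually_all_finset p.support).2 fun n _ => M.eventually_ext_le_one _
  filter_upwards [h] with i hi n
  by_cases hn : n ∈ p.support
  · exact hi n hn
  · simp [MvPolynomial.notMem_support_iff.1 hn]

theorem one_le_prod_of_le_one {x : K} (hx : x ≠ 0) (S : Finset M.Idx)
    (h : ∀ i ∉ S, M.w i x ≤ 1) : 1 ≤ ∏ i ∈ S, M.w i x := by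
  classical
  have hfin := M.finite_ne_one x hx
  have h1 : ∏ᶠ i, M.w i x = ∏ i ∈ S ∪ hfin.toFinset, M.w i x :=
    finprod_eq_prod_of_mulSupport_subset _ fun i hi => by
      simp only [Finset.coe_union, Set.Finite.coe_toFinset, Set.mem_union]
      exact Or.inr hi
  rw [M.finprod_eq_one x hx, ← Finset.union_sdiff_self_eq_union,
    Finset.prod_union Finset.disjoint_sdiff] at h1
  have h2 : ∏ i ∈ hfin.toFinset \ S, M.w i x ≤ 1 :=
    Finset.prod_le_one (fun i _ => (M.w i).nonneg _) fun i hi => h i (Finset.mem_sdiff.1 hi).2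
  have h3 : 0 ≤ ∏ i ∈ S, M.w i x := Finset.prod_nonneg fun i _ => (M.w i).nonneg _
  nlinarith

/-- Sequences that are bounded at every place, and integral at almost all places. -/
def bddSeq : Subring (ℕ → K) where
  carrier := {y | (∀ᶠ i in cofinite, ∀ m, M.w i (y m) ≤ 1) ∧ ∀ i, ∃ B, ∀ m, M.w i (y m) ≤ B}
  mul_mem' {y z} hy hz := by
    refine ⟨?_, fun i => ?_⟩
    · filter_upwards [hy.1, hz.1] with i h1 h2 m
      rw [Pi.mul_apply, map_mul]
      exact mul_le_one₀ (h1 m) ((M.w i).nonneg _) (h2 m)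
    · obtain ⟨B, hB⟩ := hy.2 i
      obtain ⟨C, hC⟩ := hz.2 i
      refine ⟨B * C, fun m => ?_⟩
      rw [Pi.mul_apply, map_mul]
      exact mul_le_mul (hB m) (hC m) ((M.w i).nonneg _) (((M.w i).nonneg _).trans (hB m))
  one_mem' := ⟨by simp, fun i => ⟨1, by simp⟩⟩
  add_mem' {y z} hy hz := by
    refine ⟨?_, fun i => ?_⟩
    · filter_upwards [hy.1, hz.1, M.eventually_nonarch] with i h1 h2 h3 m
      exact (h3 _ _).trans (max_le (h1 m) (h2 m))
    · obtain ⟨B, hB⟩ := hy.2 i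
      obtain ⟨C, hC⟩ := hz.2 i
      exact ⟨B + C, fun m => ((M.w i).add_le _ _).trans (add_le_add (hB m) (hC m))⟩
  zero_mem' := ⟨by simp, fun i => ⟨1, by simp⟩⟩
  neg_mem' {y} hy := by simpa using hy

theorem const_mem_bddSeq (c : K) : (fun _ => c) ∈ M.bddSeq :=
  ⟨(M.eventually_w_le_one c).mono fun _ h _ => h, fun i => ⟨M.w i c, fun _ => le_rfl⟩⟩

theorem mvPolynomial_mem_bddSeq {σ : Type*} (x : σ → ℕ → K) (F : MvPolynomial σ K)
    (hx : ∀ j ∈ F.vars, x j ∈ M.bddSeq) :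
    (fun m => MvPolynomial.eval (fun j => x j m) F) ∈ M.bddSeq := by
  have h : (fun m => MvPolynomial.eval (fun j => x j m) F) =
      ∑ s ∈ F.support, (fun _ : ℕ => F.coeff s) * ∏ j ∈ s.support, x j ^ s j := by
    ext m
    rw [MvPolynomial.eval_eq]
    simp
  rw [h]
  refine sum_mem fun s hs => mul_mem (M.const_mem_bddSeq _) (prod_mem fun j hj => pow_mem (hx j ?_) _)
  exact (MvPolynomial.mem_vars_iff_mem_support j).2 ⟨s, hs, hj⟩

theorem polynomial_mem_bddSeq {y : ℕ → K} (hy : y ∈ M.bddSeq) (p : K[X]) :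
    (fun m => p.eval (y m)) ∈ M.bddSeq := by
  have h : (fun m => p.eval (y m)) =
      ∑ s ∈ Finset.range (p.natDegree + 1), (fun _ : ℕ => p.coeff s) * y ^ s := by
    ext m
    rw [eval_eq_sum_range]
    simp
  rw [h]
  exact sum_mem fun s _ => mul_mem (M.const_mem_bddSeq _) (pow_mem hy _)

/-- A bounded sequence is bounded below at every place, except where it vanishes. -/
theorem exists_lower_bound {y : ℕ → K} (hy : y ∈ M.bddSeq) (i : M.Idx) :
    ∃ δ > 0, ∀ m, y m = 0 ∨ δ ≤ M.w i (y m) := by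
  classical
  have hfin : {i | ¬ ∀ m, M.w i (y m) ≤ 1}.Finite := hy.1
  choose B hB using hy.2
  let S := insert i hfin.toFinset
  have hC : 0 < ∏ j ∈ S.erase i, max (B j) 1 :=
    Finset.prod_pos fun j _ => lt_max_of_lt_right one_pos
  refine ⟨(∏ j ∈ S.erase i, max (B j) 1)⁻¹, inv_pos.2 hC, fun m => ?_⟩
  by_cases h0 : y m = 0
  · exact Or.inl h0
  right
  have h1 := M.one_le_prod_of_le_one h0 S fun j hj => by
    by_contra hcon
    exact hj (Finset.mem_insert_of_mem (by
      rw [Set.Finite.mem_toFinset]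
      exact fun h => hcon (h m)))
  rw [← Finset.mul_prod_erase S _ (Finset.mem_insert_self _ _)] at h1
  have h2 : ∏ j ∈ S.erase i, M.w j (y m) ≤ ∏ j ∈ S.erase i, max (B j) 1 :=
    Finset.prod_le_prod (fun j _ => (M.w j).nonneg _) fun j _ => (hB j m).trans (le_max_left _ _)
  rw [inv_le_iff_one_le_mul₀ hC]
  exact h1.trans (mul_le_mul_of_nonneg_left h2 ((M.w i).nonneg _))

theorem exists_lower_bound_sub {y : ℕ → K} (hy : y ∈ M.bddSeq) {i : M.Idx}
    (hi : IsNonarchimedean (M.w i)) (c : AlgebraicClosure K) :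
    ∃ δ > 0, ∀ m, algebraMap K _ (y m) = c ∨ δ ≤ M.ext i (algebraMap K _ (y m) - c) := by
  have hc : IsIntegral K c := Algebra.IsIntegral.isIntegral c
  obtain ⟨h, hh⟩ : (X - C c) ∣ (minpoly K c).map (algebraMap K (AlgebraicClosure K)) := by
    rw [dvd_iff_isRoot, IsRoot, eval_map_algebraMap]
    exact minpoly.aeval K c
  obtain ⟨δ, hδ, h1⟩ := M.exists_lower_bound (M.polynomial_mem_bddSeq hy (minpoly K c)) i
  obtain ⟨B, hB⟩ := hy.2 i
  have hbd : ∃ C > 0, ∀ m, M.ext i (h.eval (algebraMap K _ (y m))) ≤ C := by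
    refine ⟨1 + ∑ n ∈ Finset.range (h.natDegree + 1), M.ext i (h.coeff n) * B ^ n, ?_, fun m => ?_⟩
    · have hB0 : 0 ≤ B := ((M.w i).nonneg _).trans (hB 0)
      have : 0 ≤ ∑ n ∈ Finset.range (h.natDegree + 1), M.ext i (h.coeff n) * B ^ n :=
        Finset.sum_nonneg fun n _ => mul_nonneg ((M.ext i).nonneg _) (by positivity)
      linarith
    · rw [eval_eq_sum_range]
      refine ((M.ext i).sum_le _ _).trans ?_
      refine le_add_of_nonneg_of_le zero_le_one (Finset.sum_le_sum fun n _ => ?_)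
      rw [map_mul, map_pow, M.ext_algebraMap hi]
      exact mul_le_mul_of_nonneg_left (pow_le_pow_left₀ ((M.w i).nonneg _) (hB m) _)
        ((M.ext i).nonneg _)
  obtain ⟨C, hC, h2⟩ := hbd
  refine ⟨δ / C, by positivity, fun m => ?_⟩
  have h3 : algebraMap K _ ((minpoly K c).eval (y m)) =
      (algebraMap K _ (y m) - c) * h.eval (algebraMap K _ (y m)) := by
    have := congrArg (eval (algebraMap K _ (y m))) hh
    rwa [eval_mul, eval_sub, eval_X, eval_C, eval_map_algebraMap, aeval_algebraMap_apply_eq_algebraMap_eval] at this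
  rcases h1 m with h4 | h4
  · left
    have hdeg := degree_eq_one_of_irreducible_of_root (minpoly.irreducible hc) h4
    obtain ⟨z, hz⟩ := minpoly.mem_range_of_degree_eq_one K c hdeg
    rw [← hz, minpoly.eq_X_sub_C] at h4
    simp only [eval_sub, eval_X, eval_C] at h4
    rw [sub_eq_zero.1 h4, hz]
  · right
    rw [← M.ext_algebraMap hi, h3, map_mul] at h4
    rw [div_le_iff₀ hC]
    exact h4.trans (mul_le_mul_of_nonneg_left (h2 m) ((M.ext i).nonneg _))

end ProductFormulaFamily

end

section

section PolynomialBounds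

variable {F : Type*} [Field F] (w : AbsoluteValue F ℝ)

theorem AbsoluteValue.exists_eval_le (p : F[X]) (B : ℝ) : ∃ C > 0, ∀ x, w x ≤ B → w (p.eval x) ≤ C := by
  refine ⟨1 + ∑ n ∈ Finset.range (p.natDegree + 1), w (p.coeff n) * |B| ^ n, ?_, fun x hx => ?_⟩
  · have : 0 ≤ ∑ n ∈ Finset.range (p.natDegree + 1), w (p.coeff n) * |B| ^ n :=
      Finset.sum_nonneg fun n _ => mul_nonneg (w.nonneg _) (by positivity)
    linarith
  · rw [eval_eq_sum_range]
    refine (w.sum_le _ _).trans ?_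
    refine le_add_of_nonneg_of_le zero_le_one (Finset.sum_le_sum fun n _ => ?_)
    rw [map_mul, map_pow]
    exact mul_le_mul_of_nonneg_left (pow_le_pow_left₀ (w.nonneg _) (hx.trans (le_abs_self B)) _)
      (w.nonneg _)

theorem AbsoluteValue.exists_le_eval (p : F[X]) (hp : 1 ≤ p.natDegree) (T : ℝ) :
    ∃ R, ∀ x, R ≤ w x → T ≤ w (p.eval x) := by
  have h := tendsto_abv_atTop w p (natDegree_pos_iff_degree_pos.1 hp)
    (l := Filter.comap w Filter.atTop) (z := id) Filter.tendsto_comap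
  have h2 := h.eventually (Filter.eventually_ge_atTop T)
  rw [Filter.eventually_comap] at h2
  obtain ⟨R, hR⟩ := Filter.eventually_atTop.1 h2
  exact ⟨R, fun x hx => hR _ hx x rfl⟩

theorem AbsoluteValue.exists_lower_bound_of_isCoprime {U V : F[X]} (hU : 1 ≤ U.natDegree)
    (h : IsCoprime U V) : ∃ c > 0, ∀ x, c ≤ w (U.eval x) ∨ c ≤ w (V.eval x) := by
  obtain ⟨A, B, hAB⟩ := h
  obtain ⟨R, hR⟩ := w.exists_le_eval U hU 1
  obtain ⟨C, hC, h1⟩ := w.exists_eval_le A R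
  obtain ⟨D, hD, h2⟩ := w.exists_eval_le B R
  refine ⟨min 1 (1 / (C + D)), by positivity, fun x => ?_⟩
  rcases le_total R (w x) with hx | hx
  · exact Or.inl ((min_le_left _ _).trans (hR x hx))
  by_contra hcon
  push Not at hcon
  have h3 : w (U.eval x) < 1 / (C + D) := hcon.1.trans_le (min_le_right _ _)
  have h4 : w (V.eval x) < 1 / (C + D) := hcon.2.trans_le (min_le_right _ _)
  have h5 : (1 : ℝ) ≤ w (A.eval x) * w (U.eval x) + w (B.eval x) * w (V.eval x) := by
    have := congrArg (eval x) hAB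
    rw [eval_add, eval_mul, eval_mul, eval_one] at this
    rw [← map_mul, ← map_mul, ← w.map_one, ← this]
    exact w.add_le _ _
  have h6 : w (A.eval x) * w (U.eval x) ≤ C * w (U.eval x) :=
    mul_le_mul_of_nonneg_right (h1 x hx) (w.nonneg _)
  have h7 : w (B.eval x) * w (V.eval x) ≤ D * w (V.eval x) :=
    mul_le_mul_of_nonneg_right (h2 x hx) (w.nonneg _)
  have h8 : C * w (U.eval x) < C * (1 / (C + D)) := mul_lt_mul_of_pos_left h3 hC
  have h9 : D * w (V.eval x) < D * (1 / (C + D)) := mul_lt_mul_of_pos_left h4 hD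
  have h10 : C * (1 / (C + D)) + D * (1 / (C + D)) = 1 := by field_simp
  linarith

end PolynomialBounds

theorem Polynomial.isCoprime_comp_iterate {F : Type*} [Field F] {f g H : F[X]}
    (hgH : g.comp f = g * H) (hco : IsCoprime g H) {a b : ℕ} (hab : a < b) :
    IsCoprime (H.comp (f.comp^[a] X)) (H.comp (f.comp^[b] X)) := by
  have hit : ∀ l, g.comp (f.comp^[l + 1] X) = g.comp (f.comp^[l] X) * H.comp (f.comp^[l] X) := by
    intro l
    rw [Function.iterate_succ_apply', ← comp_assoc, hgH, mul_comp]
  have hdvd : ∀ l m, l ≤ m → g.comp (f.comp^[l] X) ∣ g.comp (f.comp^[m] X) := by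
    intro l m hlm
    induction m, hlm using Nat.le_induction with
    | base => exact dvd_rfl
    | succ m _ ih => exact ih.trans ⟨_, hit m⟩
  have h1 : H.comp (f.comp^[a] X) ∣ g.comp (f.comp^[b] X) :=
    (Dvd.intro_left _ (hit a).symm).trans (hdvd _ _ hab)
  have h2 : IsCoprime (g.comp (f.comp^[b] X)) (H.comp (f.comp^[b] X)) :=
    hco.map (compRingHom (f.comp^[b] X))
  exact h2.of_isCoprime_of_dvd_left h1

namespace ProductFormulaFamily

open Filter

variable {K : Type} [Field K] (M : ProductFormulaFamily K)

theorem eventually_coeff_le_one (p : K[X]) : ∀ᶠ i in cofinite, ∀ n, M.w i (p.coeff n) ≤ 1 := by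
  have h : ∀ᶠ i in cofinite, ∀ n ∈ p.support, M.w i (p.coeff n) ≤ 1 :=
    (Filter.eventually_all_finset p.support).2 fun n _ => M.eventually_w_le_one _
  filter_upwards [h] with i hi n
  by_cases hn : n ∈ p.support
  · exact hi n hn
  · simp [notMem_support_iff.1 hn]

/-- At almost every place, every polynomial over `K` takes integral values at integral points. -/
theorem eventually_eval_le_one (p : K[X]) :
    ∀ᶠ i in cofinite, ∀ x, M.w i x ≤ 1 → M.w i (p.eval x) ≤ 1 := by
  filter_upwards [M.eventually_coeff_le_one p, M.eventually_nonarch] with i h1 h2 x hx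
  exact AbsoluteValue.eval_le_one h2 (RingHom.id K) p h1 hx

theorem eventually_ext_eval_le_one (p : (AlgebraicClosure K)[X]) :
    ∀ᶠ i in cofinite, ∀ x, M.ext i x ≤ 1 → M.ext i (p.eval x) ≤ 1 := by
  filter_upwards [M.eventually_ext_coeff_le_one p] with i h1 x hx
  exact AbsoluteValue.eval_le_one (M.ext_nonarch i) (RingHom.id _) p h1 hx

variable {M} in
theorem eventually_orbit_le_one {f : K[X]} {x : ℕ → K} (hx : ∀ m, x (m + 1) = f.eval (x m)) :
    ∀ᶠ i in cofinite, ∀ m, M.w i (x m) ≤ 1 := by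
  filter_upwards [M.eventually_w_le_one (x 0), M.eventually_eval_le_one f] with i h1 h2 m
  induction m with
  | zero => exact h1
  | succ m ih => rw [hx]; exact h2 _ ih

/-- An unbounded orbit comes close to `g = 0` at infinitely many places. -/
theorem frequently_lt_one_of_isCoprime {f g H : K[X]} (hf : 2 ≤ f.natDegree) (hg : 1 ≤ g.natDegree)
    (hgH : g.comp f = g * H) (hco : IsCoprime g H) {x : ℕ → K}
    (hx : ∀ m, x (m + 1) = f.eval (x m)) {i0 : M.Idx} (hx0 : ∀ B, ∃ m, B < M.w i0 (x m)) :
    ∃ᶠ i in cofinite, ∃ m, M.w i (g.eval (x m)) < 1 := by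
  classical
  intro hcon
  push Not at hcon
  have hxs : ∀ l m, (f.comp^[l] X).eval (x m) = x (m + l) := by
    intro l m
    induction l with
    | zero => simp
    | succ l ih => rw [Function.iterate_succ_apply', eval_comp, ih, ← hx, add_assoc]
  have hstep : ∀ m, g.eval (x (m + 1)) = g.eval (x m) * H.eval (x m) := fun m => by
    rw [hx, ← eval_comp, hgH, eval_mul]
  have hH : 1 ≤ H.natDegree := by
    have h0 : H ≠ 0 := by
      rintro rfl
      rw [mul_zero] at hgH
      have := congrArg natDegree hgH
      rw [natDegree_comp, natDegree_zero] at this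
      have := Nat.mul_pos hg (by lia : 0 < f.natDegree)
      lia
    have := congrArg natDegree hgH
    rw [natDegree_comp, natDegree_mul (by rintro rfl; simp at hg) h0] at this
    nlinarith
  have hunit : ∀ᶠ i in cofinite, ∀ m, M.w i (H.eval (x m)) = 1 := by
    filter_upwards [hcon, eventually_orbit_le_one (M := M) hx, M.eventually_eval_le_one g]
      with i h1 h2 h3 m
    have h4 : ∀ m, M.w i (g.eval (x m)) = 1 := fun m => le_antisymm (h3 _ (h2 m)) (h1 m)
    have := congrArg (M.w i) (hstep m)
    rwa [map_mul, h4, h4, one_mul, eq_comm] at this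
  have hfin : {i | ¬ ∀ m, M.w i (H.eval (x m)) = 1}.Finite := hunit
  let S := insert i0 hfin.toFinset
  have hS : ∀ i ∉ S, ∀ m, M.w i (H.eval (x m)) = 1 := fun i hi => by
    by_contra h
    exact hi (Finset.mem_insert_of_mem (by simpa using h))
  have hpair : ∀ i : M.Idx, ∃ c > 0, ∀ a b, a < b → b ≤ S.card → ∀ m,
      c ≤ M.w i (H.eval (x (m + a))) ∨ c ≤ M.w i (H.eval (x (m + b))) := by
    intro i
    have h1 : ∀ a b, a < b → ∃ c > 0, ∀ m,
        c ≤ M.w i (H.eval (x (m + a))) ∨ c ≤ M.w i (H.eval (x (m + b))) := by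
      intro a b hab
      have hdeg : 1 ≤ (H.comp (f.comp^[a] X)).natDegree := by
        rw [natDegree_comp, natDegree_iterate_comp, natDegree_X, mul_one]
        exact Nat.mul_pos hH (pow_pos (by lia) _)
      obtain ⟨c, hc, h⟩ := (M.w i).exists_lower_bound_of_isCoprime hdeg
        (isCoprime_comp_iterate hgH hco hab)
      refine ⟨c, hc, fun m => ?_⟩
      have := h (x m)
      rwa [eval_comp, eval_comp, hxs, hxs] at this
    have h2 : ∀ s : Finset (ℕ × ℕ), ∃ c > 0, ∀ ab ∈ s, ab.1 < ab.2 → ∀ m,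
        c ≤ M.w i (H.eval (x (m + ab.1))) ∨ c ≤ M.w i (H.eval (x (m + ab.2))) := by
      intro s
      induction s using Finset.induction_on with
      | empty => exact ⟨1, one_pos, by simp⟩
      | insert ab s _ ih =>
        obtain ⟨c, hc, h⟩ := ih
        by_cases hab : ab.1 < ab.2
        · obtain ⟨c', hc', h'⟩ := h1 _ _ hab
          refine ⟨min c c', lt_min hc hc', fun p hp hlt m => ?_⟩
          rcases Finset.mem_insert.1 hp with rfl | hp
          · exact (h' m).imp (min_le_right _ _).trans (min_le_right _ _).trans
          · exact (h p hp hlt m).imp (min_le_left _ _).trans (min_le_left _ _).trans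
        · refine ⟨c, hc, fun p hp hlt m => ?_⟩
          rcases Finset.mem_insert.1 hp with rfl | hp
          · exact absurd hlt hab
          · exact h p hp hlt m
    obtain ⟨c, hc, h⟩ := h2 (Finset.range (S.card + 1) ×ˢ Finset.range (S.card + 1))
    refine ⟨c, hc, fun a b hab hb m => h (a, b) ?_ hab m⟩
    simp only [Finset.mem_product, Finset.mem_range]
    lia
  choose c hc hcab using hpair
  have hpig : ∀ m, ∃ l ≤ S.card, ∀ i ∈ S, c i ≤ M.w i (H.eval (x (m + l))) := by
    intro m
    by_contra h
    push Not at h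
    have : Nonempty M.Idx := ⟨i0⟩
    choose! j hjS hj using h
    obtain ⟨a, ha, b, hb, hab, hjab⟩ := Finset.exists_ne_map_eq_of_card_lt_of_maps_to
      (s := Finset.range (S.card + 1)) (t := S) (by simp) (f := j)
      (fun l hl => hjS l (by simpa [Nat.lt_succ_iff] using hl))
    simp only [Finset.mem_range, Nat.lt_succ_iff] at ha hb
    rcases lt_or_gt_of_ne hab with hlt | hlt
    · rcases hcab (j a) a b hlt hb m with h | h
      · exact absurd h (not_le.2 (hj a ha))
      · rw [hjab] at h
        exact absurd h (not_le.2 (hj b hb))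
    · rcases hcab (j a) b a hlt ha m with h | h
      · rw [hjab] at h
        exact absurd h (not_le.2 (hj b hb))
      · exact absurd h (not_le.2 (hj a ha))
  set P := ∏ i ∈ S.erase i0, c i with hPdef
  have hP : 0 < P := Finset.prod_pos fun i _ => hc i
  have hupper : ∀ m, ∃ l ≤ S.card, M.w i0 (H.eval (x (m + l))) ≤ P⁻¹ := by
    intro m
    obtain ⟨l, hl, h⟩ := hpig m
    refine ⟨l, hl, ?_⟩
    have hne : H.eval (x (m + l)) ≠ 0 := by
      intro h0
      have := h i0 (Finset.mem_insert_self _ _)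
      rw [h0, map_zero] at this
      exact absurd this (not_le.2 (hc i0))
    have h1 : ∏ᶠ i, M.w i (H.eval (x (m + l))) = ∏ i ∈ S, M.w i (H.eval (x (m + l))) :=
      finprod_eq_prod_of_mulSupport_subset _ fun i hi => by
        by_contra hiS
        exact hi (hS i hiS _)
    rw [M.finprod_eq_one _ hne, ← Finset.mul_prod_erase S _ (Finset.mem_insert_self _ _)] at h1
    have h2 : P ≤ ∏ i ∈ S.erase i0, M.w i (H.eval (x (m + l))) :=
      Finset.prod_le_prod (fun i _ => (hc i).le) fun i hi => h i (Finset.mem_of_mem_erase hi)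
    rw [le_inv_comm₀ ((M.w i0).pos hne) hP, inv_eq_of_mul_eq_one_right h1.symm]
    exact h2
  have hlower : ∀ n, ∃ R, ∀ l ≤ n, ∀ m, R ≤ M.w i0 (x m) → P⁻¹ + 1 ≤ M.w i0 (H.eval (x (m + l))) := by
    intro n
    have h1 : ∀ l, ∃ R, ∀ m, R ≤ M.w i0 (x m) → P⁻¹ + 1 ≤ M.w i0 (H.eval (x (m + l))) := by
      intro l
      have hdeg : 1 ≤ (H.comp (f.comp^[l] X)).natDegree := by
        rw [natDegree_comp, natDegree_iterate_comp, natDegree_X, mul_one]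
        exact Nat.mul_pos hH (pow_pos (by lia) _)
      obtain ⟨R, hR⟩ := (M.w i0).exists_le_eval _ hdeg (P⁻¹ + 1)
      refine ⟨R, fun m hm => ?_⟩
      have := hR (x m) hm
      rwa [eval_comp, hxs] at this
    choose R hR using h1
    refine ⟨∑ l ∈ Finset.range (n + 1), |R l|, fun l hl m hm => hR l m (le_trans ?_ hm)⟩
    exact (le_abs_self _).trans (Finset.single_le_sum (f := fun l => |R l|)
      (fun _ _ => abs_nonneg _) (by simpa [Nat.lt_succ_iff] using hl))
  obtain ⟨R, hR⟩ := hlower S.card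
  obtain ⟨m, hm⟩ := hx0 R
  obtain ⟨l, hl, h⟩ := hupper m
  have := hR l hl m hm.le
  linarith

end ProductFormulaFamily

end

section

section PeriodicPoints

variable {L : Type*} [Field L]

theorem Polynomial.exists_iterate_sub_X_factor (f : L[X]) (N : ℕ) :
    ∃ Q : L[X], f.comp^[N] X - X = (f - X) * Q ∧
      ∀ γ, f.eval γ = γ → Q.eval γ = ∑ j ∈ Finset.range N, (derivative f).eval γ ^ j := by
  induction N with
  | zero => exact ⟨0, by simp, by simp⟩
  | succ N ih =>
    obtain ⟨Q, hQ, h1⟩ := ih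
    obtain ⟨k, hk⟩ := binomExpansion (f.map C) X ((f - X) * Q)
    simp only [derivative_map, eval_map] at hk
    change f.comp _ = f.comp X + (derivative f).comp X * _ + _ at hk
    rw [comp_X, comp_X, ← hQ, add_sub_cancel, hQ] at hk
    refine ⟨(derivative f + k * ((f - X) * Q)) * Q + 1, ?_, fun γ hγ => ?_⟩
    · rw [Function.iterate_succ_apply', hk]
      ring
    · have h2 : ∑ j ∈ Finset.range N, (derivative f).eval γ ^ (j + 1) =
          Q.eval γ * (derivative f).eval γ := by
        rw [h1 γ hγ, Finset.sum_mul]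
        simp [pow_succ]
      rw [Finset.sum_range_succ', h2]
      simp [hγ]
      ring

theorem Polynomial.eval_derivative_iterate_comp (f : L[X]) (N : ℕ) (γ : L) :
    (derivative (f.comp^[N] X)).eval γ =
      ∏ j ∈ Finset.range N, (derivative f).eval ((fun x => f.eval x)^[j] γ) := by
  induction N with
  | zero => simp
  | succ N ih =>
    rw [Function.iterate_succ_apply', derivative_comp, eval_mul, ih, eval_comp, iterate_comp_eval,
      eval_X, Finset.prod_range_succ]

theorem Polynomial.exists_good_periodic_point [IsAlgClosed L] [CharZero L] {f : L[X]}
    (hf : 2 ≤ f.natDegree) {q : L[X]} (hq : q ≠ 0) :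
    ∃ N ≥ 1, ∃ γ, (f.comp^[N] X).eval γ = γ ∧ (derivative (f.comp^[N] X)).eval γ ≠ 0 ∧
      ∀ j, q.eval ((fun x => f.eval x)^[j] γ) ≠ 0 := by
  classical
  have hf' : derivative f ≠ 0 := fun h => by
    have := derivative_eq_zero.1 h
    lia
  have hfX : f - X ≠ 0 := fun h => by
    rw [sub_eq_zero.1 h, natDegree_X] at hf
    lia
  let φ : L → L := fun x => f.eval x
  let bad : Finset ℕ := ((q * derivative f).roots.toFinset.image fun δ => Function.minimalPeriod φ δ) ∪
    ((f - X).roots.toFinset.image fun δ => orderOf ((derivative f).eval δ))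
  obtain ⟨N, hN, hNbad⟩ := Nat.infinite_setOfPred_prime.exists_notMem_finset bad
  have hNp : N.Prime := hN
  have := Fact.mk hNp
  obtain ⟨Q, hQ, hQfix⟩ := f.exists_iterate_sub_X_factor N
  have hlt : f.natDegree < f.natDegree ^ N := lt_self_pow₀ (by lia) hNp.one_lt
  have hdegX : ∀ g : L[X], 2 ≤ g.natDegree → (g - X).natDegree = g.natDegree := fun g hg =>
    natDegree_sub_eq_left_of_natDegree_lt (by rw [natDegree_X]; lia)
  have hdit : (f.comp^[N] X).natDegree = f.natDegree ^ N := by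
    rw [natDegree_iterate_comp, natDegree_X, mul_one]
  have hQ0 : Q.degree ≠ 0 := by
    intro h
    have h2 := congrArg natDegree hQ
    rw [hdegX _ (by rw [hdit]; lia), hdit,
      natDegree_mul hfX (by rintro rfl; simp at h), hdegX f hf,
      natDegree_eq_zero_iff_degree_le_zero.2 h.le] at h2
    lia
  obtain ⟨γ, hγ⟩ := IsAlgClosed.exists_root Q hQ0
  have hper : (f.comp^[N] X).eval γ = γ := by
    have := congrArg (eval γ) hQ
    rwa [eval_mul, hγ.eq_zero, mul_zero, eval_sub, eval_X, sub_eq_zero] at this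
  have hper' : Function.IsPeriodicPt φ N γ := by
    rwa [iterate_comp_eval, eval_X] at hper
  have hnfix : ¬ Function.IsFixedPt φ γ := by
    intro hfix
    have h1 := hQfix γ hfix
    rw [hγ.eq_zero] at h1
    have hnot : orderOf ((derivative f).eval γ) ≠ N := fun h => hNbad <| by
      refine Finset.mem_union_right _ (Finset.mem_image.2 ⟨γ, ?_, h⟩)
      rw [Multiset.mem_toFinset, mem_roots hfX, IsRoot, eval_sub, eval_X, sub_eq_zero]
      exact hfix
    by_cases hone : (derivative f).eval γ = 1
    · rw [hone] at h1
      simp only [one_pow, Finset.sum_const, Finset.card_range, nsmul_eq_mul, mul_one] at h1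
      exact hNp.ne_zero (by exact_mod_cast h1.symm)
    · refine hnot (orderOf_eq_prime ?_ hone)
      have := geom_sum_mul ((derivative f).eval γ) N
      rw [← h1, zero_mul, eq_comm, sub_eq_zero] at this
      exact this
  have hmin := Function.minimalPeriod_eq_prime hper' hnfix
  have hgood : ∀ j, (q * derivative f).eval (φ^[j] γ) ≠ 0 := by
    intro j h0
    refine hNbad (Finset.mem_union_left _ (Finset.mem_image.2 ⟨φ^[j] γ, ?_, ?_⟩))
    · rw [Multiset.mem_toFinset, mem_roots (mul_ne_zero hq hf')]
      exact h0
    · rw [Function.minimalPeriod_apply_iterate ⟨N, hNp.pos, hper'⟩, hmin]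
  simp only [eval_mul, mul_ne_zero_iff] at hgood
  refine ⟨N, hNp.one_le, γ, hper, ?_, fun j => (hgood j).1⟩
  rw [eval_derivative_iterate_comp]
  exact Finset.prod_ne_zero_iff.2 fun j _ => (hgood j).2

end PeriodicPoints

namespace ProductFormulaFamily

open Filter

variable {K : Type} [Field K] {M : ProductFormulaFamily K}

theorem iterate_comp_eval_orbit {f : K[X]} {x : ℕ → K} (hx : ∀ m, x (m + 1) = f.eval (x m))
    (l m : ℕ) : (f.comp^[l] X).eval (x m) = x (m + l) := by
  induction l with
  | zero => simp
  | succ l ih => rw [Function.iterate_succ_apply', eval_comp, ih, ← hx, add_assoc]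

theorem unbounded_subsequence {f : K[X]} {x : ℕ → K} (hx : ∀ m, x (m + 1) = f.eval (x m))
    {i0 : M.Idx} (hx0 : ∀ B, ∃ m, B < M.w i0 (x m)) {N : ℕ} (hN : 1 ≤ N) (r : ℕ) :
    ∀ B, ∃ m, B < M.w i0 (x (r + N * m)) := by
  intro B
  by_contra hcon
  push Not at hcon
  choose C hC h using fun l => (M.w i0).exists_eval_le (f.comp^[l] X) B
  obtain ⟨m, hm⟩ := hx0 (∑ l ∈ Finset.range (N + r), (C l + M.w i0 (x l)))
  have hpos : ∀ l, 0 ≤ C l + M.w i0 (x l) := fun l => add_nonneg (hC l).le ((M.w i0).nonneg _)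
  have key : ∃ l < N + r, M.w i0 (x m) ≤ C l + M.w i0 (x l) := by
    by_cases hmr : m < r
    · exact ⟨m, by lia, le_add_of_nonneg_left (hC m).le⟩
    · refine ⟨(m - r) % N, by have := Nat.mod_lt (m - r) hN; lia, ?_⟩
      have h1 := h ((m - r) % N) _ (hcon ((m - r) / N))
      rw [iterate_comp_eval_orbit hx] at h1
      have h2 : r + N * ((m - r) / N) + (m - r) % N = m := by
        rw [add_assoc, Nat.div_add_mod]
        lia
      rw [h2] at h1
      exact h1.trans (le_add_of_nonneg_right ((M.w i0).nonneg _))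
  obtain ⟨l, hl, h1⟩ := key
  have := Finset.single_le_sum (f := fun l => C l + M.w i0 (x l)) (fun l _ => hpos l)
    (Finset.mem_range.2 hl)
  linarith

/-- For an unbounded orbit and a nonzero polynomial `q`, there are infinitely many places at which
the values of `q` are eventually units. -/
theorem frequently_eventually_eq_one [CharZero K] {f : K[X]} (hf : 2 ≤ f.natDegree) {x : ℕ → K}
    (hx : ∀ m, x (m + 1) = f.eval (x m)) {i0 : M.Idx} (hx0 : ∀ B, ∃ m, B < M.w i0 (x m))
    {q : (AlgebraicClosure K)[X]} (hq : q ≠ 0) :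
    ∃ᶠ i in cofinite, (∃ z, z ≠ 0 ∧ M.w i z ≠ 1) ∧
      ∃ m0, ∀ m ≥ m0, M.ext i (q.eval (algebraMap K _ (x m))) = 1 := by
  classical
  obtain ⟨q0, hq0, s, hs⟩ := exists_dvd_map_of_isAlgebraic (R := K) hq
  set fL := f.map (algebraMap K (AlgebraicClosure K)) with hfL
  have hfL2 : 2 ≤ fL.natDegree := by rwa [natDegree_map]
  obtain ⟨N, hN, γ, hγ, hγ', hγq⟩ := exists_good_periodic_point hfL2
    (q := q0.map (algebraMap K (AlgebraicClosure K))) (by simpa using hq0)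
  have hinteg : IsIntegral K γ := Algebra.IsIntegral.isIntegral γ
  have hmapit : ∀ l, (f.comp^[l] X).map (algebraMap K (AlgebraicClosure K)) = fL.comp^[l] X := by
    intro l
    induction l with
    | zero => simp
    | succ l ih => rw [Function.iterate_succ_apply', Function.iterate_succ_apply', Polynomial.map_comp, ih]
  set g := minpoly K γ with hg
  have hgirr : Irreducible g := minpoly.irreducible hinteg
  set F := f.comp^[N] X with hF
  have hdvd : ∀ p : K[X], g ∣ p ↔ (p.map (algebraMap K (AlgebraicClosure K))).eval γ = 0 := fun p => by
    rw [eval_map_algebraMap]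
    exact minpoly.dvd_iff
  have hFγ : (F.map (algebraMap K (AlgebraicClosure K))).eval γ = γ := by rw [hmapit, hγ]
  obtain ⟨H, hH⟩ : g ∣ g.comp F := by
    rw [hdvd, Polynomial.map_comp, eval_comp, hFγ, eval_map_algebraMap]
    exact minpoly.aeval K γ
  have hsep : (derivative (g.map (algebraMap K (AlgebraicClosure K)))).eval γ ≠ 0 := by
    rw [derivative_map, eval_map_algebraMap]
    exact (hgirr.separable).aeval_derivative_ne_zero (minpoly.aeval K γ)
  have hco : IsCoprime g H := by
    rw [hgirr.coprime_iff_not_dvd]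
    rintro ⟨t, ht⟩
    have h1 := congrArg (fun p => (derivative (p.map (algebraMap K (AlgebraicClosure K)))).eval γ) hH
    simp only [ht, Polynomial.map_comp, Polynomial.map_mul, derivative_comp, derivative_mul, eval_mul,
      eval_add, eval_comp, hFγ, (hdvd g).1 dvd_rfl, zero_mul, mul_zero, add_zero] at h1
    rcases mul_eq_zero.1 h1 with h2 | h2
    · rw [hmapit] at h2
      exact hγ' h2
    · exact hsep h2
  have hF2 : 2 ≤ F.natDegree := by
    rw [natDegree_iterate_comp, natDegree_X, mul_one]
    exact hf.trans (Nat.le_self_pow (by lia) _)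
  let y : ℕ → K := fun m => x (N * m)
  have hy : ∀ m, y (m + 1) = F.eval (y m) := fun m => by
    simp only [y, hF, iterate_comp_eval_orbit hx, mul_add, mul_one]
  have hy0 : ∀ B, ∃ m, B < M.w i0 (y m) := by
    have := unbounded_subsequence hx hx0 hN 0
    simpa only [zero_add] using this
  have hfreq := M.frequently_lt_one_of_isCoprime hF2 (minpoly.natDegree_pos hinteg) hH hco hy hy0
  have hstep : ∀ m, g.eval (y (m + 1)) = g.eval (y m) * H.eval (y m) := fun m => by
    rw [hy, ← eval_comp, hH, eval_mul]
  have hgne : ∀ m, g.eval (y m) ≠ 0 := by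
    intro m h0
    have h1 : ∀ l, g.eval (y (m + l)) = 0 := by
      intro l
      induction l with
      | zero => exact h0
      | succ l ih => rw [← add_assoc, hstep, ih, zero_mul]
    obtain ⟨B, hB⟩ := (g.roots.toFinset.image (M.w i0)).bddAbove
    obtain ⟨l, hl⟩ := unbounded_subsequence hy hy0 le_rfl m B
    refine absurd (hB (Finset.mem_image_of_mem _ (?_ : y (m + 1 * l) ∈ _))) (not_le.2 hl)
    rw [Multiset.mem_toFinset, mem_roots hgirr.ne_zero, one_mul]
    exact h1 l
  set Q := ∏ j ∈ Finset.range N, q0.comp (f.comp^[j] X) with hQ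
  have hQco : IsCoprime g Q := by
    rw [hgirr.coprime_iff_not_dvd, hdvd, hQ, Polynomial.map_prod, eval_prod, Finset.prod_eq_zero_iff]
    rintro ⟨j, -, hj⟩
    rw [Polynomial.map_comp, eval_comp, hmapit, iterate_comp_eval, eval_X] at hj
    exact hγq j hj
  obtain ⟨A, B, hAB⟩ := hQco
  refine (hfreq.and_eventually ((eventually_orbit_le_one (M := M) hx).and
    ((M.eventually_eval_le_one H).and ((M.eventually_eval_le_one A).and
    ((M.eventually_eval_le_one B).and ((M.eventually_eval_le_one q0).and
    ((M.eventually_ext_eval_le_one q).and ((M.eventually_ext_eval_le_one s).and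
    M.eventually_nonarch)))))))).mono ?_
  rintro i ⟨⟨m1, hm1⟩, hxi, hHi, hAi, hBi, hqi, hqe, hse, hna⟩
  refine ⟨⟨_, hgne m1, hm1.ne⟩, N * m1, fun m hm => ?_⟩
  have hsmall : ∀ l, M.w i (g.eval (y (m1 + l))) < 1 := by
    intro l
    induction l with
    | zero => exact hm1
    | succ l ih =>
      rw [← add_assoc, hstep, map_mul]
      exact mul_lt_one_of_nonneg_of_lt_one_left ((M.w i).nonneg _) ih (hHi _ (hxi _))
  have hq01 : ∀ m, M.w i (q0.eval (x m)) ≤ 1 := fun m => hqi _ (hxi m)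
  have hQ1 : ∀ l, M.w i (Q.eval (y (m1 + l))) = 1 := by
    intro l
    have hQle : M.w i (Q.eval (y (m1 + l))) ≤ 1 := by
      rw [hQ, eval_prod, map_prod]
      refine Finset.prod_le_one (fun _ _ => (M.w i).nonneg _) fun j _ => ?_
      rw [eval_comp, iterate_comp_eval_orbit hx]
      exact hq01 _
    have h1 := congrArg (eval (y (m1 + l))) hAB
    rw [eval_add, eval_mul, eval_mul, eval_one] at h1
    refine le_antisymm hQle ?_
    by_contra hlt
    push Not at hlt
    have h2 : M.w i (A.eval (y (m1 + l)) * g.eval (y (m1 + l))) < 1 := by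
      rw [map_mul]
      exact mul_lt_one_of_nonneg_of_lt_one_right (hAi _ (hxi _)) ((M.w i).nonneg _) (hsmall l)
    have h3 : M.w i (B.eval (y (m1 + l)) * Q.eval (y (m1 + l))) < 1 := by
      rw [map_mul]
      exact mul_lt_one_of_nonneg_of_lt_one_right (hBi _ (hxi _)) ((M.w i).nonneg _) hlt
    have h4 := hna (A.eval (y (m1 + l)) * g.eval (y (m1 + l))) (B.eval (y (m1 + l)) * Q.eval (y (m1 + l)))
    rw [h1, map_one] at h4
    exact absurd h4 (not_le.2 (max_lt h2 h3))
  have hq0one : M.w i (q0.eval (x m)) = 1 := by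
    have hm2 : m1 ≤ m / N := (Nat.le_div_iff_mul_le hN).2 (by rwa [mul_comm])
    have h1 := hQ1 (m / N - m1)
    rw [Nat.add_sub_of_le hm2, hQ, eval_prod, map_prod] at h1
    have h2 : ∀ j, (q0.comp (f.comp^[j] X)).eval (y (m / N)) = q0.eval (x (N * (m / N) + j)) := fun j => by
      rw [eval_comp, iterate_comp_eval_orbit hx]
    simp only [h2] at h1
    refine le_antisymm (hq01 m) ?_
    rw [← h1, ← Finset.mul_prod_erase _ _ (Finset.mem_range.2 (Nat.mod_lt m hN)), Nat.div_add_mod]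
    exact mul_le_of_le_one_right ((M.w i).nonneg _)
      (Finset.prod_le_one (fun _ _ => (M.w i).nonneg _) fun j _ => hq01 _)
  have h5 := congrArg (fun p => M.ext i (p.eval (algebraMap K _ (x m)))) hs
  simp only [eval_mul, map_mul] at h5
  rw [eval_map_algebraMap, aeval_algebraMap_apply_eq_algebraMap_eval, M.ext_algebraMap hna,
    hq0one] at h5
  have hxe : M.ext i (algebraMap K _ (x m)) ≤ 1 := by
    rw [M.ext_algebraMap hna]
    exact hxi m
  refine le_antisymm (hqe _ hxe) ?_
  rw [h5]
  exact mul_le_of_le_one_right ((M.ext i).nonneg _) (hse _ hxe)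

theorem frequently_nontrivial [CharZero K] (M : ProductFormulaFamily K) :
    ∃ᶠ i in cofinite, ∃ z, z ≠ 0 ∧ M.w i z ≠ 1 := by
  obtain ⟨i0, t, ht⟩ := M.nontrivial
  let x : ℕ → K := fun m => t ^ 2 ^ m
  have hx : ∀ m, x (m + 1) = (X ^ 2 : K[X]).eval (x m) := fun m => by
    simp only [x, eval_pow, eval_X]
    ring
  have hx0 : ∀ B, ∃ m, B < M.w i0 (x m) := by
    intro B
    obtain ⟨n, hn⟩ := pow_unbounded_of_one_lt B ht
    refine ⟨n, ?_⟩
    simp only [x, map_pow]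
    exact hn.trans_le (pow_le_pow_right₀ ht.le Nat.lt_two_pow_self.le)
  refine (frequently_eventually_eq_one (by simp) hx hx0
    (q := 1) one_ne_zero).mono fun i hi => hi.1

end ProductFormulaFamily

theorem infinitelyManyPlaces_of_frequently {K : Type} [Field K] {κ : Subfield K}
    {M : ProductFormulaFamily K} (hM : M.IsOver κ) {Q : PlaceK K → Prop}
    (h : ∃ᶠ i in Filter.cofinite, (∃ z, z ≠ 0 ∧ M.w i z ≠ 1) ∧ ∀ v : PlaceK K, v.v = M.w i → Q v) :
    InfinitelyManyPlaces K κ Q := by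
  classical
  have h' := h.and_eventually M.eventually_nonarch
  let P : M.Idx → Prop := fun i => ((∃ z, z ≠ 0 ∧ M.w i z ≠ 1) ∧
    ∀ v : PlaceK K, v.v = M.w i → Q v) ∧ IsNonarchimedean (M.w i)
  let r : M.Idx → M.Idx → Prop := fun i j => ¬ ∀ x, M.w i x < 1 ↔ M.w j x < 1
  have : Std.Symm r := ⟨fun i j hij hji => hij fun x => (hji x).symm⟩
  obtain ⟨F, hFP, hFr⟩ := exists_seq_of_forall_finset_exists' P r (fun s hs => by
    have hfin : ∀ i ∈ s, ∀ᶠ j in Filter.cofinite, r i j := by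
      intro i hi
      obtain ⟨⟨⟨z, hz, hz1⟩, -⟩, -⟩ := hs i hi
      obtain ⟨z, hz, hz1⟩ : ∃ z, z ≠ 0 ∧ M.w i z < 1 := by
        rcases lt_or_gt_of_ne hz1 with h | h
        · exact ⟨z, hz, h⟩
        · exact ⟨z⁻¹, inv_ne_zero hz, by rw [map_inv₀]; exact inv_lt_one_of_one_lt₀ h⟩
      filter_upwards [M.eventually_w_eq_one hz] with j hj hij
      exact ((hij z).1 hz1).ne hj
    obtain ⟨j, hj, hjr⟩ := (h'.and_eventually ((Filter.eventually_all_finset s).2 hfin)).exists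
    exact ⟨j, hj, hjr⟩)
  let T : ℕ → PlaceK K := fun n => ⟨M.w (F n), (hFP n).1.1⟩
  have hinj : Function.Injective T := by
    intro a b hab
    by_contra hne
    refine hFr hne fun x => ?_
    have : M.w (F a) = M.w (F b) := congrArg PlaceK.v hab
    rw [this]
  refine ⟨Set.range T, Set.infinite_range_of_injective hinj, ?_, ?_⟩
  · rintro _ ⟨a, rfl⟩ _ ⟨b, rfl⟩ hne heq
    exact hFr (fun h => hne (by rw [h])) heq
  · rintro _ ⟨a, rfl⟩
    refine ⟨(hFP a).2, ?_, (hFP a).1.2 _ rfl⟩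
    rcases hM with h | h
    · exact Or.inl h
    · exact Or.inr fun c hc hc0 => h _ c hc hc0

end

section

theorem MvPolynomial.exists_continuity_bound {σ F : Type*} [Field F] (w : AbsoluteValue F ℝ)
    (p : MvPolynomial σ F) : ∃ C > 0, ∀ Y Z : σ → F, (∀ j, w (Y j) ≤ 2) → (∀ j, w (Z j) ≤ 2) →
      w (eval Y p) ≤ C ∧ ∀ ε ≥ 0, (∀ j, w (Y j - Z j) ≤ ε) → w (eval Y p - eval Z p) ≤ C * ε := by
  induction p using MvPolynomial.induction_on with
  | C a =>
    refine ⟨w a + 1, by have := w.nonneg a; linarith, fun Y Z hY hZ => ⟨by simp, fun ε hε _ => ?_⟩⟩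
    simp only [eval_C, sub_self, map_zero]
    have := w.nonneg a
    positivity
  | add p q hp hq =>
    obtain ⟨C, hC, h1⟩ := hp
    obtain ⟨D, hD, h2⟩ := hq
    refine ⟨C + D, by positivity, fun Y Z hY hZ => ⟨?_, fun ε hε h => ?_⟩⟩
    · rw [eval_add]
      exact (w.add_le _ _).trans (add_le_add (h1 Y Z hY hZ).1 (h2 Y Z hY hZ).1)
    · rw [eval_add, eval_add, add_sub_add_comm, add_mul]
      exact (w.add_le _ _).trans (add_le_add ((h1 Y Z hY hZ).2 ε hε h) ((h2 Y Z hY hZ).2 ε hε h))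
  | mul_X p j hp =>
    obtain ⟨C, hC, h1⟩ := hp
    refine ⟨C * 2 + C, by positivity, fun Y Z hY hZ => ⟨?_, fun ε hε h => ?_⟩⟩
    · rw [eval_mul, eval_X, map_mul]
      have := mul_le_mul (h1 Y Z hY hZ).1 (hY j) (w.nonneg _) hC.le
      linarith
    · have h3 : eval Y (p * X j) - eval Z (p * X j) =
          (eval Y p - eval Z p) * Y j + eval Z p * (Y j - Z j) := by
        simp only [eval_mul, eval_X]
        ring
      rw [h3]
      refine (w.add_le _ _).trans ?_
      rw [map_mul, map_mul]
      have h4 := mul_le_mul ((h1 Y Z hY hZ).2 ε hε h) (hY j) (w.nonneg _) (by positivity)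
      have h5 := mul_le_mul (h1 Z Y hZ hY).1 (h j) (w.nonneg _) hC.le
      linarith

theorem polyEvalP1_infty {L : Type} [CommRing L] (f : L[X]) : polyEvalP1 f ∞ = ∞ := rfl

theorem polyEvalP1_coe {L : Type} [CommRing L] (f : L[X]) (a : L) :
    polyEvalP1 f (a : OnePoint L) = ((f.eval a : L) : OnePoint L) := rfl

theorem splitMap_iterate_infty {L : Type} [CommRing L] {ι : Type} (f : L[X]) {x : ι → OnePoint L}
    {j : ι} (h : x j = ∞) (m : ℕ) : (splitMap f)^[m] x j = ∞ := by
  induction m with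
  | zero => exact h
  | succ m ih => rw [Function.iterate_succ_apply', splitMap, ih, polyEvalP1_infty]

theorem splitMap_iterate_coe {L : Type} [CommRing L] {ι : Type} (f : L[X]) {x : ι → OnePoint L}
    {j : ι} {a : L} (h : x j = a) (m : ℕ) :
    (splitMap f)^[m] x j = (((fun t => f.eval t)^[m] a : L) : OnePoint L) := by
  induction m with
  | zero => exact h
  | succ m ih =>
    rw [Function.iterate_succ_apply', splitMap, ih, polyEvalP1_coe, Function.iterate_succ_apply']

theorem splitMap_iterate_eq_infty_iff {L : Type} [CommRing L] {ι : Type} (f : L[X])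
    {x : ι → OnePoint L} {j : ι} (m : ℕ) : (splitMap f)^[m] x j = ∞ ↔ x j = ∞ := by
  refine ⟨fun h => ?_, fun h => splitMap_iterate_infty f h m⟩
  by_contra hne
  obtain ⟨a, ha⟩ := OnePoint.ne_infty_iff_exists.1 hne
  rw [splitMap_iterate_coe f ha.symm] at h
  exact OnePoint.coe_ne_infty _ h

theorem homCoords_infty {L : Type} [CommRing L] : homCoords (∞ : OnePoint L) = ![1, 0] := rfl

theorem homCoords_coe {L : Type} [CommRing L] (a : L) : homCoords (a : OnePoint L) = ![a, 1] := rfl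

theorem homCoords_mapPoint {K L : Type} [Field K] [Field L] (φ : K →+* L) (x : OnePoint K) (s : Fin 2) :
    homCoords (mapPoint φ x) s = φ (homCoords x s) := by
  induction x using OnePoint.rec with
  | infty =>
    change homCoords ∞ s = _
    rw [homCoords_infty, homCoords_infty]
    fin_cases s <;> simp
  | coe a =>
    change homCoords ((φ a : L) : OnePoint L) s = _
    rw [homCoords_coe, homCoords_coe]
    fin_cases s <;> simp

theorem splitMap_iterate_mapPoint {K L : Type} [Field K] [Field L] {ι : Type} (φ : K →+* L) (f : K[X])
    (x : ι → OnePoint K) (m : ℕ) :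
    (splitMap (f.map φ))^[m] (fun i => mapPoint φ (x i)) =
      fun i => mapPoint φ ((splitMap f)^[m] x i) := by
  induction m with
  | zero => rfl
  | succ m ih =>
    funext i
    rw [Function.iterate_succ_apply', ih, Function.iterate_succ_apply']
    change polyEvalP1 _ (mapPoint φ _) = mapPoint φ (polyEvalP1 _ _)
    induction (splitMap f)^[m] x i using OnePoint.rec with
    | infty => rfl
    | coe a =>
      change (((f.map φ).eval (φ a) : L) : OnePoint L) = ((φ (f.eval a) : L) : OnePoint L)
      rw [eval_map, eval₂_hom]

/-- Homogeneous coordinates of the `m`-th point of the orbit of `P`. -/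
def orbitHom {K : Type} [CommRing K] {ι : Type} (f : K[X]) (P : ι → OnePoint K) (m : ℕ) :
    ι × Fin 2 → K :=
  fun jk => homCoords ((splitMap f)^[m] P jk.1) jk.2

section Distance

variable {F : Type} [Field F] (w : AbsoluteValue F ℝ)

theorem p1Dist_self (x : OnePoint F) : p1Dist w x x = 0 := by
  induction x using OnePoint.rec with
  | infty => rfl
  | coe a =>
    change w (a - a) / (max 1 (w a) * max 1 (w a)) = 0
    simp

theorem p1Dist_coe_coe (a b : F) :
    p1Dist w (a : OnePoint F) b = w (a - b) / (max 1 (w a) * max 1 (w b)) := rfl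

theorem exists_forall_p1Dist_lt {ι : Type} [Finite ι] {S : Set (ι → OnePoint F)} {y : ι → OnePoint F}
    (hy : y ∈ adicClosure w S) {ε : ι → ℝ} (hε : ∀ j, 0 < ε j) : ∃ z ∈ S, ∀ j, p1Dist w (y j) (z j) < ε j := by
  let _ : TopologicalSpace (OnePoint F) := p1Top w
  have hopen : IsOpen {z : ι → OnePoint F | ∀ j, p1Dist w (y j) (z j) < ε j} := by
    have : {z : ι → OnePoint F | ∀ j, p1Dist w (y j) (z j) < ε j} =
        ⋂ j, (fun z : ι → OnePoint F => z j) ⁻¹' {t | p1Dist w (y j) t < ε j} := by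
      ext z
      simp
    rw [this]
    refine isOpen_iInter_of_finite fun j => IsOpen.preimage (continuous_apply j) ?_
    exact TopologicalSpace.isOpen_generateFrom_of_mem ⟨y j, ε j, hε j, rfl⟩
  have hcl : y ∈ closure S := hy
  obtain ⟨z, hz, hzS⟩ := mem_closure_iff.1 hcl _ hopen fun j => by rw [p1Dist_self]; exact hε j
  exact ⟨z, hzS, hz⟩

theorem abv_sub_le_of_p1Dist_lt {a b : F} (ha : w a ≤ 1) {ε : ℝ} (hε : ε ≤ 1 / 2)
    (h : p1Dist w (b : OnePoint F) a < ε) : w b ≤ 2 ∧ w (b - a) ≤ 2 * ε := by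
  rw [p1Dist_coe_coe, max_eq_left ha, mul_one, div_lt_iff₀ (by positivity)] at h
  have h1 : w b - w a ≤ w (b - a) := w.le_sub _ _
  have h2 : w b ≤ 2 := by
    rcases le_total (w b) 1 with hb | hb
    · linarith
    · rw [max_eq_right hb] at h
      nlinarith
  have h3 : max 1 (w b) ≤ 2 := max_le (by norm_num) h2
  have h4 : 0 < ε := by
    by_contra hcon
    push Not at hcon
    have : ε * max 1 (w b) ≤ 0 := mul_nonpos_of_nonpos_of_nonneg hcon (by positivity)
    have := w.nonneg (b - a)
    linarith
  refine ⟨h2, ?_⟩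
  nlinarith

end Distance

theorem orbitClosureAvoids_of_lower_bound {K : Type} [Field K] {n : ℕ} {v : PlaceK K} {f : K[X]}
    {P : Fin n → OnePoint K} {V : ClosedSubvar K (Fin n)}
    (hinteg : ∀ m jk, v.v (orbitHom f P m jk) ≤ 1) {S : Finset (MvPolynomial (Fin n × Fin 2) K)}
    (hS : ∀ p ∈ S, p ∈ V.polys) {δ : ℝ} (hδ : 0 < δ)
    (h : ∀ m, ∃ p ∈ S, δ ≤ v.v (MvPolynomial.eval (orbitHom f P m) p)) :
    OrbitClosureAvoids v f P V := by
  classical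
  intro C
  rw [Set.eq_empty_iff_forall_notMem]
  rintro y ⟨hy, hyV⟩
  let w := C.absv
  choose B hB hBp using fun p : MvPolynomial (Fin n × Fin 2) K =>
    MvPolynomial.exists_continuity_bound w (p.map C.emb)
  have hBS : ∃ D > 0, ∀ p ∈ S, B p ≤ D := by
    refine ⟨1 + ∑ p ∈ S, B p, ?_, fun p hp => ?_⟩
    · have := Finset.sum_nonneg fun p (_ : p ∈ S) => (hB p).le
      linarith
    · have := Finset.single_le_sum (f := B) (fun p _ => (hB p).le) hp
      linarith
  obtain ⟨D, hD, hBD⟩ := hBS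
  let c : OnePoint C.carrier → ℝ := fun t => Option.elim t 1 fun b => 1 / max 1 (w b)
  have hc : ∀ t, 0 < c t := by
    intro t
    induction t using OnePoint.rec with
    | infty => exact one_pos
    | coe b =>
      change 0 < 1 / max 1 (w b)
      positivity
  set ε : ℝ := min (1 / 2) (δ / (4 * D)) with hε
  have hεpos : 0 < ε := by positivity
  obtain ⟨z, ⟨m, rfl⟩, hz⟩ := exists_forall_p1Dist_lt w hy (ε := fun j => min ε (c (y j)))
    fun j => lt_min hεpos (hc _)
  have hclose : ∀ jk : Fin n × Fin 2, w (homCoords (y jk.1) jk.2) ≤ 2 ∧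
      w (homCoords (y jk.1) jk.2 - C.emb (orbitHom f P m jk)) ≤ 2 * ε := by
    rintro ⟨j, k⟩
    have hj := hz j
    have hmj := hinteg m (j, 0)
    simp only [splitMap_iterate_mapPoint] at hj
    simp only [orbitHom] at hmj ⊢
    have h1 : p1Dist w (y j) (mapPoint C.emb ((splitMap f)^[m] P j)) < ε := hj.trans_le (min_le_left _ _)
    have h2 : p1Dist w (y j) (mapPoint C.emb ((splitMap f)^[m] P j)) < c (y j) :=
      hj.trans_le (min_le_right _ _)
    generalize (splitMap f)^[m] P j = t at *
    generalize y j = u at *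
    induction t using OnePoint.rec with
    | infty =>
      induction u using OnePoint.rec with
      | infty =>
        rw [homCoords_infty, homCoords_infty]
        refine ⟨?_, ?_⟩
        · fin_cases k <;> simp
        · fin_cases k <;> simp [hεpos.le]
      | coe b => exact absurd h2 (lt_irrefl _)
    | coe a =>
      rw [homCoords_coe] at hmj
      have ha : w (C.emb a) ≤ 1 := by
        change C.absv _ ≤ 1
        rw [C.compat]
        exact hmj
      induction u using OnePoint.rec with
      | infty =>
        have h3 : p1Dist w ∞ (mapPoint C.emb (a : OnePoint K)) = 1 := by
          change 1 / max 1 (w (C.emb a)) = 1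
          rw [max_eq_left ha, div_one]
        rw [h3] at h1
        have := min_le_left (1 / 2) (δ / (4 * D))
        linarith
      | coe b =>
        have h3 := abv_sub_le_of_p1Dist_lt w ha (min_le_left _ _) h1
        rw [homCoords_coe, homCoords_coe]
        fin_cases k
        · exact h3
        · simp [hεpos.le]
  obtain ⟨p, hp, hpδ⟩ := h m
  have h1 := (hBp p (fun jk => homCoords (y jk.1) jk.2) (fun jk => C.emb (orbitHom f P m jk))
    (fun jk => (hclose jk).1) (fun jk => by
      change C.absv _ ≤ 2
      rw [C.compat]
      linarith [hinteg m jk])).2 (2 * ε) (by positivity) fun jk => (hclose jk).2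
  have h2 : MvPolynomial.eval (fun jk => homCoords (y jk.1) jk.2) (p.map C.emb) = 0 := hyV p (hS p hp)
  have h3 : MvPolynomial.eval (fun jk => C.emb (orbitHom f P m jk)) (p.map C.emb) =
      C.emb (MvPolynomial.eval (orbitHom f P m) p) := by
    rw [MvPolynomial.eval_map]
    exact MvPolynomial.eval₂_comp_left C.emb (RingHom.id K) _ p |>.symm
  rw [h2, h3, zero_sub, w.map_neg] at h1
  change C.absv _ ≤ _ at h1
  rw [C.compat] at h1
  have h4 : B p * (2 * ε) ≤ D * (2 * ε) := mul_le_mul_of_nonneg_right (hBD p hp) (by positivity)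
  have h5 : D * (2 * ε) ≤ D * (2 * (δ / (4 * D))) := by
    have := min_le_right (1 / 2) (δ / (4 * D))
    gcongr
  have h6 : D * (2 * (δ / (4 * D))) = δ / 2 := by
    field_simp
    norm_num
  linarith

namespace ProductFormulaFamily

open Filter

variable {K : Type} [Field K] (M : ProductFormulaFamily K)

theorem eventually_orbitHom_le_one {ι : Type} [Finite ι] (f : K[X]) (P : ι → OnePoint K) :
    ∀ᶠ i in cofinite, ∀ m jk, M.w i (orbitHom f P m jk) ≤ 1 := by
  have h : ∀ j : ι, ∀ᶠ i in cofinite, ∀ m k, M.w i (orbitHom f P m (j, k)) ≤ 1 := by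
    intro j
    by_cases hj : P j = ∞
    · refine Eventually.of_forall fun i m k => ?_
      rw [orbitHom, splitMap_iterate_infty f hj, homCoords_infty]
      fin_cases k <;> simp
    · obtain ⟨a, ha⟩ := OnePoint.ne_infty_iff_exists.1 hj
      filter_upwards [eventually_orbit_le_one (M := M) (f := f) (x := fun m => (fun t => f.eval t)^[m] a)
        fun m => Function.iterate_succ_apply' _ _ _] with i hi m k
      rw [orbitHom, splitMap_iterate_coe f ha.symm, homCoords_coe]
      fin_cases k
      · exact hi m
      · simp
  filter_upwards [eventually_all.2 h] with i hi m jk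
  exact hi jk.1 m jk.2

theorem eventually_ext_mvEval_le_one {σ : Type*} (p : MvPolynomial σ (AlgebraicClosure K)) :
    ∀ᶠ i in cofinite, ∀ x : σ → AlgebraicClosure K, (∀ j, M.ext i (x j) ≤ 1) →
      M.ext i (MvPolynomial.eval x p) ≤ 1 := by
  filter_upwards [M.eventually_ext_mvCoeff_le_one p] with i hi x hx
  rw [MvPolynomial.eval_eq]
  refine AbsoluteValue.sum_le_of_nonarchimedean (M.ext_nonarch i) _ _ 1 zero_le_one fun s _ => ?_
  rw [map_mul, map_prod]
  refine mul_le_one₀ (hi s) (Finset.prod_nonneg fun _ _ => (M.ext i).nonneg _)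
    (Finset.prod_le_one (fun _ _ => (M.ext i).nonneg _) fun j _ => ?_)
  rw [map_pow]
  exact pow_le_one₀ ((M.ext i).nonneg _) (hx j)

/-- If finitely many polynomials vanish at the points of `V` of the same pattern at infinity as `P`,
then bounding them from below along the orbit separates the orbit from `V`. -/
theorem eventually_orbitClosureAvoids {n : ℕ} (f : K[X]) (P : Fin n → OnePoint K)
    (V : ClosedSubvar K (Fin n)) (U : Finset (MvPolynomial (Fin n × Fin 2) (AlgebraicClosure K)))
    (hU : ∀ u ∈ U, ∀ x ∈ V.pts (algebraMap K (AlgebraicClosure K)), (∀ j, x j = ∞ ↔ P j = ∞) →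
      MvPolynomial.eval (fun jk => homCoords (x jk.1) jk.2) u = 0) :
    ∀ᶠ i in cofinite, (∃ δ > 0, ∀ m, ∃ u ∈ U,
      δ ≤ M.ext i (MvPolynomial.eval (fun jk => algebraMap K _ (orbitHom f P m jk)) u)) →
      ∀ v : PlaceK K, v.v = M.w i → OrbitClosureAvoids v f P V := by
  classical
  let L := AlgebraicClosure K
  let T : Set (MvPolynomial (Fin n × Fin 2) L) := {q | ∀ m,
    MvPolynomial.eval (fun jk => algebraMap K L (orbitHom f P m jk)) q = 0}
  let G : Set (MvPolynomial (Fin n × Fin 2) L) := MvPolynomial.map (algebraMap K L) '' V.polys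
  have hrad : ∀ u ∈ U, u ∈ (Ideal.span (G ∪ T)).radical := by
    intro u hu
    rw [← MvPolynomial.vanishingIdeal_zeroLocus_eq_radical (K := L), MvPolynomial.mem_vanishingIdeal_iff]
    intro z hz
    rw [MvPolynomial.mem_zeroLocus_iff] at hz
    have hzT : ∀ q ∈ T, MvPolynomial.eval z q = 0 := fun q hq =>
      hz q (Ideal.subset_span (Or.inr hq))
    let x : Fin n → OnePoint L := fun j => if P j = ∞ then ∞ else (z (j, 0) : OnePoint L)
    have hxz : (fun jk : Fin n × Fin 2 => homCoords (x jk.1) jk.2) = z := by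
      funext ⟨j, k⟩
      by_cases hj : P j = ∞
      · simp only [x, hj, if_true, homCoords_infty]
        have h0 := hzT (MvPolynomial.X (j, 0) - 1) fun m => by
          simp [orbitHom, splitMap_iterate_infty f hj, homCoords_infty]
        have h1 := hzT (MvPolynomial.X (j, 1)) fun m => by
          simp [orbitHom, splitMap_iterate_infty f hj, homCoords_infty]
        simp only [map_sub, MvPolynomial.eval_X, map_one, sub_eq_zero] at h0 h1
        fin_cases k
        · exact h0.symm
        · exact h1.symm
      · simp only [x, hj, if_false, homCoords_coe]
        obtain ⟨a, ha⟩ := OnePoint.ne_infty_iff_exists.1 hj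
        have h1 := hzT (MvPolynomial.X (j, 1) - 1) fun m => by
          simp [orbitHom, splitMap_iterate_coe f ha.symm, homCoords_coe]
        simp only [map_sub, MvPolynomial.eval_X, map_one, sub_eq_zero] at h1
        fin_cases k
        · rfl
        · exact h1.symm
    have hxV : x ∈ V.pts (algebraMap K L) := fun p hp => by
      rw [vanishesAt, hxz]
      exact hz _ (Ideal.subset_span (Or.inl ⟨p, hp, rfl⟩))
    have := hU u hu x hxV fun j => by
      by_cases hj : P j = ∞ <;> simp [x, hj]
    rw [hxz] at this
    exact this
  have hlow : ∀ u ∈ U, ∃ N : ℕ, ∃ S : Finset (MvPolynomial (Fin n × Fin 2) K),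
      (∀ p ∈ S, p ∈ V.polys) ∧ ∀ᶠ i in cofinite, ∀ m, ∀ δ > 0,
        δ ≤ M.ext i (MvPolynomial.eval (fun jk => algebraMap K L (orbitHom f P m jk)) u) →
        ∃ p ∈ S, δ ^ N ≤ M.w i (MvPolynomial.eval (orbitHom f P m) p) := by
    intro u hu
    obtain ⟨N, hN⟩ := hrad u hu
    obtain ⟨c, hcu⟩ := (Finsupp.mem_span_iff_linearCombination _ _ _).1 hN
    have hpre : ∀ q : ↥(G ∪ T), ∃ p : MvPolynomial (Fin n × Fin 2) K, q.1 ∈ T ∨ p ∈ V.polys ∧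
        MvPolynomial.map (algebraMap K L) p = q.1 := by
      rintro ⟨q, ⟨p, hp, rfl⟩ | hq⟩
      · exact ⟨p, Or.inr ⟨hp, rfl⟩⟩
      · exact ⟨0, Or.inl hq⟩
    choose p hp using hpre
    refine ⟨N, (c.support.image p).filter (· ∈ V.polys), fun q hq => (Finset.mem_filter.1 hq).2, ?_⟩
    have hcoef : ∀ᶠ i in cofinite, ∀ q ∈ c.support, ∀ x : Fin n × Fin 2 → L, (∀ j, M.ext i (x j) ≤ 1) →
        M.ext i (MvPolynomial.eval x (c q)) ≤ 1 :=
      (eventually_all_finset _).2 fun q _ => M.eventually_ext_mvEval_le_one (c q)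
    filter_upwards [hcoef, M.eventually_orbitHom_le_one f P, M.eventually_nonarch] with i h1 h2 h3 m δ hδ hle
    by_contra hcon
    push Not at hcon
    have hxe : ∀ jk, M.ext i (algebraMap K L (orbitHom f P m jk)) ≤ 1 := fun jk => by
      rw [M.ext_algebraMap h3]
      exact h2 m jk
    have h4 := congrArg (MvPolynomial.eval fun jk => algebraMap K L (orbitHom f P m jk)) hcu
    rw [Finsupp.linearCombination_apply, Finsupp.sum, map_sum, map_pow] at h4
    have hlt : ∀ q ∈ c.support, M.ext i (MvPolynomial.eval (fun jk => algebraMap K L (orbitHom f P m jk))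
        (c q • q.1)) < δ ^ N := by
      intro q hq
      rw [smul_eq_mul, map_mul, map_mul]
      rcases hp q with hT | ⟨hV, hq2⟩
      · rw [hT m, map_zero, mul_zero]
        positivity
      · rw [← hq2, MvPolynomial.eval_map, ← MvPolynomial.coe_eval₂Hom]
        have h5 : MvPolynomial.eval₂Hom (algebraMap K L) (fun jk => algebraMap K L (orbitHom f P m jk)) (p q) =
            algebraMap K L (MvPolynomial.eval (orbitHom f P m) (p q)) :=
          (MvPolynomial.eval₂_comp_left (algebraMap K L) (RingHom.id K) _ (p q)).symm
        rw [h5, M.ext_algebraMap h3]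
        refine (mul_le_of_le_one_left ((M.w i).nonneg _) (h1 q hq _ hxe)).trans_lt ?_
        exact hcon _ (Finset.mem_filter.2 ⟨Finset.mem_image_of_mem _ hq, hV⟩)
    have h6 : M.ext i (∑ q ∈ c.support, MvPolynomial.eval (fun jk => algebraMap K L (orbitHom f P m jk))
        (c q • q.1)) < δ ^ N := by
      by_cases hne : c.support.Nonempty
      · obtain ⟨q, hq, hmax⟩ := c.support.exists_max_image (fun q => M.ext i
          (MvPolynomial.eval (fun jk => algebraMap K L (orbitHom f P m jk)) (c q • q.1))) hne
        exact (AbsoluteValue.sum_le_of_nonarchimedean (M.ext_nonarch i) _ _ _ ((M.ext i).nonneg _)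
          hmax).trans_lt (hlt q hq)
      · rw [Finset.not_nonempty_iff_eq_empty.1 hne, Finset.sum_empty, map_zero]
        positivity
    rw [h4, map_pow] at h6
    exact absurd (pow_le_pow_left₀ hδ.le hle N) (not_le.2 h6)
  choose! N S hSV hS using hlow
  filter_upwards [(eventually_all_finset U).2 hS, M.eventually_orbitHom_le_one f P] with i h1 h2
  rintro ⟨δ, hδ, hm⟩ v hv
  have hδ0 : 0 < min δ 1 := lt_min hδ one_pos
  refine orbitClosureAvoids_of_lower_bound (S := U.biUnion S) (δ := min δ 1 ^ ∑ u ∈ U, N u)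
    (fun m jk => by rw [hv]; exact h2 m jk) ?_ (by positivity) fun m => ?_
  · intro p hp
    obtain ⟨u, hu, hp⟩ := Finset.mem_biUnion.1 hp
    exact hSV u hu p hp
  · obtain ⟨u, hu, hle⟩ := hm m
    obtain ⟨p, hp, hpδ⟩ := h1 u hu m _ hδ0 ((min_le_left _ _).trans hle)
    refine ⟨p, Finset.mem_biUnion.2 ⟨u, hu, hp⟩, ?_⟩
    rw [hv]
    exact (pow_le_pow_of_le_one hδ0.le (min_le_right _ _)
      (Finset.single_le_sum (f := N) (fun _ _ => Nat.zero_le _) hu)).trans hpδ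

end ProductFormulaFamily

end

section

namespace MultiProjective

open MvPolynomial

variable {L : Type} [Field L] {ι : Type} [DecidableEq ι]

/-- `p` is multihomogeneous of multidegree `N`. -/
def HasMultidegree (p : MvPolynomial (ι × Fin 2) L) (N : ι → ℕ) : Prop :=
  ∀ i, p.IsWeightedHomogeneous (fun jk => if jk.1 = i then (1 : ℕ) else 0) (N i)

theorem HasMultidegree.multiHomog {p : MvPolynomial (ι × Fin 2) L} {N : ι → ℕ}
    (h : HasMultidegree p N) : MultiHomog p := fun i => ⟨N i, h i⟩

theorem exists_hasMultidegree {p : MvPolynomial (ι × Fin 2) L} (h : MultiHomog p) :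
    ∃ N, HasMultidegree p N := by
  choose N hN using h
  exact ⟨N, hN⟩

theorem HasMultidegree.mul {p q : MvPolynomial (ι × Fin 2) L} {N N' : ι → ℕ}
    (hp : HasMultidegree p N) (hq : HasMultidegree q N') : HasMultidegree (p * q) (N + N') :=
  fun i => (hp i).mul (hq i)

theorem multiHomog_mul {p q : MvPolynomial (ι × Fin 2) L} (hp : MultiHomog p) (hq : MultiHomog q) :
    MultiHomog (p * q) := fun i => by
  obtain ⟨d, hd⟩ := hp i
  obtain ⟨e, he⟩ := hq i
  exact ⟨d + e, hd.mul he⟩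

theorem multiHomog_X (jk : ι × Fin 2) : MultiHomog (X jk : MvPolynomial (ι × Fin 2) L) :=
  fun _ => ⟨_, isWeightedHomogeneous_X L _ jk⟩

theorem multiHomog_one : MultiHomog (1 : MvPolynomial (ι × Fin 2) L) :=
  fun _ => ⟨0, isWeightedHomogeneous_one L _⟩

theorem multiHomog_prod {α : Type*} (s : Finset α) (p : α → MvPolynomial (ι × Fin 2) L)
    (h : ∀ a ∈ s, MultiHomog (p a)) : MultiHomog (∏ a ∈ s, p a) := by
  classical
  induction s using Finset.induction_on with
  | empty => exact multiHomog_one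
  | insert a s ha ih =>
    rw [Finset.prod_insert ha]
    exact multiHomog_mul (h a (Finset.mem_insert_self _ _))
      (ih fun b hb => h b (Finset.mem_insert_of_mem hb))

/-- Homogeneous coordinates of a point of `(P^1)^ι`. -/
def hom (x : ι → OnePoint L) : ι × Fin 2 → L := fun jk => homCoords (x jk.1) jk.2

theorem vanishesAt_id (p : MvPolynomial (ι × Fin 2) L) (x : ι → OnePoint L) :
    vanishesAt (RingHom.id L) p x ↔ eval (hom x) p = 0 := by
  rw [vanishesAt, MvPolynomial.map_id]
  rfl

theorem isZarClosed_setOf (S : Set (MvPolynomial (ι × Fin 2) L)) (hS : ∀ p ∈ S, MultiHomog p) :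
    IsZarClosed {x : ι → OnePoint L | ∀ p ∈ S, eval (hom x) p = 0} :=
  ⟨⟨S, hS⟩, by
    ext x
    exact forall₂_congr fun p _ => (vanishesAt_id p x).symm⟩

theorem exists_polys {T : Set (ι → OnePoint L)} (hT : IsZarClosed T) :
    ∃ S : Set (MvPolynomial (ι × Fin 2) L), (∀ p ∈ S, MultiHomog p) ∧
      ∀ x, x ∈ T ↔ ∀ p ∈ S, eval (hom x) p = 0 := by
  obtain ⟨V, rfl⟩ := hT
  exact ⟨V.polys, V.homog, fun x => forall₂_congr fun p _ => vanishesAt_id p x⟩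

theorem _root_.IrrSubvar.vanish_or_vanish {T : Set (ι → OnePoint L)} (hT : IrrSubvar T)
    {p q : MvPolynomial (ι × Fin 2) L} (hp : MultiHomog p) (hq : MultiHomog q)
    (h : ∀ x ∈ T, eval (hom x) (p * q) = 0) :
    (∀ x ∈ T, eval (hom x) p = 0) ∨ ∀ x ∈ T, eval (hom x) q = 0 := by
  have := hT.2.2 _ _ (isZarClosed_setOf {p} (by simpa using hp)) (isZarClosed_setOf {q} (by simpa using hq))
    (fun x hx => by
      have := h x hx
      rw [map_mul, mul_eq_zero] at this
      simpa using this)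
  refine this.imp (fun h x hx => ?_) fun h x hx => ?_
  · simpa using h hx
  · simpa using h hx

theorem irrSubvar_of_vanish {T : Set (ι → OnePoint L)} (hne : T.Nonempty) (hT : IsZarClosed T)
    (h : ∀ p q : MvPolynomial (ι × Fin 2) L, MultiHomog p → MultiHomog q →
      (∀ x ∈ T, eval (hom x) (p * q) = 0) →
      (∀ x ∈ T, eval (hom x) p = 0) ∨ ∀ x ∈ T, eval (hom x) q = 0) : IrrSubvar T := by
  refine ⟨hne, hT, fun Z₁ Z₂ h1 h2 hsub => ?_⟩
  obtain ⟨S₁, hS₁, hZ₁⟩ := exists_polys h1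
  obtain ⟨S₂, hS₂, hZ₂⟩ := exists_polys h2
  by_contra hcon
  push Not at hcon
  obtain ⟨⟨x, hx, hx1⟩, y, hy, hy2⟩ := And.imp Set.not_subset.1 Set.not_subset.1 hcon
  rw [hZ₁] at hx1
  rw [hZ₂] at hy2
  push Not at hx1 hy2
  obtain ⟨p, hp, hpx⟩ := hx1
  obtain ⟨q, hq, hqy⟩ := hy2
  rcases h p q (hS₁ p hp) (hS₂ q hq) (fun z hz => by
    rw [map_mul, mul_eq_zero]
    rcases hsub hz with h | h
    · exact Or.inl ((hZ₁ z).1 h p hp)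
    · exact Or.inr ((hZ₂ z).1 h q hq)) with h | h
  · exact hpx (h x hx)
  · exact hqy (h y hy)

variable (c : ι → Fin 2)

/-- Affine coordinates in the chart `c`, lifted to homogeneous coordinates with the coordinates
indexed by `(i, c i)` equal to `1`. -/
def lift (y : ι → L) : ι × Fin 2 → L := fun jk => if jk.2 = c jk.1 then 1 else y jk.1

/-- The point of `(P^1)^ι` with affine coordinates `y` in the chart `c`. -/
noncomputable def pt (y : ι → L) : ι → OnePoint L := by
  classical
  exact fun i => if c i = 1 then (y i : OnePoint L) else if y i = 0 then ∞ else ((y i)⁻¹ : L)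

/-- Dehomogenization in the chart `c`. -/
noncomputable def dh : MvPolynomial (ι × Fin 2) L →ₐ[L] MvPolynomial ι L :=
  aeval fun jk => if jk.2 = c jk.1 then 1 else X jk.1

theorem eval_dh (p : MvPolynomial (ι × Fin 2) L) (y : ι → L) :
    eval y (dh c p) = eval (lift c y) p := by
  induction p using MvPolynomial.induction_on with
  | C a => simp [dh]
  | add p q hp hq => simp only [map_add, hp, hq]
  | mul_X p jk hp =>
    have hX : eval y (dh c (X jk)) = lift c y jk := by
      simp only [dh, MvPolynomial.aeval_X, lift]
      split_ifs <;> simp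
    rw [map_mul, map_mul, hp, hX, map_mul, MvPolynomial.eval_X]

theorem exists_hom_pt_eq (y : ι → L) : ∃ r : ι → L, (∀ i, r i ≠ 0) ∧
    ∀ jk, hom (pt c y) jk = r jk.1 * lift c y jk := by
  classical
  refine ⟨fun i => if c i = 1 then 1 else if y i = 0 then 1 else (y i)⁻¹, fun i => ?_, ?_⟩
  · dsimp only
    split_ifs <;> simp_all
  · rintro ⟨i, k⟩
    simp only [hom, pt, lift]
    have hc : c i = 0 ∨ c i = 1 := by
      generalize c i = t
      fin_cases t <;> simp
    rcases hc with hc | hc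
    · simp only [hc, zero_ne_one, if_false]
      split_ifs with h0 h1 h1
      · subst h1; simp [homCoords_infty]
      · have : k = 1 := by lia
        subst this
        simp [homCoords_infty, h0]
      · subst h1; simp [homCoords_coe]
      · have : k = 1 := by lia
        subst this
        simp [homCoords_coe, h0]
    · simp only [hc, if_true, homCoords_coe, one_mul]
      fin_cases k <;> simp

theorem exists_eq_pt {x : ι → OnePoint L} (h : ∀ i, hom x (i, c i) ≠ 0) : ∃ y, x = pt c y := by
  classical
  have h' : ∀ i, ∃ t : L, x i = if c i = 1 then (t : OnePoint L) else if t = 0 then ∞ else (t⁻¹ : L) := by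
    intro i
    have hi := h i
    simp only [hom] at hi
    have hc : c i = 0 ∨ c i = 1 := by
      generalize c i = t
      fin_cases t <;> simp
    generalize x i = z at *
    rcases hc with hc | hc
    · induction z using OnePoint.rec with
      | infty => exact ⟨0, by simp [hc]⟩
      | coe a =>
        rw [hc, homCoords_coe] at hi
        simp only [Fin.isValue, Matrix.cons_val_zero] at hi
        exact ⟨a⁻¹, by simp [hc, hi]⟩
    · induction z using OnePoint.rec with
      | infty => simp [hc, homCoords_infty] at hi
      | coe a => exact ⟨a, by simp [hc]⟩
  choose y hy using h'
  exact ⟨y, funext hy⟩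

theorem exists_chart (x : ι → OnePoint L) : ∃ c : ι → Fin 2, ∀ i, hom x (i, c i) ≠ 0 := by
  have : ∀ i, ∃ k : Fin 2, hom x (i, k) ≠ 0 := by
    intro i
    simp only [hom]
    induction x i using OnePoint.rec with
    | infty => exact ⟨0, by simp [homCoords_infty]⟩
    | coe a => exact ⟨1, by simp [homCoords_coe]⟩
  choose c hc using this
  exact ⟨c, hc⟩

variable [Fintype ι]

theorem sum_weight_eq {m : ι × Fin 2 →₀ ℕ} (i : ι) :
    Finsupp.weight (fun jk : ι × Fin 2 => if jk.1 = i then (1 : ℕ) else 0) m = m (i, 0) + m (i, 1) := by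
  rw [Finsupp.weight_apply, Finsupp.sum_fintype _ _ (by simp), Fintype.sum_prod_type]
  simp only [Fin.sum_univ_two, smul_eq_mul, mul_ite, mul_one, mul_zero]
  rw [Finset.sum_eq_single i (fun b _ hb => by simp [hb]) (by simp)]
  simp

theorem HasMultidegree.eval_smul {p : MvPolynomial (ι × Fin 2) L} {N : ι → ℕ} (h : HasMultidegree p N)
    (r : ι → L) (z : ι × Fin 2 → L) :
    eval (fun jk => r jk.1 * z jk) p = (∏ i, r i ^ N i) * eval z p := by
  rw [eval_eq', eval_eq', Finset.mul_sum]
  refine Finset.sum_congr rfl fun m hm => ?_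
  have h1 : ∏ jk : ι × Fin 2, (r jk.1 * z jk) ^ m jk = (∏ i, r i ^ N i) * ∏ jk, z jk ^ m jk := by
    simp only [mul_pow, Finset.prod_mul_distrib]
    congr 1
    rw [Fintype.prod_prod_type]
    refine Finset.prod_congr rfl fun i _ => ?_
    rw [Fin.prod_univ_two, ← pow_add, ← sum_weight_eq, h i (mem_support_iff.1 hm)]
  rw [h1]
  ring

theorem eval_hom_pt_eq_zero_iff {p : MvPolynomial (ι × Fin 2) L} (hp : MultiHomog p) (y : ι → L) :
    eval (hom (pt c y)) p = 0 ↔ eval y (dh c p) = 0 := by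
  obtain ⟨N, hN⟩ := exists_hasMultidegree hp
  obtain ⟨r, hr, h⟩ := exists_hom_pt_eq c y
  have h1 : hom (pt c y) = fun jk => r jk.1 * lift c y jk := funext h
  rw [h1, hN.eval_smul, eval_dh, mul_eq_zero, or_iff_right]
  exact Finset.prod_ne_zero_iff.2 fun i _ => pow_ne_zero _ (hr i)

/-- The exponents in the homogenization of a monomial. -/
noncomputable def hmExp (N : ι → ℕ) (s : ι →₀ ℕ) : ι × Fin 2 →₀ ℕ :=
  Finsupp.equivFunOnFinite.symm fun jk => if jk.2 = c jk.1 then N jk.1 - s jk.1 else s jk.1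

/-- Homogenization to multidegree `N` in the chart `c`. -/
noncomputable def hm (N : ι → ℕ) (q : MvPolynomial ι L) : MvPolynomial (ι × Fin 2) L :=
  ∑ s ∈ q.support, monomial (hmExp c N s) (q.coeff s)

theorem hmExp_sum {N : ι → ℕ} {s : ι →₀ ℕ} {i : ι} (h : s i ≤ N i) :
    hmExp c N s (i, 0) + hmExp c N s (i, 1) = N i := by
  simp only [hmExp, Finsupp.equivFunOnFinite_symm_apply_apply]
  have hc : c i = 0 ∨ c i = 1 := by
    generalize c i = t
    fin_cases t <;> simp
  rcases hc with hc | hc <;> simp [hc] <;> lia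

theorem hasMultidegree_hm {N : ι → ℕ} {q : MvPolynomial ι L} (h : ∀ i, q.degreeOf i ≤ N i) :
    HasMultidegree (hm c N q) N := fun i => by
  refine IsWeightedHomogeneous.sum _ _ _ fun s hs => ?_
  refine isWeightedHomogeneous_monomial _ _ _ ?_
  rw [sum_weight_eq, hmExp_sum]
  exact (degreeOf_le_iff.1 (h i)) s hs

theorem dh_monomial (m : ι × Fin 2 →₀ ℕ) (a : L) :
    dh c (monomial m a) = monomial (Finsupp.equivFunOnFinite.symm fun i => m (i, 1 - c i)) a := by
  rw [dh, MvPolynomial.aeval_monomial, Finsupp.prod_fintype _ _ (by simp), Fintype.prod_prod_type, monomial_eq,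
    Finsupp.prod_fintype _ _ (by simp)]
  congr 1
  refine Finset.prod_congr rfl fun i _ => ?_
  have hc : c i = 0 ∨ c i = 1 := by
    generalize c i = t
    fin_cases t <;> simp
  rcases hc with hc | hc <;> simp [hc]

theorem dh_hm (N : ι → ℕ) (q : MvPolynomial ι L) : dh c (hm c N q) = q := by
  conv_rhs => rw [q.as_sum]
  rw [hm, map_sum]
  refine Finset.sum_congr rfl fun s _ => ?_
  rw [dh_monomial]
  congr 2
  ext i
  have hc : c i = 0 ∨ c i = 1 := by
    generalize c i = t
    fin_cases t <;> simp
  rcases hc with hc | hc <;> simp [hmExp, hc]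

theorem HasMultidegree.injOn_dh {p q : MvPolynomial (ι × Fin 2) L} {N : ι → ℕ}
    (hp : HasMultidegree p N) (hq : HasMultidegree q N) (h : dh c p = dh c q) : p = q := by
  have key : ∀ r : MvPolynomial (ι × Fin 2) L, HasMultidegree r N → dh c r = 0 → r = 0 := by
    intro r hr h0
    let e : (ι × Fin 2 →₀ ℕ) → (ι →₀ ℕ) := fun m => Finsupp.equivFunOnFinite.symm fun i => m (i, 1 - c i)
    have hinj : Set.InjOn e r.support := by
      intro m hm m' hm' hmm
      ext ⟨i, k⟩
      have h1 := hr i (mem_support_iff.1 hm)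
      have h2 := hr i (mem_support_iff.1 hm')
      have h3 : m (i, 1 - c i) = m' (i, 1 - c i) := DFunLike.congr_fun hmm i
      rw [sum_weight_eq] at h1 h2
      have hc : c i = 0 ∨ c i = 1 := by
        generalize c i = t
        fin_cases t <;> simp
      have hk : k = 0 ∨ k = 1 := by fin_cases k <;> simp
      rcases hc with hc | hc <;> rcases hk with rfl | rfl <;> simp [hc] at h3 ⊢ <;> lia
    have h1 : dh c r = ∑ m ∈ r.support, monomial (e m) (r.coeff m) := by
      conv_lhs => rw [r.as_sum, map_sum]
      exact Finset.sum_congr rfl fun m _ => dh_monomial c m _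
    ext m
    rw [MvPolynomial.coeff_zero]
    by_contra hm
    have hms : m ∈ r.support := mem_support_iff.2 hm
    have h2 := congrArg (MvPolynomial.coeff (e m)) (h1.symm.trans h0)
    rw [MvPolynomial.coeff_sum, MvPolynomial.coeff_zero, Finset.sum_eq_single m] at h2
    · rw [MvPolynomial.coeff_monomial, if_pos rfl] at h2
      exact hm h2
    · intro m' hm' hne
      rw [MvPolynomial.coeff_monomial, if_neg fun h => hne (hinj hm' hms h)]
    · exact fun h => absurd hms h
  refine sub_eq_zero.1 (key _ (fun i => ?_) (by rw [map_sub, h, sub_self]))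
  exact (weightedHomogeneousSubmodule L _ _).sub_mem (hp i) (hq i)

theorem HasMultidegree.degreeOf_dh_le {p : MvPolynomial (ι × Fin 2) L} {N : ι → ℕ}
    (hp : HasMultidegree p N) (i : ι) : (dh c p).degreeOf i ≤ N i := by
  rw [p.as_sum, map_sum]
  refine (degreeOf_sum_le _ _ _).trans (Finset.sup_le fun m hm => ?_)
  rw [dh_monomial, degreeOf_monomial_eq _ _ (mem_support_iff.1 hm)]
  have h1 := hp i (mem_support_iff.1 hm)
  rw [sum_weight_eq] at h1
  have hc : c i = 0 ∨ c i = 1 := by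
    generalize c i = t
    fin_cases t <;> simp
  rcases hc with hc | hc <;> simp [hc] <;> lia

/-- A multihomogeneous polynomial whose dehomogenization is divisible by `F` is divisible by the
homogenization of `F`. -/
theorem hm_dvd_of_dvd_dh {p : MvPolynomial (ι × Fin 2) L} (hp : MultiHomog p) {F : MvPolynomial ι L}
    (h : F ∣ dh c p) : hm c (fun i => F.degreeOf i) F ∣ p := by
  obtain ⟨N, hN⟩ := exists_hasMultidegree hp
  obtain ⟨q, hq⟩ := h
  by_cases h0 : dh c p = 0
  · rw [hN.injOn_dh c (q := 0) (fun i => (weightedHomogeneousSubmodule L _ _).zero_mem) (by rw [h0, map_zero])]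
    exact dvd_zero _
  have hF0 : F ≠ 0 := by rintro rfl; simp [hq] at h0
  have hq0 : q ≠ 0 := by rintro rfl; simp [hq] at h0
  have hdeg : ∀ i, F.degreeOf i + q.degreeOf i ≤ N i := fun i => by
    rw [← degreeOf_mul_eq hF0 hq0, ← hq]
    exact hN.degreeOf_dh_le c i
  refine ⟨hm c (fun i => N i - F.degreeOf i) q, HasMultidegree.injOn_dh c hN (N := N) ?_ ?_⟩
  · have h1 := (hasMultidegree_hm c (N := fun i => F.degreeOf i) (q := F) fun i => le_rfl).mul
      (hasMultidegree_hm c (N := fun i => N i - F.degreeOf i) (q := q) fun i => by have := hdeg i; lia)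
    convert h1 using 1
    funext i
    have := hdeg i
    simp only [Pi.add_apply]
    lia
  · rw [map_mul, dh_hm, dh_hm, hq]

end MultiProjective

end

section

namespace MultiProjective

open MvPolynomial

section

variable {L : Type} [Field L] {ι : Type} [DecidableEq ι] [Fintype ι] (c : ι → Fin 2)

/-- The ideal of polynomials vanishing on the part of `T` contained in the chart `c`. -/
noncomputable def chartIdeal (T : Set (ι → OnePoint L)) : Ideal (MvPolynomial ι L) :=
  vanishingIdeal L {y | pt c y ∈ T}

variable {c}

theorem mem_chartIdeal {T : Set (ι → OnePoint L)} {q : MvPolynomial ι L} :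
    q ∈ chartIdeal c T ↔ ∀ y, pt c y ∈ T → eval y q = 0 := by
  rw [chartIdeal, mem_vanishingIdeal_iff]
  rfl

theorem dh_mem_chartIdeal {T : Set (ι → OnePoint L)} {p : MvPolynomial (ι × Fin 2) L}
    (hp : MultiHomog p) (h : ∀ x ∈ T, eval (hom x) p = 0) : dh c p ∈ chartIdeal c T :=
  mem_chartIdeal.2 fun y hy => (eval_hom_pt_eq_zero_iff c hp y).1 (h _ hy)

theorem chartIdeal_anti {T T' : Set (ι → OnePoint L)} (h : T ⊆ T') :
    chartIdeal c T' ≤ chartIdeal c T := fun _ hq =>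
  mem_chartIdeal.2 fun y hy => mem_chartIdeal.1 hq y (h hy)

theorem multiHomog_hm (q : MvPolynomial ι L) : MultiHomog (hm c (fun i => q.degreeOf i) q) :=
  (hasMultidegree_hm c fun _ => le_rfl).multiHomog

variable (c) in
/-- The product of the homogeneous coordinates that do not vanish in the chart `c`. -/
noncomputable def bdry : MvPolynomial (ι × Fin 2) L := ∏ i, X (i, c i)

theorem multiHomog_bdry : MultiHomog (bdry c : MvPolynomial (ι × Fin 2) L) :=
  multiHomog_prod _ _ fun _ _ => multiHomog_X _

theorem dh_bdry : dh c (bdry c : MvPolynomial (ι × Fin 2) L) = 1 := by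
  rw [bdry, map_prod]
  exact Finset.prod_eq_one fun i _ => by simp [dh]

theorem eval_bdry_ne_zero (y : ι → L) : eval (hom (pt c y)) (bdry c) ≠ 0 := by
  rw [Ne, eval_hom_pt_eq_zero_iff c multiHomog_bdry, dh_bdry]
  simp

theorem exists_eq_pt_of_bdry {x : ι → OnePoint L} (h : eval (hom x) (bdry c) ≠ 0) :
    ∃ y, x = pt c y := by
  refine exists_eq_pt c fun i hi => h ?_
  rw [bdry, map_prod]
  exact Finset.prod_eq_zero (Finset.mem_univ i) (by simpa using hi)

theorem eval_bdry_mul_eq_zero {T : Set (ι → OnePoint L)} {p : MvPolynomial (ι × Fin 2) L}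
    (hp : MultiHomog p) (h : dh c p ∈ chartIdeal c T) {x : ι → OnePoint L} (hx : x ∈ T) :
    eval (hom x) (bdry c * p) = 0 := by
  rw [map_mul, mul_eq_zero, or_iff_not_imp_left]
  intro h0
  obtain ⟨y, rfl⟩ := exists_eq_pt_of_bdry h0
  exact (eval_hom_pt_eq_zero_iff c hp y).2 (mem_chartIdeal.1 h y hx)

theorem _root_.IrrSubvar.eval_eq_zero {T : Set (ι → OnePoint L)} (hT : IrrSubvar T)
    {y₀ : ι → L} (hy₀ : pt c y₀ ∈ T) {p : MvPolynomial (ι × Fin 2) L}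
    (hp : MultiHomog p) (h : dh c p ∈ chartIdeal c T) {x : ι → OnePoint L} (hx : x ∈ T) :
    eval (hom x) p = 0 := by
  rcases hT.vanish_or_vanish multiHomog_bdry hp (fun x hx => eval_bdry_mul_eq_zero hp h hx) with h | h
  · exact absurd (h _ hy₀) (eval_bdry_ne_zero y₀)
  · exact h x hx

theorem _root_.IrrSubvar.isPrime_chartIdeal {T : Set (ι → OnePoint L)} (hT : IrrSubvar T)
    {y₀ : ι → L} (hy₀ : pt c y₀ ∈ T) : (chartIdeal c T).IsPrime := by
  refine Ideal.isPrime_iff.2 ⟨fun h => ?_, fun {q₁ q₂} h => ?_⟩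
  · have := mem_chartIdeal.1 ((Ideal.eq_top_iff_one _).1 h) y₀ hy₀
    simp at this
  · have h1 : dh c (hm c (fun i => q₁.degreeOf i) q₁ * hm c (fun i => q₂.degreeOf i) q₂) ∈
        chartIdeal c T := by rwa [map_mul, dh_hm, dh_hm]
    have h2 := hT.vanish_or_vanish (multiHomog_hm q₁) (multiHomog_hm q₂) fun x hx =>
      hT.eval_eq_zero hy₀ (multiHomog_mul (multiHomog_hm q₁) (multiHomog_hm q₂)) h1 hx
    refine h2.imp (fun h => ?_) fun h => ?_
    · simpa only [dh_hm] using dh_mem_chartIdeal (c := c) (multiHomog_hm q₁) h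
    · simpa only [dh_hm] using dh_mem_chartIdeal (c := c) (multiHomog_hm q₂) h

theorem _root_.IrrSubvar.subset_of_chartIdeal_le {T T' : Set (ι → OnePoint L)} (hT : IrrSubvar T)
    {y₀ : ι → L} (hy₀ : pt c y₀ ∈ T) (hT' : IsZarClosed T')
    (h : chartIdeal c T' ≤ chartIdeal c T) : T ⊆ T' := by
  intro x hx
  obtain ⟨S, hS, hTS⟩ := exists_polys hT'
  exact (hTS _).2 fun p hp => hT.eval_eq_zero hy₀ (hS p hp)
    (h (dh_mem_chartIdeal (hS p hp) fun x hx => (hTS x).1 hx p hp)) hx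

variable (c) in
/-- The closure in `(P^1)^ι` of the affine set defined by an ideal in the chart `c`. -/
def projClosure (q : Ideal (MvPolynomial ι L)) : Set (ι → OnePoint L) :=
  {x | ∀ p ∈ {p | MultiHomog p ∧ dh c p ∈ q}, eval (hom x) p = 0}

theorem isZarClosed_projClosure (q : Ideal (MvPolynomial ι L)) : IsZarClosed (projClosure c q) :=
  isZarClosed_setOf _ fun _ hp => hp.1

theorem projClosure_subset {T : Set (ι → OnePoint L)} (hT : IsZarClosed T)
    {q : Ideal (MvPolynomial ι L)} (h : chartIdeal c T ≤ q) : projClosure c q ⊆ T := by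
  intro x hx
  obtain ⟨S, hS, hTS⟩ := exists_polys hT
  exact (hTS _).2 fun p hp => hx p ⟨hS p hp,
    h (dh_mem_chartIdeal (hS p hp) fun x hx => (hTS x).1 hx p hp)⟩

theorem projClosure_anti {q q' : Ideal (MvPolynomial ι L)} (h : q ≤ q') :
    projClosure c q' ⊆ projClosure c q := fun _ hx p hp => hx p ⟨hp.1, h hp.2⟩

theorem pt_mem_projClosure_iff {q : Ideal (MvPolynomial ι L)} {y : ι → L} :
    pt c y ∈ projClosure c q ↔ ∀ p ∈ q, eval y p = 0 := by
  refine ⟨fun h p hp => ?_, fun h p hp => (eval_hom_pt_eq_zero_iff c hp.1 y).2 (h _ hp.2)⟩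
  have h1 := (eval_hom_pt_eq_zero_iff c (multiHomog_hm p) y).1 (h _ ⟨multiHomog_hm p, by rwa [dh_hm]⟩)
  rwa [dh_hm] at h1

variable [IsAlgClosed L]

theorem chartIdeal_projClosure (q : Ideal (MvPolynomial ι L)) [q.IsPrime] :
    chartIdeal c (projClosure c q) = q := by
  refine Eq.trans ?_ (IsPrime.vanishingIdeal_zeroLocus (K := L) q)
  ext p
  simp only [mem_chartIdeal, pt_mem_projClosure_iff, mem_vanishingIdeal_iff, mem_zeroLocus_iff]
  rfl

theorem exists_pt_mem_projClosure (q : Ideal (MvPolynomial ι L)) [hq : q.IsPrime] :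
    ∃ y, pt c y ∈ projClosure c q := by
  by_contra! h
  refine hq.ne_top ((Ideal.eq_top_iff_one _).2 ?_)
  rw [← chartIdeal_projClosure (c := c) q]
  exact mem_chartIdeal.2 fun y hy => absurd hy (h y)

theorem irrSubvar_projClosure (q : Ideal (MvPolynomial ι L)) [hq : q.IsPrime] :
    IrrSubvar (projClosure c q) := by
  obtain ⟨y, hy⟩ := exists_pt_mem_projClosure (c := c) q
  refine irrSubvar_of_vanish ⟨_, hy⟩ (isZarClosed_projClosure q) fun p₁ p₂ h₁ h₂ h => ?_
  have h3 := dh_mem_chartIdeal (c := c) (multiHomog_mul h₁ h₂) h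
  rw [chartIdeal_projClosure, map_mul] at h3
  exact (hq.mem_or_mem h3).imp (fun h x hx => hx _ ⟨h₁, h⟩) fun h x hx => hx _ ⟨h₂, h⟩

/-- A curve does not contain chains of three irreducible closed sets. -/
theorem not_lt_lt_of_varDim_le_one {T : Set (ι → OnePoint L)} (hdim : varDim T = ((1 : ℕ∞) : WithBot ℕ∞))
    {T₀ T₁ T₂ : Set (ι → OnePoint L)} (h₀ : IrrSubvar T₀) (h₁ : IrrSubvar T₁) (h₂ : IrrSubvar T₂)
    (h01 : T₀ ⊂ T₁) (h12 : T₁ ⊂ T₂) (h2 : T₂ ⊆ T) : False := by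
  let s : LTSeries {S : Set (ι → OnePoint L) // IrrSubvar S ∧ S ⊆ T} :=
    LTSeries.mk 2 ![⟨T₀, h₀, h01.subset.trans (h12.subset.trans h2)⟩, ⟨T₁, h₁, h12.subset.trans h2⟩, ⟨T₂, h₂, h2⟩]
      (Fin.strictMono_iff_lt_succ.2 fun i => by
        fin_cases i
        · exact h01
        · exact h12)
  have h := Order.LTSeries.length_le_krullDim s
  rw [← varDim, hdim] at h
  have h' : ((2 : ℕ) : WithBot ℕ∞) ≤ ((1 : ℕ) : WithBot ℕ∞) := h
  exact absurd (WithBot.coe_le_coe.1 h') (by decide)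

theorem projClosure_ssubset {q q' : Ideal (MvPolynomial ι L)} [q.IsPrime] [q'.IsPrime] (h : q < q') :
    projClosure c q' ⊂ projClosure c q := by
  refine ⟨projClosure_anti h.le, fun h' => h.not_ge ?_⟩
  have := chartIdeal_anti (c := c) h'
  rwa [chartIdeal_projClosure, chartIdeal_projClosure] at this

end

/-- An irreducible proper subset of dimension `n - 1` is defined by one equation in some chart. -/
theorem exists_chartIdeal_eq_span {L : Type} [Field L] [IsAlgClosed L] {n : ℕ} (hn : 1 ≤ n)
    {T : Set (Fin n → OnePoint L)} (hT : IrrSubvar T)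
    (hdim : varDim T = (((n - 1 : ℕ) : ℕ∞) : WithBot ℕ∞)) (hne : T ≠ Set.univ) :
    ∃ (c : Fin n → Fin 2) (y₀ : Fin n → L) (F : MvPolynomial (Fin n) L), pt c y₀ ∈ T ∧
      Irreducible F ∧ chartIdeal c T = Ideal.span {F} := by
  obtain ⟨l, hl⟩ := Order.le_krullDim_iff.1 (show ((n - 1 : ℕ) : WithBot ℕ∞) ≤ varDim T from hdim.ge)
  obtain ⟨z, hz⟩ := l.head.2.1.1
  obtain ⟨c, hc⟩ := exists_chart z
  obtain ⟨y₀, rfl⟩ := exists_eq_pt c hc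
  have hmem : ∀ i, pt c y₀ ∈ (l i).1 := fun i => (l.head_le i : l.head.1 ≤ (l i).1) hz
  have hT0 : pt c y₀ ∈ T := l.head.2.2 hz
  have hprime := hT.isPrime_chartIdeal hT0
  have hbot : chartIdeal c T ≠ ⊥ := by
    intro h0
    refine hne (Set.eq_univ_of_forall fun x => ?_)
    obtain ⟨S, hS, hTS⟩ := exists_polys hT.2.1
    refine (hTS x).2 fun p hp => ?_
    have h1 := dh_mem_chartIdeal (c := c) (hS p hp) fun x hx => (hTS x).1 hx p hp
    rw [h0, Ideal.mem_bot] at h1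
    obtain ⟨N, hN⟩ := exists_hasMultidegree (hS p hp)
    rw [hN.injOn_dh c (q := 0) (fun i => (weightedHomogeneousSubmodule L _ _).zero_mem) (by rw [h1, map_zero]),
      map_zero]
  obtain ⟨F, hFT, hF⟩ := hprime.exists_mem_prime_of_ne_bot hbot
  refine ⟨c, y₀, F, hT0, hF.irreducible, ?_⟩
  by_contra hcon
  have hlt : Ideal.span {F} < chartIdeal c T :=
    lt_of_le_of_ne ((Ideal.span_singleton_le_iff_mem _).2 hFT) (Ne.symm hcon)
  let g : Fin (l.length + 1) → PrimeSpectrum (MvPolynomial (Fin n) L) := fun i =>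
    ⟨chartIdeal c (l i.rev).1, (l i.rev).2.1.isPrime_chartIdeal (hmem _)⟩
  have hg : StrictMono g := by
    intro i j hij
    have h1 : (l j.rev).1 ⊂ (l i.rev).1 := l.strictMono (Fin.rev_lt_rev.2 hij)
    refine ⟨chartIdeal_anti h1.subset, fun h2 => h1.not_subset ?_⟩
    exact (l i.rev).2.1.subset_of_chartIdeal_le (hmem _) (l j.rev).2.1.2.1 h2
  let s := LTSeries.mk l.length g hg
  have hspan : (Ideal.span {F}).IsPrime := (Ideal.span_singleton_prime hF.ne_zero).2 hF
  let pF : PrimeSpectrum (MvPolynomial (Fin n) L) := ⟨Ideal.span {F}, hspan⟩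
  have hs : pF < s.head := by
    refine lt_of_lt_of_le (b := (⟨chartIdeal c T, hprime⟩ : PrimeSpectrum (MvPolynomial (Fin n) L))) hlt ?_
    exact chartIdeal_anti (l (Fin.rev 0)).2.2
  let s1 : LTSeries (PrimeSpectrum (MvPolynomial (Fin n) L)) := s.cons pF hs
  have hs1 : (⊥ : PrimeSpectrum (MvPolynomial (Fin n) L)) < s1.head := by
    rw [show s1.head = pF from RelSeries.head_cons _ _ _]
    refine bot_lt_iff_ne_bot.2 fun h => hF.ne_zero ?_
    have : Ideal.span {F} = (⊥ : Ideal _) := congrArg PrimeSpectrum.asIdeal h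
    exact Ideal.span_singleton_eq_bot.1 this
  let s2 : LTSeries (PrimeSpectrum (MvPolynomial (Fin n) L)) := s1.cons ⊥ hs1
  have hlen : s2.length = n + 1 := by
    have h1 : s2.length = l.length + 1 + 1 := by simp [s2, s1, s]
    rw [h1, hl]
    lia
  have h3 := Order.LTSeries.length_le_krullDim s2
  have h4 : ringKrullDim (MvPolynomial (Fin n) L) = n := by
    rw [MvPolynomial.ringKrullDim_of_isNoetherianRing, ringKrullDim_eq_zero_of_field, zero_add, Nat.card_fin]
  rw [← ringKrullDim, h4, hlen] at h3
  have h5 : ((n + 1 : ℕ) : ℕ∞) ≤ ((n : ℕ) : ℕ∞) := WithBot.coe_le_coe.1 h3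
  have := Nat.cast_le.1 h5
  lia

end MultiProjective

end

section

namespace Polynomial

section UFD

variable {R : Type*} [CommRing R] [IsDomain R] [UniqueFactorizationMonoid R]

/-- Coprimality over the fraction field, with denominators cleared. -/
theorem exists_combination_eq_C {G E : R[X]} (hG : Irreducible G) (hG0 : G.natDegree ≠ 0)
    (hE : ¬ G ∣ E) : ∃ (A B : R[X]) (h : R), h ≠ 0 ∧ A * G + B * E = C h := by
  have hprim := hG.isPrimitive hG0
  have hirr := (hprim.irreducible_iff_irreducible_map_fraction_map (K := FractionRing R)).1 hG
  have hndvd : ¬ G.map (algebraMap R (FractionRing R)) ∣ E.map (algebraMap R (FractionRing R)) :=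
    fun h => hE (hprim.dvd_of_fraction_map_dvd_fraction_map h)
  obtain ⟨a, b, hab⟩ := (EuclideanDomain.dvd_or_coprime _ _ hirr).resolve_left hndvd
  obtain ⟨s, hs, hs'⟩ := IsLocalization.integerNormalization_spec (nonZeroDivisors R) a
  obtain ⟨t, ht, ht'⟩ := IsLocalization.integerNormalization_spec (nonZeroDivisors R) b
  refine ⟨C t * IsLocalization.integerNormalization (nonZeroDivisors R) a,
    C s * IsLocalization.integerNormalization (nonZeroDivisors R) b, s * t,
    mul_ne_zero (nonZeroDivisors.ne_zero hs) (nonZeroDivisors.ne_zero ht), ?_⟩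
  refine map_injective _ (IsFractionRing.injective R (FractionRing R)) ?_
  simp only [Polynomial.map_add, Polynomial.map_mul, hs', ht', map_C, map_mul, Algebra.smul_def,
    Polynomial.algebraMap_apply]
  calc _ = C (algebraMap R (FractionRing R) s) * C (algebraMap R (FractionRing R) t) *
        (a * G.map (algebraMap R (FractionRing R)) + b * E.map (algebraMap R (FractionRing R))) := by
        simp only [← Polynomial.algebraMap_eq,
          ← IsScalarTower.algebraMap_apply]; ring
    _ = _ := by rw [hab, mul_one]

theorem exists_eq_span_of_isPrime (q : Ideal R[X]) [hq : q.IsPrime] (h0 : q ≠ ⊥)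
    (h : ∀ r, C r ∈ q → r = 0) :
    ∃ G : R[X], Irreducible G ∧ G.natDegree ≠ 0 ∧ q = Ideal.span {G} := by
  obtain ⟨G, hGq, hG⟩ := hq.exists_mem_prime_of_ne_bot h0
  have hdeg : G.natDegree ≠ 0 := by
    intro h1
    rw [eq_C_of_natDegree_eq_zero h1] at hGq hG
    exact hG.ne_zero (by rw [h _ hGq, C_0])
  refine ⟨G, hG.irreducible, hdeg, le_antisymm (fun E hE => ?_) ((Ideal.span_singleton_le_iff_mem _).2 hGq)⟩
  rw [Ideal.mem_span_singleton]
  by_contra hcon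
  obtain ⟨A, B, r, hr, hAB⟩ := exists_combination_eq_C hG.irreducible hdeg hcon
  exact hr (h r (hAB ▸ q.add_mem (q.mul_mem_left _ hGq) (q.mul_mem_left _ hE)))

end UFD

section Plane

variable {L : Type*} [Field L]

/-- The value `E(x, y)` of a polynomial in two variables. -/
noncomputable def biv {A : Type*} [CommRing A] [Algebra L A] (x y : A) : L[X][X] →+* A :=
  eval₂RingHom (aeval x : L[X] →ₐ[L] A).toRingHom y

section

variable {A B : Type*} [CommRing A] [Algebra L A] [CommRing B] [Algebra L B]

@[simp] theorem biv_C (x y : A) (q : L[X]) : biv x y (C q) = aeval x q := by simp [biv]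

@[simp] theorem biv_X (x y : A) : biv (L := L) x y X = y := by simp [biv]

theorem biv_unique {x y : A} {F : L[X][X] →+* A} (h : ∀ q, F (C q) = aeval x q) (h' : F X = y)
    (E : L[X][X]) : F E = biv x y E := by
  induction E using Polynomial.induction_on' with
  | add p q hp hq => rw [map_add, map_add, hp, hq]
  | monomial n a => rw [← C_mul_X_pow_eq_monomial, map_mul, map_pow, h, h', map_mul, map_pow, biv_C, biv_X]

theorem map_biv (φ : A →ₐ[L] B) (x y : A) (E : L[X][X]) : φ (biv x y E) = biv (φ x) (φ y) E :=
  biv_unique (F := (φ : A →+* B).comp (biv x y)) (fun q => by simp [aeval_algHom_apply]) (by simp) E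

@[simp] theorem biv_map_C (x y : A) (q : L[X]) : biv x y (q.map C) = aeval y q := by
  induction q using Polynomial.induction_on' with
  | add p q hp hq => simp [hp, hq]
  | monomial n a => rw [map_monomial, ← C_mul_X_pow_eq_monomial]; simp [aeval_monomial]

end

/-- The endomorphism `E(t, Y) ↦ E(g(t), g(Y))`. -/
noncomputable def planeMap (g : L[X]) : L[X][X] →+* L[X][X] := biv (C g) (g.map C)

theorem planeMap_C (g q : L[X]) : planeMap g (C q) = C (q.comp g) := by
  rw [planeMap, biv_C, comp_eq_aeval]
  exact aeval_algHom_apply (Algebra.ofId L[X] L[X][X] |>.restrictScalars L) g q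

theorem biv_planeMap {A : Type*} [CommRing A] [Algebra L A] (g : L[X]) (x y : A) (E : L[X][X]) :
    biv x y (planeMap g E) = biv (aeval x g) (aeval y g) E :=
  biv_unique (F := (biv x y).comp (planeMap g)) (fun q => by
    rw [RingHom.comp_apply, planeMap_C, biv_C, aeval_comp]) (by simp [planeMap]) E

theorem planeMap_eq (g : L[X]) (E : L[X][X]) :
    planeMap g E = (E.map (compRingHom g)).comp (g.map C) := by
  induction E using Polynomial.induction_on' with
  | add p q hp hq => rw [map_add, hp, hq, Polynomial.map_add, add_comp]
  | monomial n a =>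
    rw [← C_mul_X_pow_eq_monomial, map_mul, map_pow, planeMap_C, Polynomial.map_mul, Polynomial.map_pow, map_X, map_C,
      mul_comp, pow_comp, X_comp, C_comp, coe_compRingHom_apply, planeMap, biv_X]

theorem derivative_planeMap (g : L[X]) (E : L[X][X]) :
    derivative (planeMap g E) = (derivative g).map C * planeMap g (derivative E) := by
  rw [planeMap_eq, derivative_comp, derivative_map, planeMap_eq, derivative_map]

/-- A prime ideal of the plane, invariant under a split polynomial map, other than the ideals of
points and of vertical and horizontal lines: the cofactor `H` in `G(g, g) = G H` is coprime to `G`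
over the field of rational functions. -/
theorem exists_cofactor_coprime [CharZero L] {g : L[X]} (hg : g.natDegree ≠ 0) (q : Ideal L[X][X])
    [hq : q.IsPrime] (h0 : q ≠ ⊥) (hinv : ∀ E, E ∈ q ↔ planeMap g E ∈ q)
    (h1 : ∀ r, C r ∈ q → r = 0) (h2 : ∀ r : L[X], r.map C ∈ q → r = 0) :
    ∃ (G H A B : L[X][X]) (h : L[X]), q = Ideal.span {G} ∧ G ≠ 0 ∧ planeMap g G = G * H ∧ h ≠ 0 ∧
      A * G + B * H = C h := by
  obtain ⟨G, hG, hdeg, rfl⟩ := exists_eq_span_of_isPrime q h0 h1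
  have hmem : G ∈ Ideal.span {G} := Ideal.mem_span_singleton_self G
  obtain ⟨H, hH⟩ := Ideal.mem_span_singleton.1 ((hinv G).1 hmem)
  have hGH : ¬ G ∣ H := by
    rintro ⟨H', rfl⟩
    have h3 : derivative (planeMap g G) ∈ Ideal.span {G} := by
      rw [hH, Ideal.mem_span_singleton]
      simp only [derivative_mul]
      exact ⟨derivative G * H' + (derivative G * H' + G * derivative H'), by ring⟩
    rw [derivative_planeMap] at h3
    rcases hq.mem_or_mem h3 with h4 | h4
    · exact hg (derivative_eq_zero.1 (h2 _ h4))
    · rw [← hinv, Ideal.mem_span_singleton] at h4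
      have h5 : derivative G = 0 := by
        by_contra hne
        exact absurd (degree_le_of_dvd h4 hne) (not_le.2 (degree_derivative_lt hG.ne_zero))
      exact hdeg (derivative_eq_zero.1 h5)
  obtain ⟨A, B, h, hh, hAB⟩ := exists_combination_eq_C hG hdeg hGH
  exact ⟨G, H, A, B, h, rfl, hG.ne_zero, hH, hh, hAB⟩

end Plane

end Polynomial

/-- If all coordinates are algebraic over the coordinate `i₀` modulo `J`, then so is every `v`. -/
theorem MvPolynomial.exists_relation_mod {L : Type*} [Field L] {ι : Type*} (J : Ideal (MvPolynomial ι L))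
    (i₀ : ι) (h : ∀ j, ∃ E : L[X][X], E ≠ 0 ∧
      biv (MvPolynomial.X i₀ : MvPolynomial ι L) (MvPolynomial.X j) E ∈ J)
    (v : MvPolynomial ι L) : ∃ (a : ℕ) (q : L[X]) (s : MvPolynomial ι L), q ≠ 0 ∧
      v ^ a * (Polynomial.aeval (MvPolynomial.X i₀ : MvPolynomial ι L) q + v * s) ∈ J := by
  let A := MvPolynomial ι L ⧸ J
  let π : MvPolynomial ι L →ₐ[L] A := Ideal.Quotient.mkₐ L J
  have hπ : ∀ w, π w = 0 ↔ w ∈ J := fun w => Ideal.Quotient.eq_zero_iff_mem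
  let x0 : A := π (MvPolynomial.X i₀)
  let alg : Algebra L[X] A := (Polynomial.aeval x0 : L[X] →ₐ[L] A).toRingHom.toAlgebra
  have halg : ∀ (E : L[X][X]) (y : A), Polynomial.aeval y E = biv x0 y E := fun E y => rfl
  have key : ∀ w : MvPolynomial ι L, IsAlgebraic L[X] (π w) := by
    intro w
    induction w using MvPolynomial.induction_on with
    | C a =>
      have h1 : π (MvPolynomial.C a) = algebraMap L[X] A (Polynomial.C a) := by
        refine Eq.trans ?_ (Polynomial.aeval_C x0 a).symm
        rfl
      rw [h1]
      exact isAlgebraic_algebraMap _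
    | add p q hp hq => rw [map_add]; exact hp.add hq
    | mul_X p j hp =>
      rw [map_mul]
      refine hp.mul ?_
      obtain ⟨E, hE0, hE⟩ := h j
      exact ⟨E, hE0, by rw [halg, ← map_biv, hπ]; exact hE⟩
  obtain ⟨E, hE0, hE⟩ := key v
  obtain ⟨E', hE'⟩ := Polynomial.X_pow_dvd_iff.2 fun d (hd : d < E.natTrailingDegree) =>
    Polynomial.coeff_eq_zero_of_lt_natTrailingDegree hd
  have hc : E'.coeff 0 ≠ 0 := by
    have h1 : E.coeff E.natTrailingDegree ≠ 0 := Polynomial.trailingCoeff_nonzero_iff_nonzero.2 hE0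
    generalize E.natTrailingDegree = d at h1 hE'
    rw [hE'] at h1
    simpa [Polynomial.coeff_X_pow_mul'] using h1
  refine ⟨E.natTrailingDegree, E'.coeff 0, biv (MvPolynomial.X i₀) v E'.divX, hc, ?_⟩
  have h2 : biv (MvPolynomial.X i₀) v E = v ^ E.natTrailingDegree *
      (Polynomial.aeval (MvPolynomial.X i₀ : MvPolynomial ι L) (E'.coeff 0) +
        v * biv (MvPolynomial.X i₀) v E'.divX) := by
    conv_lhs => rw [hE', ← E'.X_mul_divX_add]
    simp only [map_mul, map_pow, biv_X, map_add, biv_C]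
    ring
  rw [← h2, ← hπ, map_biv, ← halg, hE]

section DimensionOne

/-- In a finitely generated domain of dimension at most one, any two elements are dependent. -/
theorem exists_biv_eq_zero {L A : Type} [Field L] [CommRing A] [IsDomain A] [Algebra L A]
    [Algebra.FiniteType L A] (hA : ∀ q : Ideal A, q.IsPrime → q ≠ ⊥ → q.IsMaximal) (u v : A) :
    ∃ E : L[X][X], E ≠ 0 ∧ biv u v E = 0 := by
  obtain ⟨s, g, hg, hinteg⟩ := exists_integral_inj_algHom_of_fg L A
  have hs : s ≤ 1 := by
    by_contra! hs
    let alg : Algebra (MvPolynomial (Fin s) L) A := g.toRingHom.toAlgebra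
    have : FaithfulSMul (MvPolynomial (Fin s) L) A := (faithfulSMul_iff_algebraMap_injective _ _).2 hg
    have : Algebra.IsIntegral (MvPolynomial (Fin s) L) A := ⟨hinteg⟩
    let i0 : Fin s := ⟨0, by omega⟩
    let i1 : Fin s := ⟨1, by omega⟩
    have hX : Prime (MvPolynomial.X i0 : MvPolynomial (Fin s) L) := MvPolynomial.X_prime
    have hp : (Ideal.span {(MvPolynomial.X i0 : MvPolynomial (Fin s) L)}).IsPrime :=
      (Ideal.span_singleton_prime hX.ne_zero).2 hX
    obtain ⟨Q, hQ, hQc'⟩ := Ideal.exists_ideal_over_prime_of_isIntegral_of_isDomain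
      (S := A) (Ideal.span {(MvPolynomial.X i0 : MvPolynomial (Fin s) L)}) (by
        rw [(RingHom.injective_iff_ker_eq_bot (algebraMap (MvPolynomial (Fin s) L) A)).1 hg]
        exact bot_le)
    have hQc : Ideal.comap (algebraMap (MvPolynomial (Fin s) L) A) Q = _ := hQc'
    have hQ0 : Q ≠ ⊥ := by
      intro hQ0
      have h1 : (MvPolynomial.X i0 : MvPolynomial (Fin s) L) ∈ Ideal.comap (algebraMap _ A) ⊥ := by
        rw [← hQ0, hQc]; exact Ideal.mem_span_singleton_self _
      rw [Ideal.mem_comap, Ideal.mem_bot] at h1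
      exact hX.ne_zero (hg (h1.trans (map_zero g).symm))
    have hm := hA Q hQ hQ0
    have hm' : (Ideal.span {(MvPolynomial.X i0 : MvPolynomial (Fin s) L)}).IsMaximal := by
      rw [← hQc]
      exact Ideal.isMaximal_comap_of_isIntegral_of_isMaximal (R := MvPolynomial (Fin s) L) Q
    have hle : Ideal.span {(MvPolynomial.X i0 : MvPolynomial (Fin s) L)} ≤
        RingHom.ker (MvPolynomial.aeval (R := L) (fun j : Fin s => if j = i1 then (Polynomial.X : L[X]) else 0)) := by
      rw [Ideal.span_singleton_le_iff_mem, RingHom.mem_ker, MvPolynomial.aeval_X, if_neg]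
      simp [i0, i1]
    have hker : (RingHom.ker (MvPolynomial.aeval (R := L)
        (fun j : Fin s => if j = i1 then (Polynomial.X : L[X]) else 0))).IsMaximal := by
      rwa [← hm'.eq_of_le (RingHom.ker_ne_top _) hle]
    have hsurj : Function.Surjective (MvPolynomial.aeval (R := L)
        (fun j : Fin s => if j = i1 then (Polynomial.X : L[X]) else 0)) := by
      intro p
      refine ⟨Polynomial.aeval (MvPolynomial.X i1) p, ?_⟩
      rw [← Polynomial.aeval_algHom_apply, MvPolynomial.aeval_X, if_pos rfl, Polynomial.aeval_X_left_apply]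
    have hf := (Ideal.bot_quotient_isMaximal_iff _).2 hker
    have hfield : IsField L[X] := by
      have e := RingHom.quotientKerEquivOfSurjective (f := (MvPolynomial.aeval (R := L)
        (fun j : Fin s => if j = i1 then (Polynomial.X : L[X]) else 0)).toRingHom) hsurj
      exact MulEquiv.isField ((Ideal.Quotient.maximal_ideal_iff_isField_quotient _).1 hker) e.symm.toMulEquiv
    exact Polynomial.not_isField L hfield
  have htr : Algebra.trdeg L A ≤ 1 := by
    let alg : Algebra (MvPolynomial (Fin s) L) A := g.toRingHom.toAlgebra
    have : IsScalarTower L (MvPolynomial (Fin s) L) A := IsScalarTower.of_algebraMap_eq fun x => (g.commutes x).symm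
    have : FaithfulSMul (MvPolynomial (Fin s) L) A := (faithfulSMul_iff_algebraMap_injective _ _).2 hg
    have : Algebra.IsIntegral (MvPolynomial (Fin s) L) A := ⟨hinteg⟩
    have h1 := _root_.trdeg_add_eq L (MvPolynomial (Fin s) L) (A := A)
    rw [trdeg_eq_zero (R := MvPolynomial (Fin s) L) (A := A), add_zero, MvPolynomial.trdeg_of_isDomain] at h1
    rw [← h1]
    simpa using hs
  by_contra! hcon
  have hind : AlgebraicIndependent L (fun o : Option PUnit.{1} => o.elim v fun _ => u) := by
    let T : MvPolynomial (Option PUnit.{1}) L ≃ₐ[L] L[X][X] :=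
      (MvPolynomial.optionEquivLeft L PUnit.{1}).trans
        (Polynomial.mapAlgEquiv (MvPolynomial.uniqueAlgEquiv L PUnit.{1}))
    have hT : ∀ p, biv u v (T p) =
        MvPolynomial.aeval (fun o : Option PUnit.{1} => o.elim v fun _ => u) p := by
      intro p
      induction p using MvPolynomial.induction_on with
      | C a => simp [T, MvPolynomial.optionEquivLeft_C, biv_C]
      | add p q hp hq => rw [map_add, map_add, map_add, hp, hq]
      | mul_X p o hp =>
        rw [map_mul, map_mul, map_mul, hp]
        cases o <;> simp [T, biv_C, biv_X, MvPolynomial.optionEquivLeft_X_none, MvPolynomial.optionEquivLeft_X_some]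
    rw [algebraicIndependent_iff]
    intro p hp
    by_contra hp0
    exact hcon (T p) ((map_ne_zero_iff _ T.injective).2 hp0) ((hT p).trans hp)
  have := hind.cardinalMk_le_trdeg.trans htr
  simp at this

end DimensionOne

end

section

section Sequences

open Filter

theorem exists_pos_le_of_lt (g : ℕ → ℝ) (hg : ∀ m, 0 ≤ g m) (N : ℕ) :
    ∃ δ > 0, ∀ m < N, g m = 0 ∨ δ ≤ g m := by
  induction N with
  | zero => exact ⟨1, one_pos, by simp⟩
  | succ N ih =>
    obtain ⟨δ, hδ, h⟩ := ih
    by_cases h0 : g N = 0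
    · exact ⟨δ, hδ, fun m hm => (Nat.lt_succ_iff_lt_or_eq.1 hm).elim (h m) fun hm => .inl (hm ▸ h0)⟩
    · refine ⟨min δ (g N), lt_min hδ ((hg N).lt_of_ne' h0), fun m hm => ?_⟩
      rcases Nat.lt_succ_iff_lt_or_eq.1 hm with hm | rfl
      · exact (h m hm).imp_right fun h => (min_le_left _ _).trans h
      · exact .inr (min_le_right _ _)

theorem exists_pos_le_of_ge (g : ℕ → ℝ) (hg : ∀ m, 0 ≤ g m) {N : ℕ} {δ : ℝ} (hδ : 0 < δ)
    (h : ∀ m ≥ N, g m = 0 ∨ δ ≤ g m) : ∃ δ > 0, ∀ m, g m = 0 ∨ δ ≤ g m := by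
  obtain ⟨δ', hδ', h'⟩ := exists_pos_le_of_lt g hg N
  refine ⟨min δ δ', lt_min hδ hδ', fun m => ?_⟩
  rcases lt_or_ge m N with hm | hm
  · exact (h' m hm).imp_right (min_le_right _ _).trans
  · exact (h m hm).imp_right (min_le_left _ _).trans

theorem exists_pos_le_of_residues (g : ℕ → ℝ) {k : ℕ} (hk : 0 < k)
    (h : ∀ r < k, ∃ δ > 0, ∀ t, g (r + k * t) = 0 ∨ δ ≤ g (r + k * t)) :
    ∃ δ > 0, ∀ m, g m = 0 ∨ δ ≤ g m := by
  have h' : ∀ r : Fin k, ∃ δ > 0, ∀ t, g (r + k * t) = 0 ∨ δ ≤ g (r + k * t) := fun r => h r r.2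
  choose δ hδ h' using h'
  have : Nonempty (Fin k) := ⟨⟨0, hk⟩⟩
  obtain ⟨r0, h0⟩ := Finite.exists_min δ
  refine ⟨δ r0, hδ r0, fun m => ?_⟩
  have h1 := h' ⟨m % k, Nat.mod_lt _ hk⟩ (m / k)
  simp only [Nat.mod_add_div] at h1
  exact h1.imp_right ((h0 _).trans)

/-- A sequence which is `k`-periodic as soon as it drops below `1` takes finitely many values
below `1`. -/
theorem exists_pos_le_of_periodic (g : ℕ → ℝ) (hg : ∀ m, 0 ≤ g m) {k N : ℕ} (hk : 0 < k)
    (h : ∀ m ≥ N, g m < 1 → g (m + k) = g m) : ∃ δ > 0, ∀ m, g m = 0 ∨ δ ≤ g m := by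
  refine exists_pos_le_of_residues g hk fun r _ => ?_
  by_cases hex : ∃ t ≥ N, g (r + k * t) < 1
  · obtain ⟨t, ht, hlt⟩ := hex
    have hconst : ∀ s, g (r + k * (t + s)) = g (r + k * t) := by
      intro s
      induction s with
      | zero => rfl
      | succ s ih =>
        rw [← ih, ← h (r + k * (t + s)) _ (by rwa [ih])]
        · congr 1; ring
        · nlinarith
    rcases (hg (r + k * t)).eq_or_lt with h0 | h0
    · refine exists_pos_le_of_ge (fun t => g (r + k * t)) (fun _ => hg _) one_pos (N := t) fun m hm => ?_
      obtain ⟨s, rfl⟩ := Nat.exists_eq_add_of_le hm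
      exact .inl ((hconst s).trans h0.symm)
    · refine exists_pos_le_of_ge (fun t => g (r + k * t)) (fun _ => hg _) h0 (N := t) fun m hm => ?_
      obtain ⟨s, rfl⟩ := Nat.exists_eq_add_of_le hm
      exact .inr (hconst s).ge
  · push Not at hex
    exact exists_pos_le_of_ge (fun t => g (r + k * t)) (fun _ => hg _) one_pos (N := N)
      fun m hm => .inr (hex m hm)

end Sequences

namespace ProductFormulaFamily

open Filter

variable {K : Type} [Field K] (M : ProductFormulaFamily K)

/-- Along the integral sequence `y`, the values of `t` are zero or bounded below at almost all
the places where some nonzero polynomial in `y i₀` is eventually a unit. -/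
def Discrete {ι : Type} (y : ℕ → ι → K) (i₀ : ι) (t : MvPolynomial ι (AlgebraicClosure K)) : Prop :=
  ∃ q : (AlgebraicClosure K)[X], q ≠ 0 ∧ ∀ᶠ i in cofinite,
    (∃ m0, ∀ m ≥ m0, M.ext i (q.eval (algebraMap K _ (y m i₀))) = 1) →
    ∃ δ > 0, ∀ m, M.ext i (MvPolynomial.eval (fun j => algebraMap K (AlgebraicClosure K) (y m j)) t) = 0 ∨
      δ ≤ M.ext i (MvPolynomial.eval (fun j => algebraMap K (AlgebraicClosure K) (y m j)) t)

variable {M} {ι : Type} {y : ℕ → ι → K} {i₀ : ι}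

theorem discrete_X_sub_C {j : ι} (hy : (fun m => y m j) ∈ M.bddSeq) (c : AlgebraicClosure K) :
    M.Discrete y i₀ (MvPolynomial.X j - MvPolynomial.C c) := by
  refine ⟨1, one_ne_zero, ?_⟩
  filter_upwards [M.eventually_nonarch] with i hi _
  obtain ⟨δ, hδ, h⟩ := M.exists_lower_bound_sub hy hi c
  refine ⟨δ, hδ, fun m => ?_⟩
  simp only [map_sub, MvPolynomial.eval_X, MvPolynomial.eval_C]
  exact (h m).imp_left fun h => by rw [h, sub_self, map_zero]

theorem eventually_ext_eval_seq_le_one [Finite ι] (hy : ∀ j, ∀ᶠ i in cofinite, ∀ m, M.w i (y m j) ≤ 1)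
    (t : MvPolynomial ι (AlgebraicClosure K)) : ∀ᶠ i in cofinite, ∀ m,
      M.ext i (MvPolynomial.eval (fun j => algebraMap K (AlgebraicClosure K) (y m j)) t) ≤ 1 := by
  filter_upwards [M.eventually_nonarch, eventually_all.2 hy, M.eventually_ext_mvEval_le_one t]
    with i hi h1 h2 m
  exact h2 _ fun j => by rw [M.ext_algebraMap hi]; exact h1 j m

theorem eval_biv {L : Type} [Field L] (z : ι → L) (x y : MvPolynomial ι L) (E : L[X][X]) :
    MvPolynomial.eval z (biv x y E) =
      biv (MvPolynomial.eval z x) (MvPolynomial.eval z y) E := by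
  rw [← MvPolynomial.coe_aeval_eq_eval]
  exact map_biv (MvPolynomial.aeval z) x y E

theorem eval_aeval_X {L : Type} [Field L] (z : ι → L) (i : ι) (q : L[X]) :
    MvPolynomial.eval z (Polynomial.aeval (MvPolynomial.X i) q) = q.eval (z i) := by
  rw [← MvPolynomial.coe_aeval_eq_eval]
  change (MvPolynomial.aeval z) _ = _
  rw [← Polynomial.aeval_algHom_apply, MvPolynomial.aeval_X, Polynomial.coe_aeval_eq_eval]

theorem discrete_biv [Finite ι] {f : K[X]} {k : ℕ} (hk : 0 < k)
    (hy : ∀ j, ∀ᶠ i in cofinite, ∀ m, M.w i (y m j) ≤ 1)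
    {j : ι} (hi₀ : ∀ m, y (m + 1) i₀ = f.eval (y m i₀)) (hj : ∀ m, y (m + 1) j = f.eval (y m j))
    {G H A B : (AlgebraicClosure K)[X][X]} {h : (AlgebraicClosure K)[X]}
    (hG : planeMap ((f.comp^[k] X).map (algebraMap K (AlgebraicClosure K))) G = G * H) (hh : h ≠ 0)
    (hAB : A * G + B * H = C h) :
    M.Discrete y i₀ (biv (Polynomial.aeval (MvPolynomial.X i₀) ((f.comp^[k] X).map (algebraMap K (AlgebraicClosure K))))
      (Polynomial.aeval (MvPolynomial.X j) ((f.comp^[k] X).map (algebraMap K (AlgebraicClosure K)))) G) := by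
  refine ⟨h, hh, ?_⟩
  have hinteg : ∀ E : (AlgebraicClosure K)[X][X], ∀ᶠ i in cofinite, ∀ m,
      M.ext i (biv (algebraMap K (AlgebraicClosure K) (y m i₀)) (algebraMap K _ (y m j)) E) ≤ 1 := by
    intro E
    filter_upwards [eventually_ext_eval_seq_le_one hy (biv (MvPolynomial.X i₀) (MvPolynomial.X j) E)]
      with i hi m
    simpa [eval_biv] using hi m
  filter_upwards [M.eventually_nonarch, hinteg A, hinteg B, hinteg H, hinteg G] with i hi hA hB hH hG1 ⟨m0, hm0⟩
  set g : ℕ → ℝ := fun m =>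
    M.ext i (biv (algebraMap K (AlgebraicClosure K) (y m i₀)) (algebraMap K _ (y m j)) G) with hg
  have hshift : ∀ m, biv (algebraMap K (AlgebraicClosure K) (y (m + k) i₀)) (algebraMap K _ (y (m + k) j)) G =
      biv (algebraMap K (AlgebraicClosure K) (y m i₀)) (algebraMap K _ (y m j)) (G * H) := by
    intro m
    rw [← hG, biv_planeMap]
    have h1 : ∀ j : ι, (∀ m, y (m + 1) j = f.eval (y m j)) → algebraMap K (AlgebraicClosure K) (y (m + k) j) =
        Polynomial.aeval (algebraMap K (AlgebraicClosure K) (y m j)) ((f.comp^[k] X).map (algebraMap K (AlgebraicClosure K))) := by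
      intro j hj
      have h2 := iterate_comp_eval_orbit (x := fun m => y m j) hj k m
      rw [← h2, Polynomial.coe_aeval_eq_eval, Polynomial.eval_map_algebraMap, Polynomial.aeval_algebraMap_apply,
        Polynomial.coe_aeval_eq_eval]
    rw [h1 i₀ hi₀, h1 j hj]
  have hgk : ∀ m, M.ext i (MvPolynomial.eval (fun j => algebraMap K (AlgebraicClosure K) (y m j))
      (biv (Polynomial.aeval (MvPolynomial.X i₀) ((f.comp^[k] X).map (algebraMap K (AlgebraicClosure K))))
      (Polynomial.aeval (MvPolynomial.X j) ((f.comp^[k] X).map (algebraMap K (AlgebraicClosure K)))) G)) = g (m + k) := by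
    intro m
    rw [hg]
    simp only
    rw [hshift, ← hG, biv_planeMap, eval_biv, eval_aeval_X, eval_aeval_X]
    simp only [Polynomial.coe_aeval_eq_eval]
  have hper : ∀ m ≥ m0, g m < 1 → g (m + k) = g m := by
    intro m hm hlt
    have h1 : M.ext i (biv (algebraMap K (AlgebraicClosure K) (y m i₀)) (algebraMap K _ (y m j)) H) = 1 := by
      refine le_antisymm (hH m) ?_
      by_contra! hlt'
      have h2 := congrArg (biv (algebraMap K (AlgebraicClosure K) (y m i₀)) (algebraMap K _ (y m j))) hAB
      rw [map_add, map_mul, map_mul, biv_C, Polynomial.coe_aeval_eq_eval] at h2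
      have h3 := hm0 m hm
      rw [← h2] at h3
      have h4 := M.ext_nonarch i
        (biv (algebraMap K (AlgebraicClosure K) (y m i₀)) (algebraMap K _ (y m j)) A *
          biv (algebraMap K (AlgebraicClosure K) (y m i₀)) (algebraMap K _ (y m j)) G)
        (biv (algebraMap K (AlgebraicClosure K) (y m i₀)) (algebraMap K _ (y m j)) B *
          biv (algebraMap K (AlgebraicClosure K) (y m i₀)) (algebraMap K _ (y m j)) H)
      rw [h3, map_mul, map_mul] at h4
      refine h4.not_gt (max_lt ?_ ?_)
      · exact (mul_le_of_le_one_left (AbsoluteValue.nonneg _ _) (hA m)).trans_lt hlt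
      · exact (mul_le_of_le_one_left (AbsoluteValue.nonneg _ _) (hB m)).trans_lt hlt'
    rw [hg]
    simp only
    rw [hshift, map_mul, map_mul, h1, mul_one]
  obtain ⟨δ, hδ, h⟩ := exists_pos_le_of_periodic g (fun m => AbsoluteValue.nonneg _ _) hk hper
  exact ⟨δ, hδ, fun m => by rw [hgk]; exact h _⟩

/-- If the coordinates are dependent on the unbounded coordinate `i₀` modulo the discrete
functions `T`, then the values of a polynomial where all of `T` vanish are discrete. -/
theorem frequently_discrete [CharZero K] [Finite ι] {f : K[X]} (hf : 2 ≤ f.natDegree)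
    (hy : ∀ j, ∀ᶠ i in cofinite, ∀ m, M.w i (y m j) ≤ 1)
    (hi₀ : ∀ m, y (m + 1) i₀ = f.eval (y m i₀)) {a : M.Idx} (ha : ∀ B, ∃ m, B < M.w a (y m i₀))
    (T R : Finset (MvPolynomial ι (AlgebraicClosure K))) (hT : ∀ t ∈ T, M.Discrete y i₀ t)
    (hdep : ∀ j, ∃ E : (AlgebraicClosure K)[X][X], E ≠ 0 ∧
      biv (MvPolynomial.X i₀ : MvPolynomial ι (AlgebraicClosure K)) (MvPolynomial.X j) E ∈
        Ideal.span (T : Set (MvPolynomial ι (AlgebraicClosure K)))) :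
    ∃ᶠ i in cofinite, (∃ z, z ≠ 0 ∧ M.w i z ≠ 1) ∧ ∃ δ > 0, ∀ m,
      (∃ t ∈ T, δ ≤ M.ext i (MvPolynomial.eval (fun j => algebraMap K (AlgebraicClosure K) (y m j)) t)) ∨
      ∀ v ∈ R, MvPolynomial.eval (fun j => algebraMap K (AlgebraicClosure K) (y m j)) v = 0 ∨
        δ ≤ M.ext i (MvPolynomial.eval (fun j => algebraMap K (AlgebraicClosure K) (y m j)) v) := by
  classical
  choose! qT hqT0 hqT using hT
  choose e q s hq0 hq using MvPolynomial.exists_relation_mod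
    (Ideal.span (T : Set (MvPolynomial ι (AlgebraicClosure K)))) i₀ hdep
  have hQ : (∏ t ∈ T, qT t) * ∏ v ∈ R, q v ≠ 0 :=
    mul_ne_zero (Finset.prod_ne_zero_iff.2 hqT0) (Finset.prod_ne_zero_iff.2 fun v _ => hq0 v)
  refine (frequently_eventually_eq_one (M := M) hf (x := fun m => y m i₀) hi₀ ha hQ).mp ?_
  have hcoeff : ∀ q : (AlgebraicClosure K)[X], ∀ᶠ i in cofinite, ∀ m,
      M.ext i (q.eval (algebraMap K _ (y m i₀))) ≤ 1 := by
    intro q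
    filter_upwards [M.eventually_ext_eval_le_one q, M.eventually_nonarch, hy i₀] with i h1 h2 h3 m
    exact h1 _ (by rw [M.ext_algebraMap h2]; exact h3 m)
  filter_upwards [(Finset.eventually_all T).2 hqT, (Finset.eventually_all T).2 fun t _ => hcoeff (qT t),
    (Finset.eventually_all R).2 fun v _ => hcoeff (q v),
    (Finset.eventually_all R).2 fun v _ => eventually_ext_eval_seq_le_one hy (s v)]
    with i hi1 hi2 hi3 hi4 ⟨hne, m0, hm0⟩
  refine ⟨hne, ?_⟩
  have hone : ∀ m ≥ m0, (∀ t ∈ T, M.ext i ((qT t).eval (algebraMap K _ (y m i₀))) = 1) ∧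
      ∀ v ∈ R, M.ext i ((q v).eval (algebraMap K _ (y m i₀))) = 1 := by
    intro m hm
    have h1 := hm0 m hm
    rw [eval_mul, eval_prod, eval_prod, map_mul, map_prod, map_prod] at h1
    have h2 : ∏ t ∈ T, M.ext i ((qT t).eval (algebraMap K _ (y m i₀))) ≤ 1 :=
      Finset.prod_le_one (fun _ _ => AbsoluteValue.nonneg _ _) fun t ht => hi2 t ht m
    have h3 : ∏ v ∈ R, M.ext i ((q v).eval (algebraMap K _ (y m i₀))) ≤ 1 :=
      Finset.prod_le_one (fun _ _ => AbsoluteValue.nonneg _ _) fun t ht => hi3 t ht m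
    have key : ∀ (S : Finset (MvPolynomial ι (AlgebraicClosure K)))
        (r : MvPolynomial ι (AlgebraicClosure K) → ℝ), (∀ t ∈ S, 0 ≤ r t) → (∀ t ∈ S, r t ≤ 1) →
        1 ≤ ∏ t ∈ S, r t → ∀ t ∈ S, r t = 1 := by
      intro S r hr0 hr1 hp t ht
      refine le_antisymm (hr1 t ht) (hp.trans ?_)
      rw [← Finset.mul_prod_erase S r ht]
      exact mul_le_of_le_one_right (hr0 t ht) (Finset.prod_le_one
        (fun u hu => hr0 u (Finset.mem_of_mem_erase hu)) fun u hu => hr1 u (Finset.mem_of_mem_erase hu))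
    have h2' : 0 ≤ ∏ t ∈ T, M.ext i ((qT t).eval (algebraMap K _ (y m i₀))) :=
      Finset.prod_nonneg fun _ _ => AbsoluteValue.nonneg _ _
    have h3' : 0 ≤ ∏ v ∈ R, M.ext i ((q v).eval (algebraMap K _ (y m i₀))) :=
      Finset.prod_nonneg fun _ _ => AbsoluteValue.nonneg _ _
    exact ⟨key T (fun t => M.ext i ((qT t).eval (algebraMap K _ (y m i₀))))
        (fun _ _ => AbsoluteValue.nonneg _ _) (fun t ht => hi2 t ht m) (by nlinarith),
      key R (fun v => M.ext i ((q v).eval (algebraMap K _ (y m i₀))))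
        (fun _ _ => AbsoluteValue.nonneg _ _) (fun t ht => hi3 t ht m) (by nlinarith)⟩
  have hTδ : ∀ t : T, ∃ δ > 0, ∀ m,
      M.ext i (MvPolynomial.eval (fun j => algebraMap K (AlgebraicClosure K) (y m j)) t.1) = 0 ∨
      δ ≤ M.ext i (MvPolynomial.eval (fun j => algebraMap K (AlgebraicClosure K) (y m j)) t.1) :=
    fun t => hi1 t.1 t.2 ⟨m0, fun m hm => (hone m hm).1 t.1 t.2⟩
  choose δT hδT hTδ using hTδ
  have hRδ : ∀ v : R, ∃ δ > 0, ∀ m < m0,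
      M.ext i (MvPolynomial.eval (fun j => algebraMap K (AlgebraicClosure K) (y m j)) v.1) = 0 ∨
      δ ≤ M.ext i (MvPolynomial.eval (fun j => algebraMap K (AlgebraicClosure K) (y m j)) v.1) :=
    fun v => exists_pos_le_of_lt (fun m => M.ext i (MvPolynomial.eval
      (fun j => algebraMap K (AlgebraicClosure K) (y m j)) v.1)) (fun _ => AbsoluteValue.nonneg _ _) m0
  choose δR hδR hRδ using hRδ
  have hmin : ∀ {α : Type} [Finite α] (δ : α → ℝ), (∀ a, 0 < δ a) → ∃ ε > 0, ∀ a, ε ≤ δ a := by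
    intro α _ δ hδ
    rcases isEmpty_or_nonempty α with h | h
    · exact ⟨1, one_pos, fun a => h.elim a⟩
    · obtain ⟨a, ha⟩ := Finite.exists_min δ
      exact ⟨δ a, hδ a, ha⟩
  obtain ⟨ε₁, hε₁, h₁⟩ := hmin δT hδT
  obtain ⟨ε₂, hε₂, h₂⟩ := hmin δR hδR
  refine ⟨min 1 (min ε₁ ε₂), by positivity, fun m => ?_⟩
  by_cases hall : ∀ t ∈ T, MvPolynomial.eval (fun j => algebraMap K (AlgebraicClosure K) (y m j)) t = 0
  · refine .inr fun v hv => ?_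
    by_cases hv0 : MvPolynomial.eval (fun j => algebraMap K (AlgebraicClosure K) (y m j)) v = 0
    · exact .inl hv0
    refine .inr ?_
    rcases lt_or_ge m m0 with hm | hm
    · exact ((min_le_right _ _).trans ((min_le_right _ _).trans (h₂ ⟨v, hv⟩))).trans
        ((hRδ ⟨v, hv⟩ m hm).resolve_left ((_root_.map_ne_zero _).2 hv0))
    · refine (min_le_left _ _).trans ?_
      have h5 : Ideal.span (T : Set (MvPolynomial ι (AlgebraicClosure K))) ≤
          RingHom.ker (MvPolynomial.eval (fun j => algebraMap K (AlgebraicClosure K) (y m j))) :=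
        Ideal.span_le.2 fun t ht => hall t ht
      have h6 := h5 (hq v)
      rw [RingHom.mem_ker, map_mul, map_pow, mul_eq_zero, or_iff_right (pow_ne_zero _ hv0), map_add,
        map_mul, eval_aeval_X] at h6
      have h7 := (hone m hm).2 v hv
      rw [eq_neg_of_add_eq_zero_left h6, map_neg_eq_map, map_mul] at h7
      rw [← h7]
      exact mul_le_of_le_one_right (AbsoluteValue.nonneg _ _) (hi4 v hv m)
  · push Not at hall
    obtain ⟨t, ht, ht0⟩ := hall
    exact .inl ⟨t, ht, ((min_le_right _ _).trans ((min_le_left _ _).trans (h₁ ⟨t, ht⟩))).trans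
      ((hTδ ⟨t, ht⟩ m).resolve_left ((_root_.map_ne_zero _).2 ht0))⟩

end ProductFormulaFamily

end

section

section Preperiodic

theorem exists_iterate_image_eq {L : Type} [CommRing L] {ι : Type} {f : L[X]} {X : Set (ι → OnePoint L)}
    (h : SubvarPreperiodic f X) : ∃ k, 0 < k ∧
      (splitMap f)^[k] '' ((splitMap f)^[k] '' X) = (splitMap f)^[k] '' X := by
  obtain ⟨k0, m, hm, h⟩ := h
  have h1 : ∀ t, (splitMap f)^[m * t] '' ((splitMap f)^[k0] '' X) = (splitMap f)^[k0] '' X := by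
    intro t
    induction t with
    | zero => simp
    | succ t ih => rw [Nat.mul_succ, Function.iterate_add, Set.image_comp, h, ih]
  refine ⟨m * (k0 + 1), by positivity, ?_⟩
  have h2 : k0 ≤ m * (k0 + 1) := by nlinarith
  obtain ⟨r, hr⟩ := Nat.exists_eq_add_of_le' h2
  have h3 : (splitMap f)^[m * (k0 + 1)] '' X = (splitMap f)^[r] '' ((splitMap f)^[k0] '' X) := by
    rw [← Set.image_comp, ← Function.iterate_add, ← hr]
  rw [h3, ← Set.image_comp ((splitMap f)^[m * (k0 + 1)]), ← Function.iterate_add, Nat.add_comm,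
    Function.iterate_add, Set.image_comp, h1]

end Preperiodic

namespace MultiProjective

section Chart

variable {L : Type} [Field L] {ι : Type} (c : ι → Fin 2)

theorem pt_apply_of_eq_one {y : ι → L} {i : ι} (hi : c i = 1) : pt c y i = (y i : OnePoint L) := by
  simp [pt, hi]

theorem pt_apply_of_eq_zero {y : ι → L} {i : ι} (hi : c i ≠ 1) (h : y i = 0) : pt c y i = ∞ := by
  simp [pt, hi, h]

theorem hom_pt_of_eq_zero {y : ι → L} (h : ∀ i, c i ≠ 1 → y i = 0) : hom (pt c y) = lift c y := by
  ext ⟨i, k⟩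
  by_cases hi : c i = 1
  · simp only [hom, lift, pt_apply_of_eq_one c hi, homCoords_coe, hi]
    fin_cases k <;> simp
  · have hi0 : c i = 0 := by omega
    simp only [hom, lift, pt_apply_of_eq_zero c hi (h i hi), homCoords_infty, hi0, h i hi]
    fin_cases k <;> simp

theorem exists_pt_of_eq_infty_iff {x : ι → OnePoint L} (h : ∀ i, x i = ∞ ↔ c i ≠ 1) :
    ∃ y : ι → L, x = pt c y ∧ ∀ i, c i ≠ 1 → y i = 0 := by
  have h' : ∀ i, ∃ t : L, (c i ≠ 1 → t = 0) ∧ (c i = 1 → x i = t) := by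
    intro i
    by_cases hi : c i = 1
    · obtain ⟨a, ha⟩ := OnePoint.ne_infty_iff_exists.1 (fun h0 => (h i).1 h0 hi)
      exact ⟨a, fun h0 => absurd hi h0, fun _ => ha.symm⟩
    · exact ⟨0, fun _ => rfl, fun h0 => absurd h0 hi⟩
  choose y hy0 hy1 using h'
  refine ⟨y, funext fun i => ?_, hy0⟩
  by_cases hi : c i = 1
  · rw [pt_apply_of_eq_one c hi, hy1 i hi]
  · rw [pt_apply_of_eq_zero c hi (hy0 i hi), (h i).2 hi]

theorem iterate_eval_eq (f : L[X]) (k : ℕ) (a : L) : (fun t => f.eval t)^[k] a = (f.comp^[k] X).eval a := by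
  rw [Polynomial.iterate_comp_eval, Polynomial.eval_X]

/-- The image of the `c`-stratum of a preperiodic set is periodic. -/
theorem exists_eval_eval_eq {f : L[X]} {k : ℕ} {T : Set (ι → OnePoint L)}
    (hT : (splitMap f)^[k] '' ((splitMap f)^[k] '' T) = (splitMap f)^[k] '' T) {y : ι → L}
    (hy : pt c y ∈ T) (hy0 : ∀ i, c i ≠ 1 → y i = 0) :
    (∃ y' : ι → L, pt c y' ∈ T ∧ (∀ i, c i ≠ 1 → y' i = 0) ∧ ∀ i, c i = 1 →
      (f.comp^[k] X).eval (y i) = (f.comp^[k] X).eval ((f.comp^[k] X).eval (y' i))) ∧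
    ∃ y' : ι → L, pt c y' ∈ T ∧ (∀ i, c i ≠ 1 → y' i = 0) ∧ ∀ i, c i = 1 →
      (f.comp^[k] X).eval ((f.comp^[k] X).eval (y i)) = (f.comp^[k] X).eval (y' i) := by
  have hpat : ∀ i, pt c y i = ∞ ↔ c i ≠ 1 := fun i => by
    by_cases hi : c i = 1
    · simp [pt_apply_of_eq_one c hi, hi]
    · simp [pt_apply_of_eq_zero c hi (hy0 i hi), hi]
  have hval : ∀ (z : ι → L) i, c i = 1 → ∀ k, (splitMap f)^[k] (pt c z) i =
      (((f.comp^[k] X).eval (z i) : L) : OnePoint L) := fun z i hi k => by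
    rw [splitMap_iterate_coe f (pt_apply_of_eq_one c hi), iterate_eval_eq]
  have hval2 : ∀ (z : ι → L) i, c i = 1 → (splitMap f)^[k] ((splitMap f)^[k] (pt c z)) i =
      (((f.comp^[k] X).eval ((f.comp^[k] X).eval (z i)) : L) : OnePoint L) := fun z i hi => by
    rw [splitMap_iterate_coe f (hval z i hi k), iterate_eval_eq]
  constructor
  · obtain ⟨_, ⟨x, hx, rfl⟩, hxy⟩ : (splitMap f)^[k] (pt c y) ∈
        (splitMap f)^[k] '' ((splitMap f)^[k] '' T) := hT.symm ▸ Set.mem_image_of_mem _ hy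
    obtain ⟨y', rfl, hy'⟩ := exists_pt_of_eq_infty_iff (x := x) c fun i => by
      rw [← hpat i, ← splitMap_iterate_eq_infty_iff f k, ← splitMap_iterate_eq_infty_iff f k, hxy,
        splitMap_iterate_eq_infty_iff f k]
    refine ⟨y', hx, hy', fun i hi => ?_⟩
    have := congrFun hxy i
    rw [hval2 _ _ hi, hval _ _ hi, OnePoint.coe_eq_coe] at this
    exact this.symm
  · obtain ⟨x, hx, hxy⟩ : (splitMap f)^[k] ((splitMap f)^[k] (pt c y)) ∈ (splitMap f)^[k] '' T :=
      hT ▸ Set.mem_image_of_mem _ (Set.mem_image_of_mem _ hy)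
    obtain ⟨y', rfl, hy'⟩ := exists_pt_of_eq_infty_iff (x := x) c fun i => by
      rw [← hpat i, ← splitMap_iterate_eq_infty_iff f k, hxy, splitMap_iterate_eq_infty_iff f k,
        splitMap_iterate_eq_infty_iff f k]
    refine ⟨y', hx, hy', fun i hi => ?_⟩
    have := congrFun hxy i
    rw [hval2 _ _ hi, hval _ _ hi, OnePoint.coe_eq_coe] at this
    exact this.symm

end Chart

section Orbit

variable {K : Type} [Field K] {ι : Type} (f : K[X]) (P : ι → OnePoint K)

open Classical in
/-- The chart around `P` with all the infinite coordinates at infinity. -/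
noncomputable def infChart : ι → Fin 2 := fun i => if P i = ∞ then 0 else 1

theorem infChart_eq_one_iff {K ι : Type} (P : ι → OnePoint K) {i : ι} : infChart P i = 1 ↔ P i ≠ ∞ := by
  simp only [infChart]
  split_ifs with h <;> simp [h]

open Classical in
/-- Affine coordinates of the orbit of `P` in the chart `infChart P`. -/
noncomputable def affOrbit (m : ℕ) : ι → K := fun i => if P i = ∞ then 0 else orbitHom f P m (i, 0)

theorem affOrbit_infty {i : ι} (h : P i = ∞) (m : ℕ) : affOrbit f P m i = 0 := if_pos h

theorem orbitHom_infty {i : ι} (h : P i = ∞) (m : ℕ) (k : Fin 2) :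
    orbitHom f P m (i, k) = if k = 0 then 1 else 0 := by
  rw [orbitHom, splitMap_iterate_infty f h, homCoords_infty]
  fin_cases k <;> simp

theorem affOrbit_succ {i : ι} (h : P i ≠ ∞) (m : ℕ) :
    affOrbit f P (m + 1) i = f.eval (affOrbit f P m i) := by
  obtain ⟨a, ha⟩ := OnePoint.ne_infty_iff_exists.1 h
  simp only [affOrbit, if_neg h, orbitHom, splitMap_iterate_coe f ha.symm, homCoords_coe,
    Function.iterate_succ_apply']
  rfl

theorem orbitHom_of_ne {i : ι} (h : P i ≠ ∞) (m : ℕ) (k : Fin 2) :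
    orbitHom f P m (i, k) = if k = 0 then affOrbit f P m i else 1 := by
  obtain ⟨a, ha⟩ := OnePoint.ne_infty_iff_exists.1 h
  simp only [affOrbit, if_neg h, orbitHom, splitMap_iterate_coe f ha.symm, homCoords_coe]
  fin_cases k <;> simp

theorem lift_affOrbit {L : Type} [Field L] [Algebra K L] (m : ℕ) :
    lift (infChart P) (fun i => algebraMap K L (affOrbit f P m i)) =
      fun jk => algebraMap K L (orbitHom f P m jk) := by
  ext ⟨i, k⟩
  by_cases h : P i = ∞
  · rw [orbitHom_infty f P h]
    simp only [lift, infChart, if_pos h, affOrbit_infty f P h]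
    split_ifs <;> simp
  · rw [orbitHom_of_ne f P h]
    simp only [lift, infChart, if_neg h]
    fin_cases k <;> simp

variable {f P}

theorem exists_finset_polys {n : ℕ} (V : ClosedSubvar K (Fin n)) :
    ∃ S : Finset (MvPolynomial (Fin n × Fin 2) K), ↑S ⊆ V.polys ∧
      ∀ z : Fin n × Fin 2 → K, (∀ p ∈ S, MvPolynomial.eval z p = 0) →
        ∀ p ∈ V.polys, MvPolynomial.eval z p = 0 := by
  obtain ⟨S, hS, hspan⟩ := (Submodule.fg_span_iff_fg_span_finset_subset V.polys).1
    (IsNoetherian.noetherian (Ideal.span V.polys))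
  refine ⟨S, hS, fun z hz p hp => ?_⟩
  have h1 : Ideal.span (S : Set (MvPolynomial (Fin n × Fin 2) K)) ≤ RingHom.ker (MvPolynomial.eval z) :=
    Ideal.span_le.2 hz
  have h2 : p ∈ Ideal.span (S : Set (MvPolynomial (Fin n × Fin 2) K)) := by
    have : p ∈ Submodule.span (MvPolynomial (Fin n × Fin 2) K) V.polys := Submodule.subset_span hp
    rwa [hspan] at this
  exact h1 h2

theorem exists_eval_orbitHom_ne_zero {n : ℕ} {P : Fin n → OnePoint K} {V : ClosedSubvar K (Fin n)}
    (hP : fwdOrbit (splitMap f) P ∩ V.pts (RingHom.id K) = ∅)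
    {S : Finset (MvPolynomial (Fin n × Fin 2) K)}
    (hS : ∀ z : Fin n × Fin 2 → K, (∀ p ∈ S, MvPolynomial.eval z p = 0) →
        ∀ p ∈ V.polys, MvPolynomial.eval z p = 0) (m : ℕ) :
    ∃ p ∈ S, MvPolynomial.eval (orbitHom f P m) p ≠ 0 := by
  by_contra! h
  have h1 := hS _ h
  refine Set.eq_empty_iff_forall_notMem.1 hP ((splitMap f)^[m] P) ⟨⟨m, rfl⟩, fun p hp => ?_⟩
  rw [vanishesAt, MvPolynomial.map_id]
  exact h1 p hp

end Orbit

end MultiProjective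

namespace ProductFormulaFamily

open Filter MultiProjective

variable {K : Type} [Field K] {M : ProductFormulaFamily K} {ι : Type} {f : K[X]} {P : ι → OnePoint K}

theorem affOrbit_dichotomy (M : ProductFormulaFamily K) (f : K[X]) (P : ι → OnePoint K) (j : ι) :
    (fun m => affOrbit f P m j) ∈ M.bddSeq ∨
      P j ≠ ∞ ∧ ∃ a : M.Idx, ∀ B, ∃ m, B < M.w a (affOrbit f P m j) := by
  by_cases hj : P j = ∞
  · left
    simp only [affOrbit_infty f P hj]
    exact M.const_mem_bddSeq 0
  · by_cases h : ∃ a : M.Idx, ∀ B, ∃ m, B < M.w a (affOrbit f P m j)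
    · exact .inr ⟨hj, h⟩
    · push Not at h
      exact .inl ⟨eventually_orbit_le_one (x := fun m => affOrbit f P m j) (affOrbit_succ f P hj), h⟩

theorem eventually_affOrbit_le_one (M : ProductFormulaFamily K) (f : K[X]) (P : ι → OnePoint K) (j : ι) :
    ∀ᶠ i in cofinite, ∀ m, M.w i (affOrbit f P m j) ≤ 1 := by
  by_cases hj : P j = ∞
  · simp [affOrbit_infty f P hj]
  · exact eventually_orbit_le_one (x := fun m => affOrbit f P m j) (affOrbit_succ f P hj)

theorem orbitHom_mem_bddSeq {j : ι} (h : (fun m => affOrbit f P m j) ∈ M.bddSeq) (k : Fin 2) :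
    (fun m => orbitHom f P m (j, k)) ∈ M.bddSeq := by
  by_cases hj : P j = ∞
  · simp only [orbitHom_infty f P hj]
    exact M.const_mem_bddSeq _
  · simp only [orbitHom_of_ne f P hj]
    split_ifs
    · exact h
    · exact M.const_mem_bddSeq _

end ProductFormulaFamily

end

section

theorem MvPolynomial.finite_zeros_of_no_chain {L : Type} [Field L] {ι : Type} [Finite ι]
    {p : Ideal (MvPolynomial ι L)}
    (hp : ∀ q q' : Ideal (MvPolynomial ι L), q.IsPrime → q'.IsPrime → p < q → q < q' → False)
    {g : MvPolynomial ι L} (hg : g ∉ p) :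
    {y : ι → L | (∀ r ∈ p, MvPolynomial.eval y r = 0) ∧ MvPolynomial.eval y g = 0}.Finite := by
  have hfin := Ideal.finite_minimalPrimes_of_isNoetherianRing (MvPolynomial ι L) (p ⊔ Ideal.span {g})
  refine Set.Finite.of_finite_image (f := fun y : ι → L => RingHom.ker (MvPolynomial.eval y))
    (hfin.subset ?_) ?_
  · rintro _ ⟨y, ⟨hy, hyg⟩, rfl⟩
    have hk : (RingHom.ker (MvPolynomial.eval y)).IsPrime := RingHom.ker_isPrime _
    have hle : p ⊔ Ideal.span {g} ≤ RingHom.ker (MvPolynomial.eval y) :=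
      sup_le hy ((Ideal.span_singleton_le_iff_mem _).2 hyg)
    obtain ⟨q, hq, hqk⟩ := Ideal.exists_minimalPrimes_le hle
    have hpq : p < q := by
      refine lt_of_le_of_ne (le_sup_left.trans hq.1.2) ?_
      rintro rfl
      exact hg (hq.1.2 (Ideal.mem_sup_right (Ideal.mem_span_singleton_self g)))
    rcases hqk.eq_or_lt with h | h
    · simpa only [← h] using hq
    · exact (hp q _ hq.1.1 hk hpq h).elim
  · intro y _ z _ hyz
    ext i
    have h1 : MvPolynomial.X i - MvPolynomial.C (y i) ∈ RingHom.ker (MvPolynomial.eval y) := by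
      simp [RingHom.mem_ker]
    have h2 : MvPolynomial.X i - MvPolynomial.C (y i) ∈ RingHom.ker (MvPolynomial.eval z) := by
      simp only at hyz
      rwa [← hyz]
    simp only [RingHom.mem_ker, map_sub, MvPolynomial.eval_X, MvPolynomial.eval_C, sub_eq_zero] at h2
    exact h2.symm

namespace MultiProjective

variable {L : Type} [Field L] [IsAlgClosed L] {ι : Type} [DecidableEq ι] [Fintype ι] {c : ι → Fin 2}
  {T : Set (ι → OnePoint L)}

theorem no_chain_of_varDim_eq_one (hdim : varDim T = ((1 : ℕ∞) : WithBot ℕ∞)) (hT : IsZarClosed T)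
    {q₀ q₁ q₂ : Ideal (MvPolynomial ι L)} (h₀ : q₀.IsPrime) (h₁ : q₁.IsPrime) (h₂ : q₂.IsPrime)
    (h : chartIdeal c T ≤ q₀) (h01 : q₀ < q₁) (h12 : q₁ < q₂) : False :=
  not_lt_lt_of_varDim_le_one hdim (irrSubvar_projClosure (c := c) q₂) (irrSubvar_projClosure q₁)
    (irrSubvar_projClosure q₀) (projClosure_ssubset h12) (projClosure_ssubset h01)
    (projClosure_subset hT h)

/-- Two functions on a curve are algebraically dependent. -/
theorem exists_biv_mem_chartIdeal (hdim : varDim T = ((1 : ℕ∞) : WithBot ℕ∞)) (hT : IsZarClosed T)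
    (hp : (chartIdeal c T).IsPrime) (u v : MvPolynomial ι L) :
    ∃ E : L[X][X], E ≠ 0 ∧ biv u v E ∈ chartIdeal c T := by
  obtain ⟨E, hE0, hE⟩ := exists_biv_eq_zero (L := L) (A := MvPolynomial ι L ⧸ chartIdeal c T)
    (fun q hq hq0 => by
      obtain ⟨m, hm, hqm⟩ := q.exists_le_maximal hq.ne_top
      rcases hqm.eq_or_lt with h | h
      · exact h ▸ hm
      exfalso
      have hmp := hm.isPrime
      have hs := Ideal.Quotient.mk_surjective (I := chartIdeal c T)
      have hker : RingHom.ker (Ideal.Quotient.mk (chartIdeal c T)) = chartIdeal c T := Ideal.mk_ker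
      have hmono : StrictMono (Ideal.comap (Ideal.Quotient.mk (chartIdeal c T))) :=
        Monotone.strictMono_of_injective (fun _ _ h => Ideal.comap_mono h) (Ideal.comap_injective_of_surjective _ hs)
      have h0 : Ideal.comap (Ideal.Quotient.mk (chartIdeal c T)) ⊥ = chartIdeal c T := hker
      refine no_chain_of_varDim_eq_one (c := c) hdim hT hp (hq.comap _) (hmp.comap _) le_rfl ?_ (hmono h)
      conv_lhs => rw [← h0]
      exact hmono (bot_lt_iff_ne_bot.2 hq0))
    (Ideal.Quotient.mk _ u) (Ideal.Quotient.mk _ v)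
  refine ⟨E, hE0, Ideal.Quotient.eq_zero_iff_mem.1 ?_⟩
  rw [← hE]
  exact map_biv (Ideal.Quotient.mkₐ L (chartIdeal c T)) u v E

/-- A function on an irreducible variety which is not constant is transcendental. -/
theorem exists_sub_C_mem {L : Type} [Field L] [IsAlgClosed L] {ι : Type} {c : ι → Fin 2}
    {T : Set (ι → OnePoint L)} (hp : (chartIdeal c T).IsPrime) (u : MvPolynomial ι L) {q : L[X]} (hq : q ≠ 0)
    (h : Polynomial.aeval u q ∈ chartIdeal c T) : ∃ a : L, u - MvPolynomial.C a ∈ chartIdeal c T := by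
  have hs := IsAlgClosed.splits q
  rw [hs.eq_prod_roots, map_mul, Polynomial.aeval_C] at h
  rcases hp.mem_or_mem h with h | h
  · refine (hp.ne_top (Ideal.eq_top_of_isUnit_mem _ h ?_)).elim
    exact (IsUnit.mk0 _ (leadingCoeff_ne_zero.2 hq)).map (algebraMap L (MvPolynomial ι L))
  · rw [map_multiset_prod, Multiset.map_map] at h
    obtain ⟨b, hb, hbm⟩ := (hp.multiset_prod_mem_iff_exists_mem _).1 h
    obtain ⟨a, -, rfl⟩ := Multiset.mem_map.1 hb
    refine ⟨a, ?_⟩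
    simpa [MvPolynomial.algebraMap_eq] using hbm


/-- Planar invariant relation between two coordinates of orbits under `g`. -/
def HasPlaneRelation (g : L[X]) (Z : Set (ι → L)) (i j : ι) : Prop :=
  ∃ (G H A B : L[X][X]) (h : L[X]), planeMap g G = G * H ∧ G * H ≠ 0 ∧ h ≠ 0 ∧ A * G + B * H = C h ∧
    ∀ y ∈ Z, MvPolynomial.eval y (biv (Polynomial.aeval (MvPolynomial.X i : MvPolynomial ι L) g)
      (Polynomial.aeval (MvPolynomial.X j) g) G) = 0

theorem eval_biv_aeval {L : Type} [Field L] {ι : Type} (y : ι → L) (g : L[X]) (i j : ι) (E : L[X][X]) :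
    MvPolynomial.eval y (biv (Polynomial.aeval (MvPolynomial.X i : MvPolynomial ι L) g)
      (Polynomial.aeval (MvPolynomial.X j) g) E) = biv (g.eval (y i)) (g.eval (y j)) E := by
  rw [ProductFormulaFamily.eval_biv, ProductFormulaFamily.eval_aeval_X, ProductFormulaFamily.eval_aeval_X]

/-- The plane lemma, for an irreducible set `Z` with vanishing ideal `p`. -/
theorem hasPlaneRelation_of_isPrime [CharZero L] {g : L[X]} (hg : g.natDegree ≠ 0) {Z : Set (ι → L)}
    {p : Ideal (MvPolynomial ι L)} (hp : p.IsPrime) (hpZ : ∀ r, r ∈ p ↔ ∀ y ∈ Z, MvPolynomial.eval y r = 0)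
    {i j : ι} (h1 : ∀ y ∈ Z, ∃ y' ∈ Z, g.eval (y i) = g.eval (g.eval (y' i)) ∧
      g.eval (y j) = g.eval (g.eval (y' j)))
    (h2 : ∀ y ∈ Z, ∃ y' ∈ Z, g.eval (g.eval (y i)) = g.eval (y' i) ∧
      g.eval (g.eval (y j)) = g.eval (y' j))
    (hi : ∀ q : L[X], q ≠ 0 → ∃ y ∈ Z, q.eval (y i) ≠ 0)
    (hj : ∀ q : L[X], q ≠ 0 → ∃ y ∈ Z, q.eval (y j) ≠ 0)
    (hdep : ∃ E : L[X][X], E ≠ 0 ∧ biv (Polynomial.aeval (MvPolynomial.X i : MvPolynomial ι L) g)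
      (Polynomial.aeval (MvPolynomial.X j) g) E ∈ p) : HasPlaneRelation g Z i j := by
  let ψ : L[X][X] →+* MvPolynomial ι L := biv (Polynomial.aeval (MvPolynomial.X i : MvPolynomial ι L) g)
    (Polynomial.aeval (MvPolynomial.X j) g)
  have hψ : ∀ E, E ∈ p.comap ψ ↔ ∀ y ∈ Z, biv (g.eval (y i)) (g.eval (y j)) E = 0 := fun E => by
    rw [Ideal.mem_comap, hpZ]
    simp only [ψ, eval_biv_aeval]
  have hcomp : ∀ q : L[X], q ≠ 0 → q.comp g ≠ 0 := fun q hq h => by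
    rcases comp_eq_zero_iff.1 h with h | ⟨-, h⟩
    · exact hq h
    · exact hg (by rw [h, natDegree_C])
  have h1' : ∀ r : L[X], C r ∈ p.comap ψ → r = 0 := by
    intro r hr
    by_contra hr0
    obtain ⟨y, hy, hyr⟩ := hi _ (hcomp r hr0)
    have := (hψ _).1 hr y hy
    rw [biv_C, coe_aeval_eq_eval] at this
    exact hyr (by rw [eval_comp]; exact this)
  have h2' : ∀ r : L[X], r.map C ∈ p.comap ψ → r = 0 := by
    intro r hr
    by_contra hr0
    obtain ⟨y, hy, hyr⟩ := hj _ (hcomp r hr0)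
    have := (hψ _).1 hr y hy
    rw [biv_map_C, coe_aeval_eq_eval] at this
    exact hyr (by rw [eval_comp]; exact this)
  have hpr : (p.comap ψ).IsPrime := hp.comap ψ
  obtain ⟨G, H, A, B, h, hq, hG0, hGH, hh, hAB⟩ := exists_cofactor_coprime hg (p.comap ψ) (by
      obtain ⟨E, hE0, hE⟩ := hdep
      intro h0
      exact hE0 ((Submodule.eq_bot_iff _).1 h0 E hE)) (by
      intro E
      rw [hψ, hψ]
      simp only [biv_planeMap, coe_aeval_eq_eval]
      constructor
      · intro h y hy
        obtain ⟨y', hy', e1, e2⟩ := h2 y hy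
        rw [e1, e2]
        exact h y' hy'
      · intro h y hy
        obtain ⟨y', hy', e1, e2⟩ := h1 y hy
        rw [e1, e2]
        exact h y' hy') h1' h2'
  have hGm : G ∈ p.comap ψ := hq ▸ Ideal.mem_span_singleton_self G
  refine ⟨G, H, A, B, h, hGH, ?_, hh, hAB, (hpZ _).1 hGm⟩
  intro h0
  have hH : H = 0 := (mul_eq_zero.1 h0).resolve_left hG0
  rw [hH, mul_zero, add_zero] at hAB
  exact hh (h1' h (hAB ▸ Ideal.mul_mem_left _ A hGm))

variable (c T) in
/-- The points of `T` in the stratum of the chart `c`. -/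
def stratum : Set (ι → L) := {y | pt c y ∈ T ∧ ∀ i, c i ≠ 1 → y i = 0}

theorem curve_coordinates [CharZero L] (hirr : IrrSubvar T) (hdim : varDim T = ((1 : ℕ∞) : WithBot ℕ∞))
    {f : L[X]} {k : ℕ} (hf : (f.comp^[k] X).natDegree ≠ 0)
    (hT : (splitMap f)^[k] '' ((splitMap f)^[k] '' T) = (splitMap f)^[k] '' T)
    {i : ι} (hci : c i = 1) (hi : ∀ q : L[X], q ≠ 0 → ∃ y ∈ stratum c T, q.eval (y i) ≠ 0) (j : ι)
    (hcj : c j = 1) :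
    (∃ a, ∀ y ∈ stratum c T, y j = a) ∨ HasPlaneRelation (f.comp^[k] X) (stratum c T) i j := by
  obtain ⟨y₀, hy₀, -⟩ := hi 1 one_ne_zero
  have hp := IrrSubvar.isPrime_chartIdeal hirr hy₀.1
  have hB : ∀ b, c b ≠ 1 → MvPolynomial.X b ∈ chartIdeal c T := by
    intro b hb
    by_contra hb'
    have hfin := MvPolynomial.finite_zeros_of_no_chain (p := chartIdeal c T) (fun q q' hq hq' h1 h2 =>
      no_chain_of_varDim_eq_one hdim hirr.2.1 hp hq hq' le_rfl h1 h2) hb'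
    have hsub : stratum c T ⊆ _ := fun y hy => (⟨fun r hr => mem_chartIdeal.1 hr y hy.1, by
      rw [MvPolynomial.eval_X]; exact hy.2 b hb⟩ : y ∈ {y : ι → L | (∀ r ∈ chartIdeal c T,
        MvPolynomial.eval y r = 0) ∧ MvPolynomial.eval y (MvPolynomial.X b) = 0})
    have hfin' := hfin.subset hsub
    obtain ⟨y, hy, hne⟩ := hi (∏ y ∈ hfin'.toFinset, (X - C (y i))) (Finset.prod_ne_zero_iff.2
      fun y _ => X_sub_C_ne_zero _)
    refine hne ?_
    rw [eval_prod]
    exact Finset.prod_eq_zero (hfin'.mem_toFinset.2 hy) (by simp)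
  have hpZ : ∀ r, r ∈ chartIdeal c T ↔ ∀ y ∈ stratum c T, MvPolynomial.eval y r = 0 := by
    intro r
    rw [mem_chartIdeal]
    refine ⟨fun h y hy => h y hy.1, fun h y hy => h y ⟨hy, fun b hb => ?_⟩⟩
    simpa using mem_chartIdeal.1 (hB b hb) y hy
  by_cases hj : ∀ q : L[X], q ≠ 0 → ∃ y ∈ stratum c T, q.eval (y j) ≠ 0
  · refine .inr (hasPlaneRelation_of_isPrime hf hp hpZ (fun y hy => ?_) (fun y hy => ?_) hi hj
      (exists_biv_mem_chartIdeal hdim hirr.2.1 hp _ _))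
    · obtain ⟨y', h1, h2, h3⟩ := (exists_eval_eval_eq c hT hy.1 hy.2).1
      exact ⟨y', ⟨h1, h2⟩, h3 i hci, h3 j hcj⟩
    · obtain ⟨y', h1, h2, h3⟩ := (exists_eval_eval_eq c hT hy.1 hy.2).2
      exact ⟨y', ⟨h1, h2⟩, h3 i hci, h3 j hcj⟩
  · push Not at hj
    obtain ⟨q, hq, hqj⟩ := hj
    obtain ⟨a, ha⟩ := exists_sub_C_mem hp (MvPolynomial.X j) hq ((hpZ _).2 fun y hy => by
      rw [ProductFormulaFamily.eval_aeval_X]; exact hqj y hy)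
    refine .inl ⟨a, fun y hy => ?_⟩
    simpa [sub_eq_zero] using (hpZ _).1 ha y hy

end MultiProjective

end

section

namespace ProductFormulaFamily

open Filter MultiProjective

variable {K : Type} [Field K] {M : ProductFormulaFamily K} {n : ℕ} {f : K[X]} {P : Fin n → OnePoint K}
  {V : ClosedSubvar K (Fin n)}

/-- Some member of a finite family of polynomials stays away from zero along the orbit of `P`, at infinitely
many nontrivial indices. -/
def FrequentlySeparated (M : ProductFormulaFamily K) (f : K[X]) (P : Fin n → OnePoint K)
    (U : Finset (MvPolynomial (Fin n) (AlgebraicClosure K))) : Prop :=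
  ∃ᶠ i in cofinite, (∃ z, z ≠ 0 ∧ M.w i z ≠ 1) ∧ ∃ δ > 0, ∃ m0, ∀ m ≥ m0, ∃ u ∈ U,
    δ ≤ M.ext i (MvPolynomial.eval (fun j => algebraMap K (AlgebraicClosure K) (affOrbit f P m j)) u)

theorem eval_orbitHom_map (m : ℕ) (p : MvPolynomial (Fin n × Fin 2) K) :
    MvPolynomial.eval (fun jk => algebraMap K (AlgebraicClosure K) (orbitHom f P m jk))
      (MvPolynomial.map (algebraMap K (AlgebraicClosure K)) p) =
      algebraMap K (AlgebraicClosure K) (MvPolynomial.eval (orbitHom f P m) p) := by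
  rw [MvPolynomial.eval_map, MvPolynomial.eval₂_comp]
  rfl

theorem eval_affOrbit_dh (m : ℕ) (p : MvPolynomial (Fin n × Fin 2) K) :
    MvPolynomial.eval (fun j => algebraMap K (AlgebraicClosure K) (affOrbit f P m j))
      (dh (infChart P) (MvPolynomial.map (algebraMap K (AlgebraicClosure K)) p)) =
      algebraMap K (AlgebraicClosure K) (MvPolynomial.eval (orbitHom f P m) p) := by
  rw [eval_dh, lift_affOrbit, eval_orbitHom_map]

theorem frequently_orbitClosureAvoids [CharZero K] (hP : fwdOrbit (splitMap f) P ∩ V.pts (RingHom.id K) = ∅)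
    (U : Finset (MvPolynomial (Fin n) (AlgebraicClosure K)))
    (hU : ∀ u ∈ U, ∀ y ∈ stratum (infChart P) (V.pts (algebraMap K (AlgebraicClosure K))),
      MvPolynomial.eval y u = 0)
    (h : M.FrequentlySeparated f P U) :
    ∃ᶠ i in cofinite, (∃ z, z ≠ 0 ∧ M.w i z ≠ 1) ∧
      ∀ v : PlaceK K, v.v = M.w i → OrbitClosureAvoids v f P V := by
  classical
  obtain ⟨S, hSV, hS⟩ := exists_finset_polys V
  let c := infChart P
  let em : MvPolynomial (Fin n) (AlgebraicClosure K) → MvPolynomial (Fin n × Fin 2) (AlgebraicClosure K) :=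
    fun u => MvPolynomial.aeval (fun j => if c j = 1 then MvPolynomial.X (j, 0) else 0) u
  have hem : ∀ (y : Fin n → AlgebraicClosure K) (_ : ∀ i, c i ≠ 1 → y i = 0) u,
      MvPolynomial.eval (lift c y) (em u) = MvPolynomial.eval y u := by
    intro y hy u
    have h1 : ((MvPolynomial.aeval (lift c y)).comp (MvPolynomial.aeval
        (fun j => if c j = 1 then MvPolynomial.X (j, 0) else 0)) :
        MvPolynomial (Fin n) (AlgebraicClosure K) →ₐ[AlgebraicClosure K] AlgebraicClosure K) =
        MvPolynomial.aeval y := by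
      ext j
      by_cases hj : c j = 1
      · simp [lift, hj]
      · simp [hj, hy j hj]
    have h2 := DFunLike.congr_fun h1 u
    simpa [MvPolynomial.aeval_eq_eval, em] using h2
  have hle : ∀ j, c j ≠ 1 → P j = ∞ := fun j hj => by
    by_contra h0
    exact hj ((infChart_eq_one_iff P).2 h0)
  let U' := U.image em ∪ S.image (MvPolynomial.map (algebraMap K (AlgebraicClosure K)))
  refine (h.and_eventually (M.eventually_orbitClosureAvoids f P V U' ?_)).mono ?_
  · intro u hu x hx hxP
    rcases Finset.mem_union.1 hu with hu | hu
    · obtain ⟨u', hu', rfl⟩ := Finset.mem_image.1 hu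
      obtain ⟨y, rfl, hy⟩ := exists_pt_of_eq_infty_iff c (x := x) fun i => by
        rw [hxP, Ne, infChart_eq_one_iff P, not_not]
      have : (fun jk : Fin n × Fin 2 => homCoords (pt c y jk.1) jk.2) = lift c y := hom_pt_of_eq_zero c hy
      rw [this, hem y hy]
      exact hU u' hu' y ⟨hx, hy⟩
    · obtain ⟨p, hp, rfl⟩ := Finset.mem_image.1 hu
      exact hx p (hSV hp)
  · rintro i ⟨⟨hnt, δ, hδ, m0, h1⟩, h2⟩
    refine ⟨hnt, h2 ?_⟩
    have h3 : ∀ m, ∃ u ∈ U', 0 < M.ext i (MvPolynomial.eval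
        (fun jk => algebraMap K _ (orbitHom f P m jk)) u) := by
      intro m
      obtain ⟨p, hp, hp0⟩ := exists_eval_orbitHom_ne_zero hP hS m
      refine ⟨_, Finset.mem_union_right _ (Finset.mem_image_of_mem _ hp), ?_⟩
      rw [eval_orbitHom_map]
      exact (M.ext i).pos ((_root_.map_ne_zero _).2 hp0)
    choose u hu hu0 using h3
    let g : ℕ → ℝ := fun m => M.ext i (MvPolynomial.eval
        (fun jk => algebraMap K _ (orbitHom f P m jk)) (u m))
    obtain ⟨δ', hδ', h4⟩ : ∃ δ' > 0, ∀ m < m0, δ' ≤ g m := by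
      by_cases hm0 : m0 = 0
      · exact ⟨1, one_pos, fun m hm => by omega⟩
      · have hne : (Finset.range m0).Nonempty := Finset.nonempty_range_iff.2 hm0
        obtain ⟨b, -, hb⟩ := Finset.exists_min_image (Finset.range m0) g hne
        exact ⟨g b, hu0 b, fun m hm => hb m (Finset.mem_range.2 hm)⟩
    refine ⟨min δ δ', lt_min hδ hδ', fun m => ?_⟩
    rcases lt_or_ge m m0 with hm | hm
    · exact ⟨u m, hu m, (min_le_right _ _).trans (h4 m hm)⟩
    · obtain ⟨u', hu', h5⟩ := h1 m hm
      refine ⟨em u', Finset.mem_union_left _ (Finset.mem_image_of_mem _ hu'), (min_le_left _ _).trans ?_⟩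
      rw [← lift_affOrbit, hem _ fun i hi => by rw [affOrbit_infty f P (hle i hi), map_zero]]
      exact h5

/-- If all coordinates are bounded, the defining equations themselves stay away from zero. -/
theorem frequently_orbitClosureAvoids_of_bdd [CharZero K]
    (hP : fwdOrbit (splitMap f) P ∩ V.pts (RingHom.id K) = ∅)
    (hb : ∀ j, (fun m => affOrbit f P m j) ∈ M.bddSeq) :
    ∃ᶠ i in cofinite, (∃ z, z ≠ 0 ∧ M.w i z ≠ 1) ∧
      ∀ v : PlaceK K, v.v = M.w i → OrbitClosureAvoids v f P V := by
  classical
  obtain ⟨S, hSV, hS⟩ := exists_finset_polys V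
  refine frequently_orbitClosureAvoids hP
    (S.image fun p => dh (infChart P) (MvPolynomial.map (algebraMap K (AlgebraicClosure K)) p)) ?_ ?_
  · intro u hu y hy
    obtain ⟨p, hp, rfl⟩ := Finset.mem_image.1 hu
    rw [eval_dh, ← hom_pt_of_eq_zero _ hy.2]
    exact hy.1 p (hSV hp)
  · refine (M.frequently_nontrivial.and_eventually M.eventually_nonarch).mono ?_
    rintro i ⟨hnt, hi⟩
    have h1 : ∀ p ∈ S, ∃ δ > 0, ∀ m, MvPolynomial.eval (orbitHom f P m) p = 0 ∨
        δ ≤ M.w i (MvPolynomial.eval (orbitHom f P m) p) := fun p _ =>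
      M.exists_lower_bound (M.mvPolynomial_mem_bddSeq (fun jk m => orbitHom f P m jk) p
        fun jk _ => orbitHom_mem_bddSeq (hb jk.1) jk.2) i
    obtain ⟨δ, hδ, h2⟩ : ∃ δ > 0, ∀ p ∈ S, ∀ m, MvPolynomial.eval (orbitHom f P m) p = 0 ∨
        δ ≤ M.w i (MvPolynomial.eval (orbitHom f P m) p) := by
      choose! d hd h using h1
      rcases S.eq_empty_or_nonempty with rfl | hne
      · exact ⟨1, one_pos, by simp⟩
      · obtain ⟨b, hb, hmin⟩ := Finset.exists_min_image S d hne
        exact ⟨d b, hd b hb, fun p hp m => (h p hp m).imp_right fun h => (hmin p hp).trans h⟩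
    refine ⟨hnt, δ, hδ, 0, fun m _ => ?_⟩
    obtain ⟨p, hp, hp0⟩ := exists_eval_orbitHom_ne_zero hP hS m
    refine ⟨_, Finset.mem_image_of_mem _ hp, ?_⟩
    rw [eval_affOrbit_dh, M.ext_algebraMap hi]
    exact (h2 p hp m).resolve_left hp0

theorem frequently_orbitClosureAvoids_of_univariate [CharZero K] (hf : 2 ≤ f.natDegree)
    (hP : fwdOrbit (splitMap f) P ∩ V.pts (RingHom.id K) = ∅) {j : Fin n} (hj : P j ≠ ∞) {a : M.Idx}
    (ha : ∀ B, ∃ m, B < M.w a (affOrbit f P m j)) {q : (AlgebraicClosure K)[X]} (hq : q ≠ 0)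
    (hqV : ∀ y ∈ stratum (infChart P) (V.pts (algebraMap K (AlgebraicClosure K))), q.eval (y j) = 0) :
    ∃ᶠ i in cofinite, (∃ z, z ≠ 0 ∧ M.w i z ≠ 1) ∧
      ∀ v : PlaceK K, v.v = M.w i → OrbitClosureAvoids v f P V := by
  refine frequently_orbitClosureAvoids hP {Polynomial.aeval (MvPolynomial.X j) q} ?_ ?_
  · intro u hu y hy
    rw [Finset.mem_singleton.1 hu, eval_aeval_X]
    exact hqV y hy
  · refine (M.frequently_eventually_eq_one hf (x := fun m => affOrbit f P m j)
      (fun m => affOrbit_succ f P hj m) ha hq).mono ?_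
    rintro i ⟨hnt, m0, h⟩
    refine ⟨hnt, 1, one_pos, m0, fun m hm => ⟨_, Finset.mem_singleton_self _, ?_⟩⟩
    rw [eval_aeval_X]
    exact (h m hm).ge

theorem map_iterate_comp {R S : Type} [CommRing R] [CommRing S] (φ : R →+* S) (f : R[X]) (k : ℕ) :
    (f.comp^[k] X).map φ = (f.map φ).comp^[k] X := by
  induction k with
  | zero => simp
  | succ k ih => rw [Function.iterate_succ_apply', Function.iterate_succ_apply', Polynomial.map_comp, ih]

theorem frequently_orbitClosureAvoids_of_curve [CharZero K] (hf : 2 ≤ f.natDegree)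
    (hVirr : IrrSubvar (V.pts (algebraMap K (AlgebraicClosure K))))
    (hVpre : SubvarPreperiodic (f.map (algebraMap K (AlgebraicClosure K)))
      (V.pts (algebraMap K (AlgebraicClosure K))))
    (hVdim : varDim (V.pts (algebraMap K (AlgebraicClosure K))) = ((1 : ℕ∞) : WithBot ℕ∞))
    (hP : fwdOrbit (splitMap f) P ∩ V.pts (RingHom.id K) = ∅) :
    ∃ᶠ i in cofinite, (∃ z, z ≠ 0 ∧ M.w i z ≠ 1) ∧
      ∀ v : PlaceK K, v.v = M.w i → OrbitClosureAvoids v f P V := by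
  classical
  by_cases hb : ∀ j, (fun m => affOrbit f P m j) ∈ M.bddSeq
  · exact frequently_orbitClosureAvoids_of_bdd hP hb
  by_cases huni : ∃ j, P j ≠ ∞ ∧ (∃ a : M.Idx, ∀ B, ∃ m, B < M.w a (affOrbit f P m j)) ∧
      ∃ q : (AlgebraicClosure K)[X], q ≠ 0 ∧
        ∀ y ∈ stratum (infChart P) (V.pts (algebraMap K (AlgebraicClosure K))), q.eval (y j) = 0
  · obtain ⟨j, hj, ⟨a, ha⟩, q, hq, hqV⟩ := huni
    exact frequently_orbitClosureAvoids_of_univariate hf hP hj ha hq hqV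
  push Not at hb huni
  obtain ⟨i₁, hi₁b⟩ := hb
  obtain ⟨hi₁, a, ha⟩ := (affOrbit_dichotomy M f P i₁).resolve_left hi₁b
  have hiq := huni i₁ hi₁ ⟨a, ha⟩
  set c := infChart P with hc
  set fL := f.map (algebraMap K (AlgebraicClosure K)) with hfL
  set X₀ := V.pts (algebraMap K (AlgebraicClosure K)) with hX₀
  obtain ⟨k, hk, hkX⟩ := exists_iterate_image_eq hVpre
  have hdeg : ((fL.comp)^[k] X).natDegree ≠ 0 := by
    rw [natDegree_iterate_comp, hfL, natDegree_map, natDegree_X, mul_one]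
    positivity
  have hc1 : ∀ {j}, c j = 1 ↔ P j ≠ ∞ := infChart_eq_one_iff P
  have hy1 := eventually_affOrbit_le_one M f P
  -- one polynomial for each coordinate
  have key : ∀ j, ∃ t : MvPolynomial (Fin n) (AlgebraicClosure K),
      (∀ y ∈ stratum c X₀, MvPolynomial.eval y t = 0) ∧ M.Discrete (affOrbit f P) i₁ t ∧
      ∃ E : (AlgebraicClosure K)[X][X], E ≠ 0 ∧
        biv (MvPolynomial.X i₁ : MvPolynomial (Fin n) (AlgebraicClosure K)) (MvPolynomial.X j) E ∈
          Ideal.span {t} := by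
    intro j
    by_cases hcj : c j = 1
    · rcases curve_coordinates hVirr hVdim hdeg hkX (hc1.2 hi₁) hiq j hcj with ⟨b, hb⟩ | hplane
      · have hjb : (fun m => affOrbit f P m j) ∈ M.bddSeq := by
          by_contra h
          obtain ⟨h1, a', ha'⟩ := (affOrbit_dichotomy M f P j).resolve_left h
          obtain ⟨y, hy, h2⟩ := huni j h1 ⟨a', ha'⟩ (X - C b) (X_sub_C_ne_zero b)
          exact h2 (by simp [hb y hy])
        refine ⟨MvPolynomial.X j - MvPolynomial.C b, fun y hy => by simp [hb y hy],
          discrete_X_sub_C hjb b, X - C (C b), X_sub_C_ne_zero _, ?_⟩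
        rw [map_sub, biv_X, biv_C, Polynomial.aeval_C]
        exact Ideal.subset_span rfl
      · obtain ⟨G, H, A, B, h, hG, hGH, hh, hAB, hvan⟩ := hplane
        refine ⟨_, hvan, ?_, G * H, hGH, ?_⟩
        · rw [hfL, ← map_iterate_comp] at hG ⊢
          exact discrete_biv hk hy1 (affOrbit_succ f P hi₁) (affOrbit_succ f P (hc1.1 hcj)) hG hh hAB
        · rw [← hG, biv_planeMap]
          exact Ideal.subset_span rfl
    · have hPj : P j = ∞ := by
        by_contra h0
        exact hcj (hc1.2 h0)
      refine ⟨MvPolynomial.X j - MvPolynomial.C 0, fun y hy => by simp [hy.2 j hcj],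
        discrete_X_sub_C ?_ 0, X, X_ne_zero, ?_⟩
      · simp only [affOrbit_infty f P hPj]
        exact M.const_mem_bddSeq 0
      · rw [biv_X, MvPolynomial.C_0, sub_zero]
        exact Ideal.subset_span rfl
  choose t htV htD htE using key
  obtain ⟨S, hSV, hS⟩ := exists_finset_polys V
  set R := S.image fun p => dh c (MvPolynomial.map (algebraMap K (AlgebraicClosure K)) p) with hR
  have hfreq := M.frequently_discrete (y := affOrbit f P) (i₀ := i₁) hf hy1 (affOrbit_succ f P hi₁) ha
    (Finset.univ.image t) R (fun u hu => by
      obtain ⟨j, -, rfl⟩ := Finset.mem_image.1 hu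
      exact htD j) (fun j => by
      obtain ⟨E, hE, h⟩ := htE j
      refine ⟨E, hE, Ideal.span_mono ?_ h⟩
      simp)
  refine frequently_orbitClosureAvoids hP (Finset.univ.image t ∪ R) ?_ (hfreq.mono ?_)
  · intro u hu y hy
    rcases Finset.mem_union.1 hu with hu | hu
    · obtain ⟨j, -, rfl⟩ := Finset.mem_image.1 hu
      exact htV j y hy
    · obtain ⟨p, hp, rfl⟩ := Finset.mem_image.1 hu
      rw [eval_dh, ← hom_pt_of_eq_zero _ hy.2]
      exact hy.1 p (hSV hp)
  · rintro i ⟨hnt, δ, hδ, h⟩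
    refine ⟨hnt, δ, hδ, 0, fun m _ => ?_⟩
    rcases h m with ⟨u, hu, h1⟩ | h1
    · exact ⟨u, Finset.mem_union_left _ hu, h1⟩
    · obtain ⟨p, hp, hp0⟩ := exists_eval_orbitHom_ne_zero hP hS m
      have hpR : dh c (MvPolynomial.map (algebraMap K (AlgebraicClosure K)) p) ∈ R :=
        Finset.mem_image_of_mem _ hp
      refine ⟨_, Finset.mem_union_right _ hpR, (h1 _ hpR).resolve_left ?_⟩
      rw [eval_affOrbit_dh]
      exact (_root_.map_ne_zero _).2 hp0

end ProductFormulaFamily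

end

section

namespace MultiProjective

open MvPolynomial

variable {L : Type} [Field L]

theorem hm_X {ι : Type} [DecidableEq ι] [Fintype ι] {c : ι → Fin 2} {i : ι} (hi : c i = 0) :
    hm c (fun j => (X i : MvPolynomial ι L).degreeOf j) (X i : MvPolynomial ι L) = X (i, 1) := by
  have h1 : HasMultidegree (X (i, 1) : MvPolynomial (ι × Fin 2) L)
      (fun j => (X i : MvPolynomial ι L).degreeOf j) := fun j => by
    have := isWeightedHomogeneous_X L (fun jk : ι × Fin 2 => if jk.1 = j then (1 : ℕ) else 0) (i, (1 : Fin 2))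
    beta_reduce
    rw [degreeOf_X]
    simpa [eq_comm] using this
  refine (hasMultidegree_hm c fun j => le_rfl).injOn_dh c h1 ?_
  rw [dh_hm, dh, MvPolynomial.aeval_X]
  simp [hi]

theorem exists_standard_equation [IsAlgClosed L] {n : ℕ} (hn : 1 ≤ n)
    {T : Set (Fin n → OnePoint L)} (hT : IrrSubvar T)
    (hdim : varDim T = (((n - 1 : ℕ) : ℕ∞) : WithBot ℕ∞)) (hne : T ≠ Set.univ) :
    (∃ i, ∀ x, x ∈ T ↔ x i = ∞) ∨ (∃ y₀, pt (fun _ => 1) y₀ ∈ T) ∧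
      ∃ F, Irreducible F ∧ chartIdeal (fun _ => 1) T = Ideal.span {F} := by
  obtain ⟨c, y₁, F, hy₁, hF, hcF⟩ := exists_chartIdeal_eq_span hn hT hdim hne
  by_cases hstd : ∃ y₀, pt (fun _ => 1) y₀ ∈ T
  · obtain ⟨y₀, hy₀⟩ := hstd
    refine Or.inr ⟨⟨y₀, hy₀⟩, dh (fun _ => 1) (hm c (fun i => F.degreeOf i) F), ?_⟩
    set Fh := hm c (fun i => F.degreeOf i) F with hFh
    have hFhm : MultiHomog Fh := multiHomog_hm F
    have hdvd : ∀ p, MultiHomog p → (∀ x ∈ T, eval (hom x) p = 0) → Fh ∣ p := fun p hp hpT =>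
      hm_dvd_of_dvd_dh c hp (Ideal.mem_span_singleton.1 (hcF ▸ dh_mem_chartIdeal hp hpT))
    have hFh0 : ∀ x ∈ T, eval (hom x) Fh = 0 := fun x hx =>
      IrrSubvar.eval_eq_zero hT hy₁ hFhm (by
        rw [hFh, dh_hm, hcF]
        exact Ideal.subset_span rfl) hx
    have hspan : chartIdeal (fun _ => 1) T = Ideal.span {dh (fun _ => 1) Fh} := by
      refine le_antisymm (fun q hq => ?_) ((Ideal.span_singleton_le_iff_mem _).2 (dh_mem_chartIdeal hFhm hFh0))
      have h1 := map_dvd (dh (fun _ => 1)) (hdvd (hm (fun _ => 1) (fun i => q.degreeOf i) q) (multiHomog_hm q)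
        fun x hx => IrrSubvar.eval_eq_zero hT hy₀ (multiHomog_hm q) (by rwa [dh_hm]) hx)
      rw [dh_hm] at h1
      exact Ideal.mem_span_singleton.2 h1
    have hprime := IrrSubvar.isPrime_chartIdeal hT hy₀
    rw [hspan] at hprime
    refine ⟨((Ideal.span_singleton_prime ?_).1 hprime).irreducible, hspan⟩
    intro h0
    have h1 : HasMultidegree Fh (fun i => F.degreeOf i) := hasMultidegree_hm c fun i => le_rfl
    have h2 := h1.injOn_dh (fun _ => 1) (q := 0)
      (fun i => (weightedHomogeneousSubmodule L _ _).zero_mem) (by rw [h0, map_zero])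
    have h3 := congrArg (dh c) h2
    rw [hFh, dh_hm, map_zero] at h3
    exact hF.ne_zero h3
  · left
    -- the boundary of the standard chart contains `T`
    have hprod : ∀ s : Finset (Fin n), (∀ x ∈ T, eval (hom x) (∏ i ∈ s, X (i, 1)) = 0) →
        ∃ i, ∀ x ∈ T, x i = ∞ := by
      intro s
      induction s using Finset.induction_on with
      | empty =>
        intro h
        have := h _ hy₁
        simp at this
      | insert i s hi ih =>
        intro h
        rw [Finset.prod_insert hi] at h
        rcases IrrSubvar.vanish_or_vanish hT (multiHomog_X _)
          (multiHomog_prod _ _ fun j _ => multiHomog_X _) h with h1 | h1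
        · refine ⟨i, fun x hx => ?_⟩
          have h2 := h1 x hx
          by_contra h3
          obtain ⟨a, ha⟩ := OnePoint.ne_infty_iff_exists.1 h3
          rw [MvPolynomial.eval_X] at h2
          simp only [hom, ← ha, homCoords_coe] at h2
          simp at h2
        · exact ih h1
    obtain ⟨i, hi⟩ := hprod Finset.univ fun x hx => by
      by_contra h0
      have h1 : ∀ i, ∃ a : L, (a : OnePoint L) = x i := by
        intro i
        refine OnePoint.ne_infty_iff_exists.1 fun h => h0 ?_
        rw [map_prod]
        refine Finset.prod_eq_zero (Finset.mem_univ i) ?_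
        rw [MvPolynomial.eval_X]
        simp [hom, h, homCoords_infty]
      choose a ha using h1
      refine hstd ⟨a, ?_⟩
      rwa [show pt (fun _ => 1) a = x from funext fun i => by rw [pt_apply_of_eq_one (fun _ => 1) rfl, ha]]
    refine ⟨i, fun x => ⟨hi x, fun hx => ?_⟩⟩
    have hci : c i = 0 := by
      by_contra h0
      have h1 : c i = 1 := by omega
      have := hi _ hy₁
      rw [pt_apply_of_eq_one c h1] at this
      exact OnePoint.coe_ne_infty _ this
    have hXi : X i ∈ chartIdeal c T := by
      refine mem_chartIdeal.2 fun y hy => ?_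
      rw [MvPolynomial.eval_X]
      by_contra h0
      have := hi _ hy
      simp [pt, hci, h0] at this
    have hass : Associated F (X i) := by
      rw [hcF, Ideal.mem_span_singleton] at hXi
      exact hF.associated_of_dvd MvPolynomial.X_prime.irreducible hXi
    obtain ⟨S, hS, hTS⟩ := exists_polys hT.2.1
    refine (hTS x).2 fun p hp => ?_
    have h1 : X i ∣ dh c p := by
      refine hass.symm.dvd.trans (Ideal.mem_span_singleton.1 ?_)
      rw [← hcF]
      exact dh_mem_chartIdeal (hS p hp) fun x hx => (hTS x).1 hx p hp
    obtain ⟨r, rfl⟩ := hm_dvd_of_dvd_dh c (hS p hp) h1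
    rw [hm_X hci, map_mul, MvPolynomial.eval_X]
    simp [hom, hx, homCoords_infty]

end MultiProjective

end

section

namespace MultiProjective

open MvPolynomial

section

variable {L : Type} [Field L] {ι : Type} [DecidableEq ι] [Fintype ι]

theorem HasMultidegree.fst_mem_vars {p : MvPolynomial (ι × Fin 2) L} {F : MvPolynomial ι L}
    (h : HasMultidegree p fun i => F.degreeOf i) {jk : ι × Fin 2} (hjk : jk ∈ p.vars) : jk.1 ∈ F.vars := by
  obtain ⟨d, hd, hdjk⟩ := (mem_vars_iff_mem_support jk).1 hjk
  have h1 := h jk.1 (mem_support_iff.1 hd)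
  rw [sum_weight_eq] at h1
  have h2 : d jk ≠ 0 := Finsupp.mem_support_iff.1 hdjk
  by_contra h3
  rw [mem_vars_iff_degreeOf_ne_zero, not_not] at h3
  obtain ⟨j, k⟩ := jk
  simp only [h3] at h1
  fin_cases k
  · exact h2 (by simpa using (by omega : d (j, 0) = 0))
  · exact h2 (by simpa using (by omega : d (j, 1) = 0))

theorem eval_congr_of_vars {σ : Type} {p : MvPolynomial σ L} {z z' : σ → L} (h : ∀ i ∈ p.vars, z i = z' i) :
    MvPolynomial.eval z p = MvPolynomial.eval z' p :=
  hom_congr_vars (by ext; simp) (fun i hi _ => by simpa using h i hi) rfl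

theorem eval_hm_congr {c : ι → Fin 2} {F : MvPolynomial ι L} {z z' : ι × Fin 2 → L}
    (h : ∀ i ∈ F.vars, ∀ k, z (i, k) = z' (i, k)) :
    MvPolynomial.eval z (hm c (fun i => F.degreeOf i) F) = MvPolynomial.eval z' (hm c (fun i => F.degreeOf i) F) :=
  eval_congr_of_vars fun jk hjk =>
    h jk.1 ((hasMultidegree_hm c fun _ => le_rfl).fst_mem_vars hjk) jk.2

theorem vars_subset_of_dvd {σ : Type} {F p : MvPolynomial σ L} (h : F ∣ p) (hp : p ≠ 0) : F.vars ⊆ p.vars := by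
  intro i hi
  obtain ⟨q, rfl⟩ := h
  by_contra h0
  rw [mem_vars_iff_degreeOf_ne_zero, not_not,
    degreeOf_mul_eq (left_ne_zero_of_mul hp) (right_ne_zero_of_mul hp)] at h0
  exact mem_vars_iff_degreeOf_ne_zero.1 hi (by omega)

theorem vars_aeval_X_subset {σ : Type} (i : σ) (q : L[X]) :
    (Polynomial.aeval (MvPolynomial.X i : MvPolynomial σ L) q).vars ⊆ {i} := by
  classical
  rw [Polynomial.aeval_eq_sum_range]
  refine (vars_sum_subset _ _).trans (Finset.biUnion_subset.2 fun k _ => ?_)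
  rw [MvPolynomial.smul_eq_C_mul]
  refine (vars_mul _ _).trans ?_
  rw [vars_C, Finset.empty_union]
  refine (vars_pow _ _).trans ?_
  rw [vars_X]

end

end MultiProjective

section Integral

variable {L : Type} [Field L] {A B : Type} [CommRing A] [CommRing B] [Algebra L A] [Algebra L B]

theorem RingHom.isIntegralElem_of_aeval_eq [Nontrivial A] (φ : A →+* B) (hφ : ∀ a, φ (algebraMap L A a) = algebraMap L B a)
    {g : L[X]} (hg : g.natDegree ≠ 0) {x : B} {r : A} (h : φ r = Polynomial.aeval x g) :
    φ.IsIntegralElem x := by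
  have hg0 : g ≠ 0 := by
    rintro rfl
    simp at hg
  have hm : (C g.leadingCoeff⁻¹ * g).Monic := by
    rw [mul_comm]
    exact monic_mul_leadingCoeff_inv hg0
  have hd : 0 < (C g.leadingCoeff⁻¹ * g).degree := by
    rw [degree_C_mul (inv_ne_zero (leadingCoeff_ne_zero.2 hg0))]
    exact natDegree_pos_iff_degree_pos.1 (Nat.pos_of_ne_zero hg)
  refine ⟨(C g.leadingCoeff⁻¹ * g).map (algebraMap L A) - C (algebraMap L A g.leadingCoeff⁻¹ * r), ?_, ?_⟩
  · refine (hm.map _).sub_of_left (degree_C_le.trans_lt ?_)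
    rwa [hm.degree_map]
  · have h1 : φ.comp (algebraMap L A) = algebraMap L B := RingHom.ext hφ
    rw [eval₂_sub, eval₂_map, h1, eval₂_C, eval₂_mul, eval₂_C, map_mul, hφ, h, Polynomial.aeval_def, sub_self]

theorem RingHom.exists_ne_zero_dvd [IsDomain B] [Nontrivial A] (φ : A →+* B) {x : B} (hx : x ≠ 0)
    (h : φ.IsIntegralElem x) : ∃ a, a ≠ 0 ∧ x ∣ φ a := by
  let _ := φ.toAlgebra
  have h1 := Ideal.comap_ne_bot_of_integral_mem (R := A) (I := Ideal.span {x}) hx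
    (Ideal.subset_span rfl) h
  obtain ⟨a, ha, ha0⟩ := Submodule.exists_mem_ne_zero_of_ne_bot h1
  exact ⟨a, ha0, Ideal.mem_span_singleton.1 ha⟩

theorem isIntegralElem_planeMap {g : L[X]} (hg : g.natDegree ≠ 0) (E : L[X][X]) :
    (planeMap g).IsIntegralElem E := by
  let _ := (planeMap g).toAlgebra
  have hc : ∀ a : L, C (C a) ∈ integralClosure L[X][X] L[X][X] := fun a => by
    have : (planeMap g).IsIntegralElem (planeMap g (C (C a))) := RingHom.isIntegralElem_map _
    rwa [planeMap_C, C_comp] at this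
  have h1 : C X ∈ integralClosure L[X][X] L[X][X] :=
    RingHom.isIntegralElem_of_aeval_eq (L := L) (planeMap g) (fun a => by
      simp [planeMap_C, Polynomial.algebraMap_apply]) hg (r := C X) (by
      rw [planeMap_C, X_comp]
      have := aeval_algHom_apply (Algebra.ofId L[X] L[X][X] |>.restrictScalars L) X g
      simpa using this.symm)
  have h2 : X ∈ integralClosure L[X][X] L[X][X] :=
    RingHom.isIntegralElem_of_aeval_eq (L := L) (planeMap g) (fun a => by
      simp [planeMap_C, Polynomial.algebraMap_apply]) hg (r := X) (by
      rw [planeMap, biv_X]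
      rw [Polynomial.aeval_def]
      rfl)
  have hC : ∀ q : L[X], C q ∈ integralClosure L[X][X] L[X][X] := by
    intro q
    induction q using Polynomial.induction_on' with
    | add p q hp hq => rw [C_add]; exact add_mem hp hq
    | monomial k a =>
      rw [← C_mul_X_pow_eq_monomial, C_mul, C_pow]
      exact mul_mem (hc a) (pow_mem h1 k)
  have : E ∈ integralClosure L[X][X] L[X][X] := by
    induction E using Polynomial.induction_on' with
    | add p q hp hq => exact add_mem hp hq
    | monomial k a =>
      rw [← C_mul_X_pow_eq_monomial]
      exact mul_mem (hC a) (pow_mem h2 k)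
  exact this

/-- The comorphism of the split map `(g, …, g)` of affine space. -/
noncomputable def splitHom {σ : Type} (g : L[X]) : MvPolynomial σ L →ₐ[L] MvPolynomial σ L :=
  MvPolynomial.aeval fun j => Polynomial.aeval (MvPolynomial.X j) g

theorem isIntegralElem_splitHom {σ : Type} {g : L[X]} (hg : g.natDegree ≠ 0) (E : MvPolynomial σ L) :
    (splitHom (σ := σ) g).toRingHom.IsIntegralElem E := by
  let _ := (splitHom (σ := σ) g).toRingHom.toAlgebra
  have hc : ∀ a : L, MvPolynomial.C a ∈ integralClosure (MvPolynomial σ L) (MvPolynomial σ L) := fun a => by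
    have := RingHom.isIntegralElem_map (splitHom (σ := σ) g).toRingHom (x := MvPolynomial.C a)
    rwa [show (splitHom (σ := σ) g).toRingHom (MvPolynomial.C a) = MvPolynomial.C a from
      (splitHom g).commutes a] at this
  have h2 : ∀ j, MvPolynomial.X j ∈ integralClosure (MvPolynomial σ L) (MvPolynomial σ L) := fun j =>
    RingHom.isIntegralElem_of_aeval_eq (L := L) (splitHom (σ := σ) g).toRingHom
      (fun a => (splitHom g).commutes a) hg (r := MvPolynomial.X j) (MvPolynomial.aeval_X _ _)
  have : E ∈ integralClosure (MvPolynomial σ L) (MvPolynomial σ L) := by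
    induction E using MvPolynomial.induction_on with
    | C a => exact hc a
    | add p q hp hq => exact add_mem hp hq
    | mul_X p j hp => exact mul_mem hp (h2 j)
  exact this

end Integral

end

section

namespace ProductFormulaFamily

open Filter MultiProjective

variable {K : Type} [Field K] {M : ProductFormulaFamily K} {n : ℕ} {f : K[X]} {P : Fin n → OnePoint K}
  {V : ClosedSubvar K (Fin n)} {F : MvPolynomial (Fin n) (AlgebraicClosure K)}

/-- The equation of a hypersurface, homogenized from the standard chart. -/
noncomputable def homogEq {L : Type} [Field L] (F : MvPolynomial (Fin n) L) : MvPolynomial (Fin n × Fin 2) L :=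
  hm (fun _ => 1) (fun i => F.degreeOf i) F

theorem homogEq_dvd (hF : chartIdeal (fun _ => 1) (V.pts (algebraMap K (AlgebraicClosure K))) = Ideal.span {F})
    {p : MvPolynomial (Fin n × Fin 2) K} (hp : p ∈ V.polys) :
    homogEq F ∣ MvPolynomial.map (algebraMap K (AlgebraicClosure K)) p := by
  have hpm : MultiHomog (MvPolynomial.map (algebraMap K (AlgebraicClosure K)) p) := fun i => by
    obtain ⟨N, hN⟩ := V.homog p hp i
    refine ⟨N, fun d hd => hN fun h0 => hd ?_⟩
    rw [MvPolynomial.coeff_map, h0, map_zero]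
  refine hm_dvd_of_dvd_dh _ hpm (Ideal.mem_span_singleton.1 ?_)
  rw [← hF]
  exact dh_mem_chartIdeal hpm fun x hx => hx p hp

theorem eval_homogEq_orbitHom_ne_zero (hP : fwdOrbit (splitMap f) P ∩ V.pts (RingHom.id K) = ∅)
    (hF : chartIdeal (fun _ => 1) (V.pts (algebraMap K (AlgebraicClosure K))) = Ideal.span {F}) (m : ℕ) :
    MvPolynomial.eval (fun jk => algebraMap K _ (orbitHom f P m jk)) (homogEq F) ≠ 0 := by
  obtain ⟨S, hSV, hS⟩ := exists_finset_polys V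
  obtain ⟨p, hp, hp0⟩ := exists_eval_orbitHom_ne_zero hP hS m
  obtain ⟨q, hq⟩ := homogEq_dvd hF (hSV hp)
  have h1 := eval_orbitHom_map (f := f) (P := P) m p
  rw [hq, map_mul] at h1
  intro h0
  rw [h0, zero_mul, eq_comm] at h1
  exact (_root_.map_ne_zero (algebraMap K (AlgebraicClosure K))).2 hp0 h1

theorem eval_homogEq_eq_zero (hVirr : IrrSubvar (V.pts (algebraMap K (AlgebraicClosure K))))
    {y₀ : Fin n → AlgebraicClosure K} (hy₀ : pt (fun _ => 1) y₀ ∈ V.pts (algebraMap K (AlgebraicClosure K)))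
    (hF : chartIdeal (fun _ => 1) (V.pts (algebraMap K (AlgebraicClosure K))) = Ideal.span {F})
    {x : Fin n → OnePoint (AlgebraicClosure K)} (hx : x ∈ V.pts (algebraMap K (AlgebraicClosure K))) :
    MvPolynomial.eval (hom x) (homogEq F) = 0 :=
  IrrSubvar.eval_eq_zero hVirr hy₀ (multiHomog_hm F) (by
    rw [dh_hm, hF]
    exact Ideal.subset_span rfl) hx

theorem frequently_orbitClosureAvoids_of_equation [CharZero K]
    (hVirr : IrrSubvar (V.pts (algebraMap K (AlgebraicClosure K))))
    (hP : fwdOrbit (splitMap f) P ∩ V.pts (RingHom.id K) = ∅)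
    {y₀ : Fin n → AlgebraicClosure K} (hy₀ : pt (fun _ => 1) y₀ ∈ V.pts (algebraMap K (AlgebraicClosure K)))
    (hF : chartIdeal (fun _ => 1) (V.pts (algebraMap K (AlgebraicClosure K))) = Ideal.span {F})
    (h : ∃ᶠ i in cofinite, (∃ z, z ≠ 0 ∧ M.w i z ≠ 1) ∧ ∃ δ > 0, ∃ m0, ∀ m ≥ m0,
      δ ≤ M.ext i (MvPolynomial.eval (fun jk => algebraMap K _ (orbitHom f P m jk)) (homogEq F))) :
    ∃ᶠ i in cofinite, (∃ z, z ≠ 0 ∧ M.w i z ≠ 1) ∧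
      ∀ v : PlaceK K, v.v = M.w i → OrbitClosureAvoids v f P V := by
  refine frequently_orbitClosureAvoids hP {dh (infChart P) (homogEq F)} ?_ ?_
  · intro u hu y hy
    rw [Finset.mem_singleton.1 hu, eval_dh, ← hom_pt_of_eq_zero _ hy.2]
    exact eval_homogEq_eq_zero hVirr hy₀ hF hy.1
  · refine h.mono ?_
    rintro i ⟨hnt, δ, hδ, m0, h1⟩
    refine ⟨hnt, δ, hδ, m0, fun m hm => ⟨_, Finset.mem_singleton_self _, ?_⟩⟩
    rw [eval_dh, lift_affOrbit]
    exact h1 m hm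

theorem eval_homogEq_congr {L : Type} [Field L] {F : MvPolynomial (Fin n) L} {z z' : Fin n × Fin 2 → L}
    (h : ∀ i ∈ F.vars, ∀ k, z (i, k) = z' (i, k)) :
    MvPolynomial.eval z (homogEq F) = MvPolynomial.eval z' (homogEq F) := eval_hm_congr h

theorem eval_homogEq_of_forall_eq_one {L : Type} [Field L] {F : MvPolynomial (Fin n) L} {z : Fin n × Fin 2 → L}
    (h : ∀ i ∈ F.vars, z (i, 1) = 1) :
    MvPolynomial.eval z (homogEq F) = MvPolynomial.eval (fun i => z (i, 0)) F := by
  conv_rhs => rw [← dh_hm (fun _ => (1 : Fin 2)) (fun i => F.degreeOf i) F]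
  rw [eval_dh]
  refine eval_homogEq_congr fun i hi k => ?_
  fin_cases k
  · simp [lift]
  · simpa [lift] using h i hi

/-- A hypersurface only involving bounded coordinates. -/
theorem frequently_equation_of_bdd [CharZero K]
    (hVirr : IrrSubvar (V.pts (algebraMap K (AlgebraicClosure K))))
    (hP : fwdOrbit (splitMap f) P ∩ V.pts (RingHom.id K) = ∅)
    {y₀ : Fin n → AlgebraicClosure K} (hy₀ : pt (fun _ => 1) y₀ ∈ V.pts (algebraMap K (AlgebraicClosure K)))
    (hF : chartIdeal (fun _ => 1) (V.pts (algebraMap K (AlgebraicClosure K))) = Ideal.span {F})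
    (hb : ∀ j ∈ F.vars, (fun m => affOrbit f P m j) ∈ M.bddSeq) :
    ∃ᶠ i in cofinite, (∃ z, z ≠ 0 ∧ M.w i z ≠ 1) ∧ ∃ δ > 0, ∃ m0, ∀ m ≥ m0,
      δ ≤ M.ext i (MvPolynomial.eval (fun jk => algebraMap K _ (orbitHom f P m jk)) (homogEq F)) := by
  classical
  obtain ⟨S, hSV, hS⟩ := exists_finset_polys V
  choose! q hq using fun p (hp : p ∈ S) => homogEq_dvd hF (hSV hp)
  let x' : ℕ → Fin n → OnePoint K := fun m i =>
    if i ∈ F.vars then (splitMap f)^[m] P i else ((0 : K) : OnePoint K)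
  let z : Fin n × Fin 2 → ℕ → K := fun jk m => homCoords (x' m jk.1) jk.2
  have hzb : ∀ jk, z jk ∈ M.bddSeq := by
    intro jk
    by_cases hj : jk.1 ∈ F.vars
    · have : z jk = fun m => orbitHom f P m (jk.1, jk.2) := by
        ext m
        simp only [z, x', if_pos hj, orbitHom]
      rw [this]
      exact orbitHom_mem_bddSeq (hb _ hj) _
    · simp only [z, x', if_neg hj]
      exact M.const_mem_bddSeq _
  have hzF : ∀ m, MvPolynomial.eval (fun jk => algebraMap K (AlgebraicClosure K) (z jk m)) (homogEq F) =
      MvPolynomial.eval (fun jk => algebraMap K _ (orbitHom f P m jk)) (homogEq F) := fun m =>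
    eval_homogEq_congr fun i hi k => by simp only [z, x', if_pos hi, orbitHom]
  have hmap : ∀ m p, MvPolynomial.eval (fun jk => algebraMap K (AlgebraicClosure K) (z jk m))
      (MvPolynomial.map (algebraMap K (AlgebraicClosure K)) p) =
      algebraMap K (AlgebraicClosure K) (MvPolynomial.eval (fun jk => z jk m) p) := fun m p => by
    rw [MvPolynomial.eval_map, MvPolynomial.eval₂_comp]
    rfl
  have hzS : ∀ m, ∃ p ∈ S, MvPolynomial.eval (fun jk => z jk m) p ≠ 0 := by
    intro m
    by_contra! h0
    have h1 := hS _ h0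
    refine eval_homogEq_orbitHom_ne_zero hP hF m ?_
    rw [← hzF]
    have h2 : (fun i => mapPoint (algebraMap K (AlgebraicClosure K)) (x' m i)) ∈
        V.pts (algebraMap K (AlgebraicClosure K)) := by
      intro p hp
      simp only [vanishesAt, homCoords_mapPoint]
      exact (hmap m p).trans (by rw [h1 p hp, map_zero])
    have h3 := eval_homogEq_eq_zero hVirr hy₀ hF h2
    unfold hom at h3
    simp only [homCoords_mapPoint] at h3
    exact h3
  have hle : ∀ᶠ i in cofinite, ∀ m jk, M.w i (z jk m) ≤ 1 := by
    filter_upwards [M.eventually_orbitHom_le_one f P] with i hi m jk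
    by_cases hj : jk.1 ∈ F.vars
    · simp only [z, x', if_pos hj]
      exact hi m jk
    · simp only [z, x', if_neg hj, homCoords_coe]
      obtain ⟨j, k⟩ := jk
      fin_cases k <;> simp
  have hq1 : ∀ᶠ i in cofinite, ∀ p ∈ S, ∀ x : Fin n × Fin 2 → AlgebraicClosure K, (∀ j, M.ext i (x j) ≤ 1) →
      M.ext i (MvPolynomial.eval x (q p)) ≤ 1 :=
    (eventually_all_finset S).2 fun p _ => M.eventually_ext_mvEval_le_one (q p)
  refine (M.frequently_nontrivial.and_eventually (M.eventually_nonarch.and (hle.and hq1))).mono ?_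
  rintro i ⟨hnt, hi, hle, hq1⟩
  choose! d hd h using fun p (_ : p ∈ S) =>
    M.exists_lower_bound (M.mvPolynomial_mem_bddSeq z p fun jk _ => hzb jk) i
  obtain ⟨δ, hδ, hδd⟩ : ∃ δ > 0, ∀ p ∈ S, δ ≤ d p := by
    rcases S.eq_empty_or_nonempty with rfl | hne
    · exact ⟨1, one_pos, by simp⟩
    · obtain ⟨b, hb, hmin⟩ := Finset.exists_min_image S d hne
      exact ⟨d b, hd b hb, hmin⟩
  refine ⟨hnt, δ, hδ, 0, fun m _ => ?_⟩
  obtain ⟨p, hp, hp0⟩ := hzS m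
  have h1 := (hδd p hp).trans ((h p hp m).resolve_left hp0)
  rw [← M.ext_algebraMap hi, ← hmap m p, hq p hp, map_mul, map_mul, hzF] at h1
  refine h1.trans (mul_le_of_le_one_right ((M.ext i).nonneg _) (hq1 p hp _ fun jk => ?_))
  rw [M.ext_algebraMap hi]
  exact hle m jk

/-- A hypersurface involving only one finite coordinate. -/
theorem frequently_equation_of_univariate [CharZero K] (hf : 2 ≤ f.natDegree)
    (hP : fwdOrbit (splitMap f) P ∩ V.pts (RingHom.id K) = ∅)
    (hF : chartIdeal (fun _ => 1) (V.pts (algebraMap K (AlgebraicClosure K))) = Ideal.span {F})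
    {i₁ : Fin n} (hi₁ : P i₁ ≠ ∞) {a : M.Idx} (ha : ∀ B, ∃ m, B < M.w a (affOrbit f P m i₁))
    (hv : ∀ j ∈ F.vars, j ≠ i₁ → P j = ∞) :
    ∃ᶠ i in cofinite, (∃ z, z ≠ 0 ∧ M.w i z ≠ 1) ∧ ∃ δ > 0, ∃ m0, ∀ m ≥ m0,
      δ ≤ M.ext i (MvPolynomial.eval (fun jk => algebraMap K _ (orbitHom f P m jk)) (homogEq F)) := by
  classical
  let q : (AlgebraicClosure K)[X] := MvPolynomial.aeval (fun jk : Fin n × Fin 2 =>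
    if jk.1 = i₁ then (if jk.2 = 0 then X else 1) else if jk.2 = 0 then 1 else 0) (homogEq F)
  have hq : ∀ m, q.eval (algebraMap K _ (affOrbit f P m i₁)) =
      MvPolynomial.eval (fun jk => algebraMap K _ (orbitHom f P m jk)) (homogEq F) := by
    intro m
    have h1 : q.eval (algebraMap K _ (affOrbit f P m i₁)) =
        MvPolynomial.eval (fun jk : Fin n × Fin 2 => Polynomial.eval (algebraMap K _ (affOrbit f P m i₁))
          (if jk.1 = i₁ then (if jk.2 = 0 then X else 1) else if jk.2 = 0 then 1 else 0)) (homogEq F) := by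
      have := MvPolynomial.map_aeval (fun jk : Fin n × Fin 2 =>
        (if jk.1 = i₁ then (if jk.2 = 0 then X else 1) else if jk.2 = 0 then 1 else 0 : (AlgebraicClosure K)[X]))
        (Polynomial.evalRingHom (algebraMap K (AlgebraicClosure K) (affOrbit f P m i₁))) (homogEq F)
      rw [Polynomial.coe_evalRingHom] at this
      rw [this, MvPolynomial.coe_eval₂Hom, MvPolynomial.eval, MvPolynomial.coe_eval₂Hom]
      congr 1
      ext a
      simp
    rw [h1]
    refine eval_homogEq_congr fun j hj k => ?_
    by_cases hji : j = i₁
    · subst hji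
      rw [orbitHom_of_ne f P hi₁]
      simp only [if_true]
      split_ifs <;> simp
    · rw [orbitHom_infty f P (hv j hj hji)]
      simp only [if_neg hji]
      split_ifs <;> simp
  have hq0 : q ≠ 0 := fun h0 => eval_homogEq_orbitHom_ne_zero hP hF 0 (by rw [← hq, h0, eval_zero])
  refine (M.frequently_eventually_eq_one hf (x := fun m => affOrbit f P m i₁)
    (fun m => affOrbit_succ f P hi₁ m) ha hq0).mono ?_
  rintro i ⟨hnt, m0, h⟩
  refine ⟨hnt, 1, one_pos, m0, fun m hm => ?_⟩
  rw [← hq]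
  exact (h m hm).ge

end ProductFormulaFamily

end

section

theorem exists_biv_eq_of_vars {L : Type} [Field L] {σ : Type} {F : MvPolynomial σ L} {i j : σ}
    (h : ∀ l ∈ F.vars, l = i ∨ l = j) :
    ∃ E : L[X][X], biv (MvPolynomial.X i : MvPolynomial σ L) (MvPolynomial.X j) E = F := by
  classical
  refine ⟨MvPolynomial.aeval (fun l => if l = i then C X else X) F, ?_⟩
  let φ : MvPolynomial σ L →+* MvPolynomial σ L := (biv (MvPolynomial.X i) (MvPolynomial.X j)).comp
    (MvPolynomial.aeval (R := L) (fun l => if l = i then C X else (X : L[X][X]))).toRingHom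
  have : φ F = RingHom.id _ F := by
    refine MvPolynomial.hom_congr_vars ?_ ?_ rfl
    · ext a
      simp only [φ, RingHom.comp_apply, AlgHom.toRingHom_eq_coe, RingHom.coe_coe, MvPolynomial.algHom_C]
      rw [Polynomial.algebraMap_apply, biv_C, Polynomial.algebraMap_apply, Algebra.algebraMap_self_apply, Polynomial.aeval_C]
      rfl
    · intro l hl _
      simp only [φ, RingHom.comp_apply, AlgHom.toRingHom_eq_coe, RingHom.coe_coe, MvPolynomial.aeval_X]
      rcases h l hl with rfl | rfl
      · simp
      · split_ifs with h1
        · subst h1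
          simp
        · simp
  exact this

theorem exists_biv_aeval_mem_span {L : Type} [Field L] {σ : Type} {F : MvPolynomial σ L} (hF : F ≠ 0) {i j : σ}
    (h : ∀ l ∈ F.vars, l = i ∨ l = j) {g : L[X]} (hg : g.natDegree ≠ 0) :
    ∃ E : L[X][X], E ≠ 0 ∧ biv (Polynomial.aeval (MvPolynomial.X i : MvPolynomial σ L) g)
      (Polynomial.aeval (MvPolynomial.X j) g) E ∈ Ideal.span {F} := by
  obtain ⟨F₀, rfl⟩ := exists_biv_eq_of_vars h
  obtain ⟨E, hE, hd⟩ := RingHom.exists_ne_zero_dvd (planeMap g) (x := F₀)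
    (fun h0 => hF (by rw [h0, map_zero])) (isIntegralElem_planeMap hg F₀)
  refine ⟨E, hE, Ideal.mem_span_singleton.2 ?_⟩
  rw [← biv_planeMap]
  exact map_dvd _ hd

namespace ProductFormulaFamily

open Filter MultiProjective

variable {K : Type} [Field K] {M : ProductFormulaFamily K} {n : ℕ} {f : K[X]} {P : Fin n → OnePoint K}
  {V : ClosedSubvar K (Fin n)} {F : MvPolynomial (Fin n) (AlgebraicClosure K)}

theorem exists_eval_ne_zero_of_vars {i j : Fin n} (hij : j ∈ F.vars) (hne : j ≠ i)
    (hF : chartIdeal (fun _ => 1) (V.pts (algebraMap K (AlgebraicClosure K))) = Ideal.span {F})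
    {q : (AlgebraicClosure K)[X]} (hq : q ≠ 0) :
    ∃ y, pt (fun _ => 1) y ∈ V.pts (algebraMap K (AlgebraicClosure K)) ∧ q.eval (y i) ≠ 0 := by
  by_contra! h
  have h1 : Polynomial.aeval (MvPolynomial.X i) q ∈
      chartIdeal (fun _ => 1) (V.pts (algebraMap K (AlgebraicClosure K))) := by
    rw [mem_chartIdeal]
    intro y hy
    rw [eval_aeval_X]
    exact h y hy
  rw [hF, Ideal.mem_span_singleton] at h1
  have h2 := vars_subset_of_dvd h1 (fun h0 => hq ?_) hij
  · exact hne (Finset.mem_singleton.1 (vars_aeval_X_subset i q h2))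
  · have := (MvPolynomial.transcendental_X (R := AlgebraicClosure K) i)
    exact (transcendental_iff.1 this) q h0

/-- A hypersurface involving two finite coordinates, at least one of them unbounded. -/
theorem frequently_equation_of_pair [CharZero K] (hf : 2 ≤ f.natDegree)
    (hVirr : IrrSubvar (V.pts (algebraMap K (AlgebraicClosure K))))
    (hVpre : SubvarPreperiodic (f.map (algebraMap K (AlgebraicClosure K)))
      (V.pts (algebraMap K (AlgebraicClosure K))))
    (hP : fwdOrbit (splitMap f) P ∩ V.pts (RingHom.id K) = ∅) (hF0 : F ≠ 0)
    (hF : chartIdeal (fun _ => 1) (V.pts (algebraMap K (AlgebraicClosure K))) = Ideal.span {F})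
    {i₁ i₂ : Fin n} (h12 : i₁ ≠ i₂) (hv : F.vars = {i₁, i₂}) (hi₁ : P i₁ ≠ ∞) (hi₂ : P i₂ ≠ ∞)
    {a : M.Idx} (ha : ∀ B, ∃ m, B < M.w a (affOrbit f P m i₁)) :
    ∃ᶠ i in cofinite, (∃ z, z ≠ 0 ∧ M.w i z ≠ 1) ∧ ∃ δ > 0, ∃ m0, ∀ m ≥ m0,
      δ ≤ M.ext i (MvPolynomial.eval (fun jk => algebraMap K _ (orbitHom f P m jk)) (homogEq F)) := by
  classical
  set fL := f.map (algebraMap K (AlgebraicClosure K)) with hfL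
  set X₀ := V.pts (algebraMap K (AlgebraicClosure K)) with hX₀
  obtain ⟨k, hk, hkX⟩ := exists_iterate_image_eq hVpre
  have hdeg : ((fL.comp)^[k] X).natDegree ≠ 0 := by
    rw [natDegree_iterate_comp, hfL, natDegree_map, natDegree_X, mul_one]
    positivity
  have hvars : ∀ l ∈ F.vars, l = i₁ ∨ l = i₂ := fun l hl => by simpa [hv] using hl
  have hlift := fun (y : Fin n → AlgebraicClosure K) (hy : pt (fun _ => 1) y ∈ X₀) =>
    exists_eval_eval_eq (f := fL) (k := k) (c := fun _ => 1) hkX hy (by simp)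
  have hF' : ∀ r, r ∈ Ideal.span {F} ↔ ∀ y ∈ {y | pt (fun _ => 1) y ∈ X₀}, MvPolynomial.eval y r = 0 :=
    fun r => by rw [← hF, mem_chartIdeal]; rfl
  have hprime : (Ideal.span {F}).IsPrime := by
    obtain ⟨y, hy, -⟩ := exists_eval_ne_zero_of_vars (i := i₁) (j := i₂) (by simp [hv]) h12.symm hF one_ne_zero
    rw [← hF]
    exact IrrSubvar.isPrime_chartIdeal hVirr hy
  obtain ⟨G, H, A, B, h, hG, hGH, hh, hAB, hvan⟩ := hasPlaneRelation_of_isPrime (i := i₁) (j := i₂) hdeg hprime hF'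
    (fun y hy => by
      obtain ⟨⟨y', h1, -, h2⟩, -⟩ := hlift y hy
      exact ⟨y', h1, h2 _ rfl, h2 _ rfl⟩)
    (fun y hy => by
      obtain ⟨-, y', h1, -, h2⟩ := hlift y hy
      exact ⟨y', h1, h2 _ rfl, h2 _ rfl⟩)
    (fun q hq => exists_eval_ne_zero_of_vars (by simp [hv]) h12.symm hF hq)
    (fun q hq => exists_eval_ne_zero_of_vars (by simp [hv]) h12 hF hq)
    (exists_biv_aeval_mem_span hF0 hvars hdeg)
  let y : ℕ → Fin n → K := fun m l => if l = i₁ ∨ l = i₂ then affOrbit f P m l else 0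
  have hy1 : ∀ j, ∀ᶠ i in cofinite, ∀ m, M.w i (y m j) ≤ 1 := fun j => by
    by_cases hj : j = i₁ ∨ j = i₂
    · simpa only [y, if_pos hj] using eventually_affOrbit_le_one M f P j
    · simp [y, if_neg hj]
  have hyi : ∀ m, y m i₁ = affOrbit f P m i₁ := fun m => by simp [y]
  have hyj : ∀ m, y m i₂ = affOrbit f P m i₂ := fun m => by simp [y]
  set t := biv (Polynomial.aeval (MvPolynomial.X i₁ : MvPolynomial (Fin n) (AlgebraicClosure K)) ((fL.comp)^[k] X))
    (Polynomial.aeval (MvPolynomial.X i₂) ((fL.comp)^[k] X)) G with ht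
  obtain ⟨s, hs⟩ := Ideal.mem_span_singleton.1 ((hF' t).2 hvan)
  have hyF : ∀ m, MvPolynomial.eval (fun j => algebraMap K (AlgebraicClosure K) (y m j)) F =
      MvPolynomial.eval (fun jk => algebraMap K _ (orbitHom f P m jk)) (homogEq F) := fun m => by
    rw [eval_homogEq_of_forall_eq_one]
    · refine eval_congr_of_vars fun l hl => ?_
      rcases hvars l hl with rfl | rfl
      · rw [hyi, orbitHom_of_ne f P hi₁, if_pos rfl]
      · rw [hyj, orbitHom_of_ne f P hi₂, if_pos rfl]
    · intro l hl
      rcases hvars l hl with rfl | rfl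
      · rw [orbitHom_of_ne f P hi₁]; simp
      · rw [orbitHom_of_ne f P hi₂]; simp
  have hT : ∀ u ∈ insert t ((Finset.univ.filter fun l => ¬ (l = i₁ ∨ l = i₂)).image
      fun l => (MvPolynomial.X l - MvPolynomial.C 0 : MvPolynomial (Fin n) (AlgebraicClosure K))),
      M.Discrete y i₁ u := by
    intro u hu
    rcases Finset.mem_insert.1 hu with rfl | hu
    · rw [ht, hfL, ← map_iterate_comp]
      rw [hfL, ← map_iterate_comp] at hG
      refine discrete_biv hk hy1 ?_ ?_ hG hh hAB
      · intro m
        rw [hyi, hyi]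
        exact affOrbit_succ f P hi₁ m
      · intro m
        rw [hyj, hyj]
        exact affOrbit_succ f P hi₂ m
    · obtain ⟨l, hl, rfl⟩ := Finset.mem_image.1 hu
      refine discrete_X_sub_C ?_ 0
      have := (Finset.mem_filter.1 hl).2
      simp only [y, if_neg this]
      exact M.const_mem_bddSeq 0
  have hfreq := M.frequently_discrete (y := y) (i₀ := i₁) hf hy1 (fun m => by
    rw [hyi, hyi]
    exact affOrbit_succ f P hi₁ m) (a := a) (by simpa only [hyi] using ha) _ {F} hT (fun j => by
      by_cases hj : j = i₁ ∨ j = i₂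
      · rcases hj with rfl | rfl
        · refine ⟨X - C X, X_sub_C_ne_zero _, ?_⟩
          simp
        · refine ⟨G * H, hGH, ?_⟩
          rw [← hG, biv_planeMap]
          exact Ideal.subset_span (Finset.mem_coe.2 (Finset.mem_insert_self _ _))
      · refine ⟨X, X_ne_zero, ?_⟩
        rw [biv_X]
        refine Ideal.subset_span (Finset.mem_coe.2 (Finset.mem_insert_of_mem (Finset.mem_image.2 ⟨j, by simpa using hj, ?_⟩)))
        rw [MvPolynomial.C_0, sub_zero])
  have hs1 := M.eventually_ext_mvEval_le_one s
  refine (hfreq.and_eventually (hs1.and (M.eventually_nonarch.and (eventually_all.2 hy1)))).mono ?_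
  rintro i ⟨⟨hnt, δ, hδ, h⟩, hs1, hi, hy1⟩
  refine ⟨hnt, δ, hδ, 0, fun m _ => ?_⟩
  rw [← hyF]
  rcases h m with ⟨u, hu, h1⟩ | h1
  · rcases Finset.mem_insert.1 hu with rfl | hu
    · rw [hs, map_mul, map_mul] at h1
      refine h1.trans (mul_le_of_le_one_right ((M.ext i).nonneg _) (hs1 _ fun j => ?_))
      rw [M.ext_algebraMap hi]
      exact hy1 j m
    · obtain ⟨l, hl, rfl⟩ := Finset.mem_image.1 hu
      have := (Finset.mem_filter.1 hl).2
      rw [map_sub, MvPolynomial.eval_C, MvPolynomial.eval_X] at h1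
      simp only [y, if_neg this, map_zero, sub_zero] at h1
      exact absurd h1 (not_le.2 hδ)
  · refine (h1 F (Finset.mem_singleton_self _)).resolve_left ?_
    rw [hyF]
    exact eval_homogEq_orbitHom_ne_zero hP hF m

end ProductFormulaFamily

end

section

namespace MvPolynomial

variable {L : Type} [Field L] {σ : Type}

theorem isAlgebraic_quotient {G : MvPolynomial σ L} (hG : G ≠ 0) (i : σ) (e : MvPolynomial σ L ⧸ Ideal.span {G}) :
    IsAlgebraic (supported L ({i}ᶜ : Set σ)) e := by
  classical
  obtain ⟨E, rfl⟩ := Ideal.Quotient.mk_surjective e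
  have hcoe : ∀ s : supported L ({i}ᶜ : Set σ), algebraMap _ (MvPolynomial σ L ⧸ Ideal.span {G}) s =
      Ideal.Quotient.mk _ (s : MvPolynomial σ L) := fun s => rfl
  have hX : ∀ j, j ≠ i → (X j : MvPolynomial σ L) ∈ supported L ({i}ᶜ : Set σ) := fun j hj =>
    X_mem_supported.2 (by simpa using hj)
  let u : σ → Polynomial (supported L ({i}ᶜ : Set σ)) := fun j =>
    if h : j = i then Polynomial.X else Polynomial.C ⟨X j, hX j h⟩
  let ψ : MvPolynomial σ L →ₐ[L] Polynomial (supported L ({i}ᶜ : Set σ)) := MvPolynomial.aeval u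
  have hψ : ∀ p, Polynomial.aeval (X i : MvPolynomial σ L) (ψ p) = p := by
    intro p
    have : ((Polynomial.aeval (R := supported L ({i}ᶜ : Set σ)) (X i : MvPolynomial σ L)).restrictScalars L).comp ψ =
        AlgHom.id L _ := by
      refine MvPolynomial.algHom_ext fun j => ?_
      simp only [ψ, u, AlgHom.comp_apply, MvPolynomial.aeval_X, AlgHom.restrictScalars_apply, AlgHom.id_apply]
      split_ifs with h
      · rw [Polynomial.aeval_X, h]
      · rw [Polynomial.aeval_C]
        rfl
    exact DFunLike.congr_fun this p
  induction E using MvPolynomial.induction_on with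
  | C a =>
    exact isAlgebraic_algebraMap (⟨C a, (supported L _).algebraMap_mem a⟩ : supported L ({i}ᶜ : Set σ))
  | add p q hp hq =>
    rw [map_add]
    exact hp.add hq
  | mul_X p j hp =>
    rw [map_mul]
    refine hp.mul ?_
    by_cases hj : j = i
    · subst hj
      refine ⟨ψ G, fun h0 => hG ?_, ?_⟩
      · rw [← hψ G, h0, map_zero]
      · have := Polynomial.aeval_algHom_apply (Ideal.Quotient.mkₐ (supported L ({j}ᶜ : Set σ)) (Ideal.span {G}))
          (X j) (ψ G)
        rw [hψ] at this
        exact this.trans (Ideal.Quotient.eq_zero_iff_mem.2 (Ideal.subset_span rfl))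
    · exact isAlgebraic_algebraMap (⟨X j, hX j hj⟩ : supported L ({i}ᶜ : Set σ))

theorem notMem_vars_of_mem_supported {i : σ} {p : MvPolynomial σ L} (h : p ∈ supported L ({i}ᶜ : Set σ)) :
    i ∉ p.vars := fun hi => mem_supported.1 h hi rfl

theorem mem_supported_of_notMem_vars {i : σ} {p : MvPolynomial σ L} (h : i ∉ p.vars) :
    p ∈ supported L ({i}ᶜ : Set σ) := mem_supported.2 fun j hj hji => h (by
  rw [Set.mem_singleton_iff.1 hji] at hj
  exact hj)

/-- Elimination of a variable modulo a prime polynomial. -/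
theorem exists_combination_notMem_vars {G E : MvPolynomial σ L} (hG : Prime G) (i : σ) (hE : ¬ G ∣ E) :
    ∃ h, h ≠ 0 ∧ i ∉ h.vars ∧ h ∈ Ideal.span {G, E} := by
  have hp : (Ideal.span {G}).IsPrime := (Ideal.span_singleton_prime hG.ne_zero).2 hG
  have h0 : Ideal.Quotient.mk (Ideal.span {G}) E ≠ 0 := fun h0 =>
    hE (Ideal.mem_span_singleton.1 (Ideal.Quotient.eq_zero_iff_mem.1 h0))
  obtain ⟨s, hs, b, hb⟩ := (isAlgebraic_quotient hG.ne_zero i (Ideal.Quotient.mk _ E)).exists_nonzero_dvd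
    (mem_nonZeroDivisors_of_ne_zero h0)
  obtain ⟨B, rfl⟩ := Ideal.Quotient.mk_surjective b
  refine ⟨s, fun h => hs (Subtype.ext h), notMem_vars_of_mem_supported s.2, ?_⟩
  have h1 : Ideal.Quotient.mk (Ideal.span {G}) (s : MvPolynomial σ L) = Ideal.Quotient.mk _ (E * B) := by
    rw [map_mul]
    exact hb
  rw [Ideal.Quotient.eq, Ideal.mem_span_singleton] at h1
  obtain ⟨A, hA⟩ := h1
  refine Ideal.mem_span_pair.2 ⟨A, B, ?_⟩
  rw [sub_eq_iff_eq_add.1 hA]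
  ring

/-- A homogeneous algebraic relation between two elements modulo a prime polynomial. -/
theorem exists_homogeneous_relation {G u v : MvPolynomial σ L} (hG : Prime G) (i : σ) (hv : ¬ G ∣ v) :
    ∃ (D : ℕ) (c : ℕ → MvPolynomial σ L), (∀ k, i ∉ (c k).vars) ∧ (∃ k ≤ D, c k ≠ 0) ∧
      G ∣ ∑ k ∈ Finset.range (D + 1), c k * u ^ k * v ^ (D - k) := by
  have hp : (Ideal.span {G}).IsPrime := (Ideal.span_singleton_prime hG.ne_zero).2 hG
  obtain ⟨h, hh0, hhi, hh⟩ := exists_combination_notMem_vars hG i hv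
  obtain ⟨A, B, hAB⟩ := Ideal.mem_span_pair.1 hh
  obtain ⟨p, hp0, hpe⟩ := isAlgebraic_quotient hG.ne_zero i (Ideal.Quotient.mk _ (u * B))
  refine ⟨p.natDegree, fun k => (p.coeff k : MvPolynomial σ L) * h ^ k, fun k => ?_,
    ⟨p.natDegree, le_rfl, mul_ne_zero (fun h1 => hp0 ?_) (pow_ne_zero _ hh0)⟩, ?_⟩
  · exact notMem_vars_of_mem_supported
      (mul_mem (p.coeff k).2 (pow_mem (mem_supported_of_notMem_vars hhi) k))
  · exact leadingCoeff_eq_zero.1 (Subtype.ext h1)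
  · rw [← Ideal.mem_span_singleton, ← Ideal.Quotient.eq_zero_iff_mem, map_sum]
    have hhq : Ideal.Quotient.mk (Ideal.span {G}) h = Ideal.Quotient.mk _ B * Ideal.Quotient.mk _ v := by
      rw [← map_mul, Ideal.Quotient.eq, Ideal.mem_span_singleton, ← hAB]
      exact ⟨A, by ring⟩
    rw [aeval_eq_sum_range] at hpe
    calc _ = (∑ k ∈ Finset.range (p.natDegree + 1), p.coeff k • Ideal.Quotient.mk (Ideal.span {G}) (u * B) ^ k) *
          Ideal.Quotient.mk _ v ^ p.natDegree := ?_
      _ = 0 := by rw [hpe, zero_mul]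
    rw [Finset.sum_mul]
    refine Finset.sum_congr rfl fun k hk => ?_
    have hk' : k + (p.natDegree - k) = p.natDegree := Nat.add_sub_cancel' (Nat.lt_succ_iff.1 (Finset.mem_range.1 hk))
    conv_rhs => rw [← hk', pow_add]
    have : ∀ x, p.coeff k • x = Ideal.Quotient.mk (Ideal.span {G}) (p.coeff k : MvPolynomial σ L) * x := fun x => by
      obtain ⟨x, rfl⟩ := Ideal.Quotient.mk_surjective x
      rfl
    rw [this, map_mul, map_mul, map_mul, map_pow, map_pow, map_pow, hhq, map_mul]
    ring

theorem not_dvd_pderiv [CharZero L] {G : MvPolynomial σ L} {i : σ} (hi : i ∈ G.vars) : ¬ G ∣ pderiv i G := by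
  classical
  have hd : G.degreeOf i ≠ 0 := mem_vars_iff_degreeOf_ne_zero.1 hi
  have hG : G ≠ 0 := by
    rintro rfl
    simp at hi
  obtain ⟨m, hm, hmd⟩ : ∃ m ∈ G.support, m i = G.degreeOf i := by
    rw [degreeOf_eq_sup]
    obtain ⟨m, hm, h⟩ := Finset.exists_mem_eq_sup G.support (by simpa using hG) fun m => m i
    exact ⟨m, hm, h.symm⟩
  have h0 : pderiv i G ≠ 0 := by
    intro h0
    have h1 : m = (m - Finsupp.single i 1) + Finsupp.single i 1 := by
      rw [tsub_add_cancel_of_le]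
      rw [Finsupp.single_le_iff]
      omega
    have h2 := MvPolynomial.coeff_pderiv (i := i) G (m - Finsupp.single i 1)
    rw [h0, ← h1, MvPolynomial.coeff_zero, eq_comm, mul_eq_zero] at h2
    rcases h2 with h2 | h2
    · exact mem_support_iff.1 hm h2
    · exact Nat.cast_add_one_ne_zero _ h2
  rintro ⟨q, hq⟩
  have hq0 : q ≠ 0 := by
    rintro rfl
    exact h0 (by rw [hq, mul_zero])
  have h1 : G.degreeOf i ≤ (pderiv i G).degreeOf i := by
    rw [hq, degreeOf_mul_eq hG hq0]
    omega
  obtain ⟨m', hm', h3⟩ : ∃ m ∈ (pderiv i G).support, m i = (pderiv i G).degreeOf i := by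
    rw [degreeOf_eq_sup]
    obtain ⟨m, hm, h⟩ := Finset.exists_mem_eq_sup (pderiv i G).support (by simpa using h0) fun m => m i
    exact ⟨m, hm, h.symm⟩
  rw [mem_support_iff, MvPolynomial.coeff_pderiv] at hm'
  have h4 := monomial_le_degreeOf i (mem_support_iff.2 (left_ne_zero_of_mul hm'))
  simp only [Finsupp.add_apply, Finsupp.single_eq_same] at h4
  omega

end MvPolynomial

end

section

section

variable {L : Type} [Field L] {σ : Type} {g : L[X]}

theorem splitHom_X (j : σ) : splitHom g (MvPolynomial.X j) = Polynomial.aeval (MvPolynomial.X j) g :=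
  MvPolynomial.aeval_X _ _

theorem eval_splitHom (y : σ → L) (E : MvPolynomial σ L) :
    MvPolynomial.eval y (splitHom g E) = MvPolynomial.eval (fun j => g.eval (y j)) E := by
  induction E using MvPolynomial.induction_on with
  | C a => simp [splitHom]
  | add p q hp hq => rw [map_add, map_add, map_add, hp, hq]
  | mul_X p j hp => rw [map_mul, map_mul, map_mul, hp, splitHom_X, ProductFormulaFamily.eval_aeval_X, MvPolynomial.eval_X]

theorem splitHom_ne_zero [IsAlgClosed L] (hg : g.natDegree ≠ 0) {E : MvPolynomial σ L} (hE : E ≠ 0) :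
    splitHom g E ≠ 0 := by
  refine fun h0 => hE (MvPolynomial.funext fun x => ?_)
  have : ∀ a : L, ∃ b, g.eval b = a := IsAlgClosed.eval_surjective hg
  choose s hs using this
  have h1 := eval_splitHom (g := g) (fun j => s (x j)) E
  simp only [hs] at h1
  rw [← h1, h0, map_zero, map_zero]

theorem vars_splitHom_subset (E : MvPolynomial σ L) : (splitHom g E).vars ⊆ E.vars := by
  classical
  intro i hi
  obtain ⟨j, hj, h⟩ := Finset.mem_biUnion.1 (MvPolynomial.vars_bind₁ _ E hi)
  have := MultiProjective.vars_aeval_X_subset j g h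
  rw [Finset.mem_singleton] at this
  rwa [this]

theorem pderiv_splitHom (j : σ) (E : MvPolynomial σ L) :
    MvPolynomial.pderiv j (splitHom g E) =
      splitHom g (MvPolynomial.pderiv j E) * Polynomial.aeval (MvPolynomial.X j) (derivative g) := by
  classical
  induction E using MvPolynomial.induction_on with
  | C a => simp [splitHom]
  | add p q hp hq => rw [map_add, map_add, map_add, map_add, hp, hq, add_mul]
  | mul_X p l hp =>
    have h1 : MvPolynomial.pderiv j (Polynomial.aeval (MvPolynomial.X l : MvPolynomial σ L) g) =
        splitHom g (MvPolynomial.pderiv j (MvPolynomial.X l)) *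
          Polynomial.aeval (MvPolynomial.X j) (derivative g) := by
      rw [Derivation.map_aeval]
      by_cases h : l = j
      · subst h
        rw [MvPolynomial.pderiv_X_self, map_one, one_mul, smul_eq_mul, mul_one]
      · rw [MvPolynomial.pderiv_X_of_ne h, map_zero, zero_mul, smul_zero]
    rw [map_mul, MvPolynomial.pderiv_mul, MvPolynomial.pderiv_mul, map_add, map_mul, map_mul, hp, splitHom_X, h1]
    ring

theorem aeval_X_ne_zero (j : σ) {q : L[X]} (hq : q ≠ 0) :
    Polynomial.aeval (MvPolynomial.X j : MvPolynomial σ L) q ≠ 0 := fun h =>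
  hq (transcendental_iff.1 (MvPolynomial.transcendental_X (R := L) j) q h)

theorem exists_splitHom_invariant [IsAlgClosed L] (hg : g.natDegree ≠ 0) {F : MvPolynomial σ L} (hF : Prime F)
    (hv : F.vars.Nonempty)
    (H : ∀ E, F ∣ splitHom g (splitHom g E) ↔ F ∣ splitHom g E) :
    ∃ G, Prime G ∧ F.vars ⊆ G.vars ∧ (∀ E, F ∣ splitHom g E ↔ G ∣ E) ∧ ∀ E, G ∣ E ↔ G ∣ splitHom g E := by
  have hp : (Ideal.span {F}).IsPrime := (Ideal.span_singleton_prime hF.ne_zero).2 hF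
  have hq : ((Ideal.span {F}).comap (splitHom g).toRingHom).IsPrime := Ideal.comap_isPrime _ _
  have hmem : ∀ E, E ∈ (Ideal.span {F}).comap (splitHom g).toRingHom ↔ F ∣ splitHom g E := fun E =>
    Ideal.mem_span_singleton
  obtain ⟨E₀, hE₀, hd⟩ := RingHom.exists_ne_zero_dvd (splitHom (σ := σ) g).toRingHom hF.ne_zero
    (isIntegralElem_splitHom hg F)
  obtain ⟨G, hGm, hG⟩ := hq.exists_mem_prime_of_ne_bot
    (fun h => hE₀ ((Submodule.mem_bot _).1 (h ▸ (hmem E₀).2 hd)))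
  have hFG : ∀ E, E ≠ 0 → F ∣ splitHom g E → F.vars ⊆ E.vars := fun E hE hd =>
    (MultiProjective.vars_subset_of_dvd hd (splitHom_ne_zero hg hE)).trans (vars_splitHom_subset E)
  have hFGE : ∀ E, F ∣ splitHom g E ↔ G ∣ E := by
    refine fun E => ⟨fun hE => ?_, fun hE => ((hmem G).1 hGm).trans (map_dvd _ hE)⟩
    by_contra hGE
    obtain ⟨i, hi⟩ := hv
    obtain ⟨h, hh0, hhi, hh⟩ := MvPolynomial.exists_combination_notMem_vars hG i hGE
    refine hhi (hFG h hh0 ?_ hi)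
    rw [← hmem] at hE ⊢
    refine Ideal.span_le.2 ?_ hh
    rintro x (rfl | rfl)
    · exact hGm
    · exact hE
  exact ⟨G, hG, hFG G hG.ne_zero ((hmem G).1 hGm), hFGE, fun E => by rw [← hFGE, ← hFGE, H]⟩

/-- The logarithmic semi-invariant attached to a totally invariant hypersurface involving three variables. -/
theorem exists_semiinvariant [CharZero L] [IsAlgClosed L] (hg : g.natDegree ≠ 0) {G : MvPolynomial σ L} (hG : Prime G)
    (H : ∀ E, G ∣ E ↔ G ∣ splitHom g E) {i j k : σ} (hi : i ∈ G.vars) (hj : j ∈ G.vars) (hk : k ∈ G.vars)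
    (hij : i ≠ j) (hik : i ≠ k) :
    ∃ D ≠ 0, ∃ A B : MvPolynomial σ L, A ≠ 0 ∧ B ≠ 0 ∧
      splitHom g A * B * Polynomial.aeval (MvPolynomial.X j) (derivative g) ^ D =
        splitHom g B * A * Polynomial.aeval (MvPolynomial.X k) (derivative g) ^ D := by
  classical
  set u := MvPolynomial.pderiv j G
  set v := MvPolynomial.pderiv k G
  have hu : ¬ G ∣ u := MvPolynomial.not_dvd_pderiv hj
  have hv : ¬ G ∣ v := MvPolynomial.not_dvd_pderiv hk
  set gj := Polynomial.aeval (MvPolynomial.X j : MvPolynomial σ L) (derivative g)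
  set gk := Polynomial.aeval (MvPolynomial.X k : MvPolynomial σ L) (derivative g)
  have hg' : derivative g ≠ 0 := fun h => hg (derivative_eq_zero.1 h)
  have hfree : ∀ E : MvPolynomial σ L, E ≠ 0 → i ∉ E.vars → ¬ G ∣ E := fun E hE hiE hd =>
    hiE (MultiProjective.vars_subset_of_dvd hd hE hi)
  have hgj : i ∉ gj.vars := fun h => hij (Finset.mem_singleton.1 (MultiProjective.vars_aeval_X_subset j _ h))
  have hgk : i ∉ gk.vars := fun h => hik (Finset.mem_singleton.1 (MultiProjective.vars_aeval_X_subset k _ h))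
  obtain ⟨Q, hQ⟩ := (H G).1 dvd_rfl
  have hdQ : ∀ l, MvPolynomial.pderiv l G * Q + G * MvPolynomial.pderiv l Q =
      splitHom g (MvPolynomial.pderiv l G) * Polynomial.aeval (MvPolynomial.X l) (derivative g) := fun l => by
    rw [← pderiv_splitHom, hQ, MvPolynomial.pderiv_mul]
  have hGQ : ¬ G ∣ Q := by
    intro h
    have h1 : G ∣ splitHom g u * gj := by
      rw [← hdQ j]
      exact dvd_add (h.mul_left _) (dvd_mul_right _ _)
    rcases hG.dvd_or_dvd h1 with h1 | h1
    · exact hu ((H u).2 h1)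
    · exact hfree gj (aeval_X_ne_zero j hg') hgj h1
  have hex : ∃ D, ∃ c : ℕ → MvPolynomial σ L, (∀ l, i ∉ (c l).vars) ∧ (∃ l ≤ D, c l ≠ 0) ∧
      G ∣ ∑ l ∈ Finset.range (D + 1), c l * u ^ l * v ^ (D - l) :=
    MvPolynomial.exists_homogeneous_relation hG i hv
  obtain ⟨c, hci, hc0, hcG⟩ := Nat.find_spec hex
  have hmin := fun E (hE : E < Nat.find hex) => Nat.find_min hex hE
  set D := Nat.find hex
  have hD : D ≠ 0 := by
    intro hD
    rw [hD] at hcG hc0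
    obtain ⟨l, hl, h⟩ := hc0
    obtain rfl : l = 0 := by omega
    rw [Finset.sum_range_one, pow_zero, pow_zero, mul_one, mul_one] at hcG
    exact hfree _ h (hci 0) hcG
  obtain ⟨d, hd⟩ := Nat.exists_eq_succ_of_ne_zero hD
  rw [Nat.succ_eq_add_one] at hd
  have hlast : ∀ e : ℕ → MvPolynomial σ L, (∀ l, i ∉ (e l).vars) → e D = 0 →
      G ∣ ∑ l ∈ Finset.range (D + 1), e l * u ^ l * v ^ (D - l) → ∀ l ≤ D, e l = 0 := by
    intro e hei heD heG l hl
    by_contra hel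
    refine hmin d (by omega) ⟨e, hei, ⟨l, ?_, hel⟩, ?_⟩
    · rcases hl.lt_or_eq with h | rfl
      · omega
      · exact absurd heD hel
    · rw [Finset.sum_range_succ, heD, zero_mul, zero_mul, add_zero, hd] at heG
      refine (hG.dvd_or_dvd (b := v) ?_).resolve_right hv
      convert heG using 1
      rw [Finset.sum_mul]
      refine Finset.sum_congr rfl fun l hl => ?_
      have := Finset.mem_range.1 hl
      rw [mul_assoc, ← pow_succ]
      congr 2
      omega
  have hcD : c D ≠ 0 := fun h => by
    obtain ⟨l, hl, h1⟩ := hc0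
    exact h1 (hlast c hci h hcG l hl)
  have hc00 : c 0 ≠ 0 := by
    intro h
    refine hmin d (by omega) ⟨fun l => c (l + 1), fun l => hci _, ⟨d, le_rfl, show c (d + 1) ≠ 0 by rwa [← hd]⟩, ?_⟩
    rw [Finset.sum_range_succ', h, zero_mul, zero_mul, add_zero, hd] at hcG
    refine (hG.dvd_or_dvd (b := u) ?_).resolve_right hu
    convert hcG using 1
    rw [Finset.sum_mul]
    refine Finset.sum_congr rfl fun l hl => ?_
    rw [Nat.add_sub_add_right]
    ring
  let c' : ℕ → MvPolynomial σ L := fun l => splitHom g (c l) * gk ^ l * gj ^ (D - l)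
  have hmul : ∀ {p q : MvPolynomial σ L}, i ∉ p.vars → i ∉ q.vars → i ∉ (p * q).vars := fun hp hq h =>
    (Finset.mem_union.1 (MvPolynomial.vars_mul _ _ h)).elim hp hq
  have hpow : ∀ {p : MvPolynomial σ L} (l : ℕ), i ∉ p.vars → i ∉ (p ^ l).vars := fun l hp h =>
    hp (MvPolynomial.vars_pow _ _ h)
  have hc'i : ∀ l, i ∉ (c' l).vars := fun l =>
    hmul (hmul (fun h => hci l (vars_splitHom_subset _ h)) (hpow _ hgk)) (hpow _ hgj)
  have hc'G : G ∣ ∑ l ∈ Finset.range (D + 1), c' l * u ^ l * v ^ (D - l) := by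
    have h1 : G ∣ (∑ l ∈ Finset.range (D + 1), c' l * u ^ l * v ^ (D - l)) * Q ^ D := by
      have h2 : G ∣ splitHom g (∑ l ∈ Finset.range (D + 1), c l * u ^ l * v ^ (D - l)) * (gj * gk) ^ D :=
        ((H _).1 hcG).mul_right _
      rw [← Ideal.mem_span_singleton, ← Ideal.Quotient.eq_zero_iff_mem] at h2 ⊢
      rw [← h2]
      have hπ : ∀ l, Ideal.Quotient.mk (Ideal.span {G}) (splitHom g (MvPolynomial.pderiv l G)) *
          Ideal.Quotient.mk _ (Polynomial.aeval (MvPolynomial.X l) (derivative g)) =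
          Ideal.Quotient.mk _ (MvPolynomial.pderiv l G) * Ideal.Quotient.mk _ Q := fun l => by
        rw [← map_mul, ← map_mul, ← hdQ, Ideal.Quotient.eq, Ideal.mem_span_singleton]
        exact ⟨MvPolynomial.pderiv l Q, by ring⟩
      have hπu := hπ j
      have hπv := hπ k
      rw [map_sum, map_mul, map_sum, map_mul, map_sum, Finset.sum_mul, Finset.sum_mul]
      refine Finset.sum_congr rfl fun l hl => ?_
      obtain ⟨r, hr⟩ := Nat.exists_eq_add_of_le (Nat.lt_succ_iff.1 (Finset.mem_range.1 hl))
      rw [hr, Nat.add_sub_cancel_left]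
      simp only [c', hr, Nat.add_sub_cancel_left, map_mul, map_pow]
      set π := Ideal.Quotient.mk (Ideal.span {G})
      calc _ = π (splitHom g (c l)) * π gk ^ l * π gj ^ r * (π u * π Q) ^ l * (π v * π Q) ^ r := by ring
        _ = _ := by
          rw [← hπu, ← hπv]
          ring
    exact (hG.dvd_or_dvd h1).resolve_right fun h => hGQ (hG.dvd_of_dvd_pow h)
  have hfin := hlast (fun l => c D * c' l - c' D * c l)
    (fun l => fun h => (Finset.mem_union.1 (MvPolynomial.vars_sub_subset _ h)).elim
      (hmul (hci _) (hc'i _)) (hmul (hc'i _) (hci _)))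
    (by ring) (by
      have : ∑ l ∈ Finset.range (D + 1), (c D * c' l - c' D * c l) * u ^ l * v ^ (D - l) =
          c D * (∑ l ∈ Finset.range (D + 1), c' l * u ^ l * v ^ (D - l)) -
          c' D * ∑ l ∈ Finset.range (D + 1), c l * u ^ l * v ^ (D - l) := by
        rw [Finset.mul_sum, Finset.mul_sum, ← Finset.sum_sub_distrib]
        exact Finset.sum_congr rfl fun l _ => by ring
      rw [this]
      exact dvd_sub (hc'G.mul_left _) (hcG.mul_left _)) 0 (Nat.zero_le _)
  refine ⟨D, hD, c 0, c D, hc00, hcD, ?_⟩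
  simp only [c', pow_zero, mul_one, Nat.sub_zero, Nat.sub_self] at hfin
  linear_combination hfin

end

end

section

section

variable {L : Type} [Field L] {σ : Type}

theorem Polynomial.exists_comp_eq_of_comp_mul_eq {a b h r : L[X]} {c : L} (hh : 2 ≤ h.natDegree) (hc : c ≠ 0)
    (ha : a ≠ 0) (hb : b ≠ 0) (H : a.comp h * b * r = C c * (b.comp h * a)) :
    ∃ e ≠ 0, C c * e.comp h = e * r := by
  classical
  obtain ⟨t, a', b', hcop, rfl, rfl⟩ : ∃ t a' b' : L[X], IsCoprime a' b' ∧ a = t * a' ∧ b = t * b' := by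
    have hg : EuclideanDomain.gcd a b ≠ 0 := fun h => ha (EuclideanDomain.gcd_eq_zero_iff.1 h).1
    obtain ⟨a', ha'⟩ := EuclideanDomain.gcd_dvd_left a b
    obtain ⟨b', hb'⟩ := EuclideanDomain.gcd_dvd_right a b
    refine ⟨_, a', b', ?_, ha', hb'⟩
    have hab := EuclideanDomain.gcd_eq_gcd_ab a b
    refine ⟨EuclideanDomain.gcdA a b, EuclideanDomain.gcdB a b, mul_left_cancel₀ hg ?_⟩
    linear_combination -hab - EuclideanDomain.gcdA a b * ha' - EuclideanDomain.gcdB a b * hb'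
  have ht : t ≠ 0 := left_ne_zero_of_mul ha
  have ha' : a' ≠ 0 := right_ne_zero_of_mul ha
  have hb' : b' ≠ 0 := right_ne_zero_of_mul hb
  have hcomp : ∀ {p : L[X]}, p ≠ 0 → p.comp h ≠ 0 := fun hp h0 => by
    rcases comp_eq_zero_iff.1 h0 with h0 | ⟨-, h0⟩
    · exact hp h0
    · rw [h0, natDegree_C] at hh
      omega
  have H' : a'.comp h * b' * r = C c * (b'.comp h * a') := by
    refine mul_left_cancel₀ (mul_ne_zero (hcomp ht) ht) ?_
    rw [mul_comp, mul_comp] at H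
    linear_combination H
  have hco : IsCoprime (a'.comp h) (b'.comp h) := by
    simpa using hcop.map (compRingHom h)
  have hdvd : a'.comp h ∣ a' := by
    have h1 : a'.comp h ∣ C c * (b'.comp h * a') := by
      rw [← H', mul_assoc]
      exact dvd_mul_right _ _
    rw [(isUnit_C.2 hc.isUnit).dvd_mul_left] at h1
    exact hco.dvd_of_dvd_mul_left h1
  have hdeg := natDegree_le_of_dvd hdvd ha'
  rw [natDegree_comp] at hdeg
  have h0 : a'.natDegree = 0 := by nlinarith
  rw [natDegree_eq_zero] at h0
  obtain ⟨x, rfl⟩ := h0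
  refine ⟨b', hb', mul_right_cancel₀ ha' ?_⟩
  rw [C_comp] at H'
  linear_combination -H'

theorem Polynomial.infinite_setOf_periodic [IsAlgClosed L] [CharZero L] {g : L[X]} (hg : 2 ≤ g.natDegree) :
    {x : L | ∃ N ≥ 1, (g.comp^[N] X).eval x = x}.Infinite := by
  intro hfin
  obtain ⟨N, hN, γ, hγ, -, h⟩ := exists_good_periodic_point hg
    (q := ∏ x ∈ hfin.toFinset, (X - C x)) (Finset.prod_ne_zero_iff.2 fun x _ => X_sub_C_ne_zero x)
  refine h 0 ?_
  rw [Function.iterate_zero_apply, eval_prod]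
  exact Finset.prod_eq_zero (i := γ) (hfin.mem_toFinset.2 ⟨N, hN, hγ⟩) (by simp)

theorem splitHom_comp (g h : L[X]) (E : MvPolynomial σ L) :
    splitHom (h.comp g) E = splitHom g (splitHom h E) := by
  have : splitHom (σ := σ) (h.comp g) = (splitHom g).comp (splitHom h) := by
    refine MvPolynomial.algHom_ext fun j => ?_
    rw [AlgHom.comp_apply, splitHom_X, splitHom_X, aeval_comp, ← splitHom_X, Polynomial.aeval_algHom_apply]
  exact congrArg (fun e => e E) this

/-- The logarithmic semi-invariant transfers to iterates. -/
theorem splitHom_semiinvariant_iterate [IsAlgClosed L] {g : L[X]} (hg : g.natDegree ≠ 0) {j k : σ} {D : ℕ}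
    {A B : MvPolynomial σ L} (hA : A ≠ 0) (hB : B ≠ 0)
    (H : splitHom g A * B * Polynomial.aeval (MvPolynomial.X j) (derivative g) ^ D =
        splitHom g B * A * Polynomial.aeval (MvPolynomial.X k) (derivative g) ^ D) (N : ℕ) :
    splitHom (g.comp^[N] X) A * B * Polynomial.aeval (MvPolynomial.X j) (derivative (g.comp^[N] X)) ^ D =
      splitHom (g.comp^[N] X) B * A * Polynomial.aeval (MvPolynomial.X k) (derivative (g.comp^[N] X)) ^ D := by
  induction N with
  | zero =>
    have : ∀ E : MvPolynomial σ L, splitHom (X : L[X]) E = E := fun E => by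
      have : splitHom (σ := σ) (X : L[X]) = AlgHom.id L _ := by
        refine MvPolynomial.algHom_ext fun j => ?_
        rw [splitHom_X, aeval_X, AlgHom.id_apply]
      exact congrArg (fun e => e E) this
    simp only [Function.iterate_zero_apply, this, derivative_X, map_one, one_pow, mul_one]
    ring
  | succ N ih =>
    rw [Function.iterate_succ_apply']
    set h := g.comp^[N] X
    have hh : h.natDegree ≠ 0 := by
      rw [natDegree_iterate_comp, natDegree_X, mul_one]
      exact pow_ne_zero _ hg
    have ih' := congrArg (splitHom h) H
    simp only [map_mul, map_pow, ← splitHom_comp] at ih'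
    have hd : ∀ l : σ, splitHom h (Polynomial.aeval (MvPolynomial.X l) (derivative g)) =
        Polynomial.aeval (MvPolynomial.X l) ((derivative g).comp h) := fun l => by
      rw [aeval_comp, ← splitHom_X (g := h), Polynomial.aeval_algHom_apply]
    rw [hd, hd] at ih'
    rw [derivative_comp, map_mul, map_mul]
    refine mul_left_cancel₀ (mul_ne_zero (splitHom_ne_zero hh hA) (splitHom_ne_zero hh hB)) ?_
    rw [mul_pow, mul_pow]
    linear_combination ih' * (splitHom h A * B * Polynomial.aeval (MvPolynomial.X j) (derivative h) ^ D) +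
      (splitHom (g.comp h) B * splitHom h A * Polynomial.aeval (MvPolynomial.X k) ((derivative g).comp h) ^ D) * ih

/-- A logarithmic semi-invariant in several variables produces one in a single variable, for an iterate. -/
theorem exists_univariate_semiinvariant [CharZero L] [IsAlgClosed L] [Finite σ] {g : L[X]} (hg : 2 ≤ g.natDegree)
    {j k : σ} (hjk : j ≠ k) {D : ℕ} {A B : MvPolynomial σ L} (hA : A ≠ 0) (hB : B ≠ 0)
    (H : splitHom g A * B * Polynomial.aeval (MvPolynomial.X j) (derivative g) ^ D =
        splitHom g B * A * Polynomial.aeval (MvPolynomial.X k) (derivative g) ^ D) :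
    ∃ N ≥ 1, ∃ e ≠ 0, ∃ c ≠ 0, C c * e.comp (g.comp^[N] X) = e * derivative (g.comp^[N] X) ^ D := by
  classical
  have := Fintype.ofFinite σ
  obtain ⟨y, hy, hAB⟩ : ∃ y : σ → L, (∀ l, ∃ N ≥ 1, (g.comp^[N] X).eval (y l) = y l) ∧
      MvPolynomial.eval y (A * B) ≠ 0 := by
    by_contra! hno
    refine mul_ne_zero hA hB (MvPolynomial.funext_set (fun _ : σ => {x : L | ∃ N ≥ 1, (g.comp^[N] X).eval x = x})
      (fun _ => infinite_setOf_periodic hg) fun y hy => ?_)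
    rw [map_zero]
    exact hno y fun l => hy l (Set.mem_univ l)
  choose N hN hNy using hy
  have hper : ∀ l, (g.comp^[∏ l, N l] X).eval (y l) = y l := fun l => by
    obtain ⟨r, hr⟩ := Finset.dvd_prod_of_mem N (Finset.mem_univ l)
    have h1 := hNy l
    rw [iterate_comp_eval, eval_X] at h1 ⊢
    rw [hr, Function.iterate_mul]
    exact Function.iterate_fixed h1 r
  set M := ∏ l, N l
  set h := g.comp^[M] X with hh
  have hM : 1 ≤ M := Finset.one_le_prod' fun l _ => hN l
  have hhd : 2 ≤ h.natDegree := by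
    rw [hh, natDegree_iterate_comp, natDegree_X, mul_one]
    exact hg.trans (Nat.le_self_pow (by omega) _)
  let S : MvPolynomial σ L →ₐ[L] L[X] := MvPolynomial.aeval fun l => if l = j then X else C (y l)
  have hSX : ∀ l, S (MvPolynomial.X l) = if l = j then X else C (y l) := fun l => MvPolynomial.aeval_X _ _
  have hSe : ∀ E, (S E).eval (y j) = MvPolynomial.eval y E := fun E => by
    have : (Polynomial.aeval (y j)).comp S = MvPolynomial.aeval y := by
      refine MvPolynomial.algHom_ext fun l => ?_
      rw [AlgHom.comp_apply, hSX, MvPolynomial.aeval_X]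
      split_ifs with hl
      · rw [aeval_X, hl]
      · rw [aeval_C, Algebra.algebraMap_self_apply]
    have := congrArg (fun e => e E) this
    simpa [Polynomial.coe_aeval_eq_eval, MvPolynomial.coe_aeval_eq_eval] using this
  have hSh : ∀ E, S (splitHom h E) = (S E).comp h := fun E => by
    have : S.comp (splitHom h) = (Polynomial.aeval h).comp S := by
      refine MvPolynomial.algHom_ext fun l => ?_
      rw [AlgHom.comp_apply, AlgHom.comp_apply, splitHom_X, ← Polynomial.aeval_algHom_apply, hSX]
      split_ifs with hl
      · simp
      · rw [aeval_C, ← Polynomial.algebraMap_eq, Polynomial.aeval_algebraMap_apply, Polynomial.coe_aeval_eq_eval,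
          hper l]
    exact congrArg (fun e => e E) this
  have hS := congrArg S (splitHom_semiinvariant_iterate (by omega) hA hB H M)
  rw [← hh] at hS
  simp only [map_mul, map_pow, hSh, ← Polynomial.aeval_algHom_apply, hSX, if_pos, if_neg hjk.symm] at hS
  have hk : Polynomial.aeval (C (y k)) (derivative h) = C ((derivative h).eval (y k)) := by
    rw [← Polynomial.algebraMap_eq, Polynomial.aeval_algebraMap_apply, Polynomial.coe_aeval_eq_eval]
  rw [hk, aeval_X_left_apply, ← C_pow] at hS
  rw [map_mul, ← hSe, ← hSe] at hAB
  have ha : S A ≠ 0 := fun h0 => hAB (by rw [h0]; simp)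
  have hb : S B ≠ 0 := fun h0 => hAB (by rw [h0]; simp)
  have hcomp : (S A).comp h ≠ 0 := fun h0 => by
    rcases comp_eq_zero_iff.1 h0 with h0 | ⟨-, h0⟩
    · exact ha h0
    · rw [h0, natDegree_C] at hhd
      omega
  have hdh : derivative h ≠ 0 := fun h0 => by
    have := derivative_eq_zero.1 h0
    omega
  have hc : ((derivative h).eval (y k)) ^ D ≠ 0 := by
    intro h0
    rw [h0, C_0, mul_zero] at hS
    exact mul_ne_zero (mul_ne_zero hcomp hb) (pow_ne_zero _ hdh) hS
  obtain ⟨e, he, heq⟩ := Polynomial.exists_comp_eq_of_comp_mul_eq hhd hc ha hb (r := derivative h ^ D)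
    (by rw [hS]; ring)
  exact ⟨M, hM, e, he, _, hc, heq⟩

end

end

section

section

variable {L : Type} [Field L]

theorem Polynomial.rootMultiplicity_comp_eq {e h : L[X]} (he : e ≠ 0) (hh : h.natDegree ≠ 0) (β : L) :
    (e.comp h).rootMultiplicity β =
      (h - C (h.eval β)).rootMultiplicity β * e.rootMultiplicity (h.eval β) := by
  classical
  obtain ⟨q, hq, hnd⟩ := exists_eq_pow_rootMultiplicity_mul_and_not_dvd e he (h.eval β)
  set m := e.rootMultiplicity (h.eval β)
  have hcomp : e.comp h = (h - C (h.eval β)) ^ m * q.comp h := by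
    conv_lhs => rw [hq]
    simp
  have h0 : e.comp h ≠ 0 := fun h0 => by
    rcases comp_eq_zero_iff.1 h0 with h0 | ⟨-, h0⟩
    · exact he h0
    · exact hh (by rw [h0, natDegree_C])
  have hq0 : ¬ (q.comp h).IsRoot β := by
    rw [IsRoot, eval_comp, ← IsRoot, ← dvd_iff_isRoot]
    exact hnd
  rw [hcomp] at h0 ⊢
  rw [rootMultiplicity_mul h0, rootMultiplicity_eq_zero hq0, add_zero, ← count_roots, ← count_roots, roots_pow,
    Multiset.count_nsmul, mul_comm]

/-- A polynomial satisfying the logarithmic differential equation is conjugate to a power map, or its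
critical portrait is that of a Chebyshev map. -/
theorem Polynomial.eq_power_or_chebyshev [CharZero L] [IsAlgClosed L] {e h : L[X]} {c : L} {D : ℕ} (hD : D ≠ 0)
    (hh : 2 ≤ h.natDegree) (he : e ≠ 0) (hc : c ≠ 0) (H : C c * e.comp h = e * derivative h ^ D) :
    (∃ a z, a ≠ 0 ∧ h = C a * (X - C z) ^ h.natDegree + C z) ∨
      ∃ z₁ z₂ r, z₁ ≠ z₂ ∧ r ≠ 0 ∧
        (h - C z₁) * (h - C z₂) * C r = (X - C z₁) * (X - C z₂) * derivative h ^ 2 := by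
  classical
  have hdh : derivative h ≠ 0 := fun h0 => by
    have := derivative_eq_zero.1 h0
    omega
  have hed : e.natDegree = D := by
    have h1 := congrArg natDegree H
    rw [natDegree_C_mul hc, natDegree_comp, natDegree_mul he (pow_ne_zero _ hdh), natDegree_pow,
      natDegree_derivative] at h1
    obtain ⟨d, hd⟩ := Nat.exists_eq_add_of_le' hh
    rw [hd, show d + 2 - 1 = d + 1 from rfl] at h1
    have h2 : (d + 1) * e.natDegree = (d + 1) * D := by linarith
    exact Nat.eq_of_mul_eq_mul_left (Nat.succ_pos d) h2
  have hcard : e.roots.card = D := by rw [IsAlgClosed.card_roots_eq_natDegree, hed]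
  have hμD : ∀ z, e.roots.count z ≤ D := fun z => hcard ▸ Multiset.count_le_card _ _
  have hsub : ∀ z, h - C z ≠ 0 := fun z h0 => by
    have := congrArg natDegree h0
    rw [natDegree_sub_C, natDegree_zero] at this
    omega
  have hram : ∀ β, 1 ≤ (h - C (h.eval β)).roots.count β ∧
      (h - C (h.eval β)).roots.count β * (D - e.roots.count (h.eval β)) = D - e.roots.count β := by
    intro β
    have h1 := congrArg (rootMultiplicity β) H
    have hroot : (h - C (h.eval β)).IsRoot β := by simp
    have h2 : (derivative h).rootMultiplicity β = (h - C (h.eval β)).rootMultiplicity β - 1 := by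
      rw [← derivative_rootMultiplicity_of_root hroot, derivative_sub, derivative_C, sub_zero]
    have h3 : 1 ≤ (h - C (h.eval β)).rootMultiplicity β := (rootMultiplicity_pos (hsub _)).2 hroot
    have h4 : (C c * e.comp h).rootMultiplicity β = (e.comp h).rootMultiplicity β := by
      rw [← count_roots, ← count_roots, roots_C_mul _ hc]
    have h5 : (derivative h ^ D).rootMultiplicity β = D * (derivative h).rootMultiplicity β := by
      rw [← count_roots, ← count_roots, roots_pow, Multiset.count_nsmul]
    rw [h4, rootMultiplicity_comp_eq he (by omega), rootMultiplicity_mul (mul_ne_zero he (pow_ne_zero _ hdh)), h5,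
      h2] at h1
    have h6 := hμD (h.eval β)
    have h7 := hμD β
    rw [count_roots] at h6 h7 ⊢
    rw [count_roots, count_roots]
    refine ⟨h3, ?_⟩
    obtain ⟨x, hx⟩ := Nat.exists_eq_add_of_le h6
    obtain ⟨y, hy⟩ := Nat.exists_eq_add_of_le' h3
    rw [hy, Nat.add_sub_cancel] at h1
    rw [hy, Nat.sub_eq_of_eq_add' hx]
    have : (y + 1) * x + rootMultiplicity β e = D := by
      have h8 : (y + 1) * rootMultiplicity (h.eval β) e + (y + 1) * x = (y + 1) * D := by rw [← mul_add, ← hx]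
      have h9 : (y + 1) * D = D * y + D := by ring
      omega
    omega
  have hsurj : ∀ z, ∃ β, h.eval β = z := IsAlgClosed.eval_surjective (by omega)
  by_cases hA : ∃ z, e.roots.count z = D
  · obtain ⟨z, hz⟩ := hA
    left
    have heq : ∀ β ∈ e.roots, β = z := fun β hβ => (Multiset.count_eq_card.1 (hz.trans hcard.symm) β hβ).symm
    have hroots : ∀ β ∈ (h - C z).roots, β = z := by
      intro β hβ
      have hβz : h.eval β = z := by
        have := (mem_roots (hsub z)).1 hβ
        rwa [IsRoot, eval_sub, eval_C, sub_eq_zero] at this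
      have h1 := (hram β).2
      rw [hβz, hz, Nat.sub_self, mul_zero] at h1
      have h2 := hμD β
      exact heq β (Multiset.count_pos.1 (by omega))
    have hrep : (h - C z).roots = Multiset.replicate h.natDegree z :=
      Multiset.eq_replicate.2 ⟨by rw [IsAlgClosed.card_roots_eq_natDegree, natDegree_sub_C], hroots⟩
    have hprod := (IsAlgClosed.splits (h - C z)).eq_prod_roots
    rw [hrep, Multiset.map_replicate, Multiset.prod_replicate] at hprod
    exact ⟨_, z, leadingCoeff_ne_zero.2 (hsub z), by rw [← hprod, sub_add_cancel]⟩
  · right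
    push Not at hA
    let T := e.roots.toFinset.filter fun z => 2 * e.roots.count z < D
    have hT : T = ∅ := by
      by_contra hne
      have hpre : ∀ z ∈ T, (h - C z).roots.toFinset ⊆ T ∧ (h - C z).roots.toFinset.card = h.natDegree := by
        intro z hz
        obtain ⟨hz1, hz2⟩ := Finset.mem_filter.1 hz
        have hpos : 0 < e.roots.count z := Multiset.count_pos.2 (Multiset.mem_toFinset.1 hz1)
        have key : ∀ β ∈ (h - C z).roots, (h - C z).roots.count β = 1 ∧ e.roots.count β = e.roots.count z := by
          intro β hβ
          have hβz : h.eval β = z := by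
            have := (mem_roots (hsub z)).1 hβ
            rwa [IsRoot, eval_sub, eval_C, sub_eq_zero] at this
          obtain ⟨h1, h2⟩ := hram β
          rw [hβz] at h1 h2
          have h3 := hμD β
          have h4 : (h - C z).roots.count β = 1 := by
            by_contra h5
            have : 2 * (D - e.roots.count z) ≤ (h - C z).roots.count β * (D - e.roots.count z) :=
              Nat.mul_le_mul_right _ (by omega)
            omega
          rw [h4, one_mul] at h2
          exact ⟨h4, by omega⟩
        refine ⟨fun β hβ => ?_, ?_⟩
        · have h1 := (key β (Multiset.mem_toFinset.1 hβ)).2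
          exact Finset.mem_filter.2 ⟨Multiset.mem_toFinset.2 (Multiset.count_pos.1 (h1 ▸ hpos)), h1 ▸ hz2⟩
        · have hnd : (h - C z).roots.Nodup := Multiset.nodup_iff_count_le_one.2 fun β => by
            by_cases hβ : β ∈ (h - C z).roots
            · exact (key β hβ).1.le
            · rw [Multiset.count_eq_zero_of_notMem hβ]
              exact zero_le_one
          rw [Multiset.toFinset_card_of_nodup hnd, IsAlgClosed.card_roots_eq_natDegree, natDegree_sub_C]
      have hcardT : (T.biUnion fun z => (h - C z).roots.toFinset).card = T.card * h.natDegree := by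
        rw [Finset.card_biUnion, Finset.sum_congr rfl fun z hz => (hpre z hz).2, Finset.sum_const, smul_eq_mul]
        intro x hx y hy hxy
        refine Finset.disjoint_left.2 fun β h1 h2 => hxy ?_
        have h3 := (mem_roots (hsub x)).1 (Multiset.mem_toFinset.1 h1)
        have h4 := (mem_roots (hsub y)).1 (Multiset.mem_toFinset.1 h2)
        rw [IsRoot, eval_sub, eval_C, sub_eq_zero] at h3 h4
        exact h3.symm.trans h4
      have hle := Finset.card_le_card (Finset.biUnion_subset.2 fun z hz => (hpre z hz).1)
      rw [hcardT] at hle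
      have := Finset.card_pos.2 (Finset.nonempty_iff_ne_empty.2 hne)
      nlinarith
    have hhalf : ∀ z ∈ e.roots, D ≤ 2 * e.roots.count z := by
      intro z hz
      by_contra hlt
      exact Finset.notMem_empty z (hT ▸ Finset.mem_filter.2 ⟨Multiset.mem_toFinset.2 hz, not_le.1 hlt⟩)
    obtain ⟨z₁, hz₁⟩ := Multiset.card_pos_iff_exists_mem.1 (show 0 < e.roots.card by omega)
    obtain ⟨z₂, hz₂, h12⟩ : ∃ z₂ ∈ e.roots, z₂ ≠ z₁ := by
      by_contra! hno
      exact hA z₁ (hcard ▸ Multiset.count_eq_card.2 fun x hx => (hno x hx).symm)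
    have h1 := hhalf z₁ hz₁
    have h2 := hhalf z₂ hz₂
    have hle : Multiset.replicate (e.roots.count z₁) z₁ + Multiset.replicate (e.roots.count z₂) z₂ ≤ e.roots := by
      rw [Multiset.le_iff_count]
      intro z
      rw [Multiset.count_add, Multiset.count_replicate, Multiset.count_replicate]
      split_ifs with hza hzb hzb
      · exact absurd (hzb.trans hza.symm) h12
      · rw [hza, add_zero]
      · rw [hzb, zero_add]
      · exact Nat.zero_le _
    have hsum := Multiset.card_le_card hle
    rw [Multiset.card_add, Multiset.card_replicate, Multiset.card_replicate, hcard] at hsum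
    obtain ⟨m, hm₁, hm₂⟩ : ∃ m, e.roots.count z₁ = m ∧ e.roots.count z₂ = m := ⟨_, rfl, by omega⟩
    have hroots := Multiset.eq_of_le_of_card_le hle (by
      rw [Multiset.card_add, Multiset.card_replicate, Multiset.card_replicate, hcard]
      omega)
    rw [hm₁, hm₂] at hroots
    have hDm : D = 2 * m := by omega
    have hm : m ≠ 0 := by omega
    have hprod := (IsAlgClosed.splits e).eq_prod_roots
    rw [← hroots, Multiset.map_add, Multiset.prod_add, Multiset.map_replicate, Multiset.prod_replicate,
      Multiset.map_replicate, Multiset.prod_replicate] at hprod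
    have hl : e.leadingCoeff ≠ 0 := leadingCoeff_ne_zero.2 he
    set Q := (h - C z₁) * (h - C z₂)
    set R := (X - C z₁) * (X - C z₂) * derivative h ^ 2
    have hQR : C c * Q ^ m = R ^ m := by
      rw [hprod, hDm] at H
      simp only [mul_comp, pow_comp, sub_comp, X_comp, C_comp] at H
      refine mul_left_cancel₀ (C_ne_zero.2 hl) ?_
      simp only [Q, R]
      rw [mul_pow, mul_pow, mul_pow, ← pow_mul]
      linear_combination H
    have hdvd : Q ∣ R := by
      rw [← IsIntegrallyClosed.pow_dvd_pow_iff hm, ← hQR]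
      exact dvd_mul_left _ _
    obtain ⟨t, ht⟩ := hdvd
    have hQ0 : Q ≠ 0 := mul_ne_zero (hsub _) (hsub _)
    have hR0 : R ≠ 0 := mul_ne_zero (mul_ne_zero (X_sub_C_ne_zero _) (X_sub_C_ne_zero _)) (pow_ne_zero _ hdh)
    have ht0 : t ≠ 0 := fun h0 => hR0 (by rw [ht, h0, mul_zero])
    have hdeg := congrArg natDegree ht
    rw [natDegree_mul hQ0 ht0, natDegree_mul (hsub _) (hsub _), natDegree_sub_C, natDegree_sub_C,
      natDegree_mul (mul_ne_zero (X_sub_C_ne_zero _) (X_sub_C_ne_zero _)) (pow_ne_zero _ hdh),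
      natDegree_mul (X_sub_C_ne_zero _) (X_sub_C_ne_zero _), natDegree_X_sub_C, natDegree_X_sub_C, natDegree_pow,
      natDegree_derivative] at hdeg
    obtain ⟨r, rfl⟩ := natDegree_eq_zero.1 (show t.natDegree = 0 by omega)
    exact ⟨z₁, z₂, r, h12.symm, C_ne_zero.1 ht0, ht.symm⟩

end

end

section

section

variable {L : Type} [Field L]

/-- `h` is conjugate to the power map of exponent `D` (`s = 0`) or to the Chebyshev map of degree `D`
(`s = 1`) by an affine change of variable. -/
structure Polynomial.IsSpecial (h : L[X]) (D : ℕ) (α β s : L) : Prop where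
  two_le : 2 ≤ D
  ne_zero : β ≠ 0
  eq_zero_or_eq_one : s = 0 ∨ s = 1
  eval_eq : ∀ w ≠ 0, h.eval (α + β * (w + s * w⁻¹)) = α + β * (w ^ D + s * (w ^ D)⁻¹)

theorem Polynomial.exists_clear_denominators (α β : L) {p : L[X]} {N : ℕ} (hp : p.natDegree ≤ N) :
    ∃ q : L[X], (∀ w ≠ 0, q.eval w = w ^ N * p.eval (α + β * (w + w⁻¹))) ∧ q.eval 0 = β ^ N * p.coeff N := by
  refine ⟨∑ k ∈ Finset.range (N + 1), C (p.coeff k) * X ^ (N - k) * (C α * X + C β * (X ^ 2 + 1)) ^ k, ?_, ?_⟩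
  · intro w hw
    rw [eval_eq_sum_range' (Nat.lt_succ_of_le hp), eval_finsetSum, Finset.mul_sum]
    refine Finset.sum_congr rfl fun k hk => ?_
    obtain ⟨r, rfl⟩ := Nat.exists_eq_add_of_le (Nat.lt_succ_iff.1 (Finset.mem_range.1 hk))
    have : α * w + β * (w ^ 2 + 1) = w * (α + β * (w + w⁻¹)) := by
      field_simp
    simp only [eval_mul, eval_pow, eval_add, eval_C, eval_X, eval_one, Nat.add_sub_cancel_left]
    rw [this, mul_pow, pow_add]
    ring
  · rw [eval_finsetSum, Finset.sum_eq_single_of_mem N (Finset.self_mem_range_succ N)]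
    · simp only [eval_mul, eval_pow, eval_add, eval_C, eval_X, eval_one, Nat.sub_self]
      ring
    · intro k hk hkN
      have := Finset.mem_range.1 hk
      simp only [eval_mul, eval_pow, eval_X]
      rw [zero_pow (by omega), mul_zero, zero_mul]

theorem Polynomial.eq_of_eval_eq_of_ne_zero [Infinite L] {p q : L[X]} (h : ∀ w ≠ 0, p.eval w = q.eval w) : p = q :=
  eq_of_infinite_eval_eq p q ((Set.finite_singleton (0 : L)).infinite_compl.mono fun w hw => h w hw)

theorem Polynomial.eval_eq_of_chebyshev [CharZero L] [IsAlgClosed L] {h : L[X]} (hh : 2 ≤ h.natDegree) {z₁ z₂ r : L}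
    (hz : z₁ ≠ z₂) (hr : r ≠ 0)
    (H : (h - C z₁) * (h - C z₂) * C r = (X - C z₁) * (X - C z₂) * derivative h ^ 2) :
    ∃ α β ε : L, β ≠ 0 ∧ ε ^ 2 = 1 ∧ ∀ w ≠ 0, h.eval (α + β * (w + w⁻¹)) =
      α + ε * β * (w ^ h.natDegree + (w ^ h.natDegree)⁻¹) := by
  set d := h.natDegree with hd
  obtain ⟨α, β, rfl, rfl⟩ : ∃ α β, z₁ = α + 2 * β ∧ z₂ = α - 2 * β :=
    ⟨(z₁ + z₂) / 2, (z₁ - z₂) / 4, by ring, by ring⟩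
  have hβ : β ≠ 0 := fun h0 => hz (by rw [h0]; ring)
  obtain ⟨δ, hδ⟩ := IsAlgClosed.exists_pow_nat_eq r⁻¹ (n := 2) two_pos
  obtain ⟨Q, hQ, hQ0⟩ := exists_clear_denominators α β (p := C β⁻¹ * (h - C α)) (N := d)
    (by rw [natDegree_C_mul (inv_ne_zero hβ), natDegree_sub_C])
  obtain ⟨S, hS, -⟩ := exists_clear_denominators α β (p := derivative h) (N := d - 1) (by rw [natDegree_derivative])
  have hQ0' : Q.eval 0 ≠ 0 := by
    rw [hQ0]
    refine mul_ne_zero (pow_ne_zero _ hβ) ?_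
    rw [coeff_C_mul, coeff_sub, coeff_C, if_neg (by omega), sub_zero]
    exact mul_ne_zero (inv_ne_zero hβ) (leadingCoeff_ne_zero.2 fun h0 => by rw [h0, natDegree_zero] at hd; omega)
  set a := Q + C δ * (X ^ 2 - 1) * S with ha
  set b := Q - C δ * (X ^ 2 - 1) * S with hb
  have hab : a * b = C 4 * X ^ (2 * d) := by
    refine eq_of_eval_eq_of_ne_zero fun w hw => ?_
    have h1 := congrArg (eval (α + β * (w + w⁻¹))) H
    simp only [eval_mul, eval_sub, eval_pow, eval_X, eval_C] at h1
    simp only [ha, hb, eval_mul, eval_sub, eval_add, eval_pow, eval_X, eval_C, eval_one, hQ w hw, hS w hw]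
    set y := h.eval (α + β * (w + w⁻¹))
    set y' := (derivative h).eval (α + β * (w + w⁻¹))
    have h2 : (y - (α + 2 * β)) * (y - (α - 2 * β)) = δ ^ 2 * (β ^ 2 * (w - w⁻¹) ^ 2 * y' ^ 2) := by
      rw [hδ]
      field_simp
      field_simp at h1
      linear_combination h1
    have h3 : w ^ d = w * w ^ (d - 1) := by rw [← pow_succ', Nat.sub_add_cancel (by omega)]
    have h4 : (w ^ 2 - 1) = w * (w - w⁻¹) := by
      field_simp
    rw [h4, mul_comm 2 d, pow_mul, h3]
    have hββ : β * β⁻¹ = 1 := mul_inv_cancel₀ hβ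
    linear_combination (w * w ^ (d - 1)) ^ 2 * β⁻¹ ^ 2 * h2 +
      (w * w ^ (d - 1)) ^ 2 * (β * β⁻¹ + 1) * (4 + δ ^ 2 * (w - w⁻¹) ^ 2 * y' ^ 2) * hββ
  have h4 : (4 : L) ≠ 0 := by exact_mod_cast (by norm_num : (4 : ℕ) ≠ 0)
  obtain ⟨u, u', huu, hu⟩ : ∃ u u' : L, u * u' = 4 ∧ a + b = C u + C u' * X ^ (2 * d) := by
    have hdvd : a ∣ X ^ (2 * d) := by
      rw [← (isUnit_C.2 h4.isUnit).dvd_mul_left (a := a), ← hab]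
      exact dvd_mul_right _ _
    obtain ⟨i, hi, hassoc⟩ := (dvd_prime_pow prime_X _).1 hdvd
    obtain ⟨v, hv⟩ := hassoc.symm
    obtain ⟨u, hu, huv⟩ := Polynomial.isUnit_iff.1 v.isUnit
    rw [← huv] at hv
    have hu0 : u ≠ 0 := hu.ne_zero
    obtain ⟨l, hl⟩ := Nat.exists_eq_add_of_le hi
    have hbv : b = C (4 / u) * X ^ l := by
      refine mul_left_cancel₀ (a := a) (fun h0 => ?_) ?_
      · rw [h0, zero_mul] at hab
        exact mul_ne_zero (C_ne_zero.2 h4) (pow_ne_zero _ X_ne_zero) hab.symm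
      · rw [hab, ← hv, hl, pow_add]
        have : (C 4 : L[X]) = C u * C (4 / u) := by rw [← C_mul, mul_div_cancel₀ _ hu0]
        rw [this]
        ring
    have hQab : a + b = 2 * Q := by rw [ha, hb]; ring
    have h00 : (a + b).eval 0 ≠ 0 := by
      rw [hQab, eval_mul]
      exact mul_ne_zero (by simp) hQ0'
    rcases Nat.eq_zero_or_pos i with rfl | hi0
    · refine ⟨u, 4 / u, mul_div_cancel₀ _ hu0, ?_⟩
      rw [hbv, ← hv, pow_zero, one_mul, hl, zero_add]
    · rcases Nat.eq_zero_or_pos l with rfl | hl0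
      · refine ⟨4 / u, u, div_mul_cancel₀ _ hu0, ?_⟩
        rw [hbv, ← hv, pow_zero, mul_one, hl, add_zero]
        ring
      · refine absurd ?_ h00
        rw [hbv, ← hv]
        simp [hi0.ne', hl0.ne']
  have hQab : a + b = 2 * Q := by rw [ha, hb]; ring
  have hy : ∀ w ≠ 0, 2 * (w ^ d * (β⁻¹ * (h.eval (α + β * (w + w⁻¹)) - α))) = u + u' * w ^ (2 * d) := by
    intro w hw
    have h1 := congrArg (eval w) (hQab.symm.trans hu)
    simp only [eval_mul, eval_add, eval_pow, eval_X, eval_C, eval_ofNat, hQ w hw, eval_sub] at h1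
    exact h1
  have hu' : u' = u := by
    have h1 := hy 2 two_ne_zero
    have h2 := hy 2⁻¹ (inv_ne_zero two_ne_zero)
    rw [inv_inv, add_comm (2⁻¹ : L) 2] at h2
    set y := β⁻¹ * (h.eval (α + β * (2 + 2⁻¹)) - α)
    rw [mul_comm 2 d, pow_mul] at h1 h2
    rw [inv_pow] at h2
    have h5 : ((2 : L) ^ d) ^ 2 ≠ 1 := by
      have : ((2 ^ d) ^ 2 : ℕ) ≠ 1 := by
        rw [← pow_mul]
        exact (Nat.one_lt_two_pow (by omega)).ne'
      exact_mod_cast this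
    have h6 : (2 : L) ^ d ≠ 0 := pow_ne_zero _ two_ne_zero
    field_simp at h2
    have h7 : (u' - u) * (((2 : L) ^ d) ^ 2 - 1) = 0 := by linear_combination h2 - h1
    exact sub_eq_zero.1 ((mul_eq_zero.1 h7).resolve_right (sub_ne_zero.2 h5))
  refine ⟨α, β, u / 2, hβ, by rw [hu'] at huu; linear_combination huu / 4, fun w hw => ?_⟩
  have h1 := hy w hw
  have hw' : w ^ d ≠ 0 := pow_ne_zero _ hw
  rw [hu', mul_comm 2 d, pow_mul] at h1
  field_simp at h1 ⊢
  linear_combination h1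

theorem Polynomial.exists_isSpecial_iterate [CharZero L] [IsAlgClosed L] {e h : L[X]} {c : L} {D : ℕ} (hD : D ≠ 0)
    (hh : 2 ≤ h.natDegree) (he : e ≠ 0) (hc : c ≠ 0) (H : C c * e.comp h = e * derivative h ^ D) :
    ∃ N ≥ 1, ∃ D' α β s, (h.comp^[N] X).IsSpecial D' α β s := by
  set d := h.natDegree with hd
  rcases eq_power_or_chebyshev hD hh he hc H with ⟨a, z, ha, hz⟩ | ⟨z₁, z₂, r, hz, hr, hcheb⟩
  · obtain ⟨β, hβ⟩ := IsAlgClosed.exists_pow_nat_eq a⁻¹ (n := d - 1) (by omega)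
    have hβ0 : β ≠ 0 := fun h0 => by
      rw [h0, zero_pow (by omega)] at hβ
      exact inv_ne_zero ha hβ.symm
    refine ⟨1, le_rfl, d, z, β, 0, hh, hβ0, Or.inl rfl, fun w _ => ?_⟩
    have h1 : a * β ^ d = β := by
      rw [← Nat.sub_add_cancel (show 1 ≤ d by omega), pow_succ, hβ, ← mul_assoc, mul_inv_cancel₀ ha, one_mul]
    rw [Function.iterate_one, comp_X, hz, ← hd]
    simp only [eval_add, eval_mul, eval_pow, eval_sub, eval_X, eval_C, zero_mul, add_zero, add_sub_cancel_left]
    rw [mul_pow, ← mul_assoc, h1, add_comm]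
  · obtain ⟨α, β, ε, hβ, hε, hw⟩ := eval_eq_of_chebyshev hh hz hr hcheb
    rw [← hd] at hw
    rcases sq_eq_one_iff.1 hε with rfl | rfl
    · refine ⟨1, le_rfl, d, α, β, 1, hh, hβ, Or.inr rfl, fun w hw0 => ?_⟩
      rw [Function.iterate_one, comp_X, one_mul, hw w hw0]
      ring
    · have hneg : ∀ w : L, α + β * (-w + (-w)⁻¹) = α + -1 * β * (w + w⁻¹) := fun w => by
        rw [inv_neg]
        ring
      rcases Nat.even_or_odd d with hev | hodd
      · refine ⟨1, le_rfl, d, α, -1 * β, 1, hh, by simpa using hβ, Or.inr rfl, fun w hw0 => ?_⟩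
        rw [Function.iterate_one, comp_X, one_mul, one_mul, ← hneg, hw _ (neg_ne_zero.2 hw0), hev.neg_pow]
      · refine ⟨2, one_le_two, d ^ 2, α, β, 1, by nlinarith, hβ, Or.inr rfl, fun w hw0 => ?_⟩
        rw [Function.iterate_succ_apply', Function.iterate_one, comp_X, eval_comp, one_mul, one_mul, hw w hw0, ← hneg,
          hw _ (neg_ne_zero.2 (pow_ne_zero _ hw0)), hodd.neg_pow, ← pow_mul, ← sq, inv_neg]
        ring

end

end

section

section

variable {F : Type*} [Field F]

/-- Raising to a power prime to the residue characteristic is an isometry on open unit residue discs. -/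
theorem AbsoluteValue.pow_sub_pow_eq {W : AbsoluteValue F ℝ} (hW : IsNonarchimedean W) {x y : F} (hx : W x ≤ 1)
    (hy : W y = 1) (hxy : W (x - y) < 1) {r : ℕ} (hr : W (r : F) = 1) : W (x ^ r - y ^ r) = W (x - y) := by
  have hle : ∀ i, W (x ^ i - y ^ i) ≤ W (x - y) := fun i => by
    rw [← geom_sum₂_mul, map_mul]
    refine mul_le_of_le_one_left (W.nonneg _) (AbsoluteValue.sum_le_of_nonarchimedean hW _ _ 1 zero_le_one
      fun j _ => ?_)
    rw [map_mul, map_pow, map_pow, hy, one_pow, mul_one]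
    exact pow_le_one₀ (W.nonneg _) hx
  have hS : W (∑ i ∈ Finset.range r, x ^ i * y ^ (r - 1 - i)) = 1 := by
    have h1 : ∑ i ∈ Finset.range r, x ^ i * y ^ (r - 1 - i) =
        ∑ i ∈ Finset.range r, (x ^ i - y ^ i) * y ^ (r - 1 - i) + r * y ^ (r - 1) := by
      have h0 : (r : F) * y ^ (r - 1) = ∑ _i ∈ Finset.range r, y ^ (r - 1) := by
        rw [Finset.sum_const, Finset.card_range, nsmul_eq_mul]
      rw [h0, ← Finset.sum_add_distrib]
      refine Finset.sum_congr rfl fun i hi => ?_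
      have := Finset.mem_range.1 hi
      rw [sub_mul, ← pow_add, show i + (r - 1 - i) = r - 1 by omega, sub_add_cancel]
    have h2 : W (r * y ^ (r - 1)) = 1 := by rw [map_mul, hr, map_pow, hy, one_pow, mul_one]
    rw [h1, ← h2]
    refine AbsoluteValue.add_eq_right_of_lt hW (lt_of_le_of_lt ?_ (h2 ▸ hxy))
    refine AbsoluteValue.sum_le_of_nonarchimedean hW _ _ _ (W.nonneg _) fun j _ => ?_
    rw [map_mul, map_pow, hy, one_pow, mul_one]
    exact hle j
  rw [← geom_sum₂_mul, map_mul, hS, one_mul]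

namespace ProductFormulaFamily

open Filter

variable {K : Type} [Field K] (M : ProductFormulaFamily K)

theorem eventually_pow_sub_lower_bound [CharZero K] {u ζ : AlgebraicClosure K} {D : ℕ} (hD : D ≠ 0) (hu : u ≠ 0)
    (hζ : IsOfFinOrder ζ) (hne : ∀ q : ℕ, u ^ D ^ q ≠ ζ) :
    ∀ᶠ i in cofinite, ∃ δ > 0, ∀ q : ℕ, δ ≤ M.ext i (u ^ D ^ q - ζ) := by
  have : CharZero (AlgebraicClosure K) := charZero_of_injective_algebraMap (algebraMap K _).injective
  obtain ⟨n, hn, hζn⟩ := isOfFinOrder_iff_pow_eq_one.1 hζ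
  have hsep : ∀ᶠ i in cofinite, ∀ a ∈ Finset.range n, ζ ^ a = ζ ∨ M.ext i (ζ ^ a - ζ) = 1 := by
    rw [Filter.eventually_all_finset]
    intro a _
    by_cases h : ζ ^ a = ζ
    · exact Eventually.of_forall fun _ => Or.inl h
    · exact (M.eventually_ext_eq_one (sub_ne_zero.2 h)).mono fun i hi => Or.inr hi
  filter_upwards [hsep, M.eventually_ext_eq_one hu,
    M.eventually_ext_eq_one (Nat.cast_ne_zero.2 hD : (D : AlgebraicClosure K) ≠ 0)] with i hi hui hDi
  have hW := M.ext_nonarch i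
  have hζ1 : M.ext i ζ = 1 := by
    have := congrArg (M.ext i) hζn
    rw [map_pow, map_one] at this
    exact (pow_eq_one_iff_of_nonneg ((M.ext i).nonneg _) hn.ne').1 this
  by_cases hclose : ∃ q : ℕ, M.ext i (u ^ D ^ q - ζ) < 1
  · obtain ⟨q₀, hq₀⟩ := hclose
    have key : ∀ q r : ℕ, M.ext i (u ^ D ^ q - ζ) < 1 → M.ext i (u ^ D ^ (q + r) - ζ) < 1 →
        M.ext i (u ^ D ^ (q + r) - ζ) = M.ext i (u ^ D ^ q - ζ) := by
      intro q r h1 h2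
      have h3 : M.ext i ((u ^ D ^ q) ^ D ^ r - ζ ^ D ^ r) = M.ext i (u ^ D ^ q - ζ) :=
        AbsoluteValue.pow_sub_pow_eq hW (by rw [map_pow, hui, one_pow]) hζ1 h1
          (by rw [Nat.cast_pow, map_pow, hDi, one_pow])
      rw [← pow_mul, ← pow_add] at h3
      have h4 : ζ ^ D ^ r = ζ := by
        have h5 : ζ ^ D ^ r = ζ ^ (D ^ r % n) := (pow_mod_orderOf ζ _).symm.trans (by
          rw [← pow_mod_orderOf ζ (D ^ r % n), Nat.mod_mod_of_dvd _ (orderOf_dvd_of_pow_eq_one hζn)])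
        rw [h5]
        refine (hi _ (Finset.mem_range.2 (Nat.mod_lt _ hn))).resolve_right fun h6 => ?_
        rw [← h5] at h6
        have h7 := hW (u ^ D ^ (q + r) - ζ) (-(u ^ D ^ (q + r) - ζ ^ D ^ r))
        rw [(M.ext i).map_neg, h3, show u ^ D ^ (q + r) - ζ + -(u ^ D ^ (q + r) - ζ ^ D ^ r) = ζ ^ D ^ r - ζ by ring,
          h6] at h7
        exact absurd h7 (not_le.2 (max_lt h2 h1))
      rwa [h4] at h3
    refine ⟨M.ext i (u ^ D ^ q₀ - ζ), (M.ext i).pos (sub_ne_zero.2 (hne _)), fun q => ?_⟩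
    by_cases hq : M.ext i (u ^ D ^ q - ζ) < 1
    · rcases le_total q₀ q with h | h
      · obtain ⟨r, rfl⟩ := Nat.exists_eq_add_of_le h
        exact (key _ _ hq₀ hq).ge
      · obtain ⟨r, rfl⟩ := Nat.exists_eq_add_of_le h
        exact (key _ _ hq hq₀).le
    · exact hq₀.le.trans (not_lt.1 hq)
  · push Not at hclose
    exact ⟨1, one_pos, hclose⟩

theorem eventually_eval_pow_lower_bound [CharZero K] {u : AlgebraicClosure K} {D : ℕ} (hD : D ≠ 0) (hu : u ≠ 0)
    {e : (AlgebraicClosure K)[X]} (he : ∀ ζ, e.eval ζ = 0 → IsOfFinOrder ζ) (hne : ∀ q : ℕ, e.eval (u ^ D ^ q) ≠ 0) :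
    ∀ᶠ i in cofinite, ∃ δ > 0, ∀ q : ℕ, δ ≤ M.ext i (e.eval (u ^ D ^ q)) := by
  classical
  have he0 : e ≠ 0 := fun h => hne 0 (by rw [h, eval_zero])
  have hprod := (IsAlgClosed.splits e).eq_prod_roots
  have hroots : ∀ᶠ i in cofinite, ∀ ζ ∈ e.roots.toFinset, ∃ δ > 0, ∀ q : ℕ, δ ≤ M.ext i (u ^ D ^ q - ζ) := by
    rw [Filter.eventually_all_finset]
    intro ζ hζ
    have hζ0 : e.eval ζ = 0 := (mem_roots he0).1 (Multiset.mem_toFinset.1 hζ)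
    exact M.eventually_pow_sub_lower_bound hD hu (he ζ hζ0) fun q h => hne q (h ▸ hζ0)
  filter_upwards [hroots, M.eventually_ext_eq_one (leadingCoeff_ne_zero.2 he0)] with i hi hl
  have hms : ∀ s : Multiset (AlgebraicClosure K), (∀ ζ ∈ s, ζ ∈ e.roots.toFinset) →
      ∃ δ > 0, ∀ q : ℕ, δ ≤ M.ext i ((s.map fun a => X - C a).prod.eval (u ^ D ^ q)) := by
    intro s
    induction s using Multiset.induction_on with
    | empty => exact fun _ => ⟨1, one_pos, fun q => by simp⟩
    | cons ζ s ih =>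
      intro hs
      obtain ⟨δ, hδ, h⟩ := ih fun x hx => hs x (Multiset.mem_cons_of_mem hx)
      obtain ⟨δ', hδ', h'⟩ := hi ζ (hs ζ (Multiset.mem_cons_self _ _))
      refine ⟨δ' * δ, mul_pos hδ' hδ, fun q => ?_⟩
      rw [Multiset.map_cons, Multiset.prod_cons, eval_mul, map_mul, eval_sub, eval_X, eval_C]
      exact mul_le_mul (h' q) (h q) hδ.le ((M.ext i).nonneg _)
  obtain ⟨δ, hδ, h⟩ := hms e.roots fun ζ hζ => Multiset.mem_toFinset.2 hζ
  refine ⟨δ, hδ, fun q => ?_⟩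
  rw [hprod, eval_mul, eval_C, map_mul, hl, one_mul]
  exact h q

end ProductFormulaFamily

end

end

section

namespace MvPolynomial

variable {σ L : Type} [Field L]

/-- The endomorphism scaling the variables. -/
noncomputable def scaleHom (s : σ → L) : MvPolynomial σ L →ₐ[L] MvPolynomial σ L :=
  MvPolynomial.aeval fun j => MvPolynomial.C (s j) * MvPolynomial.X j

theorem scaleHom_monomial (s : σ → L) (α : σ →₀ ℕ) (c : L) :
    scaleHom s (monomial α c) = monomial α ((α.prod fun j m => s j ^ m) * c) := by
  rw [scaleHom, aeval_monomial, algebraMap_eq, monomial_eq, Finsupp.prod, Finsupp.prod, Finsupp.prod]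
  simp_rw [mul_pow, Finset.prod_mul_distrib, ← map_pow]
  rw [← map_prod, map_mul]
  ring

theorem coeff_scaleHom (s : σ → L) (E : MvPolynomial σ L) (α : σ →₀ ℕ) :
    (scaleHom s E).coeff α = (α.prod fun j m => s j ^ m) * E.coeff α := by
  induction E using MvPolynomial.induction_on' with
  | monomial β c =>
    classical
    rw [scaleHom_monomial, coeff_monomial, coeff_monomial]
    split_ifs with h
    · rw [h]
    · rw [mul_zero]
  | add p q hp hq => rw [map_add, MvPolynomial.coeff_add, hp, hq, MvPolynomial.coeff_add, mul_add]

theorem scaleHom_scaleHom_inv {s : σ → L} (hs : ∀ j, s j ≠ 0) (E : MvPolynomial σ L) :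
    scaleHom s (scaleHom s⁻¹ E) = E := by
  ext α
  rw [coeff_scaleHom, coeff_scaleHom, ← mul_assoc, ← Finsupp.prod_mul]
  refine (congrArg (· * _) (Finset.prod_eq_one fun j _ => ?_)).trans (one_mul _)
  change s j ^ α j * (s j)⁻¹ ^ α j = 1
  rw [← mul_pow, mul_inv_cancel₀ (hs _), one_pow]

theorem prime_scaleHom {s : σ → L} (hs : ∀ j, s j ≠ 0) {E : MvPolynomial σ L} (hE : Prime E) :
    Prime (scaleHom s E) := by
  have h2 : ∀ x, scaleHom s⁻¹ (scaleHom s x) = x := fun x => by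
    have := scaleHom_scaleHom_inv (s := s⁻¹) (fun j => inv_ne_zero (hs j)) x
    rwa [inv_inv] at this
  exact (MulEquiv.prime_iff ({ scaleHom s with
    invFun := scaleHom s⁻¹
    left_inv := h2
    right_inv := scaleHom_scaleHom_inv hs } : MvPolynomial σ L ≃* MvPolynomial σ L)).2 hE

theorem support_scaleHom {s : σ → L} (hs : ∀ j, s j ≠ 0) (E : MvPolynomial σ L) :
    (scaleHom s E).support = E.support := by
  ext α
  rw [mem_support_iff, mem_support_iff, coeff_scaleHom, mul_ne_zero_iff, and_iff_right]
  exact Finset.prod_ne_zero_iff.2 fun j _ => pow_ne_zero _ (hs j)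

theorem degreeOf_scaleHom {s : σ → L} (hs : ∀ j, s j ≠ 0) (E : MvPolynomial σ L) (l : σ) :
    (scaleHom s E).degreeOf l = E.degreeOf l := by
  rw [degreeOf_eq_sup, degreeOf_eq_sup, support_scaleHom hs]

theorem scaleHom_expand {s : σ → L} {N : ℕ} (hs : ∀ j, s j ^ N = 1) (G : MvPolynomial σ L) :
    scaleHom s (expand N G) = expand N G := by
  refine DFunLike.congr_fun (f := (scaleHom s).comp (expand N)) (g := expand N) ?_ G
  refine algHom_ext fun j => ?_
  rw [AlgHom.comp_apply, expand_X, map_pow, scaleHom, MvPolynomial.aeval_X, mul_pow, ← map_pow, hs, map_one, one_mul]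

theorem degreeOf_expand_le {N : ℕ} (hN : N ≠ 0) (G : MvPolynomial σ L) (l : σ) :
    (expand N G).degreeOf l ≤ N * G.degreeOf l := by
  classical
  refine degreeOf_le_iff.2 fun m hm => ?_
  rw [support_expand _ hN] at hm
  obtain ⟨m', hm', rfl⟩ := Finset.mem_image.1 hm
  exact Nat.mul_le_mul_left _ (degreeOf_le_iff.1 le_rfl m' hm')

/-- A prime polynomial dividing polynomials in arbitrarily high powers of the variables has support on a line. -/
theorem minor_eq_zero_of_dvd_expand [Fintype σ] [CharZero L] [IsAlgClosed L] {E Γ : MvPolynomial σ L} (hE : Prime E)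
    (hΓ : Γ ≠ 0) (H : ∀ B : ℕ, ∃ N > B, E ∣ expand N Γ) {α α' α'' : σ →₀ ℕ} (hα : α ∈ E.support)
    (hα' : α' ∈ E.support) (hα'' : α'' ∈ E.support) (l k : σ) :
    ((α' l : ℤ) - α l) * (α'' k - α k) - (α' k - α k) * (α'' l - α l) = 0 := by
  classical
  by_contra hΔ
  have hlk : l ≠ k := by
    rintro rfl
    exact hΔ (by ring)
  set Δ := ((α' l : ℤ) - α l) * (α'' k - α k) - (α' k - α k) * (α'' l - α l) with hΔdef
  have hd : 1 ≤ E.degreeOf l := by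
    by_contra h
    have h0 : ∀ β ∈ E.support, β l = 0 := fun β hβ => by
      have := degreeOf_le_iff.1 (le_refl (E.degreeOf l)) β hβ
      omega
    exact hΔ (by rw [hΔdef, h0 _ hα, h0 _ hα', h0 _ hα'']; ring)
  obtain ⟨N, hN, hdvd⟩ := H (Δ.natAbs * (2 * Δ.natAbs * Γ.degreeOf l + 1))
  have hΔ0 : 0 < Δ.natAbs := Int.natAbs_pos.2 hΔ
  have hN0 : N ≠ 0 := by omega
  have : NeZero (N : L) := ⟨Nat.cast_ne_zero.2 hN0⟩
  have : NeZero N := ⟨hN0⟩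
  obtain ⟨ζ, hζ⟩ := HasEnoughRootsOfUnity.exists_primitiveRoot L N
  have hζ0 : ζ ≠ 0 := hζ.ne_zero hN0
  set M := N / Δ.natAbs with hM
  let w : ℕ × ℕ → σ → ℕ := fun ab j => ab.1 * (if j = l then 1 else 0) + ab.2 * (if j = k then 1 else 0)
  let s : ℕ × ℕ → σ → L := fun ab j => ζ ^ w ab j
  have hs0 : ∀ ab j, s ab j ≠ 0 := fun ab j => pow_ne_zero _ hζ0
  have hsprod : ∀ ab (β : σ →₀ ℕ), (β.prod fun j m => s ab j ^ m) = ζ ^ (ab.1 * β l + ab.2 * β k) := by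
    intro ab β
    rw [Finsupp.prod_fintype _ _ fun j => pow_zero _]
    simp_rw [s, ← pow_mul]
    rw [Finset.prod_pow_eq_pow_sum]
    congr 1
    simp [w, add_mul, Finset.sum_add_distrib]
  have hprod : ∏ ab ∈ Finset.range M ×ˢ Finset.range M, scaleHom (s ab) E ∣ expand N Γ := by
    refine Finset.prod_dvd_of_isRelPrime ?_ fun ab _ => ?_
    · intro ab hab ab' hab' hne
      rw [Function.onFun, (prime_scaleHom (hs0 ab) hE).irreducible.isRelPrime_iff_not_dvd,
        (prime_scaleHom (hs0 ab) hE).dvd_prime_iff_associated (prime_scaleHom (hs0 ab') hE)]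
      rintro ⟨u, hu⟩
      obtain ⟨c, hc, hcu⟩ := (MvPolynomial.isUnit_iff_eq_C_of_isReduced).1 u.isUnit
      have hcoef : ∀ β ∈ E.support, ζ ^ ((ab.1 : ℤ) * β l + ab.2 * β k) * c = ζ ^ ((ab'.1 : ℤ) * β l + ab'.2 * β k) := by
        intro β hβ
        have h1 := congrArg (MvPolynomial.coeff β) hu
        rw [hcu, mul_comm _ (MvPolynomial.C c), MvPolynomial.coeff_C_mul, coeff_scaleHom, coeff_scaleHom, hsprod, hsprod,
            ← mul_assoc, mul_comm c] at h1
        have h2 := mul_right_cancel₀ (mem_support_iff.1 hβ) h1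
        exact_mod_cast h2
      have hdiff : ∀ β ∈ E.support, (N : ℤ) ∣ ((ab.1 : ℤ) - ab'.1) * (β l - α l) + (ab.2 - ab'.2) * (β k - α k) := by
        intro β hβ
        rw [← hζ.zpow_eq_one_iff_dvd]
        have h1 := hcoef β hβ
        have h2 := hcoef α hα
        have hz : ∀ m : ℤ, ζ ^ m ≠ 0 := fun m => zpow_ne_zero _ hζ0
        rw [show ((ab.1 : ℤ) - ab'.1) * (β l - α l) + (ab.2 - ab'.2) * (β k - α k) =
          ((ab.1 : ℤ) * β l + ab.2 * β k) + (ab'.1 * α l + ab'.2 * α k) - (ab.1 * α l + ab.2 * α k) -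
            (ab'.1 * β l + ab'.2 * β k) by ring, zpow_sub₀ hζ0, zpow_sub₀ hζ0, zpow_add₀ hζ0, ← h1, ← h2]
        have := hz (ab.1 * α l + ab.2 * α k)
        have := hz (ab.1 * β l + ab.2 * β k)
        have hc0 := hc.ne_zero
        field_simp
      have h1 := hdiff α' hα'
      have h2 := hdiff α'' hα''
      have h3 : (N : ℤ) ∣ ((ab.1 : ℤ) - ab'.1) * Δ := by
        have := (h1.mul_right (α'' k - α k)).sub (h2.mul_right (α' k - α k)) |>.trans (dvd_of_eq
          (show _ = ((ab.1 : ℤ) - ab'.1) * Δ by rw [hΔdef]; ring))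
        exact this
      have h4 : (N : ℤ) ∣ ((ab.2 : ℤ) - ab'.2) * Δ := by
        have := (h2.mul_right (α' l - α l)).sub (h1.mul_right (α'' l - α l)) |>.trans (dvd_of_eq
          (show _ = ((ab.2 : ℤ) - ab'.2) * Δ by rw [hΔdef]; ring))
        exact this
      have key : ∀ a b : ℕ, a < M → b < M → (N : ℤ) ∣ ((a : ℤ) - b) * Δ → a = b := by
        intro a b ha hb h
        by_contra hab
        have h5 : N ≤ ((a : ℤ) - b).natAbs * Δ.natAbs := by
          rw [← Int.natAbs_mul]
          exact Nat.le_of_dvd (Int.natAbs_pos.2 (mul_ne_zero (sub_ne_zero.2 (Nat.cast_injective.ne hab)) hΔ))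
            (Int.natCast_dvd.1 h)
        have h6 : ((a : ℤ) - b).natAbs < M := by omega
        have h7 := Nat.mul_lt_mul_of_pos_right h6 hΔ0
        exact absurd (h5.trans_lt h7) (not_lt.2 (Nat.div_mul_le_self N Δ.natAbs))
      have hm := Finset.mem_product.1 (Finset.mem_coe.1 hab)
      have hm' := Finset.mem_product.1 (Finset.mem_coe.1 hab')
      exact hne (Prod.ext (key _ _ (Finset.mem_range.1 hm.1) (Finset.mem_range.1 hm'.1) h3)
        (key _ _ (Finset.mem_range.1 hm.2) (Finset.mem_range.1 hm'.2) h4))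
    · rw [← scaleHom_expand (s := s ab) (N := N) (fun j => ?_) Γ]
      · exact map_dvd _ hdvd
      · rw [← pow_mul, mul_comm, pow_mul, hζ.pow_eq_one, one_pow]
  have hexp0 : expand N Γ ≠ 0 := (map_ne_zero_iff _ (expand_injective (Nat.pos_of_ne_zero hN0))).2 hΓ
  obtain ⟨R, hR⟩ := hprod
  have hdeg : (∏ ab ∈ Finset.range M ×ˢ Finset.range M, scaleHom (s ab) E).degreeOf l ≤
      (expand N Γ).degreeOf l := by
    rw [hR] at hexp0 ⊢
    rw [degreeOf_mul_eq (left_ne_zero_of_mul hexp0) (right_ne_zero_of_mul hexp0)]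
    exact Nat.le_add_right _ _
  rw [degreeOf_prod_eq _ _ fun ab _ => (prime_scaleHom (hs0 ab) hE).ne_zero,
    Finset.sum_congr rfl fun ab _ => degreeOf_scaleHom (hs0 ab) E l, Finset.sum_const, Finset.card_product,
    Finset.card_range, smul_eq_mul] at hdeg
  have hle : M * M ≤ N * Γ.degreeOf l :=
    (Nat.le_mul_of_pos_right _ hd).trans (hdeg.trans (degreeOf_expand_le hN0 Γ l))
  have hM1 : 2 * Δ.natAbs * Γ.degreeOf l + 1 ≤ M :=
    (Nat.le_div_iff_mul_le hΔ0).2 (by rw [mul_comm]; exact hN.le)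
  have hNM : N < (M + 1) * Δ.natAbs := by
    rw [hM, mul_comm]; exact Nat.lt_mul_div_succ N hΔ0
  nlinarith [Nat.zero_le (Γ.degreeOf l)]

end MvPolynomial

end

section

namespace MvPolynomial

variable {σ L : Type} [Fintype σ] [Field L]

/-- The univariate polynomial parametrizing a polynomial with support on a line. -/
noncomputable def lineSection (E : MvPolynomial σ L) (α : σ →₀ ℕ) (l : σ) : L[X] :=
  ∑ β ∈ E.support, Polynomial.C (E.coeff β) * Polynomial.X ^ (β l - α l)

theorem eval_pow_eq_lineSection {E : MvPolynomial σ L} {α α' : σ →₀ ℕ} {l : σ} (hl : α l < α' l)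
    (hmin : ∀ β ∈ E.support, α l ≤ β l)
    (hline : ∀ β ∈ E.support, ∀ k, ((α' l : ℤ) - α l) * (β k - α k) = (α' k - α k) * (β l - α l))
    {ω : σ → L} (hω : ∀ j, ω j ≠ 0) :
    MvPolynomial.eval (fun j => ω j ^ (α' l - α l)) E =
      (∏ j, ω j ^ ((α' l - α l) * α j)) * (lineSection E α l).eval (∏ j, ω j ^ ((α' j : ℤ) - α j)) := by
  rw [MvPolynomial.eval_eq', lineSection, eval_finsetSum, Finset.mul_sum]
  refine Finset.sum_congr rfl fun β hβ => ?_
  rw [Polynomial.eval_mul, Polynomial.eval_C, Polynomial.eval_pow, Polynomial.eval_X, mul_left_comm, ← Finset.prod_pow,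
    ← Finset.prod_mul_distrib]
  congr 1
  refine Finset.prod_congr rfl fun j _ => ?_
  rw [← pow_mul, ← zpow_natCast, ← zpow_natCast, ← zpow_natCast, ← zpow_mul, ← zpow_add₀ (hω j)]
  congr 1
  have := hline β hβ j
  push_cast [Nat.cast_sub hl.le, Nat.cast_sub (hmin β hβ)]
  linear_combination this

theorem eq_zero_of_forall_eval_eq_zero [Infinite L] {G : MvPolynomial σ L} (a : L)
    (h : ∀ x : σ → L, (∀ j, x j ≠ a) → MvPolynomial.eval x G = 0) : G = 0 := by
  have h1 : G * ∏ j, Polynomial.aeval (MvPolynomial.X j) (Polynomial.X - Polynomial.C a) = 0 := by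
    refine MvPolynomial.funext fun x => ?_
    rw [map_mul, map_prod, map_zero]
    by_cases hx : ∀ j, x j ≠ a
    · rw [h x hx, zero_mul]
    · push Not at hx
      obtain ⟨j, hj⟩ := hx
      rw [Finset.prod_eq_zero (Finset.mem_univ j) (by
        rw [ProductFormulaFamily.eval_aeval_X, Polynomial.eval_sub, Polynomial.eval_X, Polynomial.eval_C, hj, sub_self]),
        mul_zero]
  exact (mul_eq_zero.1 h1).resolve_right (Finset.prod_ne_zero_iff.2 fun j _ =>
    aeval_X_ne_zero j (Polynomial.X_sub_C_ne_zero a))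

theorem isOfFinOrder_of_eval_lineSection_eq_zero [CharZero L] [IsAlgClosed L] {E Γ : MvPolynomial σ L} (hΓ : Γ ≠ 0)
    {D : ℕ} (hD : 2 ≤ D) (H : ∀ t : ℕ, 1 ≤ t → E ∣ expand (D ^ t) Γ) {α α' : σ →₀ ℕ} {l : σ} (hl : α l < α' l)
    (hmin : ∀ β ∈ E.support, α l ≤ β l)
    (hline : ∀ β ∈ E.support, ∀ k, ((α' l : ℤ) - α l) * (β k - α k) = (α' k - α k) * (β l - α l))
    {ρ : L} (hρ0 : ρ ≠ 0) (hρ : (lineSection E α l).eval ρ = 0) : IsOfFinOrder ρ := by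
  classical
  by_contra hord
  refine hΓ (eq_zero_of_forall_eval_eq_zero 0 fun x hx => ?_)
  set d := α' l - α l with hd
  have hd0 : d ≠ 0 := by omega
  have hdZ : (d : ℤ) = (α' l : ℤ) - α l := by omega
  obtain ⟨t, ht⟩ : ∃ t : σ → L, ∀ j, t j ^ (d * d) = x j :=
    Classical.skolem.1 fun j => IsAlgClosed.exists_pow_nat_eq (x j) (Nat.pos_of_ne_zero (mul_ne_zero hd0 hd0))
  have ht0 : ∀ j, t j ≠ 0 := fun j h => hx j (by rw [← ht j, h, zero_pow (mul_ne_zero hd0 hd0)])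
  obtain ⟨ρ', hρ'⟩ := IsAlgClosed.exists_pow_nat_eq ρ (Nat.pos_of_ne_zero hd0)
  have hρ'0 : ρ' ≠ 0 := fun h => hρ0 (by rw [← hρ', h, zero_pow hd0])
  set c : L := (∏ j ∈ Finset.univ.erase l, t j ^ (-((α' j : ℤ) - α j))) ^ d with hc
  have hc0 : c ≠ 0 := pow_ne_zero _ (Finset.prod_ne_zero_iff.2 fun j _ => zpow_ne_zero _ (ht0 j))
  have hev : ∀ n : ℕ, MvPolynomial.eval (Function.update x l (ρ ^ D ^ (n + 1) * c)) Γ = 0 := by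
    intro n
    have hN : D ^ (n + 1) ≠ 0 := pow_ne_zero _ (by omega)
    obtain ⟨s, hs⟩ : ∃ s : σ → L, ∀ j, s j ^ D ^ (n + 1) = t j :=
      Classical.skolem.1 fun j => IsAlgClosed.exists_pow_nat_eq (t j) (Nat.pos_of_ne_zero hN)
    have hs0 : ∀ j, s j ≠ 0 := fun j h => ht0 j (by rw [← hs j, h, zero_pow hN])
    set z : L := ρ' * ∏ j ∈ Finset.univ.erase l, s j ^ (-((α' j : ℤ) - α j)) with hz
    have hz0 : z ≠ 0 := mul_ne_zero hρ'0 (Finset.prod_ne_zero_iff.2 fun j _ => zpow_ne_zero _ (hs0 j))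
    let ω : σ → L := Function.update (fun j => s j ^ d) l z
    have hωl : ω l = z := Function.update_self ..
    have hωj : ∀ j, j ≠ l → ω j = s j ^ d := fun j hj => Function.update_of_ne hj ..
    have hω : ∀ j, ω j ≠ 0 := fun j => by
      by_cases hj : j = l
      · rw [hj, hωl]; exact hz0
      · rw [hωj j hj]; exact pow_ne_zero _ (hs0 j)
    have hu : ∏ j, ω j ^ ((α' j : ℤ) - α j) = ρ := by
      rw [← Finset.mul_prod_erase _ _ (Finset.mem_univ l), hωl, ← hdZ, zpow_natCast, hz, mul_pow, hρ',
        mul_assoc, ← Finset.prod_pow, ← Finset.prod_mul_distrib, Finset.prod_eq_one, mul_one]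
      intro j hj
      rw [hωj j (Finset.ne_of_mem_erase hj), ← zpow_natCast, ← zpow_natCast, ← zpow_mul, ← zpow_mul,
        ← zpow_add₀ (hs0 j)]
      have h0 : (-((α' j : ℤ) - α j)) * d + d * ((α' j : ℤ) - α j) = 0 := by ring
      rw [h0, zpow_zero]
    obtain ⟨R, hR⟩ := H (n + 1) (by omega)
    have h1 := congrArg (MvPolynomial.eval fun j => ω j ^ d) hR
    rw [map_mul, eval_pow_eq_lineSection hl hmin hline hω, hu, hρ, mul_zero, zero_mul, eval_expand] at h1
    rw [← h1]
    congr 2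
    funext j
    by_cases hj : j = l
    · have h2 : (∏ j ∈ Finset.univ.erase l, s j ^ (-((α' j : ℤ) - α j))) ^ D ^ (n + 1) =
          ∏ j ∈ Finset.univ.erase l, t j ^ (-((α' j : ℤ) - α j)) := by
        rw [← Finset.prod_pow]
        refine Finset.prod_congr rfl fun k _ => ?_
        rw [← hs k, ← zpow_natCast, ← zpow_natCast, ← zpow_mul, ← zpow_mul, mul_comm]
      rw [hj, Function.update_self, Pi.pow_apply, hωl, hz, hc, mul_pow, mul_pow, hρ', pow_right_comm, h2]
    · rw [Function.update_of_ne hj, Pi.pow_apply, hωj j hj, ← ht j, ← hs j]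
      ring
  let p : L[X] := MvPolynomial.aeval (Function.update (fun j => Polynomial.C (x j)) l Polynomial.X) Γ
  have hp : ∀ T, p.eval T = MvPolynomial.eval (Function.update x l T) Γ := by
    intro T
    have h1 := (map_aeval (R := L) (Function.update (fun j => Polynomial.C (x j)) l Polynomial.X)
      (Polynomial.evalRingHom T) Γ)
    refine h1.trans ?_
    rw [show ((Polynomial.evalRingHom T).comp (algebraMap L L[X])) = RingHom.id L from
      RingHom.ext fun a => Polynomial.eval_C]
    have h2 : (fun j => Polynomial.evalRingHom T (Function.update (fun j => Polynomial.C (x j)) l Polynomial.X j)) =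
        Function.update x l T := by
      funext j
      by_cases hj : j = l
      · subst hj; simp
      · simp [Function.update_of_ne hj]
    rw [h2]
    rfl
  have hp0 : p = 0 := by
    refine Polynomial.eq_zero_of_infinite_isRoot _ (Set.infinite_of_injective_forall_mem
      (f := fun n : ℕ => ρ ^ D ^ (n + 1) * c) (fun a b hab => ?_) fun n => ?_)
    · have h2 := mul_right_cancel₀ hc0 hab
      have key : ∀ m k : ℕ, ρ ^ m = ρ ^ k → k ≤ m := fun m k h => by
        by_contra! hlt
        refine hord (isOfFinOrder_iff_pow_eq_one.2 ⟨k - m, by omega, ?_⟩)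
        rw [pow_sub₀ _ hρ0 hlt.le, h, mul_inv_cancel₀ (pow_ne_zero _ hρ0)]
      have h3 : D ^ (a + 1) = D ^ (b + 1) := le_antisymm (key _ _ h2.symm) (key _ _ h2)
      have := Nat.pow_right_injective hD h3
      omega
    · exact (hp _).trans (hev n)
  have := hp (x l)
  rwa [hp0, Polynomial.eval_zero, Function.update_eq_self, eq_comm] at this

end MvPolynomial

namespace ProductFormulaFamily

open Filter

variable {K : Type} [Field K] (M : ProductFormulaFamily K)

theorem eventually_prod_ext_eq_one {σ : Type} [Fintype σ] {x : σ → AlgebraicClosure K} (hx : ∀ j, x j ≠ 0) :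
    ∀ᶠ i in cofinite, ∀ m : σ → ℕ, M.ext i (∏ j, x j ^ m j) = 1 := by
  filter_upwards [Filter.eventually_all.2 fun j => M.eventually_ext_eq_one (hx j)] with i hi m
  rw [map_prod]
  exact Finset.prod_eq_one fun j _ => by rw [map_pow, hi, one_pow]

/-- A prime polynomial with toric support is bounded below along the power maps. -/
theorem eventually_eval_lower_bound_of_dvd_expand [CharZero K] {σ : Type} [Fintype σ]
    {E Γ : MvPolynomial σ (AlgebraicClosure K)} (hE : Prime E) (hΓ : Γ ≠ 0) {D : ℕ} (hD : 2 ≤ D)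
    (H : ∀ t : ℕ, 1 ≤ t → E ∣ MvPolynomial.expand (D ^ t) Γ) {x : σ → AlgebraicClosure K}
    (hx : ∀ q : ℕ, MvPolynomial.eval (fun j => x j ^ D ^ q) E ≠ 0) :
    ∀ᶠ i in cofinite, ∃ δ > 0, ∀ q : ℕ, δ ≤ M.ext i (MvPolynomial.eval (fun j => x j ^ D ^ q) E) := by
  classical
  have : CharZero (AlgebraicClosure K) := charZero_of_injective_algebraMap (algebraMap K _).injective
  have hD0 : ∀ q : ℕ, D ^ q ≠ 0 := fun q => pow_ne_zero _ (by omega)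
  have hminor : ∀ α ∈ E.support, ∀ α' ∈ E.support, ∀ α'' ∈ E.support, ∀ l k,
      ((α' l : ℤ) - α l) * (α'' k - α k) - (α' k - α k) * (α'' l - α l) = 0 :=
    fun α hα α' hα' α'' hα'' l k => MvPolynomial.minor_eq_zero_of_dvd_expand hE hΓ
      (fun B => ⟨D ^ (B + 1), (Nat.lt_pow_self (by omega)).trans' (Nat.lt_succ_self B), H _ (by omega)⟩) hα hα' hα'' l k
  set x' : σ → AlgebraicClosure K := fun j => if x j = 0 then 1 else x j with hx'
  have hx'0 : ∀ j, x' j ≠ 0 := fun j => by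
    by_cases h : x j = 0 <;> simp [hx', h]
  set S := E.support.filter fun β => ∀ j, x j = 0 → β j = 0 with hS
  have hval : ∀ q : ℕ, MvPolynomial.eval (fun j => x j ^ D ^ q) E =
      ∑ β ∈ S, E.coeff β * ∏ j, (x' j ^ D ^ q) ^ β j := by
    intro q
    rw [MvPolynomial.eval_eq', hS, Finset.sum_filter]
    refine Finset.sum_congr rfl fun β _ => ?_
    split_ifs with h
    · congr 1
      refine Finset.prod_congr rfl fun j _ => ?_
      by_cases hj : x j = 0
      · rw [h j hj, pow_zero, pow_zero]
      · simp [hx', hj]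
    · push Not at h
      obtain ⟨j, hj, hβ⟩ := h
      rw [Finset.prod_eq_zero (Finset.mem_univ j) (by rw [hj, zero_pow (hD0 q), zero_pow hβ]), mul_zero]
  by_cases hcard : ∀ a ∈ S, ∀ b ∈ S, a = b
  · obtain ⟨β, hβ⟩ : S.Nonempty := by
      by_contra h
      rw [Finset.not_nonempty_iff_eq_empty] at h
      exact hx 0 (by rw [hval, h, Finset.sum_empty])
    have hSβ : S = {β} := Finset.eq_singleton_iff_unique_mem.2 ⟨hβ, fun a ha => hcard a ha β hβ⟩
    filter_upwards [M.eventually_prod_ext_eq_one hx'0,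
      M.eventually_ext_eq_one (MvPolynomial.mem_support_iff.1 (Finset.mem_filter.1 hβ).1)] with i hi hi'
    refine ⟨1, one_pos, fun q => ?_⟩
    rw [hval, hSβ, Finset.sum_singleton, map_mul, hi', one_mul]
    simp_rw [← pow_mul]
    rw [hi]
  · push Not at hcard
    obtain ⟨a, ha, b, hb, hab⟩ := hcard
    obtain ⟨l, hl⟩ : ∃ l, a l ≠ b l := by
      by_contra! h
      exact hab (Finsupp.ext h)
    have haE := Finset.mem_filter.1 ha
    have hbE := Finset.mem_filter.1 hb
    have hSE : S = E.support := by
      refine Finset.filter_true_of_mem fun γ hγ j hj => ?_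
      have h1 := hminor a haE.1 b hbE.1 γ hγ l j
      rw [haE.2 j hj, hbE.2 j hj] at h1
      have h2 : ((b l : ℤ) - a l) * γ j = 0 := by simpa using h1
      have h3 := (mul_eq_zero.1 h2).resolve_left (by omega)
      exact_mod_cast h3
    obtain ⟨α, hα, hmin⟩ := E.support.exists_min_image (fun β => β l) ⟨a, haE.1⟩
    obtain ⟨α', hα', hlt⟩ : ∃ α' ∈ E.support, α l < α' l := by
      have h1 := hmin a haE.1
      have h2 := hmin b hbE.1
      by_cases h : α l < a l
      · exact ⟨a, haE.1, h⟩
      · exact ⟨b, hbE.1, by omega⟩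
    have hline : ∀ β ∈ E.support, ∀ k, ((α' l : ℤ) - α l) * (β k - α k) = (α' k - α k) * (β l - α l) :=
      fun β hβ k => sub_eq_zero.1 (hminor α hα α' hα' β hβ l k)
    have hd : 0 < α' l - α l := by omega
    obtain ⟨ω, hω⟩ : ∃ ω : σ → AlgebraicClosure K, ∀ j, ω j ^ (α' l - α l) = x' j :=
      Classical.skolem.1 fun j => IsAlgClosed.exists_pow_nat_eq (x' j) hd
    have hω0 : ∀ j, ω j ≠ 0 := fun j h => hx'0 j (by rw [← hω j, h, zero_pow hd.ne'])
    set e := MvPolynomial.lineSection E α l with he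
    set u := ∏ j, ω j ^ ((α' j : ℤ) - α j) with hu
    have hu0 : u ≠ 0 := Finset.prod_ne_zero_iff.2 fun j _ => zpow_ne_zero _ (hω0 j)
    have hval' : ∀ q : ℕ, MvPolynomial.eval (fun j => x j ^ D ^ q) E =
        (∏ j, ω j ^ (D ^ q * ((α' l - α l) * α j))) * e.eval (u ^ D ^ q) := by
      intro q
      have h1 := MvPolynomial.eval_pow_eq_lineSection hlt hmin hline (ω := fun j => ω j ^ D ^ q)
        fun j => pow_ne_zero _ (hω0 j)
      simp_rw [pow_right_comm _ (D ^ q) (α' l - α l), hω, ← pow_mul] at h1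
      rw [hval, hSE, ← MvPolynomial.eval_eq', h1, he, hu, ← Finset.prod_pow]
      congr 2
      refine Finset.prod_congr rfl fun j _ => ?_
      rw [← zpow_natCast, ← zpow_natCast, ← zpow_mul, ← zpow_mul, mul_comm]
    have he0 : e.eval 0 ≠ 0 := by
      rw [he, MvPolynomial.lineSection, eval_finsetSum, Finset.sum_eq_single_of_mem α hα fun β hβ hne => ?_]
      · simpa using MvPolynomial.mem_support_iff.1 hα
      · have h1 : β l - α l ≠ 0 := fun h => hne (Finsupp.ext fun k => by
          have h2 := hmin β hβ
          have h3 := hline β hβ k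
          rw [show (β l : ℤ) - α l = 0 by omega, mul_zero] at h3
          have := (mul_eq_zero.1 h3).resolve_left (by omega)
          omega)
        rw [eval_mul, eval_pow, eval_X, zero_pow h1, mul_zero]
    have hroots : ∀ ζ, e.eval ζ = 0 → IsOfFinOrder ζ := fun ζ hζ =>
      MvPolynomial.isOfFinOrder_of_eval_lineSection_eq_zero hΓ hD H hlt hmin hline
        (fun h => he0 (h ▸ hζ)) hζ
    filter_upwards [M.eventually_prod_ext_eq_one hω0, M.eventually_eval_pow_lower_bound (by omega : D ≠ 0) hu0 hroots
      fun q h => hx q (by rw [hval', h, mul_zero])] with i hi ⟨δ, hδ, h⟩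
    refine ⟨δ, hδ, fun q => ?_⟩
    rw [hval', map_mul, hi, one_mul]
    exact h q

end ProductFormulaFamily

end

section

section

variable {L : Type} [Field L] [IsAlgClosed L] {H : L[X]} {D : ℕ} {α β s : L}

theorem Polynomial.IsSpecial.eval_affine (hH : H.IsSpecial D α β 0) (w : L) :
    H.eval (α + β * w) = α + β * w ^ D := by
  have hD := hH.two_le
  have h1 : H.comp (C α + C β * X) = C α + C β * X ^ D :=
    Polynomial.eq_of_eval_eq_of_ne_zero fun u hu => by
      have := hH.eval_eq u hu
      simp only [zero_mul, add_zero] at this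
      simp [eval_comp, this]
  simpa [eval_comp] using congrArg (Polynomial.eval w) h1

/-- A special polynomial is uniformized, near any orbit, by power maps. -/
theorem Polynomial.IsSpecial.exists_uniformization (hH : H.IsSpecial D α β s) {z : ℕ → Fin 2 → L}
    (hz : (∀ q, z q 0 = 1 ∧ z q 1 = 0) ∨ ∃ a, ∀ q, z q 0 = (fun x => H.eval x)^[q] a ∧ z q 1 = 1) :
    ∃ (U : Fin 2 → L[X]) (ε : ℕ) (π : L → L) (w c : L) (m : ℕ → ℕ), c ≠ 0 ∧
      (∀ u ≠ 0, (U 0).eval u = u ^ ε * π u ∧ (U 1).eval u = u ^ ε) ∧ (∀ u ≠ 0, H.eval (π u) = π (u ^ D)) ∧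
      (∀ y ≠ α, ∃ u ≠ 0, π u = y) ∧ ∀ q k, (U k).eval (w ^ D ^ q) = c ^ m q * z q k := by
  have hβ := hH.ne_zero
  have hD := hH.two_le
  have hD0 : ∀ q : ℕ, D ^ q ≠ 0 := fun q => pow_ne_zero _ (by omega)
  rcases hH.eq_zero_or_eq_one with rfl | rfl
  · rcases hz with hz | ⟨a, hz⟩
    · refine ⟨![C α * X + C β, X], 1, fun u => α + β * u⁻¹, 0, β, fun _ => 1, hβ, fun u hu => ?_, fun u hu => ?_,
        fun y hy => ?_, fun q k => ?_⟩
      · constructor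
        · simp; field_simp
        · simp
      · rw [hH.eval_affine, inv_pow]
      · have hy' := sub_ne_zero.2 hy
        refine ⟨β / (y - α), div_ne_zero hβ hy', ?_⟩
        field_simp
        ring
      · rw [zero_pow (hD0 q)]
        fin_cases k
        · simp [(hz q).1]
        · simp [(hz q).2]
    · have h1 : ∀ q, (fun x => H.eval x)^[q] a = α + β * ((a - α) / β) ^ D ^ q := by
        intro q
        induction q with
        | zero =>
          rw [Function.iterate_zero_apply, pow_zero, pow_one, mul_div_cancel₀ _ hβ, add_sub_cancel]
        | succ q ih => rw [Function.iterate_succ_apply', ih, hH.eval_affine, ← pow_mul, pow_succ]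
      refine ⟨![C α + C β * X, 1], 0, fun u => α + β * u, (a - α) / β, 1, fun _ => 1, one_ne_zero, fun u hu => ?_,
        fun u hu => hH.eval_affine u, fun y hy => ?_, fun q k => ?_⟩
      · simp
      · refine ⟨(y - α) / β, div_ne_zero (sub_ne_zero.2 hy) hβ, ?_⟩
        field_simp
        ring
      · fin_cases k
        · simp [(hz q).1, h1]
        · simp [(hz q).2]
  · have hev : ∀ u ≠ 0, H.eval (α + β * (u + u⁻¹)) = α + β * (u ^ D + (u ^ D)⁻¹) := fun u hu => by
      simpa using hH.eval_eq u hu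
    have hsurj : ∀ y, ∃ u ≠ 0, α + β * (u + u⁻¹) = y := by
      intro y
      obtain ⟨u, hu⟩ := IsAlgClosed.exists_root (X ^ 2 - C ((y - α) / β) * X + 1 : L[X]) (by
        rw [show (X ^ 2 - C ((y - α) / β) * X + 1 : L[X]) = C 1 * X ^ 2 + C (-((y - α) / β)) * X + C 1 by
          simp; ring, degree_quadratic one_ne_zero]
        norm_num)
      simp only [IsRoot.def, eval_add, eval_sub, eval_pow, eval_X, eval_mul, eval_C, eval_one] at hu
      have hu0 : u ≠ 0 := by
        rintro rfl
        simp at hu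
      refine ⟨u, hu0, ?_⟩
      field_simp at hu ⊢
      linear_combination hu
    have hpar : ∀ u ≠ 0, (![C α * X + C β * (X ^ 2 + 1), X] 0 : L[X]).eval u = u ^ 1 * (α + β * (u + u⁻¹)) ∧
        (![C α * X + C β * (X ^ 2 + 1), X] 1 : L[X]).eval u = u ^ 1 := fun u hu => by
      constructor
      · simp; field_simp
      · simp
    rcases hz with hz | ⟨a, hz⟩
    · refine ⟨![C α * X + C β * (X ^ 2 + 1), X], 1, fun u => α + β * (u + u⁻¹), 0, β, fun _ => 1, hβ, hpar, hev,
        fun y _ => hsurj y, fun q k => ?_⟩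
      rw [zero_pow (hD0 q)]
      fin_cases k
      · simp [(hz q).1]
      · simp [(hz q).2]
    · obtain ⟨w, hw, hwa⟩ := hsurj a
      have h1 : ∀ q, (fun x => H.eval x)^[q] a = α + β * (w ^ D ^ q + (w ^ D ^ q)⁻¹) := by
        intro q
        induction q with
        | zero => simp [hwa]
        | succ q ih => rw [Function.iterate_succ_apply', ih, hev _ (pow_ne_zero _ hw), ← pow_mul, pow_succ]
      refine ⟨![C α * X + C β * (X ^ 2 + 1), X], 1, fun u => α + β * (u + u⁻¹), w, w, fun q => D ^ q, hw, hpar, hev,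
        fun y _ => hsurj y, fun q k => ?_⟩
      fin_cases k
      · change (![C α * X + C β * (X ^ 2 + 1), X] 0 : L[X]).eval _ = _ * z q 0
        rw [(hpar _ (pow_ne_zero _ hw)).1, (hz q).1, h1, pow_one]
      · simp [(hz q).2]

end

end

section

namespace ProductFormulaFamily

open Filter MultiProjective

variable {K : Type} [Field K] (M : ProductFormulaFamily K)

theorem eval_homogEq_smul {L : Type} [Field L] {n : ℕ} (F : MvPolynomial (Fin n) L) (r : Fin n → L)
    (z : Fin n × Fin 2 → L) : MvPolynomial.eval (fun jk => r jk.1 * z jk) (homogEq F) =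
      (∏ j, r j ^ F.degreeOf j) * MvPolynomial.eval z (homogEq F) :=
  (hasMultidegree_hm (fun _ => 1) fun _ => le_rfl).eval_smul r z

theorem homogEq_dvd_homogEq {L : Type} [Field L] {n : ℕ} {F G : MvPolynomial (Fin n) L} (h : F ∣ G) :
    homogEq F ∣ homogEq G :=
  hm_dvd_of_dvd_dh _ (multiHomog_hm G) (by rwa [dh_hm])

/-- A polynomial all of whose prime factors are coordinates or have toric support is bounded below along the
power maps. -/
theorem eventually_eval_lower_bound_of_dvd_expand_mul [CharZero K] {σ : Type} [Fintype σ]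
    {Γ : MvPolynomial σ (AlgebraicClosure K)} (hΓ : Γ ≠ 0) {D : ℕ} (hD : 2 ≤ D) {x : σ → AlgebraicClosure K}
    (p : MvPolynomial σ (AlgebraicClosure K))
    (H : ∀ t : ℕ, 1 ≤ t → ∃ b : σ → ℕ, p ∣ MvPolynomial.expand (D ^ t) Γ * ∏ j, MvPolynomial.X j ^ b j)
    (hx : ∀ q : ℕ, MvPolynomial.eval (fun j => x j ^ D ^ q) p ≠ 0) :
    ∀ᶠ i in cofinite, ∃ δ > 0, ∀ q : ℕ, δ ≤ M.ext i (MvPolynomial.eval (fun j => x j ^ D ^ q) p) := by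
  induction p using UniqueFactorizationMonoid.induction_on_prime with
  | h₁ => exact absurd (map_zero _) (hx 0)
  | h₂ u hu =>
    obtain ⟨c, hc, rfl⟩ := (MvPolynomial.isUnit_iff_eq_C_of_isReduced).1 hu
    filter_upwards [M.eventually_ext_eq_one hc.ne_zero] with i hi
    exact ⟨1, one_pos, fun q => by rw [MvPolynomial.eval_C, hi]⟩
  | h₃ p E _ hE ih =>
    have h1 := ih (fun t ht => (H t ht).imp fun b hb => (dvd_mul_left p E).trans hb)
      fun q h => hx q (by rw [map_mul, h, mul_zero])
    have hEx : ∀ q : ℕ, MvPolynomial.eval (fun j => x j ^ D ^ q) E ≠ 0 := fun q h => hx q (by rw [map_mul, h, zero_mul])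
    have h2 : ∀ᶠ i in cofinite, ∃ δ > 0, ∀ q : ℕ, δ ≤ M.ext i (MvPolynomial.eval (fun j => x j ^ D ^ q) E) := by
      by_cases hX : ∃ j, E ∣ MvPolynomial.X j
      · obtain ⟨j, hj⟩ := hX
        obtain ⟨u, hu⟩ := (hE.dvd_prime_iff_associated MvPolynomial.X_prime).1 hj
        obtain ⟨c, hc, hcu⟩ := (MvPolynomial.isUnit_iff_eq_C_of_isReduced).1 u.isUnit
        have hval : ∀ q : ℕ, MvPolynomial.eval (fun j => x j ^ D ^ q) E * c = x j ^ D ^ q := fun q => by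
          rw [← MvPolynomial.eval_C (f := fun j => x j ^ D ^ q) c, ← hcu, ← map_mul, hu, MvPolynomial.eval_X]
        have hxj : x j ≠ 0 := fun h => mul_ne_zero (hEx 0) hc.ne_zero (by rw [hval, h, pow_zero, pow_one])
        filter_upwards [M.eventually_ext_eq_one hc.ne_zero, M.eventually_ext_eq_one hxj] with i hi hi'
        refine ⟨1, one_pos, fun q => ?_⟩
        have := congrArg (M.ext i) (hval q)
        rw [map_mul, hi, mul_one, map_pow, hi', one_pow] at this
        exact this.ge
      · push Not at hX
        refine M.eventually_eval_lower_bound_of_dvd_expand hE hΓ hD (fun t ht => ?_) hEx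
        obtain ⟨b, hb⟩ := H t ht
        refine (hE.dvd_or_dvd ((dvd_mul_right E p).trans hb)).resolve_right fun h => ?_
        obtain ⟨j, -, hj⟩ := (Prime.dvd_finsetProd_iff hE _).1 h
        exact hX j (hE.dvd_of_dvd_pow hj)
    filter_upwards [h1, h2] with i ⟨δ, hδ, hi⟩ ⟨δ', hδ', hi'⟩
    refine ⟨δ' * δ, mul_pos hδ' hδ, fun q => ?_⟩
    rw [map_mul, map_mul]
    exact mul_le_mul (hi' q) (hi q) hδ.le ((M.ext i).nonneg _)

/-- The equation of a hypersurface that is totally invariant under a special polynomial is bounded below along orbits. -/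
theorem eventually_eval_homogEq_lower_bound [CharZero K] {n : ℕ} {F G : MvPolynomial (Fin n) (AlgebraicClosure K)}
    (hG : G ≠ 0) {H : (AlgebraicClosure K)[X]} {D : ℕ} {α β s : AlgebraicClosure K} (hH : H.IsSpecial D α β s)
    (hFG : ∀ t : ℕ, 1 ≤ t → F ∣ splitHom (H.comp^[t] X) G) {z : ℕ → Fin n × Fin 2 → AlgebraicClosure K}
    (hz : ∀ j, (∀ q, z q (j, 0) = 1 ∧ z q (j, 1) = 0) ∨
      ∃ a, ∀ q, z q (j, 0) = (fun x => H.eval x)^[q] a ∧ z q (j, 1) = 1)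
    (hne : ∀ q, MvPolynomial.eval (z q) (homogEq F) ≠ 0) :
    ∀ᶠ i in cofinite, ∃ δ > 0, ∀ q : ℕ, δ ≤ M.ext i (MvPolynomial.eval (z q) (homogEq F)) := by
  choose U ε π w c m hc hU hπ hsurj hw using fun j => hH.exists_uniformization (z := fun q k => z q (j, k)) (hz j)
  have hD := hH.two_le
  let Φ : MvPolynomial (Fin n × Fin 2) (AlgebraicClosure K) →ₐ[AlgebraicClosure K]
      MvPolynomial (Fin n) (AlgebraicClosure K) :=
    MvPolynomial.aeval fun jk => Polynomial.aeval (MvPolynomial.X jk.1) (U jk.1 jk.2)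
  have hΦ : ∀ y p, MvPolynomial.eval y (Φ p) = MvPolynomial.eval (fun jk => (U jk.1 jk.2).eval (y jk.1)) p := by
    intro y p
    refine (MvPolynomial.map_aeval _ (MvPolynomial.eval y) p).trans ?_
    simp_rw [eval_aeval_X]
    rw [show (MvPolynomial.eval y).comp (algebraMap (AlgebraicClosure K) (MvPolynomial (Fin n) (AlgebraicClosure K))) =
      RingHom.id _ from RingHom.ext fun a => MvPolynomial.eval_C a]
    rfl
  have hval : ∀ q : ℕ, MvPolynomial.eval (fun j => w j ^ D ^ q) (Φ (homogEq F)) =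
      (∏ j, c j ^ (m j q * F.degreeOf j)) * MvPolynomial.eval (z q) (homogEq F) := by
    intro q
    simp_rw [hΦ, hw, pow_mul]
    exact eval_homogEq_smul F (fun j => c j ^ m j q) (z q)
  have hgen : ∀ E (u : Fin n → AlgebraicClosure K), (∀ j, u j ≠ 0) → MvPolynomial.eval u (Φ (homogEq E)) =
      (∏ j, u j ^ (ε j * E.degreeOf j)) * MvPolynomial.eval (fun j => π j (u j)) E := by
    intro E u hu
    have h1 : (fun jk : Fin n × Fin 2 => (U jk.1 jk.2).eval (u jk.1)) =
        fun jk => u jk.1 ^ ε jk.1 * (if jk.2 = 0 then π jk.1 (u jk.1) else 1) := by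
      funext ⟨j, k⟩
      have := hU j (u j) (hu j)
      fin_cases k
      · simpa using this.1
      · simpa using this.2
    simp_rw [hΦ, h1, pow_mul]
    rw [eval_homogEq_smul E (fun j => u j ^ ε j) fun jk => if jk.2 = 0 then π jk.1 (u jk.1) else 1,
      eval_homogEq_of_forall_eq_one fun _ _ => rfl]
    rfl
  have hΓ : Φ (homogEq G) ≠ 0 := fun h0 => hG (MvPolynomial.eq_zero_of_forall_eval_eq_zero α fun x hx => by
    choose u hu hux using fun j => hsurj j (x j) (hx j)
    have h1 := hgen G u hu
    rw [h0, map_zero, zero_eq_mul] at h1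
    simpa [hux] using h1.resolve_left (Finset.prod_ne_zero_iff.2 fun j _ => pow_ne_zero _ (hu j)))
  have hπt : ∀ t j u, u ≠ 0 → (H.comp^[t] X).eval (π j u) = π j (u ^ D ^ t) := by
    intro t j u hu
    rw [← iterate_eval_eq]
    induction t with
    | zero => simp
    | succ t ih => rw [Function.iterate_succ_apply', ih, hπ j _ (pow_ne_zero _ hu), ← pow_mul, pow_succ]
  have hdvd : ∀ t : ℕ, 1 ≤ t → ∃ b : Fin n → ℕ, Φ (homogEq F) ∣
      MvPolynomial.expand (D ^ t) (Φ (homogEq G)) * ∏ j, MvPolynomial.X j ^ b j := by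
    intro t ht
    set G' := splitHom (H.comp^[t] X) G with hG'
    refine ⟨fun j => ε j * G'.degreeOf j, (map_dvd Φ (homogEq_dvd_homogEq (hFG t ht))).trans ?_⟩
    refine ⟨∏ j, MvPolynomial.X j ^ (D ^ t * (ε j * G.degreeOf j)), ?_⟩
    rw [← sub_eq_zero]
    refine MvPolynomial.eq_zero_of_forall_eval_eq_zero 0 fun u hu => ?_
    have h1 : MvPolynomial.eval u (MvPolynomial.expand (D ^ t) (Φ (homogEq G))) =
        MvPolynomial.eval (fun j => u j ^ D ^ t) (Φ (homogEq G)) := MvPolynomial.eval_expand ..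
    rw [map_sub, map_mul, map_mul, h1, hgen G _ fun j => pow_ne_zero _ (hu j), hgen G' u hu, hG', eval_splitHom]
    simp_rw [hπt _ _ _ (hu _), map_prod, map_pow, MvPolynomial.eval_X, ← pow_mul]
    ring
  filter_upwards [M.eventually_eval_lower_bound_of_dvd_expand_mul hΓ hD _ hdvd fun q => by
    rw [hval]
    exact mul_ne_zero (Finset.prod_ne_zero_iff.2 fun j _ => pow_ne_zero _ (hc j)) (hne q),
    M.eventually_prod_ext_eq_one hc] with i ⟨δ, hδ, h⟩ hi
  refine ⟨δ, hδ, fun q => (h q).trans ?_⟩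
  rw [hval, map_mul, hi fun j => m j q * F.degreeOf j, one_mul]

end ProductFormulaFamily

end

section

theorem iterate_comp_iterate {L : Type} [Field L] [CharZero L] (g : L[X]) (N t : ℕ) :
    (g.comp^[N] X).comp^[t] X = g.comp^[N * t] X := by
  refine Polynomial.funext fun a => ?_
  rw [← MultiProjective.iterate_eval_eq, ← MultiProjective.iterate_eval_eq, Function.iterate_mul]
  congr 1
  funext b
  rw [MultiProjective.iterate_eval_eq]

theorem splitHom_iterate_succ {L σ : Type} [Field L] [CharZero L] (g : L[X]) (G : MvPolynomial σ L) (m : ℕ) :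
    splitHom (g.comp^[m + 1] X) G = splitHom g (splitHom (g.comp^[m] X) G) := by
  refine MvPolynomial.funext fun y => ?_
  rw [eval_splitHom, eval_splitHom, eval_splitHom]
  exact congrArg (fun u => MvPolynomial.eval u G) (funext fun j => by
    rw [← MultiProjective.iterate_eval_eq, ← MultiProjective.iterate_eval_eq, Function.iterate_succ_apply])

theorem dvd_splitHom_iterate {L σ : Type} [Field L] [CharZero L] {g : L[X]} {F G : MvPolynomial σ L}
    (h1 : ∀ E, F ∣ splitHom g E ↔ G ∣ E) (h2 : ∀ E, G ∣ E ↔ G ∣ splitHom g E) (m : ℕ) :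
    F ∣ splitHom (g.comp^[m + 1] X) G := by
  rw [splitHom_iterate_succ, h1]
  induction m with
  | zero => exact dvd_of_eq (MvPolynomial.funext fun y => by rw [eval_splitHom]; simp)
  | succ m ih =>
    rw [splitHom_iterate_succ]
    exact (h2 _).1 ih

namespace ProductFormulaFamily

open Filter MultiProjective

variable {K : Type} [Field K] {M : ProductFormulaFamily K} {n : ℕ} {f : K[X]} {P : Fin n → OnePoint K}
  {V : ClosedSubvar K (Fin n)} {F : MvPolynomial (Fin n) (AlgebraicClosure K)}

theorem algebraMap_affOrbit_add {j : Fin n} (h : P j ≠ ∞) (r m : ℕ) :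
    algebraMap K (AlgebraicClosure K) (affOrbit f P (r + m) j) =
      (fun x => (f.map (algebraMap K (AlgebraicClosure K))).eval x)^[m] (algebraMap K _ (affOrbit f P r j)) := by
  induction m with
  | zero => rfl
  | succ m ih => rw [Function.iterate_succ_apply', ← ih, ← add_assoc, affOrbit_succ f P h, eval_map_algebraMap,
      aeval_algebraMap_apply, coe_aeval_eq_eval]

/-- A hypersurface involving at least three coordinates. -/
theorem frequently_equation_of_three [CharZero K] (hf : 2 ≤ f.natDegree)
    (hVpre : SubvarPreperiodic (f.map (algebraMap K (AlgebraicClosure K)))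
      (V.pts (algebraMap K (AlgebraicClosure K))))
    (hP : fwdOrbit (splitMap f) P ∩ V.pts (RingHom.id K) = ∅) (hFp : Prime F)
    (hF : chartIdeal (fun _ => 1) (V.pts (algebraMap K (AlgebraicClosure K))) = Ideal.span {F})
    (hcard : 2 < F.vars.card) :
    ∃ᶠ i in cofinite, (∃ z, z ≠ 0 ∧ M.w i z ≠ 1) ∧ ∃ δ > 0, ∃ m0, ∀ m ≥ m0,
      δ ≤ M.ext i (MvPolynomial.eval (fun jk => algebraMap K _ (orbitHom f P m jk)) (homogEq F)) := by
  classical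
  set fL := f.map (algebraMap K (AlgebraicClosure K)) with hfL
  set X₀ := V.pts (algebraMap K (AlgebraicClosure K)) with hX₀
  obtain ⟨k, hk, hkX⟩ := exists_iterate_image_eq hVpre
  set g := fL.comp^[k] X with hg
  have hdeg : 2 ≤ g.natDegree := by
    rw [hg, natDegree_iterate_comp, hfL, natDegree_map, natDegree_X, mul_one]
    exact hf.trans (Nat.le_self_pow hk.ne' _)
  have hlift := fun (y : Fin n → AlgebraicClosure K) (hy : pt (fun _ => 1) y ∈ X₀) =>
    exists_eval_eval_eq (f := fL) (k := k) (c := fun _ => 1) hkX hy (by simp)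
  have hF' : ∀ r, F ∣ r ↔ ∀ y, pt (fun _ => 1) y ∈ X₀ → MvPolynomial.eval y r = 0 :=
    fun r => by rw [← Ideal.mem_span_singleton, ← hF, mem_chartIdeal]
  have hinv : ∀ E, F ∣ splitHom g (splitHom g E) ↔ F ∣ splitHom g E := by
    refine fun E => ⟨fun h => ?_, fun h => ?_⟩ <;> rw [hF'] at h ⊢ <;> intro y hy
    · obtain ⟨⟨y', h1, -, h2⟩, -⟩ := hlift y hy
      have := h y' h1
      rw [eval_splitHom, eval_splitHom] at this
      rw [eval_splitHom, ← this]
      exact congrArg (fun u => MvPolynomial.eval u E) (funext fun i => h2 i rfl)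
    · obtain ⟨-, y', h1, -, h2⟩ := hlift y hy
      have := h y' h1
      rw [eval_splitHom] at this
      rw [eval_splitHom, eval_splitHom, ← this]
      exact congrArg (fun u => MvPolynomial.eval u E) (funext fun i => h2 i rfl)
  obtain ⟨i₁, m1, i₂, m2, i₃, m3, h12, h13, h23⟩ := Finset.two_lt_card.1 hcard
  obtain ⟨G, hGp, hFG, hG1, hG2⟩ := exists_splitHom_invariant (by omega) hFp ⟨i₁, m1⟩ hinv
  obtain ⟨D, hD, A, B, hA, hB, hAB⟩ := exists_semiinvariant (by omega) hGp hG2 (hFG m1) (hFG m2) (hFG m3) h12 h13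
  obtain ⟨N, hN, e, he, c, hc, hec⟩ := exists_univariate_semiinvariant hdeg h23 hA hB hAB
  have hdegN : 2 ≤ (g.comp^[N] X).natDegree := by
    rw [natDegree_iterate_comp, natDegree_X, mul_one]
    exact hdeg.trans (Nat.le_self_pow (by omega) _)
  obtain ⟨N', hN', D', α, β, s, hH⟩ := exists_isSpecial_iterate hD hdegN he hc hec
  rw [iterate_comp_iterate] at hH
  set K₀ := k * (N * N') with hK₀
  have hK₀pos : 0 < K₀ := by positivity
  have hdvd : ∀ t, 1 ≤ t → F ∣ splitHom ((g.comp^[N * N'] X).comp^[t] X) G := by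
    intro t ht
    rw [iterate_comp_iterate]
    have hpos : 0 < N * N' * t := by positivity
    obtain ⟨m, hm⟩ := Nat.exists_eq_succ_of_ne_zero hpos.ne'
    rw [hm]
    exact dvd_splitHom_iterate hG1 hG2 m
  have hiter : ∀ q, (fun x => (g.comp^[N * N'] X).eval x)^[q] = (fun x => fL.eval x)^[K₀ * q] := by
    intro q
    rw [Function.iterate_mul _ K₀ q, hK₀, hg, iterate_comp_iterate]
    congr 1
    funext x
    rw [MultiProjective.iterate_eval_eq]
  have hmain : ∀ r ∈ Finset.range K₀, ∀ᶠ i in cofinite, ∃ δ > 0, ∀ q, δ ≤ M.ext i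
      (MvPolynomial.eval (fun jk => algebraMap K _ (orbitHom f P (r + K₀ * q) jk)) (homogEq F)) := by
    intro r _
    refine M.eventually_eval_homogEq_lower_bound hGp.ne_zero hH hdvd
      (z := fun q jk => algebraMap K _ (orbitHom f P (r + K₀ * q) jk)) (fun j => ?_)
      fun q => eval_homogEq_orbitHom_ne_zero hP hF _
    by_cases hj : P j = ∞
    · left
      intro q
      constructor <;> rw [orbitHom_infty f P hj] <;> simp
    · refine Or.inr ⟨algebraMap K _ (affOrbit f P r j), fun q => ⟨?_, ?_⟩⟩
      · rw [orbitHom_of_ne f P hj, if_pos rfl, hiter, algebraMap_affOrbit_add hj]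
      · rw [orbitHom_of_ne f P hj]; simp
  refine (M.frequently_nontrivial.and_eventually ((eventually_all_finset _).2 hmain)).mono ?_
  rintro i ⟨hnt, hi⟩
  refine ⟨hnt, ?_⟩
  choose! δ hδ hle using hi
  obtain ⟨r₀, hr₀, hmin⟩ := Finset.exists_min_image (Finset.range K₀) δ ⟨0, Finset.mem_range.2 hK₀pos⟩
  refine ⟨δ r₀, hδ r₀ hr₀, 0, fun m _ => ?_⟩
  have hmr : m % K₀ ∈ Finset.range K₀ := Finset.mem_range.2 (Nat.mod_lt _ hK₀pos)
  have := hle _ hmr (m / K₀)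
  rw [Nat.mod_add_div] at this
  exact (hmin _ hmr).trans this

/-- The hypersurface case. -/
theorem frequently_orbitClosureAvoids_of_hypersurface [CharZero K] (hn : 2 ≤ n) (hf : 2 ≤ f.natDegree)
    (hVirr : IrrSubvar (V.pts (algebraMap K (AlgebraicClosure K))))
    (hVpre : SubvarPreperiodic (f.map (algebraMap K (AlgebraicClosure K)))
      (V.pts (algebraMap K (AlgebraicClosure K))))
    (hVdim : varDim (V.pts (algebraMap K (AlgebraicClosure K))) = (((n - 1 : ℕ) : ℕ∞) : WithBot ℕ∞))
    (hP : fwdOrbit (splitMap f) P ∩ V.pts (RingHom.id K) = ∅) :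
    ∃ᶠ i in cofinite, (∃ z, z ≠ 0 ∧ M.w i z ≠ 1) ∧
      ∀ v : PlaceK K, v.v = M.w i → OrbitClosureAvoids v f P V := by
  classical
  set X₀ := V.pts (algebraMap K (AlgebraicClosure K)) with hX₀
  have hmap : ∀ m, (fun i => mapPoint (algebraMap K (AlgebraicClosure K)) ((splitMap f)^[m] P i)) ∉ X₀ := by
    intro m h
    have h1 : (splitMap f)^[m] P ∈ fwdOrbit (splitMap f) P ∩ V.pts (RingHom.id K) := by
      refine ⟨⟨m, rfl⟩, fun p hp => ?_⟩
      have h2 := h p hp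
      simp only [vanishesAt, homCoords_mapPoint] at h2
      rw [MvPolynomial.eval_map] at h2
      have h3 := MvPolynomial.eval₂_comp (algebraMap K (AlgebraicClosure K))
        (fun jk : Fin n × Fin 2 => homCoords ((splitMap f)^[m] P jk.1) jk.2) p
      simp only [vanishesAt, MvPolynomial.map_id]
      exact (map_eq_zero (algebraMap K (AlgebraicClosure K))).1 (h3.trans h2)
    rw [hP] at h1
    exact h1
  rcases exists_standard_equation (by omega) hVirr hVdim
    (fun h => hmap 0 (h ▸ Set.mem_univ _)) with ⟨i, hi⟩ | ⟨⟨y₀, hy₀⟩, F, hFirr, hF⟩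
  · have hPi : P i ≠ ∞ := fun h => hmap 0 ((hi _).2 (by
      rw [Function.iterate_zero, id, h]
      rfl))
    refine frequently_orbitClosureAvoids hP {1} ?_ ?_
    · intro u _ y hy
      have h1 := (hi _).1 hy.1
      rw [pt_apply_of_eq_one _ ((infChart_eq_one_iff P).2 hPi)] at h1
      exact absurd h1 (OnePoint.coe_ne_infty _)
    · refine M.frequently_nontrivial.mono fun i hnt => ⟨hnt, 1, one_pos, 0, fun m _ => ⟨1, by simp, ?_⟩⟩
      simp
  · refine frequently_orbitClosureAvoids_of_equation hVirr hP hy₀ hF ?_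
    by_cases hb : ∀ j ∈ F.vars, (fun m => affOrbit f P m j) ∈ M.bddSeq
    · exact frequently_equation_of_bdd hVirr hP hy₀ hF hb
    push Not at hb
    obtain ⟨i₁, hi₁v, hi₁b⟩ := hb
    obtain ⟨hi₁, a, ha⟩ := (affOrbit_dichotomy M f P i₁).resolve_left hi₁b
    by_cases hv : ∀ j ∈ F.vars, j ≠ i₁ → P j = ∞
    · exact frequently_equation_of_univariate hf hP hF hi₁ ha hv
    push Not at hv
    obtain ⟨i₂, hi₂v, h21, hi₂⟩ := hv
    have hsub : {i₁, i₂} ⊆ F.vars := Finset.insert_subset hi₁v (Finset.singleton_subset_iff.2 hi₂v)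
    rcases (Finset.card_le_card hsub).eq_or_lt with h | h <;> rw [Finset.card_pair h21.symm] at h
    · exact frequently_equation_of_pair hf hVirr hVpre hP hFirr.ne_zero hF h21.symm
        (Finset.eq_of_subset_of_card_le hsub (by rw [Finset.card_pair h21.symm, h])).symm hi₁ hi₂ ha
    · exact frequently_equation_of_three hf hVpre hP hFirr.prime hF h

end ProductFormulaFamily

end

/-- **Dynamical Hasse principle for diagonally split polynomial maps**
(Theorem 1.1 of "Some Arithmetic Dynamics of Diagonally Split Polynomial Maps").

Let `K` be a number field or a function field of characteristic 0, `n ≥ 2`, `f ∈ K[X]`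
a polynomial of degree at least 2, and `φ = (f,…,f) : (P^1_K)^n → (P^1_K)^n`. Let `V` be an
absolutely irreducible `φ`-preperiodic closed subvariety of `(P^1_K)^n` which is a curve or
a hypersurface, and `P ∈ (P^1)^n(K)` a point whose forward `φ`-orbit does not meet `V(K)`.
Then there are infinitely many non-archimedean places `𝔭` of `K` such that the `𝔭`-adic
closure of the orbit in `(P^1)^n(K_𝔭)` is disjoint from `V(K_𝔭)`. -/
theorem dynamical_hasse_principle_curve_or_hypersurface
    (K : Type) [Field K] (κ : Subfield K)
    (hK : NumberFieldOrFunctionFieldOver K κ)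
    (n : ℕ) (hn : 2 ≤ n)
    (f : Polynomial K) (hf : 2 ≤ f.natDegree)
    (V : ClosedSubvar K (Fin n))
    (hVirr : IrrSubvar (V.pts (algebraMap K (AlgebraicClosure K))))
    (hVpre : SubvarPreperiodic (f.map (algebraMap K (AlgebraicClosure K)))
      (V.pts (algebraMap K (AlgebraicClosure K))))
    (hVdim : varDim (V.pts (algebraMap K (AlgebraicClosure K))) = ((1 : ℕ∞) : WithBot ℕ∞) ∨
      varDim (V.pts (algebraMap K (AlgebraicClosure K))) = (((n - 1 : ℕ) : ℕ∞) : WithBot ℕ∞))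
    (P : Fin n → OnePoint K)
    (hP : fwdOrbit (splitMap f) P ∩ V.pts (RingHom.id K) = ∅) :
    InfinitelyManyPlaces K κ fun w => OrbitClosureAvoids w f P V := by
  have : CharZero K := hK.elim (fun _ => inferInstance) And.left
  obtain ⟨M, hM⟩ := exists_productFormulaFamily K κ hK
  refine infinitelyManyPlaces_of_frequently hM ?_
  rcases hVdim with h | h
  · exact ProductFormulaFamily.frequently_orbitClosureAvoids_of_curve hf hVirr hVpre h hP
  · exact ProductFormulaFamily.frequently_orbitClosureAvoids_of_hypersurface hn hf hVirr hVpre h hP
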